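/- Let p be a prime, let k be the algebraic closure of the finite field with p elements, and let A be a finite type k-algebra. Let I ⊂ A be a local complete intersection ideal of height r ≥ 2 with dim(A/I) ≤ 2. Then there exists an ideal J ⊂ A such that √J = √I, J is a local complete intersection ideal of height r, and J/J² is a free A/J-module of rank r. -/

import Mathlib

/-- The height of an ideal `I`: the infimum of the heights of the prime ideals
containing `I` (computed in the prime spectrum). -/
noncomputable def idealHeight {A : Type*} [CommRing A] (I : Ideal A) : ℕ∞ :=
  ⨅ (p : PrimeSpectrum A) (_ : I ≤ p.asIdeal), Order.height p

/-- `I` is a local complete intersection ideal of height `n`: `I` has height `n`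
and, for every prime ideal `P ⊇ I`, the ideal `I · A_P` of the localization `A_P`
is generated by a regular sequence of length `n`. -/
def IsLocalCompleteIntersectionOfHeight {A : Type*} [CommRing A] (I : Ideal A) (n : ℕ) : Prop :=
  idealHeight I = n ∧
  ∀ (P : Ideal A) [P.IsPrime], I ≤ P →
    ∃ rs : List (Localization.AtPrime P),
      rs.length = n ∧ RingTheory.Sequence.IsRegular (Localization.AtPrime P) rs ∧
      Ideal.ofList rs = I.map (algebraMap A (Localization.AtPrime P))

section
namespace FpLci

section F1
variable {R : Type*} [CommRing R]

/-- there is a chain of `n+1` primes containing `a` ending at `p`. -/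
def ChainTo (a : Ideal R) : ℕ → Ideal R → Prop
  | 0, p => p.IsPrime ∧ a ≤ p
  | n + 1, p => p.IsPrime ∧ ∃ q, ChainTo a n q ∧ q < p

/-- `dim R/a < d`. -/
def DimLt (a : Ideal R) (d : ℕ) : Prop := ∀ p, ¬ ChainTo a d p

theorem ChainTo.isPrime {a : Ideal R} : ∀ {n : ℕ} {p : Ideal R}, ChainTo a n p → p.IsPrime
  | 0, _, h => h.1
  | _ + 1, _, h => h.1

theorem ChainTo.le {a : Ideal R} : ∀ {n : ℕ} {p : Ideal R}, ChainTo a n p → a ≤ p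
  | 0, _, h => h.2
  | _ + 1, _, h => by
    obtain ⟨_, q, hq, hlt⟩ := h
    exact hq.le.trans hlt.le

theorem ChainTo.pred {a : Ideal R} : ∀ {n : ℕ} {p : Ideal R}, ChainTo a (n + 1) p → ChainTo a n p
  | 0, _, h => by
    obtain ⟨h1, q, hq, hlt⟩ := h
    exact ⟨h1, hq.le.trans hlt.le⟩
  | n + 1, _, h => by
    obtain ⟨h1, q, hq, hlt⟩ := h
    exact ⟨h1, q, hq.pred, hlt⟩

theorem ChainTo.of_le {a : Ideal R} {n m : ℕ} {p : Ideal R} (h : ChainTo a n p) (hm : m ≤ n) :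
    ChainTo a m p := by
  induction n, hm using Nat.le_induction with
  | base => exact h
  | succ n _ ih => exact ih h.pred

theorem ChainTo.prepend {a a' : Ideal R}
    (H : ∀ p : Ideal R, p.IsPrime → a' ≤ p → ∃ q : Ideal R, q.IsPrime ∧ a ≤ q ∧ q < p) :
    ∀ {n : ℕ} {p : Ideal R}, ChainTo a' n p → ChainTo a (n + 1) p
  | 0, p, h => by
    obtain ⟨q, h1, h2, h3⟩ := H p h.1 h.2
    exact ⟨h.1, q, ⟨h1, h2⟩, h3⟩
  | n + 1, p, h => by
    obtain ⟨h1, q, hq, hlt⟩ := h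
    exact ⟨h1, q, hq.prepend H, hlt⟩

theorem DimLt.mono {a : Ideal R} {d d' : ℕ} (h : DimLt a d) (hd : d ≤ d') : DimLt a d' :=
  fun p hp => h p (hp.of_le hd)

theorem ChainTo.anti {a b : Ideal R} (hab : a ≤ b) :
    ∀ {n : ℕ} {p : Ideal R}, ChainTo b n p → ChainTo a n p
  | 0, _, h => ⟨h.1, hab.trans h.2⟩
  | _ + 1, _, h => by
    obtain ⟨h1, q, hq, hlt⟩ := h
    exact ⟨h1, q, hq.anti hab, hlt⟩

theorem DimLt.anti {a b : Ideal R} {d : ℕ} (h : DimLt a d) (hab : a ≤ b) : DimLt b d :=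
  fun p hp => h p (hp.anti hab)

theorem DimLt.radical {a : Ideal R} {d : ℕ} (h : DimLt a d) : DimLt a.radical d :=
  h.anti Ideal.le_radical

theorem DimLt.of_radical {a : Ideal R} {d : ℕ} (h : DimLt a.radical d) : DimLt a d := by
  have key : ∀ {n : ℕ} {p : Ideal R}, ChainTo a n p → ChainTo a.radical n p := by
    intro n
    induction n with
    | zero => exact fun h => ⟨h.1, h.1.radical_le_iff.2 h.2⟩
    | succ n ih => rintro p ⟨h1, q, hq, hlt⟩; exact ⟨h1, q, ih hq, hlt⟩
  exact fun p hp => h p (key hp)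

theorem DimLt.drop {a : Ideal R} {d : ℕ} (h : DimLt a (d + 1)) {x : R}
    (hx : ∀ q ∈ a.minimalPrimes, x ∉ q) : DimLt (a ⊔ Ideal.span {x}) d := by
  intro p hp
  refine h p (hp.prepend ?_)
  intro p hp hap
  haveI := hp
  obtain ⟨q, hq, hqp⟩ := Ideal.exists_minimalPrimes_le (le_sup_left.trans hap)
  refine ⟨q, hq.1.1, hq.1.2, lt_of_le_of_ne hqp ?_⟩
  rintro rfl
  exact hx q hq (hap (Ideal.mem_sup_right (Ideal.mem_span_singleton_self x)))

theorem ChainTo.height_le {a : Ideal R} : ∀ {n : ℕ} {p : Ideal R}, ChainTo a n p →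
    (n : ℕ∞) ≤ (p.map (Ideal.Quotient.mk a)).height
  | 0, _, _ => by simp
  | n + 1, p, h => by
    obtain ⟨h1, q, hq, hlt⟩ := h
    have hq1 := hq.isPrime
    have e1 : (p.map (Ideal.Quotient.mk a)).IsPrime :=
      Ideal.map_isPrime_of_surjective Ideal.Quotient.mk_surjective
        (by rw [Ideal.mk_ker]; exact hq.le.trans hlt.le)
    have e2 : (q.map (Ideal.Quotient.mk a)).IsPrime :=
      Ideal.map_isPrime_of_surjective Ideal.Quotient.mk_surjective
        (by rw [Ideal.mk_ker]; exact hq.le)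
    have ih := hq.height_le
    have hlt' : q.map (Ideal.Quotient.mk a) < p.map (Ideal.Quotient.mk a) := by
      refine lt_of_le_of_ne (Ideal.map_mono hlt.le) ?_
      intro he
      have := congrArg (Ideal.comap (Ideal.Quotient.mk a)) he
      rw [Ideal.comap_map_of_surjective _ Ideal.Quotient.mk_surjective,
        Ideal.comap_map_of_surjective _ Ideal.Quotient.mk_surjective, ← RingHom.ker_eq_comap_bot,
        Ideal.mk_ker, sup_eq_left.2 hq.le, sup_eq_left.2 (hq.le.trans hlt.le)] at this
      exact hlt.ne this
    have := Ideal.height_add_one_le_of_lt_of_isPrime hlt'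
    push_cast
    exact (add_le_add_left ih 1).trans this

theorem dimLt_of_ringKrullDim {a : Ideal R} {d : ℕ} (h : ringKrullDim (R ⧸ a) ≤ d) :
    DimLt a (d + 1) := by
  intro p hp
  have hp1 := hp.isPrime
  have e1 : (p.map (Ideal.Quotient.mk a)).IsPrime :=
      Ideal.map_isPrime_of_surjective Ideal.Quotient.mk_surjective
        (by rw [Ideal.mk_ker]; exact hp.le)
  have h1 := hp.height_le
  have h2 := (Ideal.height_le_ringKrullDim_of_isPrime
    (I := p.map (Ideal.Quotient.mk a))).trans h
  have h3 : ((d + 1 : ℕ) : WithBot ℕ∞) ≤ d := le_trans (by exact_mod_cast h1) h2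
  have : d + 1 ≤ d := by exact_mod_cast h3
  omega

/-- prime avoidance: finitely many pairwise incomparable primes, prescribed membership. -/
theorem exists_prescribed (S : Finset (Ideal R)) (hS : ∀ q ∈ S, q.IsPrime)
    (hinc : ∀ q ∈ S, ∀ q' ∈ S, q ≤ q' → q = q') (Q : Ideal R → Prop) :
    ∃ c : R, (∀ q ∈ S, Q q → c ∉ q) ∧ (∀ q ∈ S, ¬ Q q → c ∈ q) := by
  classical
  have hsub := (Ideal.subset_union_prime (s := S.filter Q) (f := fun q => q)
    (⊥ : Ideal R) ⊥ (fun i hi _ _ => hS i (Finset.mem_filter.1 hi).1)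
    (I := (S.filter (fun q => ¬ Q q)).inf id)).not
  have hne : ¬ ∃ i ∈ S.filter Q, (S.filter (fun q => ¬ Q q)).inf id ≤ i := by
    rintro ⟨i, hi, hle⟩
    obtain ⟨hi1, hi2⟩ := Finset.mem_filter.1 hi
    obtain ⟨q, hq, hqi⟩ := (Ideal.IsPrime.inf_le' (hS i hi1)).1 hle
    obtain ⟨hq1, hq2⟩ := Finset.mem_filter.1 hq
    exact hq2 (hinc q hq1 i hi1 hqi ▸ hi2)
  obtain ⟨c, hc1, hc2⟩ := Set.not_subset.1 (hsub.2 hne)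
  refine ⟨c, fun q hq hQ hcq => hc2 ?_, fun q hq hQ => ?_⟩
  · simp only [Set.mem_iUnion]
    exact ⟨q, by simp [hq, hQ], hcq⟩
  · exact (Finset.inf_le (f := id) (Finset.mem_filter.2 ⟨hq, hQ⟩) : _ ≤ q) hc1

theorem exists_add_mul_notMem (S : Finset (Ideal R)) (hS : ∀ q ∈ S, q.IsPrime)
    (hinc : ∀ q ∈ S, ∀ q' ∈ S, q ≤ q' → q = q') (a t : R) :
    ∃ c : R, ∀ q ∈ S, t ∉ q → a + t * c ∉ q := by
  obtain ⟨c, h1, h2⟩ := exists_prescribed S hS hinc (fun q => a ∈ q)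
  refine ⟨c, fun q hq htq hmem => ?_⟩
  haveI := hS q hq
  by_cases ha : a ∈ q
  · have : t * c ∈ q := (Ideal.add_mem_iff_right q ha).1 hmem
    rcases (hS q hq).mem_or_mem this with h | h
    · exact htq h
    · exact h1 q hq ha h
  · exact ha ((Ideal.add_mem_iff_left q (q.mul_mem_left t (h2 q hq ha))).1 hmem)

/-- F1 -/
theorem exists_row [IsNoetherianRing R] (I : Ideal R) (t : R) (n : ℕ) (a : Fin n → R) :
    ∃ c : Fin n → R, ∀ p : Ideal R, p.IsPrime → I ≤ p → t ∉ p → (∀ i, a i + t * c i ∈ p) →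
      ChainTo I n p := by
  classical
  induction n with
  | zero => exact ⟨fun _ => 0, fun p hp hI _ _ => ⟨hp, hI⟩⟩
  | succ n ih =>
    obtain ⟨c, hc⟩ := ih (fun i => a i.castSucc)
    let K : Ideal R := I ⊔ Ideal.span (Set.range fun i : Fin n => a i.castSucc + t * c i)
    have hfin : K.minimalPrimes.Finite := Ideal.finite_minimalPrimes_of_isNoetherianRing R K
    obtain ⟨c', hc'⟩ := exists_add_mul_notMem hfin.toFinset
      (fun q hq => (hfin.mem_toFinset.1 hq).1.1)
      (fun q hq q' hq' hle => le_antisymm hle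
        ((hfin.mem_toFinset.1 hq').2 ((hfin.mem_toFinset.1 hq).1) hle)) (a (Fin.last n)) t
    refine ⟨Fin.snoc c c', fun p hp hI ht hmem => ?_⟩
    have hKp : K ≤ p := by
      refine sup_le hI (Ideal.span_le.2 ?_)
      rintro _ ⟨i, rfl⟩
      simpa using hmem i.castSucc
    obtain ⟨q, hq, hqp⟩ := Ideal.exists_minimalPrimes_le hKp
    refine ⟨hp, q, hc q hq.1.1 (le_sup_left.trans hq.1.2) (fun h => ht (hqp h)) (fun i => ?_), ?_⟩
    · exact hq.1.2 (Ideal.mem_sup_right (Ideal.subset_span ⟨i, rfl⟩))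
    · refine lt_of_le_of_ne hqp ?_
      rintro rfl
      refine hc' q (hfin.mem_toFinset.2 hq) ht ?_
      simpa using hmem (Fin.last n)

end F1
end FpLci
end

section
namespace FpLci

section F2
variable {R : Type*} [CommRing R] {M : Type*} [AddCommGroup M] [Module R M]
  {N : Type*} [AddCommGroup N] [Module R N]

/-- the order ideal of an element. -/
def ordI (x : M) : Ideal R := LinearMap.range (Module.Dual.eval R M x)

theorem mem_ordI {x : M} {a : R} : a ∈ ordI (R := R) x ↔ ∃ φ : M →ₗ[R] R, φ x = a := by
  simp only [ordI, LinearMap.mem_range, Module.Dual.eval_apply]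

theorem apply_mem_ordI (φ : M →ₗ[R] R) (x : M) : φ x ∈ ordI (R := R) x := mem_ordI.2 ⟨φ, rfl⟩

theorem ordI_add_smul_le (x y : M) (c : R) (p : Ideal R) (hc : c ∈ p)
    (h : ordI (R := R) (x + c • y) ≤ p) : ordI (R := R) x ≤ p := by
  intro a ha
  obtain ⟨φ, rfl⟩ := mem_ordI.1 ha
  have h1 := h (apply_mem_ordI φ (x + c • y))
  rw [map_add, map_smul, smul_eq_mul] at h1
  exact (Ideal.add_mem_iff_left p (p.mul_mem_right _ hc)).1 h1

variable (R M) in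
/-- locally free of constant rank `n`, in an elementary formulation. -/
def LocFree (n : ℕ) : Prop := ∀ p : Ideal R, p.IsPrime → ∃ t ∉ p,
  ∃ (α : (Fin n → R) →ₗ[R] M) (β : M →ₗ[R] (Fin n → R)),
    (∀ m, α (β m) = t • m) ∧ (∀ v, β (α v) = t • v)

theorem LocFree.of_equiv {n : ℕ} (h : LocFree R M n) (e : M ≃ₗ[R] N) : LocFree R N n := by
  intro p hp
  obtain ⟨t, ht, α, β, h1, h2⟩ := h p hp
  refine ⟨t, ht, e.toLinearMap ∘ₗ α, β ∘ₗ e.symm.toLinearMap, fun m => ?_, fun v => ?_⟩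
  · simp [h1]
  · simp [h2]

theorem locFree_fin (n : ℕ) : LocFree R (Fin n → R) n := by
  intro p hp
  exact ⟨1, (Ideal.ne_top_iff_one p).1 hp.ne_top, LinearMap.id, LinearMap.id,
    by simp, by simp⟩

theorem locFree_self : LocFree R R 1 :=
  (locFree_fin 1).of_equiv (LinearEquiv.funUnique (Fin 1) R R)

theorem LocFree.prod {n m : ℕ} (h : LocFree R M n) (h' : LocFree R N m) :
    LocFree R (M × N) (n + m) := by
  intro p hp
  obtain ⟨t, ht, α, β, h1, h2⟩ := h p hp
  obtain ⟨t', ht', α', β', h1', h2'⟩ := h' p hp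
  let e : (Fin (n + m) → R) ≃ₗ[R] (Fin n → R) × (Fin m → R) :=
    (LinearEquiv.funCongrLeft R R finSumFinEquiv).trans
      (LinearEquiv.sumArrowLequivProdArrow (Fin n) (Fin m) R R)
  refine ⟨t * t', fun h => (hp.mem_or_mem h).elim ht ht',
    (LinearMap.prodMap (t' • α) (t • α')) ∘ₗ e.toLinearMap,
    e.symm.toLinearMap ∘ₗ (LinearMap.prodMap β β'), ?_, ?_⟩
  · rintro ⟨x, y⟩
    simp [h1, h1', smul_smul, mul_comm]
  · intro v
    have : ∀ w : (Fin n → R) × (Fin m → R),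
        (LinearMap.prodMap β β') ((LinearMap.prodMap (t' • α) (t • α')) w) = (t * t') • w := by
      rintro ⟨x, y⟩
      simp [h2, h2', smul_smul, mul_comm]
    simp only [LinearMap.comp_apply, LinearEquiv.coe_coe, this]
    simp

/-- gluing local trivialisations at the minimal primes of a radical ideal. -/
theorem LocFree.glue [IsNoetherianRing R] {n : ℕ} (hM : LocFree R M n) (I : Ideal R)
    (hI : I.IsRadical) :
    ∃ h : R, (∀ q ∈ I.minimalPrimes, h ∉ q) ∧
      ∃ (α : (Fin n → R) →ₗ[R] M) (β : M →ₗ[R] (Fin n → R)), 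
        ∀ v i, β (α v) i - h * v i ∈ I := by
  classical
  have hfin : I.minimalPrimes.Finite := Ideal.finite_minimalPrimes_of_isNoetherianRing R I
  let S := hfin.toFinset
  have hS : ∀ {q}, q ∈ S ↔ q ∈ I.minimalPrimes := hfin.mem_toFinset
  have hinc : ∀ q ∈ S, ∀ q' ∈ S, q ≤ q' → q = q' := fun q hq q' hq' hle =>
    le_antisymm hle ((hS.1 hq').2 ((hS.1 hq).1) hle)
  have hu : ∀ q : S, ∃ u : R, u ∉ q.1 ∧ ∀ q' ∈ S, q' ≠ q.1 → u ∈ q' := by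
    intro q
    obtain ⟨c, h1, h2⟩ := exists_prescribed S (fun q hq => (hS.1 hq).1.1) hinc (fun q' => q' = q.1)
    exact ⟨c, h1 _ q.2 rfl, fun q' hq' hne => h2 q' hq' hne⟩
  choose u hu1 hu2 using hu
  have ht := fun q : S => hM q.1 (hS.1 q.2).1.1
  choose t ht α β hαβ hβα using ht
  have hmemI : ∀ x : R, (∀ q ∈ S, x ∈ q) → x ∈ I := by
    intro x hx
    rw [← hI.radical, ← Ideal.sInf_minimalPrimes, Ideal.mem_sInf]
    exact fun q hq => hx q (hS.2 hq)
  refine ⟨∑ q, u q ^ 2 * t q, ?_, ∑ q, u q • α q, ∑ q, u q • β q, ?_⟩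
  · intro q hq hmem
    have hqS : q ∈ S := hS.2 hq
    rw [← Finset.add_sum_erase _ _ (Finset.mem_univ (⟨q, hqS⟩ : S))] at hmem
    have h2 : ∑ x ∈ Finset.univ.erase (⟨q, hqS⟩ : S), u x ^ 2 * t x ∈ q := by
      refine Ideal.sum_mem _ fun x hx => ?_
      refine q.mul_mem_right _ (q.pow_mem_of_mem (hu2 x q hqS ?_) 2 (by norm_num))
      rintro rfl
      exact (Finset.mem_erase.1 hx).1 rfl
    have h3 := (Ideal.add_mem_iff_left q h2).1 hmem
    have hqp := hq.1.1
    rcases hqp.mem_or_mem h3 with h | h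
    · exact hu1 ⟨q, hqS⟩ (hqp.mem_of_pow_mem _ h)
    · exact ht ⟨q, hqS⟩ h
  · intro v i
    apply hmemI
    intro q hqS
    have key : ∀ (x y : S), (x.1 ≠ q ∨ y.1 ≠ q) →
        (u x • β x (u y • α y v)) i ∈ q := by
      rintro x y (h | h)
      · simp only [Pi.smul_apply, smul_eq_mul]
        exact q.mul_mem_right _ (hu2 x q hqS (Ne.symm h))
      · simp only [map_smul, Pi.smul_apply, smul_eq_mul]
        exact q.mul_mem_left _ (q.mul_mem_right _ (hu2 y q hqS (Ne.symm h)))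
    simp only [LinearMap.sum_apply, LinearMap.smul_apply, map_sum, Finset.sum_apply,
      Finset.sum_mul]
    rw [← Finset.sum_sub_distrib]
    refine Ideal.sum_mem _ fun x _ => ?_
    by_cases hx : x.1 = q
    · rw [← Finset.add_sum_erase _ _ (Finset.mem_univ x)]
      have h2 : ∑ y ∈ Finset.univ.erase x, (u y • β y (u x • α x v)) i ∈ q := by
        refine Ideal.sum_mem _ fun y hy => key y x (Or.inl ?_)
        intro h
        exact (Finset.mem_erase.1 hy).1 (Subtype.ext (h.trans hx.symm))
      have : (u x • β x (u x • α x v)) i = u x ^ 2 * t x * v i := by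
        simp only [map_smul, hβα, Pi.smul_apply, smul_eq_mul]; ring
      rw [this, add_sub_cancel_left]
      exact h2
    · refine Ideal.sub_mem _ (Ideal.sum_mem _ fun y _ => key y x (Or.inr hx)) ?_
      refine q.mul_mem_right _ (q.mul_mem_right _ (q.pow_mem_of_mem (hu2 x q hqS ?_) 2 
        (by norm_num)))
      exact fun h => hx h.symm

/-- F2: stable range for locally free modules, relative to an ideal. -/
theorem srm [IsNoetherianRing R] {n : ℕ} (hM : LocFree R M n) (d : ℕ) (hd : d ≤ n)
    (I : Ideal R) (hI : DimLt I d) (x : M) (c : R)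
    (hx : ∀ p : Ideal R, p.IsPrime → I ≤ p → c ∈ p → ¬ ordI (R := R) x ≤ p) :
    ∃ y : M, ∀ p : Ideal R, p.IsPrime → I ≤ p → ¬ ordI (R := R) (x + c • y) ≤ p := by
  induction d generalizing I x with
  | zero => exact ⟨0, fun p hp hIp => absurd ⟨hp, hIp⟩ (hI p)⟩
  | succ d ih =>
    obtain ⟨h, hh, α, β, hβα⟩ := hM.glue I.radical (Ideal.radical_isRadical I)
    have hdrop := (hI.radical).drop hh
    obtain ⟨y, hy⟩ := ih (by omega) (I.radical ⊔ Ideal.span {h}) hdrop x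
      (fun p hp hIp => hx p hp (Ideal.le_radical.trans (le_sup_left.trans hIp)))
    obtain ⟨b, hb⟩ := exists_row I (c * h * h) n (fun i => β (x + c • y) i)
    refine ⟨y + h • α b, fun p hp hIp hle => ?_⟩
    have hIr : I.radical ≤ p := hp.radical_le_iff.2 hIp
    have e1 : x + c • (y + h • α b) = x + c • y + (c * h) • α b := by
      simp only [smul_add, smul_smul, add_assoc]
    rw [e1] at hle
    by_cases hch : c * h ∈ p
    · have h1 := ordI_add_smul_le _ _ _ p hch hle
      rcases hp.mem_or_mem hch with hc | hc
      · exact hx p hp hIp hc (ordI_add_smul_le _ _ _ p hc h1)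
      · exact hy p hp (sup_le hIr ((Ideal.span_singleton_le_iff_mem p).2 hc)) h1
    · refine hI p ((hb p hp hIp ?_ ?_).of_le hd)
      · intro h'
        rcases hp.mem_or_mem h' with h' | h'
        · exact hch h'
        · exact hch (p.mul_mem_left _ h')
      · intro i
        have h1 := hle (apply_mem_ordI (LinearMap.proj i ∘ₗ β) _)
        simp only [LinearMap.comp_apply, map_add, LinearMap.proj_apply, map_smul,
          smul_eq_mul] at h1 ⊢
        have h2 := hIr (hβα b i)
        have : β x i + c * β y i + c * h * h * b i =
          (β x i + c * β y i + c * h * β (α b) i) - c * h * (β (α b) i - h * b i) := by ring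
        simp only [Pi.add_apply, Pi.smul_apply, smul_eq_mul] at h1 ⊢
        rw [this]
        exact p.sub_mem h1 (p.mul_mem_left _ h2)

theorem eq_top_of_no_prime (I : Ideal R) (h : ∀ p : Ideal R, p.IsPrime → ¬ I ≤ p) : I = ⊤ := by
  by_contra hne
  obtain ⟨m, hm, hle⟩ := Ideal.exists_le_maximal I hne
  exact h m hm.isPrime hle

theorem exists_unimodular [IsNoetherianRing R] {n : ℕ} (hM : LocFree R M n) 
    (hd : DimLt (⊥ : Ideal R) n) (x : M) (c : R) (hx : ordI (R := R) x ⊔ Ideal.span {c} = ⊤) :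
    ∃ y : M, ∃ φ : M →ₗ[R] R, φ (x + c • y) = 1 := by
  obtain ⟨y, hy⟩ := srm hM n le_rfl ⊥ hd x c (fun p hp _ hc hle => hp.ne_top
    (top_le_iff.1 (hx ▸ sup_le hle ((Ideal.span_singleton_le_iff_mem p).2 hc))))
  have := eq_top_of_no_prime _ (fun p hp => hy p hp bot_le)
  exact ⟨y, mem_ordI.1 (this ▸ Submodule.mem_top)⟩

end F2

section F3
variable {R : Type*} [CommRing R] {M : Type*} [AddCommGroup M] [Module R M]
  {N : Type*} [AddCommGroup N] [Module R N] {M' : Type*} [AddCommGroup M'] [Module R M']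

/-- identify a complement with the target of a surjection. -/
theorem equiv_of_surj (e : (M' × R) ≃ₗ[R] N) (θ : N →ₗ[R] M) (hs : Function.Surjective θ)
    (hk : ∀ z, θ z = 0 ↔ ∃ a : R, z = a • e (0, 1)) : Nonempty (M' ≃ₗ[R] M) := by
  let g : M' →ₗ[R] M := θ ∘ₗ e.toLinearMap ∘ₗ LinearMap.inl R M' R
  have h0 : θ (e (0, 1)) = 0 := (hk _).2 ⟨1, by simp⟩
  have hdec : ∀ (x : M') (b : R), θ (e (x, b)) = g x := by
    intro x b
    have : ((x, b) : M' × R) = (x, 0) + b • ((0 : M'), (1 : R)) := by simp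
    rw [this, map_add, map_smul, map_add, map_smul, h0, smul_zero, add_zero]
    simp [g]
  refine ⟨LinearEquiv.ofBijective g ⟨?_, ?_⟩⟩
  · rw [injective_iff_map_eq_zero]
    intro x hx
    obtain ⟨a, ha⟩ := (hk (e (x, 0))).1 (by rw [hdec]; exact hx)
    rw [← map_smul] at ha
    have := e.injective ha
    simpa using congrArg Prod.fst this
  · intro y
    obtain ⟨z, rfl⟩ := hs y
    obtain ⟨⟨x, b⟩, rfl⟩ := e.surjective z
    exact ⟨x, (hdec x b).symm⟩

/-- transvection `(x, c) ↦ (x + c y, c)` -/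
def tvL (y : M) : (M × R) ≃ₗ[R] (M × R) where
  toFun z := (z.1 + z.2 • y, z.2)
  invFun z := (z.1 - z.2 • y, z.2)
  map_add' z w := by ext <;> simp [add_smul]; abel
  map_smul' a z := by ext <;> simp [smul_smul]
  left_inv z := by ext <;> simp
  right_inv z := by ext <;> simp

/-- transvection `(x, c) ↦ (x, c + φ x)` -/
def tvR (φ : M →ₗ[R] R) : (M × R) ≃ₗ[R] (M × R) where
  toFun z := (z.1, z.2 + φ z.1)
  invFun z := (z.1, z.2 - φ z.1)
  map_add' z w := by ext <;> simp; abel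
  map_smul' a z := by ext <;> simp [mul_add]
  left_inv z := by ext <;> simp
  right_inv z := by ext <;> simp

@[simp] theorem tvL_apply (y : M) (z : M × R) : tvL y z = (z.1 + z.2 • y, z.2) := rfl
@[simp] theorem tvR_apply (φ : M →ₗ[R] R) (z : M × R) : tvR φ z = (z.1, z.2 + φ z.1) := rfl

/-- F3: Bass cancellation. -/
theorem bass_cancel [IsNoetherianRing R] {n : ℕ} (hM : LocFree R M n)
    (hd : DimLt (⊥ : Ideal R) n) (e : (M' × R) ≃ₗ[R] (M × R)) : Nonempty (M' ≃ₗ[R] M) := by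
  obtain ⟨⟨x, c⟩, h⟩ : ∃ z, e (0, 1) = z := ⟨_, rfl⟩
  have hx : ordI (R := R) x ⊔ Ideal.span {c} = ⊤ := by
    rw [Ideal.eq_top_iff_one]
    let ψ : M × R →ₗ[R] R := LinearMap.snd R M' R ∘ₗ e.symm.toLinearMap
    have h1 : ψ (x, c) = 1 := by simp [ψ, ← h]
    have h2 : ((x, c) : M × R) = LinearMap.inl R M R x + c • ((0 : M), (1 : R)) := by simp
    rw [h2, map_add, map_smul, smul_eq_mul] at h1
    rw [← h1]
    exact add_mem (Ideal.mem_sup_left (apply_mem_ordI (ψ ∘ₗ LinearMap.inl R M R) x))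
      (Ideal.mem_sup_right (Ideal.mem_span_singleton.2 (Dvd.intro _ rfl)))
  obtain ⟨y, φ, hφ⟩ := exists_unimodular hM hd x c hx
  let a := ((tvL y).trans (tvR ((1 - c) • φ))).trans (tvL (-(x + c • y)))
  have ha : a (x, c) = (0, 1) := by
    simp [a, hφ]
  refine equiv_of_surj (e.trans a) (LinearMap.fst R M R) (fun m => ⟨(m, 0), rfl⟩) ?_
  intro z
  simp only [LinearEquiv.trans_apply, h, ha]
  constructor
  · intro hz
    exact ⟨z.2, by ext <;> simp_all⟩
  · rintro ⟨b, rfl⟩; simp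

end F3
end FpLci
end

section
namespace FpLci

section F4a
variable {B : Type*} [CommRing B]

/-- the symplectic form on `B²` -/
def om (x y : B × B) : B := x.1 * y.2 - x.2 * y.1

/-- `om` as a linear form in the first variable -/
def omL (y : B × B) : (B × B) →ₗ[B] B where
  toFun x := om x y
  map_add' a b := by simp only [om, Prod.fst_add, Prod.snd_add]; ring
  map_smul' a b := by simp only [om, Prod.smul_fst, Prod.smul_snd, smul_eq_mul, RingHom.id_apply]; ring

@[simp] theorem omL_apply (x y : B × B) : omL y x = om x y := rfl

theorem square_lemma (T : Submodule B (B × B)) (s : B) (hs : s ∈ nonZeroDivisors B)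
    (p y : T) (lam : T →ₗ[B] B) (hy : ∀ x : T, s * lam x = om x y) (c d : B)
    (h : s * lam p + c * d = 1) :
    ∃ θ : (T × B) →ₗ[B] T, Function.Surjective θ ∧
      ∀ z, θ z = 0 ↔ ∃ a : B, z = a • (s • p, c ^ 2) := by
  have hpy : om (p : B × B) y = 1 - c * d := by rw [← hy]; linear_combination h
  let n : T := (1 + c * d) • p - c • y
  let Tm : T →ₗ[B] T := c • LinearMap.id + ((omL (n : B × B)) ∘ₗ T.subtype).smulRight n
  let u : T := (c * d ^ 2) • (s • p) + ((1 - c * d) * s) • y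
  let θ : (T × B) →ₗ[B] T := Tm ∘ₗ LinearMap.fst B T B - (LinearMap.snd B T B).smulRight u
  have hθ : ∀ (x : T) (τ : B), θ (x, τ) = c • x + om (x : B × B) n • n - τ • u := by
    intro x τ; rfl
  have hn1 : (n : B × B).1 = (1 + c * d) * (p : B × B).1 - c * (y : B × B).1 := rfl
  have hn2 : (n : B × B).2 = (1 + c * d) * (p : B × B).2 - c * (y : B × B).2 := rfl
  have hu1 : (u : B × B).1 = (c * d ^ 2) * (s * (p : B × B).1) + ((1 - c * d) * s) * (y : B × B).1 :=
    rfl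
  have hu2 : (u : B × B).2 = (c * d ^ 2) * (s * (p : B × B).2) + ((1 - c * d) * s) * (y : B × B).2 :=
    rfl
  refine ⟨θ, ?_, ?_⟩
  · -- surjective
    let W := LinearMap.range θ
    -- step: every z is in W + c T
    have hc2 : ∀ z : T, c ^ 2 • z ∈ W := by
      intro z
      refine ⟨(c • z - om (z : B × B) n • n, 0), ?_⟩
      rw [hθ]
      ext <;> simp [om] <;> ring
    have hp : ∃ z' : T, p + c • z' ∈ W := by
      refine ⟨-y - (d * c * d) • p + ((1 - c * d) * (1 + c * d)) • (-y) + d • p - (d * c * d) • (c * d) • p, ⟨(-y, 0), ?_⟩⟩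
      rw [hθ]
      have h1 : om ((-y : T) : B × B) n = (1 + c * d) * (1 - c * d) := by
        rw [← hpy]; simp only [om, hn1, hn2, NegMemClass.coe_neg, Prod.fst_neg, Prod.snd_neg]; ring
      rw [h1, zero_smul, sub_zero]
      ext
      · simp [hn1]; ring
      · simp [hn2]; ring
    have hyy : ∃ z' : T, y + c • z' ∈ W := by
      refine ⟨lam p • (d ^ 2 • (s • p)) - (2 * d) • y + (c * d * d) • y, ⟨(0, - lam p), ?_⟩⟩
      rw [hθ]
      have e : s * lam p = 1 - c * d := by linear_combination h
      ext
      · simp [om, hu1]; linear_combination (1 - c * d) * (y : B × B).1 * e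
      · simp [om, hu2]; linear_combination (1 - c * d) * (y : B × B).2 * e
    obtain ⟨p', hp'⟩ := hp
    obtain ⟨y', hy'⟩ := hyy
    have hall : ∀ z : T, ∃ z' : T, z + c • z' ∈ W := by
      intro z
      have hz : z = (c * d) • z + lam z • s • p - om (z : B × B) p • y := by
        have := hy z
        have h1 : (z : B × B).1 * (1 - c * d) = om (z : B × B) y * (p : B × B).1
            - om (z : B × B) p * (y : B × B).1 := by
          rw [← hpy]; simp only [om]; ring
        have h2 : (z : B × B).2 * (1 - c * d) = om (z : B × B) y * (p : B × B).2
            - om (z : B × B) p * (y : B × B).2 := by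
          rw [← hpy]; simp only [om]; ring
        ext
        · simp; linear_combination h1 - (p : B × B).1 * this
        · simp; linear_combination h2 - (p : B × B).2 * this
      refine ⟨-d • z + lam z • s • p' - om (z : B × B) p • y', ?_⟩
      have : z + c • (-d • z + lam z • s • p' - om (z : B × B) p • y') =
        (lam z * s) • (p + c • p') - om (z : B × B) p • (y + c • y') := by
        nth_rewrite 1 [hz]
        module
      rw [this]
      exact W.sub_mem (W.smul_mem _ hp') (W.smul_mem _ hy')
    intro z
    obtain ⟨z1, h1⟩ := hall z
    obtain ⟨z2, h2⟩ := hall z1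
    have : z ∈ W := by
      have e : z = (z + c • z1) - c • (z1 + c • z2) + c ^ 2 • z2 := by module
      rw [e]
      exact W.add_mem (W.sub_mem h1 (W.smul_mem _ h2)) (hc2 z2)
    exact this
  · rintro ⟨x, τ⟩
    constructor
    · intro hz
      rw [hθ] at hz
      have e1 := congrArg (fun t : T => (t : B × B).1) hz
      have e2 := congrArg (fun t : T => (t : B × B).2) hz
      simp only [Submodule.coe_add, Submodule.coe_sub, Submodule.coe_smul, Prod.fst_add,
        Prod.fst_sub, Prod.smul_fst, Prod.snd_add, Prod.snd_sub, Prod.smul_snd, smul_eq_mul,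
        ZeroMemClass.coe_zero, Prod.fst_zero, Prod.snd_zero] at e1 e2
      have hb := hy x
      set b := s * lam x with hbdef
      set a := om (x : B × B) p with ha
      set m := om (x : B × B) n with hm
      have hm' : m = (1 + c * d) * a - c * b := by
        rw [hb, hm, ha]; simp only [om, hn1, hn2]; ring
      rw [hu1, hn1] at e1
      rw [hu2, hn2] at e2
      have hb' := hb
      have ha' := ha
      have hpy' := hpy
      simp only [om] at hb' ha' hpy'
      -- apply om(.,p) and om(.,y)
      have E1 : c * (a + (1 - c * d) * m) = - (τ * s * (1 - c * d) ^ 2) := by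
        have : c * a + m * c * (om (p : B × B) y) + τ * ((1 - c * d) * s) * om (p : B × B) y = 0 := by
          rw [ha]; simp only [om]
          linear_combination (p : B × B).2 * e1 - (p : B × B).1 * e2
        rw [hpy] at this
        linear_combination this
      have E2 : c * b + m * (1 - c * d) * (1 + c * d) = τ * c * d ^ 2 * s * (1 - c * d) := by
        have : c * b + m * (1 + c * d) * om (p : B × B) y - τ * (c * d ^ 2) * s * om (p : B × B) y = 0 := by
          rw [hb]; simp only [om]
          linear_combination (y : B × B).2 * e1 - (y : B × B).1 * e2
        rw [hpy] at this
        linear_combination this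
      have hcm : c * m = - (τ * s * (1 - c * d)) := by
        linear_combination (1 + c * d) * E1 - c * E2 + c * hm'
      have hcb : c ^ 2 * b = τ * s * (1 - c * d) := by
        linear_combination c * E2 - (1 - c * d) * (1 + c * d) * hcm
      have hca : c * a = 0 := by linear_combination E1 - (1 - c * d) * hcm
      have ha0 : a = 0 := by
        linear_combination (-1 : B) * hm' * (1 - c * d) * (1 + c * d) + E2 - c * d ^ 2 * hcb
          - d * hca * (1 - c * d - (c * d) ^ 2) + 2 * d * hca - 2 * d * hca
      have hms : m = - (c * b) := by rw [hm', ha0]; ring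
      refine ⟨lam x * (1 + c * d) + d ^ 2 * τ, ?_⟩
      have hx1 : (x : B × B).1 = b * (p : B × B).1 + c * d * (x : B × B).1 := by
        have : (x : B × B).1 * om (p : B × B) y = b * (p : B × B).1 - a * (y : B × B).1 := by
          rw [hb, ha]; simp only [om]; ring
        rw [hpy, ha0] at this; linear_combination this
      have hx2 : (x : B × B).2 = b * (p : B × B).2 + c * d * (x : B × B).2 := by
        have : (x : B × B).2 * om (p : B × B) y = b * (p : B × B).2 - a * (y : B × B).2 := by
          rw [hb, ha]; simp only [om]; ring
        rw [hpy, ha0] at this; linear_combination this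
      refine Prod.ext (Subtype.ext (Prod.ext ?_ ?_)) ?_
      · simp only [Prod.smul_fst, Submodule.coe_smul, smul_eq_mul]
        have : (x : B × B).1 = (s * lam x * (1 + c * d) + d ^ 2 * τ * s) * (p : B × B).1 := by
          rw [← hbdef]
          rw [hms] at e1 hcm
          linear_combination hx1 + d * e1 + d ^ 2 * (p : B × B).1 * hcb + d * (y : B × B).1 * hcm
        linear_combination this
      · simp only [Prod.smul_fst, Submodule.coe_smul, smul_eq_mul, Prod.smul_snd]
        have : (x : B × B).2 = (s * lam x * (1 + c * d) + d ^ 2 * τ * s) * (p : B × B).2 := by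
          rw [← hbdef]
          rw [hms] at e2 hcm
          linear_combination hx2 + d * e2 + d ^ 2 * (p : B × B).2 * hcb + d * (y : B × B).2 * hcm
        linear_combination this
      · simp only [Prod.smul_snd, smul_eq_mul]
        have : s * (τ - (lam x * (1 + c * d) + d ^ 2 * τ) * c ^ 2) = 0 := by
          linear_combination (-(1 + c * d)) * hcb + (1 + c * d) * c ^ 2 * hbdef
        have h0 := (mem_nonZeroDivisors_iff.1 hs).1 _ this
        linear_combination h0
    · rintro ⟨a, ha⟩
      obtain ⟨rfl, rfl⟩ := Prod.mk.inj ha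
      have : θ (s • p, c ^ 2) = 0 := by
        rw [hθ]
        have : om ((s • p : T) : B × B) n = -(s * c * (1 - c * d)) := by
          rw [← hpy]
          simp only [om, hn1, hn2, Submodule.coe_smul, Prod.smul_fst, Prod.smul_snd, smul_eq_mul]
          ring
        rw [this]
        ext
        · simp [hu1, hn1]; ring
        · simp [hu2, hn2]; ring
      rw [show ((a • (s • p), a • (c ^ 2)) : T × B) = a • (s • p, c ^ 2) from rfl, map_smul, this,
        smul_zero]

end F4a
end FpLci
end

section
namespace FpLci

section sqrt
open Polynomial

/-- square roots of units in finite-dimensional algebras, odd characteristic. -/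
theorem exists_sqrt {k : Type*} [Field k] [IsAlgClosed k] (p : ℕ) [hp : Fact p.Prime] [CharP k p]
    (hp2 : p ≠ 2) {S' : Type*} [CommRing S'] [Algebra k S'] [Module.Finite k S'] (c : S')
    (hc : IsUnit c) : ∃ d : S', d ^ 2 = c := by
  classical
  nontriviality S'
  have : CharP S' p := charP_of_injective_algebraMap (algebraMap k S').injective p
  have hIntegral : IsIntegral k c := Algebra.IsIntegral.isIntegral c
  let f := minpoly k c
  have hsplit : f.Splits := IsAlgClosed.splits f
  have hmonic : f.Monic := minpoly.monic hIntegral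
  let S := f.roots.toFinset
  let n := Multiset.card f.roots
  let Q := p ^ n
  have hnQ : n ≤ Q := (Nat.lt_pow_self hp.out.one_lt).le
  have hprod : ∏ a ∈ S, (c - algebraMap k S' a) ^ Q = 0 := by
    have h1 : f = (f.roots.map fun a => X - C a).prod := by
      conv_lhs => rw [hsplit.eq_prod_roots]
      rw [hmonic.leadingCoeff]; simp
    have h2 : aeval c f = 0 := minpoly.aeval k c
    have h3 : f ∣ ∏ a ∈ S, (X - C a) ^ Q := by
      conv_lhs => rw [h1]
      rw [Finset.prod_multiset_map_count]
      refine Finset.prod_dvd_prod_of_dvd _ _ fun a _ => pow_dvd_pow _ ?_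
      exact (Multiset.count_le_card a f.roots).trans hnQ
    have h4 := map_dvd (aeval c) h3
    rw [h2, zero_dvd_iff] at h4
    simpa [map_prod] using h4
  have hfrob : ∀ a : k, (c - algebraMap k S' a) ^ Q = c ^ Q - algebraMap k S' (a ^ Q) := by
    intro a
    rw [sub_pow_char_pow, map_pow]
  have hsq : ∀ a : k, ∃ b : k, b ^ 2 = a ^ Q := fun a =>
    IsAlgClosed.exists_pow_nat_eq _ (by norm_num)
  choose r hr using hsq
  have hinj : Set.InjOn (fun a : k => a ^ Q) (S : Set k) := by
    intro a _ b _ hab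
    exact iterateFrobenius_inj k p n (by simpa [iterateFrobenius_def] using hab)
  let l := Lagrange.interpolate S (fun a : k => a ^ Q) r
  have hl : ∀ a ∈ S, eval (a ^ Q) l = r a := fun a ha =>
    Lagrange.eval_interpolate_at_node r hinj ha
  have hdvd : ∏ a ∈ S, (X - C (a ^ Q)) ∣ l ^ 2 - X := by
    refine Finset.prod_dvd_of_coprime ?_ ?_
    · intro a ha b hb hab
      exact isCoprime_X_sub_C_of_isUnit_sub
        (sub_ne_zero.2 fun h => hab (hinj ha hb h)).isUnit
    · intro a ha
      rw [dvd_iff_isRoot, IsRoot.def, eval_sub, eval_pow, hl a ha, hr, eval_X, sub_self]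
  have hlc : aeval (c ^ Q) l ^ 2 = c ^ Q := by
    have h4 := map_dvd (aeval (c ^ Q)) hdvd
    have h5 : aeval (c ^ Q) (∏ a ∈ S, (X - C (a ^ Q))) = 0 := by
      rw [map_prod, ← hprod]
      refine Finset.prod_congr rfl fun a _ => ?_
      rw [hfrob]; simp
    rw [h5, zero_dvd_iff, map_sub, map_pow, aeval_X, sub_eq_zero] at h4
    exact h4
  have hodd : Odd Q := (hp.out.odd_of_ne_two hp2).pow
  obtain ⟨m, hm⟩ := hodd
  have hu : IsUnit (aeval (c ^ Q) l) := by
    rw [← isUnit_pow_iff two_ne_zero, hlc]; exact hc.pow Q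
  obtain ⟨u, hu⟩ := hu
  refine ⟨c ^ (m + 1) * (u⁻¹ : S'ˣ), ?_⟩
  have h1 : (c ^ (m + 1)) ^ 2 = c ^ Q * c := by rw [hm]; ring
  rw [mul_pow, h1, ← hlc, ← hu, mul_right_comm, ← mul_pow, Units.mul_inv]
  simp
end sqrt

section cancel
variable {B : Type*} [CommRing B] {M' : Type*} [AddCommGroup M'] [Module B M']

theorem exists_y (T : Submodule B (B × B)) (s : B) (hT : ∀ z, s • z ∈ T) (lam : T →ₗ[B] B) :
    ∃ y : T, ∀ x : T, s ^ 2 * lam x = om x y := by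
  let l1 := lam ⟨s • (1, 0), hT _⟩
  let l2 := lam ⟨s • (0, 1), hT _⟩
  refine ⟨⟨s • (-l2, l1), hT _⟩, fun x => ?_⟩
  have h : s • x = (x : B × B).1 • (⟨s • (1, 0), hT _⟩ : T) + (x : B × B).2 • ⟨s • (0, 1), hT _⟩ := by
    ext <;> simp [mul_comm]
  have h2 := congrArg lam h
  rw [map_smul, map_add, map_smul, map_smul] at h2
  simp only [smul_eq_mul] at h2
  simp only [om, Prod.smul_mk, smul_eq_mul]
  linear_combination s * h2

theorem uni_of_equiv {M : Type*} [AddCommGroup M] [Module B M] (e : (M' × B) ≃ₗ[B] (M × B))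
    {x : M} {c : B} (h : e (0, 1) = (x, c)) : ∃ (lam : M →ₗ[B] B) (d : B), lam x + c * d = 1 := by
  let ψ : M × B →ₗ[B] B := LinearMap.snd B M' B ∘ₗ e.symm.toLinearMap
  have h1 : ψ (x, c) = 1 := by simp [ψ, ← h]
  have h2 : ((x, c) : M × B) = LinearMap.inl B M B x + c • ((0 : M), (1 : B)) := by simp
  rw [h2, map_add, map_smul, smul_eq_mul] at h1
  exact ⟨ψ ∘ₗ LinearMap.inl B M B, _, h1⟩

/-- the last step of the cancellation. -/
theorem cancel_finish (T : Submodule B (B × B)) (s : B) (hs : s ∈ nonZeroDivisors B)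
    (hT : ∀ z, s • z ∈ T) (e : (M' × B) ≃ₗ[B] (T × B)) (p : T) (c : B)
    (he : e (0, 1) = (s ^ 2 • p, c ^ 2)) : Nonempty (M' ≃ₗ[B] T) := by
  obtain ⟨lam, d, h⟩ := uni_of_equiv e he
  obtain ⟨y, hy⟩ := exists_y T s hT lam
  rw [map_smul, smul_eq_mul] at h
  obtain ⟨θ, h1, h2⟩ := square_lemma T (s ^ 2) (pow_mem hs 2) p y lam hy c (c * d)
    (by linear_combination h)
  exact equiv_of_surj e θ h1 (by rw [he]; exact h2)

theorem DimLt.drop_nzd {d : ℕ} (h : DimLt (⊥ : Ideal B) (d + 1)) {x : B}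
    (hx : x ∈ nonZeroDivisors B) : DimLt (Ideal.span {x}) d := by
  have := h.drop (x := x) (fun q hq hxq => by
    have := Set.disjoint_left.1 (Ideal.disjoint_nonZeroDivisors_of_mem_minimalPrimes hq) 
    exact this hxq hx)
  simpa using this

/-- first normalisation: `p ≡ 0` and `c ≡ 1` modulo `s`. -/
theorem cancel_step1 [IsNoetherianRing B] {T : Type*} [AddCommGroup T] [Module B T]
    (hT : LocFree B T 2) (hd : DimLt (⊥ : Ideal B) 3) (s : B) (hs : s ∈ nonZeroDivisors B)
    (e : (M' × B) ≃ₗ[B] (T × B)) :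
    ∃ (e' : (M' × B) ≃ₗ[B] (T × B)) (p : T) (b : B), e' (0, 1) = (s • p, 1 + s * b) := by
  obtain ⟨⟨x, c⟩, h⟩ : ∃ z, e (0, 1) = z := ⟨_, rfl⟩
  obtain ⟨lam, d, hlam⟩ := uni_of_equiv e h
  obtain ⟨y, hy⟩ := srm hT 2 le_rfl (Ideal.span {s}) (hd.drop_nzd hs) x c (by
    intro p hp _ hc hle
    refine hp.ne_top ((Ideal.eq_top_iff_one p).2 ?_)
    rw [← hlam]
    exact add_mem (hle (apply_mem_ordI lam x)) (p.mul_mem_right _ hc))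
  have htop : ordI (R := B) (x + c • y) ⊔ Ideal.span {s} = ⊤ :=
    eq_top_of_no_prime _ fun p hp hle => hy p hp (le_sup_right.trans hle) (le_sup_left.trans hle)
  obtain ⟨a, ha, b, hb, hab⟩ := Submodule.mem_sup.1 ((Ideal.eq_top_iff_one _).1 htop)
  obtain ⟨φ, hφ⟩ := mem_ordI.1 ha
  obtain ⟨b, rfl⟩ := Ideal.mem_span_singleton.1 hb
  let a := ((tvL y).trans (tvR ((1 - c) • φ))).trans (tvL (-(x + c • y)))
  refine ⟨e.trans a, ((1 - c) * b) • (x + c • y), -(1 - c) * b, ?_⟩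
  rw [LinearEquiv.trans_apply, h]
  have hφ' : φ (x + c • y) = 1 - s * b := by rw [hφ]; linear_combination hab
  simp only [a, LinearEquiv.trans_apply, tvL_apply, tvR_apply, LinearMap.smul_apply, hφ',
    smul_eq_mul]
  refine Prod.ext ?_ ?_
  · simp only
    module
  · simp only
    ring

theorem cancel_odd [IsNoetherianRing B] {k : Type*} [Field k] [IsAlgClosed k] (p : ℕ)
    [hp : Fact p.Prime] [CharP k p]
    (hp2 : p ≠ 2) [Algebra k B] [Algebra.FiniteType k B]
    (T : Submodule B (B × B)) (s : B) (hs : s ∈ nonZeroDivisors B)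
    (hT : ∀ z, s • z ∈ T) (hTl : LocFree B T 2) (hd : DimLt (⊥ : Ideal B) 3)
    (e : (M' × B) ≃ₗ[B] (T × B)) : Nonempty (M' ≃ₗ[B] T) := by
  obtain ⟨e, p1, b, he⟩ := cancel_step1 hTl hd (s ^ 2) (pow_mem hs 2) e
  obtain ⟨c, hc⟩ : ∃ c, c = 1 + s ^ 2 * b := ⟨_, rfl⟩
  rw [← hc] at he
  -- make `p1` unimodular mod `s`
  obtain ⟨y', hy'⟩ := srm hTl 2 le_rfl (Ideal.span {s}) (hd.drop_nzd hs) p1 c (by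
    intro q hq hs hcq
    refine fun _ => hq.ne_top ((Ideal.eq_top_iff_one q).2 ?_)
    have h1 : s ∈ q := hs (Ideal.mem_span_singleton_self s)
    rw [show (1 : B) = c - s * (s * b) by rw [hc]; ring]
    exact sub_mem hcq (q.mul_mem_right _ h1))
  obtain ⟨p2, hp2'⟩ : ∃ p2, p2 = p1 + c • y' := ⟨_, rfl⟩
  rw [← hp2'] at hy'
  -- general position
  obtain ⟨w, hw⟩ := exists_row (⊥ : Ideal B) (c * s ^ 2) 2 ![(p2 : B × B).1, (p2 : B × B).2]
  let y'' : T := ⟨s • (w 0, w 1), hT _⟩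
  obtain ⟨p3, hp3⟩ : ∃ p3 : T, p3 = p2 + (c * s) • y'' := ⟨_, rfl⟩
  let e3 := e.trans (tvL (s ^ 2 • (y' + s • y'')))
  have he3 : e3 (0, 1) = (s ^ 2 • p3, c) := by
    simp only [e3, LinearEquiv.trans_apply, he, tvL_apply, hp3, hp2']
    refine Prod.ext ?_ rfl
    simp only
    module
  obtain ⟨lam, d, hlam⟩ := uni_of_equiv e3 he3
  rw [map_smul, smul_eq_mul] at hlam
  let I := ordI (R := B) p3
  have hIs : ∀ q : Ideal B, q.IsPrime → I ≤ q → s ∉ q := by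
    intro q hq hle hsq
    rw [show I = ordI (R := B) (p2 + (c * s) • y'') by rw [← hp3]] at hle
    exact hy' q hq ((Ideal.span_singleton_le_iff_mem q).2 hsq)
      (ordI_add_smul_le _ _ _ q (q.mul_mem_left _ hsq) hle)
  have hIc : ∀ q : Ideal B, q.IsPrime → I ≤ q → c ∉ q := by
    intro q hq hle hcq
    refine hq.ne_top ((Ideal.eq_top_iff_one q).2 ?_)
    rw [← hlam]
    exact add_mem (q.mul_mem_left _ (hle (apply_mem_ordI lam p3))) (q.mul_mem_right _ hcq)
  have hchain : ∀ q : Ideal B, q.IsPrime → I ≤ q → ChainTo (⊥ : Ideal B) 2 q := by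
    intro q hq hle
    refine hw q hq bot_le ?_ ?_
    · intro h
      rcases hq.mem_or_mem h with h | h
      · exact hIc q hq hle h
      · exact hIs q hq hle (hq.mem_of_pow_mem _ h)
    · have h1 := hle (apply_mem_ordI (LinearMap.fst B B B ∘ₗ T.subtype) p3)
      have h2 := hle (apply_mem_ordI (LinearMap.snd B B B ∘ₗ T.subtype) p3)
      simp only [hp3, y'', LinearMap.comp_apply, Submodule.subtype_apply, LinearMap.fst_apply,
        LinearMap.snd_apply, Submodule.coe_add, Submodule.coe_smul, Prod.fst_add, Prod.snd_add,
        Prod.smul_fst, Prod.smul_snd, smul_eq_mul] at h1 h2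
      intro i
      fin_cases i
      · convert h1 using 1; simp; ring
      · convert h2 using 1; simp; ring
  have hmax : ∀ q : Ideal B, q.IsPrime → I ≤ q → q.IsMaximal := by
    intro q hq hle
    obtain ⟨m, hm, hqm⟩ := Ideal.exists_le_maximal q hq.ne_top
    rcases eq_or_lt_of_le hqm with h | h
    · exact h ▸ hm
    · exact absurd ⟨hm.isPrime, q, hchain q hq hle, h⟩ (hd m)
  have : Ring.KrullDimLE 0 (B ⧸ I) := Ring.KrullDimLE.mk₀ fun P hP => by
    have h1 := hmax (P.comap (Ideal.Quotient.mk I)) inferInstance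
      (fun x hx => by simp [Ideal.mem_comap, Ideal.Quotient.eq_zero_iff_mem.2 hx])
    have h2 := Ideal.map_eq_top_or_isMaximal_of_surjective (Ideal.Quotient.mk I)
      Ideal.Quotient.mk_surjective h1
    rw [Ideal.map_comap_of_surjective _ Ideal.Quotient.mk_surjective] at h2
    exact h2.resolve_left hP.ne_top
  have : IsArtinianRing (B ⧸ I) := IsNoetherianRing.isArtinianRing_of_krullDimLE_zero
  have : Module.Finite k (B ⧸ I) := Module.finite_of_isArtinianRing k (B ⧸ I)
  have hunit : IsUnit (Ideal.Quotient.mk I c) := by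
    refine IsUnit.of_mul_eq_one (Ideal.Quotient.mk I d) ?_
    rw [← map_mul, ← map_one (Ideal.Quotient.mk I), Ideal.Quotient.eq]
    rw [show c * d - 1 = -(s ^ 2 * lam p3) by linear_combination hlam]
    exact I.neg_mem (I.mul_mem_left _ (apply_mem_ordI lam p3))
  obtain ⟨r, hr⟩ := exists_sqrt (k := k) p hp2 _ hunit
  obtain ⟨c2, rfl⟩ := Ideal.Quotient.mk_surjective r
  rw [← map_pow, Ideal.Quotient.eq] at hr
  have hcop : I ⊔ Ideal.span {s ^ 2} = ⊤ := eq_top_of_no_prime _ fun q hq hle =>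
    hIs q hq (le_sup_left.trans hle) (hq.mem_of_pow_mem _
      (le_sup_right.trans hle (Ideal.mem_span_singleton_self _)))
  obtain ⟨i, hi, j, hj, hij⟩ := Submodule.mem_sup.1 ((Ideal.eq_top_iff_one _).1 hcop)
  obtain ⟨j, rfl⟩ := Ideal.mem_span_singleton.1 hj
  -- c1 ≡ c2 mod I, ≡ 1 mod s²
  let c1 := s ^ 2 * j * c2 + i
  have hc1I : c1 ^ 2 - c ∈ I := by
    have h1 : c1 - c2 ∈ I := by
      rw [show c1 - c2 = i * (1 - c2) by simp only [c1]; linear_combination c2 * hij]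
      exact I.mul_mem_right _ hi
    rw [show c1 ^ 2 - c = (c1 - c2) * (c1 + c2) + (c2 ^ 2 - c) by ring]
    exact I.add_mem (I.mul_mem_right _ h1) hr
  obtain ⟨g, hg⟩ : ∃ g, c1 ^ 2 - c = s ^ 2 * g := by
    refine ⟨(j * (c2 - 1)) * (c1 + 1) - b, ?_⟩
    simp only [hc, c1]
    linear_combination (2 + s ^ 2 * j * (c2 - 1) + i + s ^ 2 * j - 1 + s ^ 2 * j * (c2 - 1)) * hij
     - (s ^ 2 * j * (c2 - 1)) * hij
  have hgI : c1 ^ 2 - c = s ^ 2 * (g * i + j * (c1 ^ 2 - c)) := by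
    linear_combination i * hg - (c1 ^ 2 - c) * hij
  obtain ⟨φ, hφ⟩ := mem_ordI.1 (I.add_mem (I.mul_mem_left g hi) (I.mul_mem_left j hc1I))
  let e4 := e3.trans (tvR φ)
  refine cancel_finish T s hs hT e4 p3 c1 ?_
  simp only [e4, LinearEquiv.trans_apply, he3, tvR_apply, map_smul, hφ, smul_eq_mul, ← hgI]
  refine Prod.ext rfl ?_
  simp only
  ring

end cancel
end FpLci
end

section
namespace FpLci

section frob
variable {B : Type*} [CommRing B]

/-- entrywise `q`-th power. -/
def fr (q : ℕ) (x : B × B) : B × B := (x.1 ^ q, x.2 ^ q)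

/-- span of the entrywise `q`-th powers. -/
def frobS (q : ℕ) (T : Submodule B (B × B)) : Submodule B (B × B) :=
  Submodule.span B (fr q '' T)

theorem fr_mem (q : ℕ) {T : Submodule B (B × B)} {x : B × B} (hx : x ∈ T) : fr q x ∈ frobS q T :=
  Submodule.subset_span ⟨x, hx, rfl⟩

theorem frobS_one (T : Submodule B (B × B)) : frobS 1 T = T := by
  have : fr 1 '' (T : Set (B × B)) = T := by
    have : fr 1 = (id : B × B → B × B) := by funext x; simp [fr]
    rw [this, Set.image_id]
  rw [frobS, this, Submodule.span_eq]

theorem frobS_smul_mem (q : ℕ) (hq : q ≠ 0) {T : Submodule B (B × B)} {s : B}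
    (hT : ∀ z, s • z ∈ T) (z : B × B) : s ^ q • z ∈ frobS q T := by
  have h1 : fr q (s • ((1 : B), (0 : B))) ∈ frobS q T := fr_mem q (hT _)
  have h2 : fr q (s • ((0 : B), (1 : B))) ∈ frobS q T := fr_mem q (hT _)
  have : s ^ q • z = z.1 • fr q (s • ((1 : B), (0 : B))) + z.2 • fr q (s • ((0 : B), (1 : B))) := by
    ext <;> simp [fr, mul_comm, hq]
  rw [this]
  exact add_mem (Submodule.smul_mem _ _ h1) (Submodule.smul_mem _ _ h2)

/-- entrywise power on `(B × B) × B`. -/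
def fr3 (q : ℕ) (z : (B × B) × B) : (B × B) × B := (fr q z.1, z.2 ^ q)

theorem prod_eq_span (q : ℕ) (hq : q ≠ 0) (T : Submodule B (B × B)) :
    (frobS q T).prod ⊤ = Submodule.span B (fr3 q '' {z | z.1 ∈ T}) := by
  apply le_antisymm
  · rintro ⟨x, b⟩ ⟨hx, -⟩
    have h1 : ∀ x ∈ frobS q T, ((x, 0) : (B × B) × B) ∈ Submodule.span B (fr3 q '' {z | z.1 ∈ T}) := by
      intro x hx
      induction hx using Submodule.span_induction with
      | mem x h =>
        obtain ⟨y, hy, rfl⟩ := h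
        exact Submodule.subset_span ⟨(y, 0), hy, by simp [fr3, hq]⟩
      | zero => exact Submodule.zero_mem _
      | add x y _ _ hx hy => simpa using add_mem hx hy
      | smul a x _ hx => simpa using Submodule.smul_mem _ a hx
    have h2 : ((0, 1) : (B × B) × B) ∈ Submodule.span B (fr3 q '' {z | z.1 ∈ T}) :=
      Submodule.subset_span ⟨(0, 1), T.zero_mem, by simp [fr3, fr, hq]⟩
    simpa using add_mem (h1 x hx) (Submodule.smul_mem _ b h2)
  · rw [Submodule.span_le]
    rintro _ ⟨z, hz, rfl⟩
    exact ⟨fr_mem q hz, trivial⟩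

theorem frob_map (q : ℕ) (hq : q ≠ 0) (hadd : ∀ a b : B, (a + b) ^ q = a ^ q + b ^ q)
    (T T' : Submodule B (B × B)) (s : B) (hs : s ∈ nonZeroDivisors B)
    (hT' : ∀ z, s • z ∈ T') (e : (T' × B) →ₗ[B] (T × B)) :
    ∃ g : (frobS q T' × B) →ₗ[B] (frobS q T × B), ∀ (x : T') (b : B),
      g (⟨fr q x, fr_mem q x.2⟩, b ^ q) =
        (⟨fr q (e (x, b)).1, fr_mem q (e (x, b)).1.2⟩, (e (x, b)).2 ^ q) := by
  let ι : (T × B) →ₗ[B] ((B × B) × B) := T.subtype.prodMap LinearMap.id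
  let u1 := ι (e (⟨s • (1, 0), hT' _⟩, 0))
  let u2 := ι (e (⟨s • (0, 1), hT' _⟩, 0))
  let u3 := ι (e (0, s))
  let num : ((B × B) × B) →ₗ[B] ((B × B) × B) :=
    (LinearMap.toSpanSingleton B _ (fr3 q u1)) ∘ₗ LinearMap.fst B B B ∘ₗ LinearMap.fst B (B × B) B
    + (LinearMap.toSpanSingleton B _ (fr3 q u2)) ∘ₗ LinearMap.snd B B B ∘ₗ LinearMap.fst B (B × B) B
    + (LinearMap.toSpanSingleton B _ (fr3 q u3)) ∘ₗ LinearMap.snd B (B × B) B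
  have hfr3 : ∀ (x y z : (B × B) × B) (a b c : B), fr3 q (a • x + b • y + c • z) =
      a ^ q • fr3 q x + b ^ q • fr3 q y + c ^ q • fr3 q z := by
    intro x y z a b c
    simp only [fr3, fr]
    ext <;> simp [hadd, mul_pow]
  have hnum : ∀ (x : T') (b : B), num (fr3 q ((x : B × B), b)) = s ^ q • fr3 q (ι (e (x, b))) := by
    intro x b
    have h : s • ((x, b) : T' × B) = (x : B × B).1 • (⟨s • (1, 0), hT' _⟩, 0)
        + (x : B × B).2 • (⟨s • (0, 1), hT' _⟩, 0) + b • (0, s) := by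
      refine Prod.ext (Subtype.ext ?_) ?_
      · ext <;> simp [mul_comm]
      · simp [mul_comm]
    have h2 := congrArg (fun w => ι (e w)) h
    simp only [map_smul, map_add] at h2
    have h3 := congrArg (fr3 q) h2
    rw [hfr3] at h3
    have h4 : fr3 q (s • ι (e (x, b))) = s ^ q • fr3 q (ι (e (x, b))) := by
      simp only [fr3, fr]
      ext <;> simp [mul_pow]
    rw [h4] at h3
    rw [h3]
    simp [num, fr3, fr, u1, u2, u3]
  have hsq : s ^ q ∈ nonZeroDivisors B := pow_mem hs q
  let ι2 : (frobS q T × B) →ₗ[B] ((B × B) × B) := (frobS q T).subtype.prodMap LinearMap.id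
  let ι1 : (frobS q T' × B) →ₗ[B] ((B × B) × B) := (frobS q T').subtype.prodMap LinearMap.id
  let μ : (frobS q T × B) →ₗ[B] ((B × B) × B) := s ^ q • ι2
  have hμ : Function.Injective μ := by
    rw [← LinearMap.ker_eq_bot, LinearMap.ker_eq_bot']
    rintro ⟨x, b⟩ h
    simp only [μ, ι2, LinearMap.smul_apply, LinearMap.prodMap_apply, Submodule.subtype_apply,
      LinearMap.id_apply, Prod.smul_mk, Prod.mk_eq_zero, smul_eq_mul] at h
    obtain ⟨h1, h2⟩ := h
    refine Prod.ext (Subtype.ext (Prod.ext ?_ ?_)) ?_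
    · exact (mul_right_mem_nonZeroDivisors_eq_zero_iff hsq).1
        ((mul_comm _ _).trans (congrArg Prod.fst h1))
    · exact (mul_right_mem_nonZeroDivisors_eq_zero_iff hsq).1
        ((mul_comm _ _).trans (congrArg Prod.snd h1))
    · exact (mul_right_mem_nonZeroDivisors_eq_zero_iff hsq).1 ((mul_comm _ _).trans h2)
  have hmem : ∀ z : frobS q T' × B, (num ∘ₗ ι1) z ∈ LinearMap.range μ := by
    intro z
    have hz : ι1 z ∈ (frobS q T').prod ⊤ := ⟨z.1.2, trivial⟩
    rw [prod_eq_span q hq] at hz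
    have : Submodule.span B (fr3 q '' {z | z.1 ∈ T'}) ≤ (LinearMap.range μ).comap num := by
      rw [Submodule.span_le]
      rintro _ ⟨⟨x, b⟩, hx, rfl⟩
      have := hnum ⟨x, hx⟩ b
      simp only at this
      rw [SetLike.mem_coe, Submodule.mem_comap, this]
      exact ⟨(⟨fr q (e (⟨x, hx⟩, b)).1, fr_mem q (e (⟨x, hx⟩, b)).1.2⟩, (e (⟨x, hx⟩, b)).2 ^ q), rfl⟩
    exact this hz
  let g := (LinearEquiv.ofInjective μ hμ).symm.toLinearMap ∘ₗ
    LinearMap.codRestrict (LinearMap.range μ) (num ∘ₗ ι1) hmem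
  have hg : ∀ z, μ (g z) = num (ι1 z) := by
    intro z
    have := (LinearEquiv.ofInjective μ hμ).apply_symm_apply
      (LinearMap.codRestrict (LinearMap.range μ) (num ∘ₗ ι1) hmem z)
    have h2 := congrArg Subtype.val this
    simpa [g] using h2
  refine ⟨g, fun x b => hμ ?_⟩
  rw [hg]
  exact hnum x b

theorem frob_equiv (q : ℕ) (hq : q ≠ 0) (hadd : ∀ a b : B, (a + b) ^ q = a ^ q + b ^ q)
    (T T' : Submodule B (B × B)) (s : B) (hs : s ∈ nonZeroDivisors B)
    (hT : ∀ z, s • z ∈ T) (hT' : ∀ z, s • z ∈ T') (e : (T' × B) ≃ₗ[B] (T × B)) :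
    ∃ g : (frobS q T' × B) ≃ₗ[B] (frobS q T × B), ∀ (x : T') (b : B),
      g (⟨fr q x, fr_mem q x.2⟩, b ^ q) =
        (⟨fr q (e (x, b)).1, fr_mem q (e (x, b)).1.2⟩, (e (x, b)).2 ^ q) := by
  obtain ⟨g, hg⟩ := frob_map q hq hadd T T' s hs hT' e.toLinearMap
  obtain ⟨h, hh⟩ := frob_map q hq hadd T' T s hs hT e.symm.toLinearMap
  have key : ∀ (T : Submodule B (B × B)) (f : (frobS q T × B) →ₗ[B] (frobS q T × B)),
      (∀ (x : T) (b : B), f (⟨fr q x, fr_mem q x.2⟩, b ^ q) = (⟨fr q x, fr_mem q x.2⟩, b ^ q)) →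
      f = LinearMap.id := by
    intro T f hf
    have h0 : ∀ x (hx : x ∈ frobS q T), f (⟨x, hx⟩, 0) = (⟨x, hx⟩, 0) := by
      intro x hx
      induction hx using Submodule.span_induction with
      | mem x h =>
        obtain ⟨y, hy, rfl⟩ := h
        have := hf ⟨y, hy⟩ 0
        simpa [hq] using this
      | zero => exact map_zero f
      | add x y hx hy h1 h2 =>
        have : ((⟨x + y, add_mem hx hy⟩, 0) : frobS q T × B) = (⟨x, hx⟩, 0) + (⟨y, hy⟩, 0) := by
          simp; rfl
        rw [this, map_add, h1, h2]
      | smul a x hx h1 =>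
        have : ((⟨a • x, Submodule.smul_mem _ a hx⟩, 0) : frobS q T × B) = a • (⟨x, hx⟩, 0) := by
          simp; rfl
        rw [this, map_smul, h1]
    have h1 : f (0, 1) = (0, 1) := by
      have := hf 0 1
      have h2 : (⟨fr q ((0 : T) : B × B), fr_mem q (0 : T).2⟩ : frobS q T) = 0 :=
        Subtype.ext (by simp [fr, hq])
      rw [h2] at this
      simpa using this
    refine LinearMap.ext fun z => ?_
    have : z = (z.1, 0) + z.2 • ((0 : frobS q T), (1 : B)) := by simp
    rw [this, map_add, map_smul, h1, h0 z.1 z.1.2]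
    rfl
  refine ⟨LinearEquiv.ofLinearMap g h (key _ _ fun x b => ?_) (key _ _ fun x b => ?_), hg⟩
  · rw [LinearMap.comp_apply, hh]
    have := hg (e.symm (x, b)).1 (e.symm (x, b)).2
    refine (hg (e.symm (x, b)).1 (e.symm (x, b)).2).trans ?_
    simp
  · rw [LinearMap.comp_apply, hg]
    refine (hh (e (x, b)).1 (e (x, b)).2).trans ?_
    simp

theorem cancel_even [IsNoetherianRing B] [CharP B 2]
    (T T' : Submodule B (B × B)) (s : B) (hs : s ∈ nonZeroDivisors B)
    (hT : ∀ z, s • z ∈ T) (hT' : ∀ z, s • z ∈ T') (hTl : LocFree B T 2)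
    (hd : DimLt (⊥ : Ideal B) 3)
    (e : (T' × B) ≃ₗ[B] (T × B)) : Nonempty (frobS 2 T' ≃ₗ[B] frobS 2 T) := by
  obtain ⟨e, p1, b, he⟩ := cancel_step1 hTl hd (s ^ 2) (pow_mem hs 2) e
  have hadd : ∀ a b : B, (a + b) ^ 2 = a ^ 2 + b ^ 2 := fun a b => by
    have : Fact (Nat.Prime 2) := ⟨Nat.prime_two⟩
    exact add_pow_char (R := B) a b 2
  obtain ⟨g, hg⟩ := frob_equiv 2 two_ne_zero hadd T T' s hs hT hT' e
  refine cancel_finish (frobS 2 T) (s ^ 2) (pow_mem hs 2) (frobS_smul_mem 2 two_ne_zero hT) g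
    ⟨fr 2 p1, fr_mem 2 p1.2⟩ (1 + s ^ 2 * b) ?_
  have := hg 0 1
  have h2 : (⟨fr 2 ((0 : T') : B × B), fr_mem 2 (0 : T').2⟩ : frobS 2 T') = 0 :=
    Subtype.ext (by simp [fr])
  rw [h2, one_pow] at this
  rw [this]
  refine Prod.ext (Subtype.ext ?_) ?_
  · simp only at he ⊢
    have h3 := congrArg Prod.fst he
    have h4 := congrArg Subtype.val h3
    simp only [Submodule.coe_smul] at h4 ⊢
    rw [h4]
    ext <;> simp [fr, mul_pow]
  · have h3 := congrArg Prod.snd he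
    simp only at h3 ⊢
    rw [h3]

/-- rank two stable isomorphism implies isomorphism, possibly after a Frobenius twist. -/
theorem cancel_main [IsNoetherianRing B] {k : Type*} [Field k] [IsAlgClosed k] (p : ℕ)
    [hp : Fact p.Prime] [CharP k p] [CharP B p] [Algebra k B] [Algebra.FiniteType k B]
    (T T' : Submodule B (B × B)) (s : B) (hs : s ∈ nonZeroDivisors B)
    (hT : ∀ z, s • z ∈ T) (hT' : ∀ z, s • z ∈ T') (hTl : LocFree B T 2)
    (hd : DimLt (⊥ : Ideal B) 3)
    (e : (T' × B) ≃ₗ[B] (T × B)) :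
    ∃ m : ℕ, Nonempty (frobS (p ^ m) T' ≃ₗ[B] frobS (p ^ m) T) := by
  by_cases h2 : p = 2
  · subst h2
    exact ⟨1, by rw [pow_one]; exact cancel_even T T' s hs hT hT' hTl hd e⟩
  · refine ⟨0, ?_⟩
    rw [pow_zero, frobS_one, frobS_one]
    exact cancel_odd (k := k) p h2 T s hs hT hTl hd e

end frob
end FpLci
end

section
namespace FpLci
universe u

section stab
variable (B : Type u) [CommRing B]

/-- stable equivalence of modules -/
def StabEq (M N : Type u) [AddCommGroup M] [Module B M] [AddCommGroup N] [Module B N] : Prop :=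
  ∃ a b : ℕ, Nonempty ((M × (Fin a → B)) ≃ₗ[B] (N × (Fin b → B)))

variable {B}
variable {M N P Q M' N' : Type u} [AddCommGroup M] [Module B M] [AddCommGroup N] [Module B N]
  [AddCommGroup P] [Module B P] [AddCommGroup Q] [Module B Q]
  [AddCommGroup M'] [Module B M'] [AddCommGroup N'] [Module B N']

/-- `B^a × B^b = B^(a+b)`. -/
noncomputable def finAddEquiv (a b : ℕ) : ((Fin a → B) × (Fin b → B)) ≃ₗ[B] (Fin (a + b) → B) :=
  (LinearEquiv.sumArrowLequivProdArrow (Fin a) (Fin b) B B).symm.trans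
    (LinearEquiv.funCongrLeft B B finSumFinEquiv.symm)

theorem StabEq.of_equiv (e : M ≃ₗ[B] N) : StabEq B M N :=
  ⟨0, 0, ⟨e.prodCongr (LinearEquiv.refl B _)⟩⟩

theorem StabEq.rfl : StabEq B M M := .of_equiv (LinearEquiv.refl B _)

theorem StabEq.symm (h : StabEq B M N) : StabEq B N M := by
  obtain ⟨a, b, ⟨e⟩⟩ := h
  exact ⟨b, a, ⟨e.symm⟩⟩

theorem StabEq.trans (h : StabEq B M N) (h' : StabEq B N P) : StabEq B M P := by
  obtain ⟨a, b, ⟨e⟩⟩ := h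
  obtain ⟨c, d, ⟨f⟩⟩ := h'
  refine ⟨a + c, d + b, ⟨?_⟩⟩
  have e1 : (M × (Fin (a + c) → B)) ≃ₗ[B] ((N × (Fin b → B)) × (Fin c → B)) :=
    ((LinearEquiv.refl B M).prodCongr (finAddEquiv a c).symm).trans
      ((LinearEquiv.prodAssoc B _ _ _).symm.trans (e.prodCongr (LinearEquiv.refl B _)))
  have e2 : ((N × (Fin b → B)) × (Fin c → B)) ≃ₗ[B] ((N × (Fin c → B)) × (Fin b → B)) :=
    (LinearEquiv.prodAssoc B _ _ _).trans (((LinearEquiv.refl B N).prodCongr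
      (LinearEquiv.prodComm B _ _)).trans (LinearEquiv.prodAssoc B _ _ _).symm)
  have e3 : (P × (Fin (d + b) → B)) ≃ₗ[B] ((N × (Fin c → B)) × (Fin b → B)) :=
    ((LinearEquiv.refl B P).prodCongr (finAddEquiv d b).symm).trans
      ((LinearEquiv.prodAssoc B _ _ _).symm.trans (f.symm.prodCongr (LinearEquiv.refl B _)))
  exact e1.trans (e2.trans e3.symm)

theorem StabEq.free_left (a : ℕ) : StabEq B (M × (Fin a → B)) M :=
  ⟨0, a, ⟨(LinearEquiv.prodUnique (R := B) (M := M × (Fin a → B)) (M₂ := Fin 0 → B))⟩⟩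

theorem StabEq.prodR (h : StabEq B M N) : StabEq B (M × P) (N × P) := by
  obtain ⟨a, b, ⟨e⟩⟩ := h
  have h1 : ∀ (M : Type u) [AddCommGroup M] [Module B M] (a : ℕ),
      Nonempty (((M × P) × (Fin a → B)) ≃ₗ[B] ((M × (Fin a → B)) × P)) := fun M _ _ a => 
    ⟨(LinearEquiv.prodAssoc B _ _ _).trans (((LinearEquiv.refl B M).prodCongr
      (LinearEquiv.prodComm B _ _)).trans (LinearEquiv.prodAssoc B _ _ _).symm)⟩
  obtain ⟨e1⟩ := h1 M a
  obtain ⟨e2⟩ := h1 N b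
  exact ⟨a, b, ⟨e1.trans ((e.prodCongr (LinearEquiv.refl B _)).trans e2.symm)⟩⟩

theorem StabEq.comm : StabEq B (M × N) (N × M) := .of_equiv (LinearEquiv.prodComm B _ _)
theorem StabEq.assoc : StabEq B ((M × N) × P) (M × (N × P)) :=
  .of_equiv (LinearEquiv.prodAssoc B _ _ _)

theorem StabEq.prodL (h : StabEq B M N) : StabEq B (P × M) (P × N) :=
  StabEq.comm.trans (h.prodR.trans StabEq.comm)

theorem StabEq.prod (h : StabEq B M N) (h' : StabEq B M' N') : StabEq B (M × M') (N × N') :=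
  h.prodR.trans h'.prodL

/-- Schanuel's lemma. -/
theorem schanuel {W : Type u} [AddCommGroup W] [Module B W] [Module.Projective B P]
    [Module.Projective B Q] (f : P →ₗ[B] W) (g : Q →ₗ[B] W)
    (hf : Function.Surjective f) (hg : Function.Surjective g) :
    Nonempty ((LinearMap.ker f × Q) ≃ₗ[B] (LinearMap.ker g × P)) := by
  obtain ⟨s, hs⟩ := Module.projective_lifting_property g f hg
  obtain ⟨t, ht⟩ := Module.projective_lifting_property f g hf
  have hs' : ∀ x, g (s x) = f x := fun x => LinearMap.congr_fun hs x
  have ht' : ∀ x, f (t x) = g x := fun x => LinearMap.congr_fun ht x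
  let p1 : (LinearMap.ker f × Q) →ₗ[B] P :=
    (LinearMap.ker f).subtype.coprod t
  let q1 : (LinearMap.ker g × P) →ₗ[B] Q := (LinearMap.ker g).subtype.coprod s
  let F : (LinearMap.ker f × Q) →ₗ[B] (LinearMap.ker g × P) :=
    (LinearMap.codRestrict (LinearMap.ker g) (LinearMap.snd B _ _ - s ∘ₗ p1) (fun z => by
      simp [p1, hs', ht'])).prod p1
  let G : (LinearMap.ker g × P) →ₗ[B] (LinearMap.ker f × Q) :=
    (LinearMap.codRestrict (LinearMap.ker f) (LinearMap.snd B _ _ - t ∘ₗ q1) (fun z => by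
      simp [q1, hs', ht'])).prod q1
  refine ⟨LinearEquiv.ofLinearMap F G ?_ ?_⟩
  · refine LinearMap.ext fun z => Prod.ext (Subtype.ext ?_) ?_ <;> simp [F, G, p1, q1]
  · refine LinearMap.ext fun z => Prod.ext (Subtype.ext ?_) ?_ <;> simp [F, G, p1, q1]

variable (B) in
/-- number of generators -/
noncomputable def gN (W : Type u) [AddCommGroup W] [Module B W] [Module.Finite B W] : ℕ :=
  (Module.Finite.exists_fin' B W).choose

variable (B) in
/-- a chosen presentation -/
noncomputable def gF (W : Type u) [AddCommGroup W] [Module B W] [Module.Finite B W] :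
    (Fin (gN B W) → B) →ₗ[B] W :=
  (Module.Finite.exists_fin' B W).choose_spec.choose

theorem gF_surj (W : Type u) [AddCommGroup W] [Module B W] [Module.Finite B W] :
    Function.Surjective (gF B W) :=
  (Module.Finite.exists_fin' B W).choose_spec.choose_spec

variable (B) in
/-- syzygy module -/
abbrev Syz (W : Type u) [AddCommGroup W] [Module B W] [Module.Finite B W] : Type u :=
  LinearMap.ker (gF B W)

theorem stab_ker {W : Type u} [AddCommGroup W] [Module B W] [Module.Finite B W]
    [Module.Projective B P] (f : P →ₗ[B] W) (hf : Function.Surjective f) :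
    StabEq B (LinearMap.ker f) (P × Syz B W) := by
  obtain ⟨e⟩ := schanuel f (gF B W) hf (gF_surj W)
  exact (StabEq.free_left _).symm.trans ((StabEq.of_equiv e).trans StabEq.comm)

theorem syz_congr {W W' : Type u} [AddCommGroup W] [Module B W] [Module.Finite B W]
    [AddCommGroup W'] [Module B W'] [Module.Finite B W'] (e : W ≃ₗ[B] W') :
    StabEq B (Syz B W) (Syz B W') := by
  obtain ⟨e'⟩ := schanuel (e.toLinearMap ∘ₗ gF B W) (gF B W')
    (e.surjective.comp (gF_surj W)) (gF_surj W')
  have h : LinearMap.ker (e.toLinearMap ∘ₗ gF B W) = LinearMap.ker (gF B W) :=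
    LinearEquiv.ker_comp e _
  rw [h] at e'
  exact (StabEq.free_left _).symm.trans ((StabEq.of_equiv e').trans (StabEq.free_left _))

theorem syz_prod {W W' : Type u} [AddCommGroup W] [Module B W] [Module.Finite B W]
    [AddCommGroup W'] [Module B W'] [Module.Finite B W'] :
    StabEq B (Syz B (W × W')) (Syz B W × Syz B W') := by
  have hsurj : Function.Surjective ((gF B W).prodMap (gF B W')) :=
    Prod.map_surjective.2 ⟨gF_surj W, gF_surj W'⟩
  obtain ⟨e'⟩ := schanuel (gF B (W × W')) ((gF B W).prodMap (gF B W')) (gF_surj _) hsurj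
  have e1 : LinearMap.ker ((gF B W).prodMap (gF B W')) ≃ₗ[B] (Syz B W × Syz B W') :=
    { toFun := fun z => (⟨z.1.1, congrArg Prod.fst z.2⟩, ⟨z.1.2, congrArg Prod.snd z.2⟩)
      invFun := fun z => ⟨(z.1.1, z.2.1), Prod.ext z.1.2 z.2.2⟩
      map_add' := fun _ _ => _root_.rfl
      map_smul' := fun _ _ => _root_.rfl
      left_inv := fun _ => _root_.rfl
      right_inv := fun _ => _root_.rfl }
  have h2 : StabEq B (Syz B (W × W') × ((Fin (gN B W) → B) × (Fin (gN B W') → B)))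
      (Syz B (W × W')) :=
    (StabEq.of_equiv ((LinearEquiv.refl B _).prodCongr (finAddEquiv _ _))).trans
      (StabEq.free_left _)
  exact h2.symm.trans ((StabEq.of_equiv e').trans ((StabEq.free_left _).trans (.of_equiv e1)))

end stab

section inv
open TensorProduct
variable {C : Type u} [CommRing C]

theorem inv_comm {D : Type u} [AddCommGroup D] [Module C D] [Module.Invertible C D]
    (φ : D →ₗ[C] C) (x y : D) : φ x • y = φ y • x := by
  have h := Module.Invertible.tmul_comm (R := C) (m₁ := x) (m₂ := y)
  have := congrArg (TensorProduct.lift ((LinearMap.lsmul C D).comp φ)) h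
  simpa using this

theorem inv_sum (D : Type u) [AddCommGroup D] [Module C D] [Module.Invertible C D] :
    ∃ (n : ℕ) (φ : Fin n → (D →ₗ[C] C)) (x : Fin n → D), ∑ i, φ i (x i) = 1 := by
  obtain ⟨z, hz⟩ := (Module.Invertible.linearEquiv C D).surjective 1
  obtain ⟨n, φ, x, rfl⟩ := TensorProduct.exists_sum_tmul_eq z
  refine ⟨n, φ, x, ?_⟩
  rw [← hz, map_sum]
  rfl

theorem inv_locFree (D : Type u) [AddCommGroup D] [Module C D] [Module.Invertible C D] :
    LocFree C D 1 := by
  obtain ⟨n, φ, x, h⟩ := inv_sum (C := C) D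
  intro p hp
  obtain ⟨i, hi⟩ : ∃ i, φ i (x i) ∉ p := by
    by_contra hcon
    push Not at hcon
    exact hp.ne_top ((Ideal.eq_top_iff_one p).2 (h ▸ Ideal.sum_mem _ fun i _ => hcon i))
  refine ⟨_, hi, (LinearMap.toSpanSingleton C D (x i)) ∘ₗ LinearMap.proj 0,
    LinearMap.pi fun _ => φ i, fun m => ?_, fun v => ?_⟩
  · simpa using inv_comm (φ i) m (x i)
  · funext j
    fin_cases j
    simp [mul_comm]

theorem inv_add [IsNoetherianRing C] (hd : DimLt (⊥ : Ideal C) 2) (D D' : Type u)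
    [AddCommGroup D] [Module C D] [Module.Invertible C D]
    [AddCommGroup D'] [Module C D'] [Module.Invertible C D'] :
    Nonempty ((D × D') ≃ₗ[C] (C × (D ⊗[C] D'))) := by
  obtain ⟨⟨d, d'⟩, φ, hφ⟩ := exists_unimodular ((inv_locFree (C := C) D).prod (inv_locFree D')) hd
    0 1 (by simp)
  let φ1 := φ ∘ₗ LinearMap.inl C D D'
  let φ2 := φ ∘ₗ LinearMap.inr C D D'
  have hs : φ1 d + φ2 d' = 1 := by
    rw [← hφ]
    simp [φ1, φ2, ← map_add]
  let θ : D × D' →ₗ[C] D ⊗[C] D' :=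
    ((TensorProduct.mk C D D').flip d').coprod (-(TensorProduct.mk C D D' d))
  let ψ : D ⊗[C] D' →ₗ[C] D × D' := TensorProduct.lift
    (LinearMap.mk₂ C (fun x x' => (φ2 x' • x, -(φ1 x • x'))) 
      (by intros; simp [add_smul]; abel) (by intros; simp [smul_smul, mul_comm])
      (by intros; simp [add_smul]; abel) (by intros; simp [smul_smul, mul_comm]))
  have hθ : ∀ x x', θ (x, x') = x ⊗ₜ[C] d' - d ⊗ₜ[C] x' := fun x x' => by
    simp [θ, sub_eq_add_neg]
  have hψ : ∀ x x', ψ (x ⊗ₜ[C] x') = (φ2 x' • x, -(φ1 x • x')) := fun x x' => by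
    simp [ψ]
  let F : (D × D') →ₗ[C] (C × (D ⊗[C] D')) := (φ1.coprod φ2).prod θ
  let G : (C × (D ⊗[C] D')) →ₗ[C] (D × D') := (LinearMap.toSpanSingleton C _ (d, d')).coprod ψ
  have hF : ∀ x x', F (x, x') = (φ1 x + φ2 x', θ (x, x')) := fun x x' => by simp [F]
  have hG : ∀ c z, G (c, z) = c • (d, d') + ψ z := fun c z => by simp [G]
  refine ⟨LinearEquiv.ofLinearMap F G ?_ ?_⟩
  · refine LinearMap.prod_ext ?_ ?_
    · refine LinearMap.ext_ring ?_
      simp only [LinearMap.comp_apply, LinearMap.inl_apply, LinearMap.id_apply, hG, map_zero,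
        add_zero, one_smul, hF, hs, hθ, sub_self]
    · refine TensorProduct.ext' fun x x' => ?_
      simp only [LinearMap.comp_apply, LinearMap.inr_apply, LinearMap.id_apply, hG, zero_smul,
        zero_add, hψ, hF, hθ]
      refine Prod.ext ?_ ?_
      · simp [mul_comm]
      · simp only [TensorProduct.tmul_neg, sub_neg_eq_add]
        rw [TensorProduct.smul_tmul, inv_comm φ2 x' d', TensorProduct.tmul_smul,
          ← TensorProduct.smul_tmul, inv_comm φ1 x d, ← TensorProduct.smul_tmul', ← add_smul,
          add_comm, hs, one_smul]
  · refine LinearMap.ext fun ⟨x, x'⟩ => ?_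
    simp only [LinearMap.comp_apply, hF, hG, hθ, map_sub, hψ, LinearMap.id_apply]
    refine Prod.ext ?_ ?_
    · simp only [Prod.fst_add, Prod.smul_fst, Prod.fst_sub, add_smul]
      rw [inv_comm φ1 x d]
      rw [show φ1 d • x + φ2 x' • d + (φ2 d' • x - φ2 x' • d) = (φ1 d + φ2 d') • x by module, hs,
        one_smul]
    · simp only [Prod.snd_add, Prod.smul_snd, Prod.snd_sub, add_smul]
      rw [inv_comm φ2 x' d']
      rw [show φ1 x • d' + φ2 d' • x' + (-(φ1 x • d') - -(φ1 d • x')) = (φ1 d + φ2 d') • x' by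
        module, hs, one_smul]

end inv

section chain
open TensorProduct
variable {B : Type u} [CommRing B] (c : Ideal B)

/-- restriction of scalars along `B → B/c` -/
def RS {B : Type u} [CommRing B] (_c : Ideal B) (D : Type u) : Type u := D

instance (D : Type u) [h : AddCommGroup D] : AddCommGroup (RS c D) := h
instance (D : Type u) [AddCommGroup D] [h : Module (B ⧸ c) D] : Module (B ⧸ c) (RS c D) := h
instance (D : Type u) [AddCommGroup D] [h : Module (B ⧸ c) D] : Module B (RS c D) :=
  Module.compHom D (algebraMap B (B ⧸ c))
instance (D : Type u) [AddCommGroup D] [h : Module (B ⧸ c) D] :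
    IsScalarTower B (B ⧸ c) (RS c D) := IsScalarTower.of_algebraMap_smul fun _ _ => rfl
instance (D : Type u) [AddCommGroup D] [Module (B ⧸ c) D] [h : Module.Finite (B ⧸ c) D] :
    Module.Finite B (RS c D) := by
  have : Module.Finite (B ⧸ c) (RS c D) := h
  exact Module.Finite.trans (B ⧸ c) _

/-- syzygy of a line bundle on `V(c)`. -/
noncomputable abbrev SyzP (δ : CommRing.Pic (B ⧸ c)) : Type u :=
  Syz B (RS c δ)

theorem syzP_of_equiv (D : Type u) [AddCommGroup D] [Module B D] [Module (B ⧸ c) D]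
    [IsScalarTower B (B ⧸ c) D] [Module.Finite B D] (δ : CommRing.Pic (B ⧸ c))
    (e : D ≃ₗ[B ⧸ c] δ) : StabEq B (Syz B D) (SyzP c δ) := by
  refine syz_congr (W' := RS c δ)
    { e.toAddEquiv with
      map_smul' := fun b x => ?_ }
  have : b • x = (algebraMap B (B ⧸ c) b) • x := (algebraMap_smul (B ⧸ c) b x).symm
  exact (congrArg e this).trans (e.map_smul _ x)

theorem syzP_mul [IsNoetherianRing B] (hd : DimLt (⊥ : Ideal (B ⧸ c)) 2)
    (δ ε : CommRing.Pic (B ⧸ c)) :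
    StabEq B (SyzP c δ × SyzP c ε) (SyzP c 1 × SyzP c (δ * ε)) := by
  obtain ⟨e⟩ := inv_add hd δ ε
  obtain ⟨e1⟩ := (CommRing.Pic.mk_eq_iff (R := B ⧸ c) (M := B ⧸ c)).1 CommRing.Pic.mk_self
  obtain ⟨e2⟩ := (CommRing.Pic.mk_eq_iff (R := B ⧸ c) (M := δ ⊗[B ⧸ c] ε)).1
    (CommRing.Pic.mul_eq_tensor δ ε).symm
  let e' := e.trans (e1.prodCongr e2)
  let E : (RS c δ × RS c ε) ≃ₗ[B]
    (RS c (1 : CommRing.Pic (B ⧸ c)) × RS c (δ * ε : CommRing.Pic (B ⧸ c))) :=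
    { e'.toAddEquiv with
      map_smul' := fun b x => e'.map_smul (algebraMap B (B ⧸ c) b) x }
  exact syz_prod.symm.trans ((syz_congr E).trans syz_prod)

/-- the invariant of the chain of lattices. -/
def Inv (T : Type u) [AddCommGroup T] [Module B T] (n : ℕ) (δ : CommRing.Pic (B ⧸ c)) : Prop :=
  StabEq B (T × SyzP c 1) ((Fin n → SyzP c 1) × SyzP c δ)

variable {c}

theorem Inv.congr {T T' : Type u} [AddCommGroup T] [Module B T] [AddCommGroup T'] [Module B T']
    {n : ℕ} {δ : CommRing.Pic (B ⧸ c)} (h : Inv c T n δ) (e : T ≃ₗ[B] T') : Inv c T' n δ :=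
  (StabEq.of_equiv e.symm).prodR.trans h

theorem Inv.base : Inv c (B × B) 0 1 := by
  have e : (B × B) ≃ₗ[B] (Fin 2 → B) := (LinearEquiv.finTwoArrow B B).symm
  refine ((StabEq.of_equiv e).prodR.trans (StabEq.comm.trans (StabEq.free_left 2))).trans ?_
  exact StabEq.of_equiv (LinearEquiv.prodUnique (R := B)).symm |>.trans StabEq.comm

theorem Inv.step [IsNoetherianRing B] (hd : DimLt (⊥ : Ideal (B ⧸ c)) 2)
    {T T' : Type u} [AddCommGroup T] [Module B T] [AddCommGroup T'] [Module B T']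
    [Module.Projective B T]
    {n : ℕ} {δ : CommRing.Pic (B ⧸ c)} (h : Inv c T n δ) (ε : CommRing.Pic (B ⧸ c))
    (D : Type u) [AddCommGroup D] [Module B D] [Module (B ⧸ c) D]
    [IsScalarTower B (B ⧸ c) D] (e : D ≃ₗ[B ⧸ c] ε)
    (f : T →ₗ[B] D) (hf : Function.Surjective f) (e' : LinearMap.ker f ≃ₗ[B] T') :
    Inv c T' (n + 1) (δ * ε) := by
  have : Module.Finite (B ⧸ c) D := Module.Finite.equiv e.symm
  have : Module.Finite B D := Module.Finite.trans (B ⧸ c) D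
  have h1 : StabEq B T' (T × SyzP c ε) :=
    (StabEq.of_equiv e'.symm).trans ((stab_ker f hf).trans (syzP_of_equiv c D ε e).prodL)
  have h2 : StabEq B (T' × SyzP c 1) ((T × SyzP c 1) × SyzP c ε) :=
    h1.prodR.trans (StabEq.assoc.trans (StabEq.comm.prodL.trans StabEq.assoc.symm))
  have h3 : StabEq B ((T × SyzP c 1) × SyzP c ε) ((Fin n → SyzP c 1) × (SyzP c 1 × SyzP c (δ * ε))) :=
    h.prodR.trans (StabEq.assoc.trans (syzP_mul c hd δ ε).prodL)
  refine h2.trans (h3.trans (StabEq.assoc.symm.trans (StabEq.prodR ?_)))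
  refine StabEq.comm.trans (StabEq.of_equiv ?_)
  exact (Fin.consLinearEquiv B (fun _ : Fin (n + 1) => SyzP c 1))

theorem Inv.stab [IsNoetherianRing B] {T T' : Type u} [AddCommGroup T] [Module B T] [AddCommGroup T'] [Module B T']
    {n : ℕ} {δ : CommRing.Pic (B ⧸ c)} (h : Inv c T n δ) (h' : Inv c T' n δ)
    (hc : Module.Projective B c) : StabEq B T T' := by
  have h0 : StabEq B (T × SyzP c 1) (T' × SyzP c 1) := h.trans h'.symm
  obtain ⟨e1⟩ := (CommRing.Pic.mk_eq_iff (R := B ⧸ c) (M := B ⧸ c)).1 CommRing.Pic.mk_self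
  have h1 := syzP_of_equiv c (B ⧸ c) 1 e1
  have h2 := stab_ker (Submodule.mkQ c) (Submodule.mkQ_surjective c)
  rw [Submodule.ker_mkQ] at h2
  have h3 : StabEq B c (SyzP c 1) :=
    h2.trans ((StabEq.comm.trans ((StabEq.of_equiv ((LinearEquiv.refl B _).prodCongr
      (LinearEquiv.funUnique (Fin 1) B B).symm)).trans (StabEq.free_left 1))).trans h1)
  have h4 : StabEq B (T × c) (T' × c) := h3.prodL.trans (h0.trans h3.prodL.symm)
  obtain ⟨e⟩ := schanuel (gF B c) (LinearMap.id : c →ₗ[B] c) (gF_surj _) Function.surjective_id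
  rw [LinearMap.ker_id] at e
  have e' : (Syz B c × c) ≃ₗ[B] (Fin (gN B c) → B) :=
    e.trans ((LinearEquiv.prodComm B _ _).trans (LinearEquiv.prodUnique (R := B)))
  have h5 : ∀ (T : Type u) [AddCommGroup T] [Module B T], StabEq B ((T × c) × Syz B c) T :=
    fun T _ _ => StabEq.assoc.trans ((StabEq.comm.trans (.of_equiv e')).prodL.trans
      (StabEq.free_left _))
  exact (h5 T).symm.trans (h4.prodR.trans (h5 T'))

end chain
end FpLci
end

section
namespace FpLci
universe u

section
variable {B : Type u} [CommRing B]
variable {M : Type u} [AddCommGroup M] [Module B M]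

theorem LocFree.rank_le [Nontrivial B] {n m : ℕ} (h : LocFree B M n) (h' : LocFree B M m) :
    n ≤ m := by
  obtain ⟨p, hp⟩ := Ideal.exists_maximal B
  obtain ⟨t, ht, α, β, h1, h2⟩ := h p hp.isPrime
  obtain ⟨t', ht', α', β', h1', h2'⟩ := h' p hp.isPrime
  let f := β' ∘ₗ α
  let g := β ∘ₗ α'
  have hgf : ∀ v, g (f v) = (t * t') • v := by
    intro v
    simp only [f, g, LinearMap.comp_apply, h1']
    rw [map_smul, h2, smul_smul, mul_comm]
  let K := B ⧸ p
  letI : Field K := Ideal.Quotient.field p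
  let φ := Ideal.Quotient.mk p
  have hm : LinearMap.toMatrix' g * LinearMap.toMatrix' f = (t * t') • 1 := by
    rw [← LinearMap.toMatrix'_comp]
    have : g ∘ₗ f = (t * t') • LinearMap.id := LinearMap.ext fun v => by simp [hgf]
    rw [this, map_smul, LinearMap.toMatrix'_id]
  have hmK : (LinearMap.toMatrix' g).map φ * (LinearMap.toMatrix' f).map φ
      = (φ (t * t')) • (1 : Matrix (Fin n) (Fin n) K) := by
    rw [← Matrix.map_mul, hm]
    ext i j
    simp [Matrix.one_apply, apply_ite φ]
  have hne : φ (t * t') ≠ 0 := by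
    rw [Ne, Ideal.Quotient.eq_zero_iff_mem]
    exact fun h => (hp.isPrime.mem_or_mem h).elim ht ht'
  have hinj : Function.Injective (Matrix.toLin' ((LinearMap.toMatrix' f).map φ)) := by
    rw [← LinearMap.ker_eq_bot, LinearMap.ker_eq_bot']
    intro v hv
    rw [Matrix.toLin'_apply] at hv
    have := congrArg (Matrix.mulVec ((LinearMap.toMatrix' g).map φ)) hv
    rw [Matrix.mulVec_mulVec, hmK, Matrix.mulVec_zero, Matrix.smul_mulVec, Matrix.one_mulVec] at this
    exact (smul_eq_zero.1 this).resolve_left hne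
  simpa using LinearMap.finrank_le_finrank_of_injective hinj

theorem stab_cancel [IsNoetherianRing B] {T T' : Type u} [AddCommGroup T] [Module B T]
    [AddCommGroup T'] [Module B T'] (hT : LocFree B T 2) (hT' : LocFree B T' 2)
    (hd : DimLt (⊥ : Ideal B) 3) (h : StabEq B T T') : Nonempty ((T × B) ≃ₗ[B] (T' × B)) := by
  have e1 : (Fin 1 → B) ≃ₗ[B] B := LinearEquiv.funUnique (Fin 1) B B
  rcases subsingleton_or_nontrivial B with hB | hB
  · have : Subsingleton T := Module.subsingleton B T
    have : Subsingleton T' := Module.subsingleton B T'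
    exact ⟨{ (0 : (T × B) →ₗ[B] (T' × B)) with
      invFun := 0
      left_inv := fun _ => Subsingleton.elim _ _
      right_inv := fun _ => Subsingleton.elim _ _ }⟩
  obtain ⟨a, b, ⟨e⟩⟩ := h
  have hab : a = b := by
    have r1 := (hT.prod (locFree_fin (R := B) a)).of_equiv e
    have r2 := hT'.prod (locFree_fin (R := B) b)
    have := r1.rank_le r2
    have := r2.rank_le r1
    omega
  subst hab
  induction a with
  | zero =>
    exact ⟨((LinearEquiv.prodUnique (R := B)).symm.trans
      (e.trans (LinearEquiv.prodUnique (R := B)))).prodCongr (LinearEquiv.refl B B)⟩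
  | succ a ih =>
    have e2 : (Fin (a + 1) → B) ≃ₗ[B] ((Fin a → B) × B) :=
      (finAddEquiv a 1).symm.trans ((LinearEquiv.refl B _).prodCongr e1)
    have e3 : ∀ (T : Type u) [AddCommGroup T] [Module B T],
        Nonempty ((T × (Fin (a + 1) → B)) ≃ₗ[B] ((T × (Fin a → B)) × B)) := fun T _ _ =>
      ⟨((LinearEquiv.refl B T).prodCongr e2).trans (LinearEquiv.prodAssoc B _ _ _).symm⟩
    obtain ⟨f⟩ := e3 T
    obtain ⟨f'⟩ := e3 T'
    rcases a with _ | a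
    · exact ⟨((LinearEquiv.refl B T).prodCongr e1).symm.trans
        (e.trans ((LinearEquiv.refl B T').prodCongr e1))⟩
    · obtain ⟨g⟩ := bass_cancel (hT'.prod (locFree_fin (R := B) (a + 1))) (hd.mono (by omega))
        (f.symm.trans (e.trans f'))
      exact ih g
end
end FpLci
end

section
namespace FpLci
open Polynomial

theorem exists_chain_of_ltSeries {R : Type*} [CommRing R] (l : LTSeries (PrimeSpectrum R)) :
    ∀ (i : ℕ) (hi : i < l.length + 1), ChainTo (⊥ : Ideal R) i (l ⟨i, hi⟩).asIdeal := by
  intro i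
  induction i with
  | zero => exact fun hi => ⟨(l ⟨0, hi⟩).2, bot_le⟩
  | succ i ih =>
    intro hi
    refine ⟨(l ⟨i+1, hi⟩).2, (l ⟨i, by omega⟩).asIdeal, ih (by omega), ?_⟩
    have : l ⟨i, by omega⟩ < l ⟨i+1, hi⟩ := l.strictMono (by simp [Fin.lt_def])
    exact this

theorem exists_chain {R : Type*} [CommRing R] {n : ℕ} (h : (n : WithBot ℕ∞) ≤ ringKrullDim R) :
    ∃ p, ChainTo (⊥ : Ideal R) n p := by
  obtain ⟨l, hl⟩ := Order.le_krullDim_iff.1 h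
  exact ⟨_, exists_chain_of_ltSeries l n (by omega)⟩

theorem DimLt.of_integral {R S : Type*} [CommRing R] [CommRing S] [Algebra R S]
    [Algebra.IsIntegral R S] (hinj : Function.Injective (algebraMap R S)) {d : ℕ}
    (h : DimLt (⊥ : Ideal S) d) : DimLt (⊥ : Ideal R) d := by
  have key : ∀ (n : ℕ) (p : Ideal R), ChainTo ⊥ n p →
      ∃ P : Ideal S, ChainTo ⊥ n P ∧ P.comap (algebraMap R S) = p := by
    intro n
    induction n with
    | zero =>
      intro p hp
      have := hp.1
      obtain ⟨Q, -, h1, h2⟩ := Ideal.exists_ideal_over_prime_of_isIntegral p (⊥ : Ideal S)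
        (by rw [← RingHom.ker_eq_comap_bot, (RingHom.injective_iff_ker_eq_bot _).1 hinj]; exact bot_le)
      exact ⟨Q, ⟨h1, bot_le⟩, h2⟩
    | succ n ih =>
      rintro p ⟨h1, q, hq, hlt⟩
      obtain ⟨Q, hQ, rfl⟩ := ih q hq
      obtain ⟨P, hP, h3, h4⟩ := Ideal.exists_ideal_over_prime_of_isIntegral p Q hlt.le
      refine ⟨P, ⟨h3, Q, hQ, lt_of_le_of_ne hP ?_⟩, h4⟩
      rintro rfl
      exact hlt.ne h4
  intro p hp
  obtain ⟨P, hP, -⟩ := key d p hp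
  exact h P hP

theorem dom_approx_aux (p : ℕ) [Fact p.Prime] {S : Type*} [CommRing S] [IsDomain S]
    [Algebra (ZMod p)[X] S] [Module.Finite (ZMod p)[X] S]
    (hinj : Function.Injective (algebraMap (ZMod p)[X] S)) :
    ∃ m : S, m ≠ 0 ∧ ∀ I : Ideal S, I ≠ ⊥ → ∃ b ∈ I, b ≠ 0 ∧ ∀ x ∈ I, b ∣ m * x := by
  classical
  have : FaithfulSMul (ZMod p)[X] S := (faithfulSMul_iff_algebraMap_injective _ _).2 hinj
  have : Module.IsTorsionFree (ZMod p)[X] S := inferInstance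
  have : Module.Free (ZMod p)[X] S := inferInstance
  let bS := Module.Free.chooseBasis (ZMod p)[X] S
  let adm := Polynomial.cardPowDegreeIsAdmissible (Fq := ZMod p)
  refine ⟨_, ClassGroup.prod_finsetApprox_ne_zero bS adm, fun I hI => ?_⟩
  obtain ⟨b, b_mem, b_ne_zero, b_min⟩ := ClassGroup.exists_min (R := (ZMod p)[X])
    (Polynomial.cardPowDegree (Fq := ZMod p)) ⟨I, mem_nonZeroDivisors_iff_ne_zero.2 hI⟩
  refine ⟨b, b_mem, b_ne_zero, fun a ha => ?_⟩
  obtain ⟨q, r, r_mem, lt⟩ := ClassGroup.exists_mem_finset_approx' bS adm a b_ne_zero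
  apply @dvd_of_mul_left_dvd _ _ q
  simp only [Algebra.smul_def] at lt
  rw [← sub_eq_zero.mp (b_min _ (I.sub_mem (I.mul_mem_left _ ha) (I.mul_mem_left _ b_mem)) lt)]
  refine mul_dvd_mul_right (map_dvd _ ?_) _
  exact Multiset.dvd_prod (Multiset.mem_map.mpr ⟨_, r_mem, rfl⟩)

theorem dom_approx (p : ℕ) [Fact p.Prime] (R : Type*) [CommRing R] [IsDomain R]
    [Algebra (ZMod p) R] [Algebra.FiniteType (ZMod p) R] (hd : DimLt (⊥ : Ideal R) 2) :
    ∃ m : R, m ≠ 0 ∧ ∀ I : Ideal R, I ≠ ⊥ → ∃ b ∈ I, b ≠ 0 ∧ ∀ x ∈ I, b ∣ m * x := by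
  obtain ⟨s, g, hg, hfin⟩ := exists_finite_inj_algHom_of_fg (ZMod p) R
  let := g.toRingHom.toAlgebra
  have hfin' : Module.Finite (MvPolynomial (Fin s) (ZMod p)) R := hfin
  have hs : s < 2 := by
    by_contra hs
    have h1 : DimLt (⊥ : Ideal (MvPolynomial (Fin s) (ZMod p))) 2 :=
      DimLt.of_integral (S := R) hg hd
    obtain ⟨P, hP⟩ := exists_chain (R := MvPolynomial (Fin s) (ZMod p)) (n := 2) (by
      have h2 := MvPolynomial.ringKrullDim_of_isNoetherianRing (R := ZMod p) (ι := Fin s)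
      rw [ringKrullDim_eq_zero_of_field, zero_add, Nat.card_fin] at h2
      rw [h2]
      exact_mod_cast not_lt.1 hs)
    exact h1 P hP
  interval_cases s
  · have : Module.Finite (ZMod p) (MvPolynomial (Fin 0) (ZMod p)) :=
      Module.Finite.equiv (MvPolynomial.isEmptyAlgEquiv (ZMod p) (Fin 0)).symm.toLinearEquiv
    have : IsScalarTower (ZMod p) (MvPolynomial (Fin 0) (ZMod p)) R :=
      IsScalarTower.of_algebraMap_eq fun x => (g.commutes x).symm
    have : Module.Finite (ZMod p) R := Module.Finite.trans (MvPolynomial (Fin 0) (ZMod p)) R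
    have : Finite R := Module.finite_of_finite (ZMod p)
    have hf := Finite.isField_of_domain R
    refine ⟨1, one_ne_zero, fun I hI => ?_⟩
    obtain ⟨b, hb, hb0⟩ := (Submodule.ne_bot_iff _).1 hI
    obtain ⟨c, hc⟩ := hf.mul_inv_cancel hb0
    refine ⟨b, hb, hb0, fun x _ => ⟨c * x, ?_⟩⟩
    rw [← mul_assoc, hc]
  · let e := (MvPolynomial.uniqueAlgEquiv (ZMod p) (Fin 1)).symm
    let : Algebra (ZMod p)[X] R := (g.toRingHom.comp e.toRingHom).toAlgebra
    have : Module.Finite (ZMod p)[X] R := by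
      have h1 : RingHom.Finite e.toRingHom := RingHom.Finite.of_surjective _ e.surjective
      exact RingHom.Finite.comp hfin h1
    exact dom_approx_aux p (hg.comp e.injective)
end FpLci
end

section
universe u
namespace FpLci

section
variable {R : Type u} [CommRing R]

theorem emb (q : Ideal R) [hq : q.IsPrime] (m : R ⧸ q)
    (hm : ∀ I : Ideal (R ⧸ q), I ≠ ⊥ → ∃ b ∈ I, b ≠ 0 ∧ ∀ x ∈ I, b ∣ m * x) (hm0 : m ≠ 0)
    (M : Type u) [AddCommGroup M] [Module R M] [Module.Invertible R M] :
    ∃ ψ : M →ₗ[R] R ⧸ q, (∀ x, ψ x = 0 → ∀ φ : M →ₗ[R] R, φ x ∈ q) ∧ ∃ x, ψ x = m := by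
  obtain ⟨n, φ, x, h⟩ := inv_sum (C := R) M
  obtain ⟨i, hi⟩ : ∃ i, φ i (x i) ∉ q := by
    by_contra hcon
    push Not at hcon
    exact hq.ne_top ((Ideal.eq_top_iff_one q).2 (h ▸ Ideal.sum_mem _ fun i _ => hcon i))
  let f := φ i
  let I : Ideal (R ⧸ q) := Ideal.map (Ideal.Quotient.mk q) (LinearMap.range f)
  have hI : ∀ z ∈ I, ∃ y, Ideal.Quotient.mk q (f y) = z := by
    intro z hz
    obtain ⟨w, ⟨y, rfl⟩, rfl⟩ := (Ideal.mem_map_iff_of_surjective _ Ideal.Quotient.mk_surjective).1 hz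
    exact ⟨y, rfl⟩
  have hfI : ∀ y, Ideal.Quotient.mk q (f y) ∈ I := fun y => Ideal.mem_map_of_mem _ ⟨y, rfl⟩
  obtain ⟨b, hb, hb0, hdvd⟩ := hm I (fun h0 => hi (by
    have := hfI (x i)
    rw [h0] at this
    exact Ideal.Quotient.eq_zero_iff_mem.1 this))
  choose g hg using fun y => hdvd _ (hfI y)
  refine ⟨{ toFun := g, map_add' := ?_, map_smul' := ?_ }, ?_, ?_⟩
  · intro y z
    refine mul_left_cancel₀ hb0 ?_
    rw [← hg, mul_add, ← hg, ← hg, map_add, map_add, mul_add]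
  · intro r y
    refine mul_left_cancel₀ hb0 ?_
    rw [← hg, map_smul, RingHom.id_apply, smul_eq_mul, map_mul, mul_left_comm, hg,
      mul_left_comm]
    exact congrArg (b * ·) (Algebra.smul_def r (g y)).symm
  · intro y hy φ'
    have h1 : m * Ideal.Quotient.mk q (f y) = 0 := by
      rw [hg]
      exact (congrArg (b * ·) hy).trans (mul_zero _)
    have h2 : f y ∈ q := Ideal.Quotient.eq_zero_iff_mem.1 ((mul_eq_zero.1 h1).resolve_left hm0)
    have h3 := congrArg φ' (inv_comm f y (x i))
    simp only [map_smul, smul_eq_mul] at h3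
    have h4 : f (x i) * φ' y ∈ q := h3 ▸ q.mul_mem_right _ h2
    exact (hq.mem_or_mem h4).resolve_left hi
  · obtain ⟨y, hy⟩ := hI b hb
    refine ⟨y, mul_left_cancel₀ hb0 ?_⟩
    change b * g y = _
    rw [← hg, hy, mul_comm]

theorem finite_quot (p : ℕ) [Fact p.Prime] [IsDomain R]
    [Algebra (ZMod p) R] [Algebra.FiniteType (ZMod p) R] (hd : DimLt (⊥ : Ideal R) 2)
    (m : R) (hm : m ≠ 0) : Finite (R ⧸ Ideal.span {m}) := by
  have : IsNoetherianRing R := Algebra.FiniteType.isNoetherianRing (ZMod p) R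
  have h1 := hd.drop_nzd (mem_nonZeroDivisors_of_ne_zero hm)
  set I := Ideal.span {m}
  have : Ring.KrullDimLE 0 (R ⧸ I) := Ring.KrullDimLE.mk₀ fun P hP => by
    have hle : I ≤ P.comap (Ideal.Quotient.mk I) :=
      fun x hx => by simp [Ideal.mem_comap, Ideal.Quotient.eq_zero_iff_mem.2 hx]
    have h3 : (P.comap (Ideal.Quotient.mk I)).IsMaximal := by
      obtain ⟨Q, hQ, hPQ⟩ := Ideal.exists_le_maximal (P.comap (Ideal.Quotient.mk I)) 
        (Ideal.IsPrime.ne_top inferInstance)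
      rcases hPQ.eq_or_lt with h | h
      · rw [h]; exact hQ
      · exact absurd ⟨hQ.isPrime, _, ⟨inferInstance, hle⟩, h⟩ (h1 Q)
    have h2 := Ideal.map_eq_top_or_isMaximal_of_surjective (Ideal.Quotient.mk I)
      Ideal.Quotient.mk_surjective h3
    rw [Ideal.map_comap_of_surjective _ Ideal.Quotient.mk_surjective] at h2
    exact h2.resolve_left hP.ne_top
  have : IsArtinianRing (R ⧸ I) := IsNoetherianRing.isArtinianRing_of_krullDimLE_zero
  have : Module.Finite (ZMod p) (R ⧸ I) := Module.finite_of_isArtinianRing (ZMod p) (R ⧸ I)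
  exact Module.finite_of_finite (ZMod p)

theorem DimLt.quot {a : Ideal R} {d : ℕ} (h : DimLt a d) : DimLt (⊥ : Ideal (R ⧸ a)) d := by
  have key : ∀ (n : ℕ) (P : Ideal (R ⧸ a)), ChainTo ⊥ n P →
      ChainTo a n (P.comap (Ideal.Quotient.mk a)) := by
    intro n
    induction n with
    | zero =>
      intro P hP
      have := hP.1
      exact ⟨inferInstance, fun x hx => by simp [Ideal.mem_comap, Ideal.Quotient.eq_zero_iff_mem.2 hx]⟩
    | succ n ih =>
      rintro P ⟨h1, Q, hQ, hlt⟩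
      refine ⟨inferInstance, _, ih Q hQ, lt_of_le_of_ne (Ideal.comap_mono hlt.le) fun h => ?_⟩
      exact hlt.ne (Ideal.comap_injective_of_surjective _ Ideal.Quotient.mk_surjective h)
  exact fun p hp => h _ (key d p hp)

theorem finite_pic (p : ℕ) [Fact p.Prime]
    [Algebra (ZMod p) R] [Algebra.FiniteType (ZMod p) R] (hd : DimLt (⊥ : Ideal R) 2) :
    Finite (CommRing.Pic R) := by
  classical
  have : IsNoetherianRing R := Algebra.FiniteType.isNoetherianRing (ZMod p) R
  let ι := {q : Ideal R // q ∈ minimalPrimes R}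
  have : Finite ι := (minimalPrimes.finite_of_isNoetherianRing R).to_subtype
  have := Fintype.ofFinite ι
  have hpr : ∀ i : ι, i.1.IsPrime := fun i => i.2.1.1
  have hdq : ∀ i : ι, DimLt (⊥ : Ideal (R ⧸ i.1)) 2 := fun i => (hd.anti bot_le).quot
  choose m hm0 hm using fun i : ι => dom_approx p (R ⧸ i.1) (hdq i)
  -- separating elements
  have hsep : ∀ i : ι, ∃ a : R, a ∉ i.1 ∧ ∀ j, j ≠ i → a ∈ j.1 := by
    intro i
    have h1 : ∀ j : ι, j ≠ i → ∃ a ∈ j.1, a ∉ i.1 := by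
      intro j hj
      by_contra hcon
      push Not at hcon
      have h2 : j.1 ≤ i.1 := hcon
      exact hj (Subtype.ext (le_antisymm h2 (i.2.2 ⟨(hpr j), bot_le⟩ h2)))
    choose a ha ha' using h1
    refine ⟨∏ j : ι, if h : j ≠ i then a j h else 1, ?_, ?_⟩
    · have := hpr i
      rw [Ideal.IsPrime.prod_mem_iff]
      rintro ⟨j, -, hj⟩
      split_ifs at hj with h
      · exact ha' j h hj
      · exact (hpr i).ne_top ((Ideal.eq_top_iff_one _).2 hj)
    · intro j hj
      have := hpr j
      rw [Ideal.IsPrime.prod_mem_iff]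
      refine ⟨j, Finset.mem_univ _, ?_⟩
      rw [dif_pos hj]; exact ha j hj
  choose a ha ha' using hsep
  let c : ∀ i : ι, R ⧸ i.1 := fun i => Ideal.Quotient.mk _ (a i) * m i
  have hc : ∀ i, c i ≠ 0 := fun i => mul_ne_zero
    (fun h => ha i (Ideal.Quotient.eq_zero_iff_mem.1 h)) (hm0 i)
  let S := ∀ i : ι, R ⧸ i.1
  let Y : Submodule R S := Submodule.pi Set.univ fun i =>
    (Ideal.span {c i}).restrictScalars R
  have hfin : Finite (S ⧸ Y) := by
    have : ∀ i, Finite ((R ⧸ i.1) ⧸ (Ideal.span {c i}).restrictScalars R) := fun i => 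
      finite_quot p (hdq i) (c i) (hc i)
    exact Finite.of_equiv _ (Submodule.quotientPi fun i : ι =>
      (Ideal.span {c i}).restrictScalars R).symm.toEquiv
  have hfinX : Finite {X : Submodule R S // Y ≤ X} := by
    have : Finite (Submodule R (S ⧸ Y)) := inferInstance
    exact Finite.of_equiv _ (Submodule.comapMkQRelIso Y).toEquiv
  choose ψ hψ hx using fun (M : CommRing.Pic R) (i : ι) =>
    emb i.1 (m i) (hm i) (hm0 i) M
  let Ψ : ∀ M : CommRing.Pic R, M →ₗ[R] S := fun M => LinearMap.pi (ψ M)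
  have hY : ∀ M, Y ≤ LinearMap.range (Ψ M) := by
    intro M s hs
    have h1 : ∀ i, ∃ r : R, s i = Ideal.Quotient.mk _ (r * a i) * m i := by
      intro i
      have := hs i (Set.mem_univ i)
      obtain ⟨r, hr⟩ := Ideal.mem_span_singleton.1 this
      obtain ⟨r, rfl⟩ := Ideal.Quotient.mk_surjective r
      refine ⟨r, hr.trans ?_⟩
      simp only [c, map_mul]
      ring
    choose r hr using h1
    choose x hx' using hx M
    refine ⟨∑ i, (r i * a i) • x i, funext fun j => ?_⟩
    change ψ M j (∑ i, (r i * a i) • x i) = s j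
    simp only [map_sum, map_smul]
    rw [Finset.sum_eq_single j, hx', hr, Algebra.smul_def]
    · rfl
    · intro i _ hi
      rw [Algebra.smul_def]
      have : algebraMap R (R ⧸ j.1) (r i * a i) = 0 := 
        Ideal.Quotient.eq_zero_iff_mem.2 (j.1.mul_mem_left _ (ha' i j (Ne.symm hi)))
      rw [this, zero_mul]
    · intro h; exact absurd (Finset.mem_univ _) h
  refine Finite.of_injective (β := {X : Submodule R S // Y ≤ X})
    (fun M => ⟨LinearMap.range (Ψ M), hY M⟩) ?_
  intro M M' hMM
  have hX : LinearMap.range (Ψ M) = LinearMap.range (Ψ M') := congrArg Subtype.val hMM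
  obtain ⟨g, hg⟩ := Module.projective_lifting_property (Ψ M').rangeRestrict
    ((Ψ M).codRestrict (LinearMap.range (Ψ M')) fun x => hX ▸ ⟨x, rfl⟩)
    (LinearMap.surjective_rangeRestrict _)
  have hg' : ∀ x, Ψ M' (g x) = Ψ M x := fun x => by
    have := congrArg Subtype.val (LinearMap.congr_fun hg x)
    exact this
  have hsurj : Function.Surjective g := by
    rw [← LinearMap.range_eq_top, eq_top_iff]
    refine Submodule.le_of_le_smul_of_le_jacobson_bot (I := nilradical R) Module.Finite.fg_top ?_ ?_
    · rw [nilradical]; exact Ideal.radical_le_jacobson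
    · intro y _
      obtain ⟨x, hx⟩ : Ψ M' y ∈ LinearMap.range (Ψ M) := hX ▸ ⟨y, rfl⟩
      have hker : ∀ i, ψ M' i (y - g x) = 0 := fun i => by
        rw [map_sub, sub_eq_zero]
        have h2 := congrFun (hg' x) i
        have h3 := congrFun hx i
        exact (h2.trans h3).symm
      obtain ⟨n, φ, z, h⟩ := inv_sum (C := R) M'
      have hz : y - g x = ∑ i, φ i (y - g x) • z i := by
        conv_lhs => rw [← one_smul R (y - g x), ← h, Finset.sum_smul]
        exact Finset.sum_congr rfl fun i _ => inv_comm _ _ _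
      have hy : y = g x + (y - g x) := by abel
      rw [hy]
      refine Submodule.add_mem_sup ⟨x, rfl⟩ ?_
      rw [hz]
      refine Submodule.sum_mem _ fun i _ => Submodule.smul_mem_smul ?_ trivial
      rw [nilradical, ← Ideal.sInf_minimalPrimes, Submodule.mem_sInf]
      intro q hq
      exact hψ M' ⟨q, hq⟩ _ (hker _) _
  have hbij := Module.Invertible.bijective_of_surjective hsurj
  rw [← CommRing.Pic.mk_eq_self (M := M), ← CommRing.Pic.mk_eq_self (M := M')]
  exact CommRing.Pic.mk_eq_mk_iff.2 ⟨LinearEquiv.ofBijective g hbij⟩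

end
end FpLci
end

section
universe u
namespace FpLci
open TensorProduct

section
variable {C : Type u} [CommRing C]

theorem inv_of_data {D : Type u} [AddCommGroup D] [Module C D] {n : ℕ} (φ : Fin n → (D →ₗ[C] C))
    (x : Fin n → D) (h1 : ∑ i, φ i (x i) = 1) (h2 : ∀ i y z, φ i y • z = φ i z • y) :
    Module.Invertible C D := by
  have hd : ∀ y, y = ∑ i, φ i y • x i := fun y => by
    conv_lhs => rw [← one_smul C y, ← h1, Finset.sum_smul]
    exact Finset.sum_congr rfl fun i _ => h2 i _ _
  have hc : ∀ (ψ : D →ₗ[C] C) y z, ψ y • z = ψ z • y := by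
    intro ψ y z
    have h3 : ∀ i, ψ y * φ i z = ψ z * φ i y := fun i => by
      have := congrArg ψ (h2 i y z)
      simp only [map_smul, smul_eq_mul] at this
      rw [mul_comm, ← this, mul_comm]
    rw [hd (ψ y • z), hd (ψ z • y)]
    exact Finset.sum_congr rfl fun i _ => by simp only [map_smul, smul_eq_mul, h3]
  refine Module.Invertible.right (M := Module.Dual C D) (LinearEquiv.ofLinearMap (contractLeft C D)
    (LinearMap.toSpanSingleton C _ (∑ i, φ i ⊗ₜ[C] x i)) ?_ ?_)
  · ext
    simp [h1]
  · refine TensorProduct.ext' fun ψ y => ?_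
    simp only [LinearMap.comp_apply, contractLeft_apply, LinearMap.toSpanSingleton_apply,
      LinearMap.id_apply]
    rw [Finset.smul_sum]
    have h4 : ∀ i, ψ y • (φ i ⊗ₜ[C] x i) = (ψ (x i) • φ i) ⊗ₜ[C] y := fun i => by
      rw [← TensorProduct.tmul_smul, hc, TensorProduct.tmul_smul, TensorProduct.smul_tmul']
    simp_rw [h4]
    rw [← TensorProduct.sum_tmul]
    congr 1
    ext z
    simp only [LinearMap.sum_apply, LinearMap.smul_apply, smul_eq_mul]
    conv_rhs => rw [hd z]
    simp [mul_comm]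

/-- rank one idempotent matrices -/
structure RankOne {n : ℕ} (E : Matrix (Fin n) (Fin n) C) : Prop where
  comm : ∀ i j k l, E i j * E k l = E i l * E k j
  tr : ∑ i, E i i = 1

abbrev rng {n : ℕ} (E : Matrix (Fin n) (Fin n) C) : Submodule C (Fin n → C) :=
  LinearMap.range E.mulVecLin

theorem RankOne.inv {n : ℕ} {E : Matrix (Fin n) (Fin n) C} (h : RankOne E) :
    Module.Invertible C (rng E) := by
  refine inv_of_data (fun i => LinearMap.proj i ∘ₗ (rng E).subtype)
    (fun i => ⟨E.mulVecLin (Pi.single i 1), ⟨_, rfl⟩⟩) ?_ ?_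
  · simp [h.tr]
  · rintro i ⟨_, a, rfl⟩ ⟨_, b, rfl⟩
    refine Subtype.ext (funext fun k => ?_)
    simp only [LinearMap.comp_apply, Submodule.subtype_apply, LinearMap.proj_apply,
      SetLike.mk_smul_mk, Pi.smul_apply, smul_eq_mul, Matrix.mulVecLin_apply, Matrix.mulVec,
      dotProduct]
    rw [Finset.sum_mul_sum, Finset.sum_mul_sum, Finset.sum_comm]
    refine Finset.sum_congr rfl fun j _ => Finset.sum_congr rfl fun m _ => ?_
    linear_combination a m * b j * h.comm i m k j

theorem RankOne.map {C' : Type*} [CommRing C'] (g : C →+* C') {n : ℕ}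
    {E : Matrix (Fin n) (Fin n) C} (h : RankOne E) : RankOne (E.map g) :=
  ⟨fun i j k l => by simp only [Matrix.map_apply, ← map_mul, h.comm i j k l],
   by simp only [Matrix.map_apply, ← map_sum, h.tr, map_one]⟩

theorem exists_rankOne (D : Type u) [AddCommGroup D] [Module C D] [Module.Invertible C D] :
    ∃ (n : ℕ) (E : Matrix (Fin n) (Fin n) C), RankOne E ∧ Nonempty (D ≃ₗ[C] rng E) := by
  obtain ⟨n, φ, x, h⟩ := inv_sum (C := C) D
  let E : Matrix (Fin n) (Fin n) C := fun i j => φ i (x j)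
  have hd : ∀ y, y = ∑ i, φ i y • x i := fun y => by
    conv_lhs => rw [← one_smul C y, ← h, Finset.sum_smul]
    exact Finset.sum_congr rfl fun i _ => inv_comm _ _ _
  let f : D →ₗ[C] (Fin n → C) := LinearMap.pi φ
  have hf : ∀ y, f y = E.mulVecLin (f y) := fun y => by
    funext i
    have := congrArg (φ i) (hd y)
    simp only [map_sum, map_smul, smul_eq_mul] at this
    simp only [f, LinearMap.pi_apply, Matrix.mulVecLin_apply, Matrix.mulVec, dotProduct, E]
    rw [this]
    exact Finset.sum_congr rfl fun j _ => mul_comm _ _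
  refine ⟨n, E, ⟨fun i j k l => ?_, h⟩, ?_⟩
  · have := congrArg (φ k) (inv_comm (φ i) (x j) (x l))
    simpa using this
  · refine ⟨LinearEquiv.ofBijective (f.codRestrict (rng E) fun y => ⟨_, (hf y).symm⟩) ⟨?_, ?_⟩⟩
    · intro y z hyz
      have h1 : ∀ i, φ i y = φ i z := fun i => congrFun (congrArg Subtype.val hyz) i
      rw [hd y, hd z]
      simp_rw [h1]
    · rintro ⟨_, a, rfl⟩
      refine ⟨∑ j, a j • x j, Subtype.ext (funext fun i => ?_)⟩
      change φ i (∑ j, a j • x j) = ∑ j, φ i (x j) * a j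
      simp [map_sum, mul_comm]

theorem pic_map_rng (C0 : Type u) [CommRing C0] [Algebra C0 C] {n : ℕ}
    {E : Matrix (Fin n) (Fin n) C0} (h : RankOne E) (D : Type u) [AddCommGroup D] [Module C D]
    [Module.Invertible C D] (e : D ≃ₗ[C] rng (E.map (algebraMap C0 C))) :
    CommRing.Pic.mk C D ∈ Set.range (CommRing.Pic.mapAlgebra C0 C) := by
  have := h.inv
  have := (h.map (algebraMap C0 C)).inv
  refine ⟨CommRing.Pic.mk C0 (rng E), ?_⟩
  rw [CommRing.Pic.mapAlgebra_apply, CommRing.Pic.mk_eq_mk_iff]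
  let E' := E.map (algebraMap C0 C)
  have key : ∀ a : Fin n → C0, (fun i => algebraMap C0 C (E.mulVec a i)) =
      E'.mulVec (fun i => algebraMap C0 C (a i)) := fun a => by
    funext i
    simp [Matrix.mulVec, dotProduct, E']
  let g0 : rng E →ₗ[C0] rng E' :=
    { toFun := fun x => ⟨fun i => algebraMap C0 C (x.1 i), by
        obtain ⟨_, a, rfl⟩ := x
        exact ⟨_, (key a).symm⟩⟩
      map_add' := fun x y => Subtype.ext (funext fun i => by simp)
      map_smul' := fun c x => Subtype.ext (funext fun i => by simp [Algebra.smul_def]) }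
  let g : C ⊗[C0] rng E →ₗ[C] rng E' := AlgebraTensorModule.lift
    ((LinearMap.toSpanSingleton C (rng E →ₗ[C0] rng E') g0))
  have hg : ∀ c x, g (c ⊗ₜ x) = c • g0 x := fun c x => by simp [g]
  have hsurj : Function.Surjective g := by
    rintro ⟨_, a, rfl⟩
    refine ⟨∑ j, a j ⊗ₜ ⟨E.mulVecLin (Pi.single j 1), ⟨_, rfl⟩⟩, Subtype.ext (funext fun i => ?_)⟩
    rw [map_sum]
    simp_rw [hg]
    simp [g0, Matrix.mulVec, dotProduct, E', mul_comm]
  exact ⟨((AlgebraTensorModule.congr (LinearEquiv.refl C C)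
    (CommRing.Pic.mk.linearEquiv C0 (rng E)))).trans
    ((LinearEquiv.ofBijective g (Module.Invertible.bijective_of_surjective hsurj)).trans e.symm)⟩

end
end FpLci
end

section
universe u
namespace FpLci
open TensorProduct

section
variable {B : Type u} [CommRing B]

/-- `c^l ⊗ c ≃ c^(l+1)` for flat `c`. -/
theorem pow_tensor (c : Ideal B) [Module.Flat B c] (l : ℕ) :
    Nonempty ((↥(c ^ l) ⊗[B] c) ≃ₗ[B] ↥(c ^ (l + 1))) := by
  let g : (↥(c ^ l) ⊗[B] c) →ₗ[B] B := TensorProduct.lift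
    (((LinearMap.mul B B).compl₂ c.subtype).comp (c ^ l).subtype)
  have hg : ∀ x y, g (x ⊗ₜ y) = x.1 * y.1 := fun x y => by simp [g]
  have hinj : Function.Injective g := by
    have h1 := Module.Flat.rTensor_preserves_injective_linearMap (M := c) (c ^ l).subtype
      (Submodule.subtype_injective _)
    have h2 : g = c.subtype ∘ₗ (TensorProduct.lid B c).toLinearMap ∘ₗ
        (c ^ l).subtype.rTensor c := by
      refine TensorProduct.ext' fun x y => ?_
      rw [hg]; simp
    rw [h2]
    exact (Submodule.subtype_injective _).comp ((TensorProduct.lid B c).injective.comp h1)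
  have hr : LinearMap.range g = c ^ (l + 1) := by
    apply le_antisymm
    · rintro _ ⟨z, rfl⟩
      induction z using TensorProduct.induction_on with
      | zero => simp
      | tmul x y => rw [hg, pow_succ]; exact Ideal.mul_mem_mul x.2 y.2
      | add x y hx hy => rw [map_add]; exact add_mem hx hy
    · rw [pow_succ, Ideal.mul_le]
      intro x hx y hy
      exact ⟨⟨x, hx⟩ ⊗ₜ ⟨y, hy⟩, hg _ _⟩
  exact ⟨(LinearEquiv.ofInjective g hinj).trans (LinearEquiv.ofEq _ _ hr)⟩

theorem pow_inv (c : Ideal B) [Module.Invertible B c] (l : ℕ) : Module.Invertible B ↥(c ^ l) := by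
  induction l with
  | zero =>
    have e : B ≃ₗ[B] ↥(c ^ 0) :=
      (Submodule.topEquiv.symm).trans (LinearEquiv.ofEq _ _ (by simp))
    exact Module.Invertible.congr e
  | succ l ih =>
    obtain ⟨e⟩ := pow_tensor c l
    exact Module.Invertible.congr e

theorem pow_mk (c : Ideal B) [Module.Invertible B c] (l : ℕ) : ∀ [Module.Invertible B ↥(c ^ l)],
    CommRing.Pic.mk B ↥(c ^ l) = CommRing.Pic.mk B c ^ l := by
  induction l with
  | zero =>
    intro _
    have e : B ≃ₗ[B] ↥(c ^ 0) :=
      (Submodule.topEquiv.symm).trans (LinearEquiv.ofEq _ _ (by simp))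
    rw [pow_zero (CommRing.Pic.mk B c), CommRing.Pic.mk_eq_one_iff]
    exact ⟨e.symm⟩
  | succ l ih =>
    intro _
    have := pow_inv c l
    obtain ⟨e⟩ := pow_tensor c l
    rw [pow_succ (CommRing.Pic.mk B c), ← ih, ← CommRing.Pic.mk_tensor, CommRing.Pic.mk_eq_mk_iff]
    exact ⟨e.symm⟩

/-- the matrix `1 - [v|w]` modulo an ideal -/
def eM (c : Ideal B) (v w : B × B) : Matrix (Fin 2) (Fin 2) (B ⧸ c) :=
  !![Ideal.Quotient.mk c w.2, - Ideal.Quotient.mk c w.1;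
     - Ideal.Quotient.mk c v.2, Ideal.Quotient.mk c v.1]

theorem eM_rankOne (c : Ideal B) (v w : B × B) (h1 : v.1 + w.2 = 1) (h2 : om v w ∈ c) :
    RankOne (eM c v w) := by
  have h3 : Ideal.Quotient.mk c v.1 * Ideal.Quotient.mk c w.2 =
      Ideal.Quotient.mk c v.2 * Ideal.Quotient.mk c w.1 := by
    rw [← map_mul, ← map_mul, Ideal.Quotient.eq]; exact h2
  refine ⟨?_, ?_⟩
  · intro i j k l
    fin_cases i <;> fin_cases j <;> fin_cases k <;> fin_cases l <;> simp [eM] <;>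
      first | ring1 | (linear_combination h3) | (linear_combination -h3)
  · simp only [Fin.sum_univ_two, eM]
    change Ideal.Quotient.mk c w.2 + Ideal.Quotient.mk c v.1 = 1
    rw [← map_add, add_comm, h1, map_one]

end
end FpLci
end

section
universe u
namespace FpLci
open TensorProduct

section
variable {B : Type u} [CommRing B]

theorem mem_pow_of_tmul_eq_zero (c : Ideal B) (l : ℕ) (y : ↥(c ^ l))
    (h : (1 : B ⧸ c) ⊗ₜ[B] y = 0) : y.1 ∈ c ^ (l + 1) := by
  have h1 := congrArg (TensorProduct.quotTensorEquivQuotSMul ↥(c ^ l) c) h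
  have h2 : TensorProduct.quotTensorEquivQuotSMul ↥(c ^ l) c ((1 : B ⧸ c) ⊗ₜ[B] y) =
    Submodule.Quotient.mk y := by
    simp
  rw [h2, map_zero, Submodule.Quotient.mk_eq_zero] at h1
  have h3 : (c • (⊤ : Submodule B ↥(c ^ l))).map (c ^ l).subtype = c ^ (l + 1) := by
    rw [Submodule.map_smul'', Submodule.map_top, Submodule.range_subtype, pow_succ']
    rfl
  rw [← h3]
  exact ⟨y, h1, rfl⟩

theorem tmul_eq_zero_of_mem (c : Ideal B) (l : ℕ) (y : ↥(c ^ l)) (hy : y.1 ∈ c ^ (l + 1))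
    {L : Type u} [AddCommGroup L] [Module B L] [Module (B ⧸ c) L] [IsScalarTower B (B ⧸ c) L]
    (m : L) : m ⊗ₜ[B] y = 0 := by
  have h3 : (c • (⊤ : Submodule B ↥(c ^ l))).map (c ^ l).subtype = c ^ (l + 1) := by
    rw [Submodule.map_smul'', Submodule.map_top, Submodule.range_subtype, pow_succ']
    rfl
  rw [← h3] at hy
  obtain ⟨y', h1, h2⟩ := hy
  obtain rfl : y' = y := Subtype.ext h2
  clear h2
  induction h1 using Submodule.smul_induction_on' with
  | smul r hr n _ =>
    rw [← TensorProduct.smul_tmul, ← algebraMap_smul (B ⧸ c) r m]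
    have : algebraMap B (B ⧸ c) r = 0 := Ideal.Quotient.eq_zero_iff_mem.2 hr
    rw [this, zero_smul, TensorProduct.zero_tmul]
  | add x _ y _ hx hy => rw [TensorProduct.tmul_add, hx, hy, add_zero]

/-- the class of `rng(eM) ⊗ c^l` -/
theorem class_tensor (c : Ideal B) [Module.Invertible B c] (l : ℕ)
    (L : Type u) [AddCommGroup L] [Module B L] [Module (B ⧸ c) L] [IsScalarTower B (B ⧸ c) L]
    [Module.Invertible (B ⧸ c) L] :
    Nonempty ((L ⊗[B] ↥(c ^ l)) ≃ₗ[B ⧸ c] ((CommRing.Pic.mk (B ⧸ c) L *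
      (CommRing.Pic.mapAlgebra B (B ⧸ c) (CommRing.Pic.mk B c)) ^ l : CommRing.Pic (B ⧸ c)))) := by
  have := pow_inv c l
  have h : CommRing.Pic.mk (B ⧸ c) L *
      (CommRing.Pic.mapAlgebra B (B ⧸ c) (CommRing.Pic.mk B c)) ^ l =
      CommRing.Pic.mk (B ⧸ c) (L ⊗[B] ↥(c ^ l)) := by
    rw [← map_pow, ← pow_mk, CommRing.Pic.mapAlgebra_apply, ← CommRing.Pic.mk_tensor,
      CommRing.Pic.mk_eq_mk_iff]
    exact ⟨(AlgebraTensorModule.congr (LinearEquiv.refl (B ⧸ c) L)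
      (AlgebraTensorModule.congr (LinearEquiv.refl (B ⧸ c) (B ⧸ c))
        (CommRing.Pic.mk.linearEquiv B ↥(c ^ l)))).trans
      (AlgebraTensorModule.cancelBaseChange B (B ⧸ c) (B ⧸ c) L ↥(c ^ l))⟩
  rw [h]
  exact ⟨(CommRing.Pic.mk.linearEquiv (B ⧸ c) (L ⊗[B] ↥(c ^ l))).symm⟩

end
end FpLci
end

section
universe u
namespace FpLci
open TensorProduct

section
variable {B : Type u} [CommRing B]

/-- class of the image of `1-[v|w]` modulo `c` -/
noncomputable def rho (c : Ideal B) (v w : B × B) (h1 : v.1 + w.2 = 1) (h2 : om v w ∈ c) :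
    CommRing.Pic (B ⧸ c) :=
  haveI := (eM_rankOne c v w h1 h2).inv
  CommRing.Pic.mk (B ⧸ c) (rng (eM c v w))

set_option maxHeartbeats 1600000 in
theorem chain_step [IsNoetherianRing B] (c : Ideal B) [Module.Invertible B c]
    (hd : DimLt (⊥ : Ideal (B ⧸ c)) 2) (v w : B × B) (h1 : v.1 + w.2 = 1) (h2 : om v w ∈ c)
    (T T' : Submodule B (B × B)) [Module.Projective B T] (l : ℕ)
    (hT : ∀ x ∈ T, om x w ∈ c ^ l ∧ om v x ∈ c ^ l)
    (hT1 : ∀ x ∈ T, om v w * x.1 ∈ c ^ (l + 1) ∧ om v w * x.2 ∈ c ^ (l + 1))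
    (hT2 : ∀ y ∈ c ^ l, y • ((w.2, -v.2) : B × B) ∈ T ∧ y • ((-w.1, v.1) : B × B) ∈ T)
    (hT' : ∀ x, x ∈ T' ↔ x ∈ T ∧ om x w ∈ c ^ (l + 1) ∧ om v x ∈ c ^ (l + 1))
    {n : ℕ} {δ : CommRing.Pic (B ⧸ c)} (h : Inv c T n δ) :
    Inv c T' (n + 1) (δ * (rho c v w h1 h2 *
      (CommRing.Pic.mapAlgebra B (B ⧸ c) (CommRing.Pic.mk B c)) ^ l)) := by
  have hinv := (eM_rankOne c v w h1 h2).inv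
  obtain ⟨e⟩ := class_tensor c l (rng (eM c v w))
  let col : Fin 2 → rng (eM c v w) := fun j => ⟨(eM c v w).mulVecLin (Pi.single j 1), ⟨_, rfl⟩⟩
  have hcol : ∀ i j, (col j).1 i = eM c v w i j := fun i j => by
    simp [col]
  let a1 : T →ₗ[B] ↥(c ^ l) := (omL w ∘ₗ T.subtype).codRestrict _ fun x => (hT x.1 x.2).1
  let a2 : T →ₗ[B] ↥(c ^ l) := ((-omL v) ∘ₗ T.subtype).codRestrict _ fun x => by
    have : ((-omL v) ∘ₗ T.subtype) x = om v x.1 := by simp [om]; ring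
    rw [this]
    exact (hT x.1 x.2).2
  have ha1 : ∀ x, (a1 x).1 = om x.1 w := fun x => rfl
  have ha2 : ∀ x, (a2 x).1 = om v x.1 := fun x => by
    simp [a2, om]; ring
  let f : T →ₗ[B] (rng (eM c v w) ⊗[B] ↥(c ^ l)) :=
    (TensorProduct.mk B _ _ (col 0)) ∘ₗ a1 + (TensorProduct.mk B _ _ (col 1)) ∘ₗ a2
  have hf : ∀ x, f x = col 0 ⊗ₜ a1 x + col 1 ⊗ₜ a2 x := fun x => rfl
  have hvw : v.1 = 1 - w.2 := by rw [← h1]; ring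
  have hker : ∀ x : T, f x = 0 ↔ om x.1 w ∈ c ^ (l + 1) ∧ om v x.1 ∈ c ^ (l + 1) := by
    intro x
    constructor
    · intro hx
      have hpr : ∀ i : Fin 2, (eM c v w i 0) ⊗ₜ[B] a1 x + (eM c v w i 1) ⊗ₜ[B] a2 x = 0 := by
        intro i
        have := congrArg (LinearMap.rTensor ↥(c ^ l)
          (((LinearMap.proj i : (Fin 2 → B ⧸ c) →ₗ[B ⧸ c] (B ⧸ c)) ∘ₗ
            (rng (eM c v w)).subtype).restrictScalars B)) hx
        rw [hf] at this
        simp only [map_add, LinearMap.rTensor_tmul, map_zero] at this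
        rw [← hcol, ← hcol]
        exact this
      have hmk : ∀ (b : B) (y : ↥(c ^ l)), (Ideal.Quotient.mk c b) ⊗ₜ[B] y =
          (1 : B ⧸ c) ⊗ₜ[B] (b • y) := fun b y => by
        rw [TensorProduct.tmul_smul, TensorProduct.smul_tmul', Algebra.smul_def, mul_one]; rfl
      have e1 := hpr 0
      have e2 := hpr 1
      have E00 : eM c v w 0 0 = Ideal.Quotient.mk c w.2 := rfl
      have E01 : eM c v w 0 1 = Ideal.Quotient.mk c (-w.1) := by rw [map_neg]; rfl
      have E10 : eM c v w 1 0 = Ideal.Quotient.mk c (-v.2) := by rw [map_neg]; rfl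
      have E11 : eM c v w 1 1 = Ideal.Quotient.mk c v.1 := rfl
      rw [E00, E01, hmk, hmk, ← TensorProduct.tmul_add] at e1
      rw [E10, E11, hmk, hmk, ← TensorProduct.tmul_add] at e2
      have m1 := mem_pow_of_tmul_eq_zero c l _ e1
      have m2 := mem_pow_of_tmul_eq_zero c l _ e2
      simp only [Submodule.coe_add, Submodule.coe_smul, smul_eq_mul, ha1, ha2] at m1 m2
      have m3 := hT1 x.1 x.2
      constructor
      · have : om x.1 w = (w.2 * om x.1 w + -w.1 * om v x.1) + om v w * x.1.1 := by
          simp only [om, hvw]; ring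
        rw [this]; exact add_mem m1 m3.1
      · have : om v x.1 = (-v.2 * om x.1 w + v.1 * om v x.1) + om v w * x.1.2 := by
          simp only [om, hvw]; ring
        rw [this]; exact add_mem m2 m3.2
    · rintro ⟨hx1, hx2⟩
      rw [hf, tmul_eq_zero_of_mem c l _ (by rw [ha1]; exact hx1),
        tmul_eq_zero_of_mem c l _ (by rw [ha2]; exact hx2), add_zero]
  have hsurj : Function.Surjective f := by
    have hd0 : Ideal.Quotient.mk c v.1 * Ideal.Quotient.mk c w.2 =
        Ideal.Quotient.mk c v.2 * Ideal.Quotient.mk c w.1 := by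
      rw [← map_mul, ← map_mul, Ideal.Quotient.eq]; exact h2
    have hd1 : Ideal.Quotient.mk c v.1 = 1 - Ideal.Quotient.mk c w.2 := by
      rw [hvw, map_sub, map_one]
    have hsm : ∀ (b : B) (m : rng (eM c v w)) (y : ↥(c ^ l)),
        (Ideal.Quotient.mk c b • m) ⊗ₜ[B] y = m ⊗ₜ[B] (b • y) := fun b m y => by
      rw [← TensorProduct.smul_tmul, ← algebraMap_smul (B ⧸ c) b m]; rfl
    have hdy : ∀ y : ↥(c ^ l), om v w * y.1 ∈ c ^ (l + 1) := fun y => by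
      rw [pow_succ']; exact Ideal.mul_mem_mul h2 y.2
    have c0 : Ideal.Quotient.mk c w.2 • col 0 + Ideal.Quotient.mk c (-v.2) • col 1 = col 0 := by
      refine Subtype.ext (funext fun i => ?_)
      simp only [Submodule.coe_add, Submodule.coe_smul, Pi.add_apply, Pi.smul_apply, hcol,
        smul_eq_mul, map_neg]
      fin_cases i
      · simp [eM]; linear_combination -hd0 + Ideal.Quotient.mk c w.2 * hd1
      · simp [eM]; linear_combination (- Ideal.Quotient.mk c v.2) * hd1
    have c1 : Ideal.Quotient.mk c (-w.1) • col 0 + Ideal.Quotient.mk c v.1 • col 1 = col 1 := by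
      refine Subtype.ext (funext fun i => ?_)
      simp only [Submodule.coe_add, Submodule.coe_smul, Pi.add_apply, Pi.smul_apply, hcol,
        smul_eq_mul, map_neg]
      fin_cases i
      · simp [eM]; linear_combination (- Ideal.Quotient.mk c w.1) * hd1
      · simp [eM]; linear_combination Ideal.Quotient.mk c v.1 * hd1 - hd0
    have hp : ∀ (k : Fin 2) (y : ↥(c ^ l)), col k ⊗ₜ[B] y ∈ LinearMap.range f := by
      intro k y
      have key : ∀ (x : T) (b0 b1 : B), om x.1 w - b0 * y.1 ∈ c ^ (l + 1) →
          om v x.1 - b1 * y.1 ∈ c ^ (l + 1) →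
          f x = (Ideal.Quotient.mk c b0 • col 0 + Ideal.Quotient.mk c b1 • col 1) ⊗ₜ[B] y := by
        intro x b0 b1 k0 k1
        rw [TensorProduct.add_tmul, hsm, hsm, hf]
        congr 1
        · rw [← sub_eq_zero, ← TensorProduct.tmul_sub]
          exact tmul_eq_zero_of_mem c l _ k0 _
        · rw [← sub_eq_zero, ← TensorProduct.tmul_sub]
          refine tmul_eq_zero_of_mem c l _ ?_ _
          rw [Submodule.coe_sub, ha2]
          exact k1
      fin_cases k
      · refine ⟨⟨_, (hT2 y.1 y.2).1⟩, ?_⟩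
        rw [key _ w.2 (-v.2) ?_ ?_, c0]
        · rfl
        · have : om (y.1 • ((w.2, -v.2) : B × B)) w - w.2 * y.1 = - (om v w * y.1) := by
            simp only [om, Prod.smul_mk, smul_eq_mul, hvw]; ring
          rw [this]; exact neg_mem (hdy y)
        · have : om v (y.1 • ((w.2, -v.2) : B × B)) - (-v.2) * y.1 = 0 := by
            simp only [om, Prod.smul_mk, smul_eq_mul, hvw]; ring
          rw [this]; exact zero_mem _
      · refine ⟨⟨_, (hT2 y.1 y.2).2⟩, ?_⟩
        rw [key _ (-w.1) v.1 ?_ ?_, c1]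
        · rfl
        · have : om (y.1 • ((-w.1, v.1) : B × B)) w - (-w.1) * y.1 = 0 := by
            simp only [om, Prod.smul_mk, smul_eq_mul, hvw]; ring
          rw [this]; exact zero_mem _
        · have : om v (y.1 • ((-w.1, v.1) : B × B)) - v.1 * y.1 = - (om v w * y.1) := by
            simp only [om, Prod.smul_mk, smul_eq_mul, hvw]; ring
          rw [this]; exact neg_mem (hdy y)
    rw [← LinearMap.range_eq_top, eq_top_iff]
    rintro z -
    induction z using TensorProduct.induction_on with
    | zero => exact zero_mem _
    | add x y hx hy => exact add_mem hx hy
    | tmul m y =>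
      obtain ⟨_, a, rfl⟩ := m
      obtain ⟨b0, hb0⟩ := Ideal.Quotient.mk_surjective (a 0)
      obtain ⟨b1, hb1⟩ := Ideal.Quotient.mk_surjective (a 1)
      have : (⟨(eM c v w).mulVecLin a, ⟨a, rfl⟩⟩ : rng (eM c v w)) =
          Ideal.Quotient.mk c b0 • col 0 + Ideal.Quotient.mk c b1 • col 1 := by
        refine Subtype.ext (funext fun i => ?_)
        simp only [Submodule.coe_add, Submodule.coe_smul, Pi.add_apply, Pi.smul_apply, hcol,
          smul_eq_mul, Matrix.mulVecLin_apply, Matrix.mulVec, dotProduct, Fin.sum_univ_two, hb0, hb1]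
        ring
      have h5 := add_mem (hp 0 (b0 • y)) (hp 1 (b1 • y))
      rw [← hsm, ← hsm, ← TensorProduct.add_tmul, ← this] at h5
      exact h5
  have h6 : T' ≤ T := fun x hx => ((hT' x).1 hx).1
  have h7 : LinearMap.ker f = T'.comap T.subtype := by
    ext x
    rw [LinearMap.mem_ker, hker, Submodule.mem_comap, hT']
    exact ⟨fun h => ⟨x.2, h⟩, fun h => h.2⟩
  exact Inv.step hd h _ (rng (eM c v w) ⊗[B] ↥(c ^ l)) e f hsurj
    ((LinearEquiv.ofEq _ _ h7).trans (Submodule.comapSubtypeEquivOfLe h6))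

end
end FpLci
end

section
universe u
namespace FpLci
open TensorProduct

section
variable {B : Type u} [CommRing B]

/-- `{x ∈ c^a B² | (1-[v|w]) x ∈ c^l B²}` -/
def TT (c : Ideal B) (v w : B × B) (a l : ℕ) : Submodule B (B × B) where
  carrier := {x | (x.1 ∈ c ^ a ∧ x.2 ∈ c ^ a) ∧ om x w ∈ c ^ l ∧ om v x ∈ c ^ l}
  zero_mem' := by simp [om]
  add_mem' := by
    rintro x y ⟨⟨h1, h2⟩, h3, h4⟩ ⟨⟨h1', h2'⟩, h3', h4'⟩
    refine ⟨⟨add_mem h1 h1', add_mem h2 h2'⟩, ?_, ?_⟩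
    · have : om (x + y) w = om x w + om y w := by simp only [om, Prod.fst_add, Prod.snd_add]; ring
      rw [this]; exact add_mem h3 h3'
    · have : om v (x + y) = om v x + om v y := by simp only [om, Prod.fst_add, Prod.snd_add]; ring
      rw [this]; exact add_mem h4 h4'
  smul_mem' := by
    rintro b x ⟨⟨h1, h2⟩, h3, h4⟩
    refine ⟨⟨Ideal.mul_mem_left _ _ h1, Ideal.mul_mem_left _ _ h2⟩, ?_, ?_⟩
    · have : om (b • x) w = b * om x w := by
        simp only [om, Prod.smul_fst, Prod.smul_snd, smul_eq_mul]; ring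
      rw [this]; exact Ideal.mul_mem_left _ _ h3
    · have : om v (b • x) = b * om v x := by
        simp only [om, Prod.smul_fst, Prod.smul_snd, smul_eq_mul]; ring
      rw [this]; exact Ideal.mul_mem_left _ _ h4

theorem mem_TT {c : Ideal B} {v w : B × B} {a l : ℕ} {x : B × B} : x ∈ TT c v w a l ↔
    (x.1 ∈ c ^ a ∧ x.2 ∈ c ^ a) ∧ om x w ∈ c ^ l ∧ om v x ∈ c ^ l := Iff.rfl

theorem om_mem_left (a : Ideal B) {x : B × B} (h1 : x.1 ∈ a) (h2 : x.2 ∈ a) (y : B × B) :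
    om x y ∈ a ∧ om y x ∈ a :=
  ⟨sub_mem (Ideal.mul_mem_right _ _ h1) (Ideal.mul_mem_right _ _ h2),
   sub_mem (Ideal.mul_mem_left _ _ h2) (Ideal.mul_mem_left _ _ h1)⟩

theorem TT_proj (c : Ideal B) [Module.Invertible B c] (v w : B × B) (h1 : v.1 + w.2 = 1)
    {q : ℕ} (h2 : om v w ∈ c ^ q) (a l : ℕ) (hal : a ≤ l) (hl : l ≤ a + q) :
    Module.Projective B (TT c v w a l) := by
  have := pow_inv c a
  have := pow_inv c l
  have hle : c ^ l ≤ c ^ a := Ideal.pow_le_pow_right hal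
  let i : TT c v w a l →ₗ[B] ((↥(c ^ a) × ↥(c ^ a)) × (↥(c ^ l) × ↥(c ^ l))) :=
    { toFun := fun x => ((⟨x.1.1, x.2.1.1⟩, ⟨x.1.2, x.2.1.2⟩),
        (⟨om x.1 w, x.2.2.1⟩, ⟨om v x.1, x.2.2.2⟩))
      map_add' := fun x y => by
        refine Prod.ext (Prod.ext rfl rfl) (Prod.ext (Subtype.ext ?_) (Subtype.ext ?_)) <;>
          simp [om] <;> ring
      map_smul' := fun b x => by
        refine Prod.ext (Prod.ext rfl rfl) (Prod.ext (Subtype.ext ?_) (Subtype.ext ?_)) <;>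
          simp [om] <;> ring }
  let g : ((↥(c ^ a) × ↥(c ^ a)) × (↥(c ^ l) × ↥(c ^ l))) → B × B := fun z => z.1.1.1 • v + z.1.2.1 • w + (z.2.1.1, z.2.2.1)
  have hvw : v.1 = 1 - w.2 := by rw [← h1]; ring
  have hg : ∀ z, g z ∈ TT c v w a l := by
    rintro ⟨⟨⟨x1, hx1⟩, ⟨x2, hx2⟩⟩, ⟨⟨y1, hy1⟩, ⟨y2, hy2⟩⟩⟩
    have hmul : ∀ x ∈ c ^ a, om v w * x ∈ c ^ l := fun x hx =>
      Ideal.pow_le_pow_right hl (by rw [add_comm, pow_add]; exact Ideal.mul_mem_mul h2 hx)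
    refine ⟨⟨?_, ?_⟩, ?_, ?_⟩
    · simp only [g, Prod.fst_add, Prod.smul_fst, smul_eq_mul]
      exact add_mem (add_mem (Ideal.mul_mem_right _ _ hx1) (Ideal.mul_mem_right _ _ hx2)) (hle hy1)
    · simp only [g, Prod.snd_add, Prod.smul_snd, smul_eq_mul]
      exact add_mem (add_mem (Ideal.mul_mem_right _ _ hx1) (Ideal.mul_mem_right _ _ hx2)) (hle hy2)
    · have : om (x1 • v + x2 • w + (y1, y2)) w = om v w * x1 + om (y1, y2) w := by
        simp only [om, Prod.fst_add, Prod.snd_add, Prod.smul_fst, Prod.smul_snd, smul_eq_mul]; ring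
      exact this ▸ add_mem (hmul _ hx1) (om_mem_left _ hy1 hy2 _).1
    · have : om v (x1 • v + x2 • w + (y1, y2)) = om v w * x2 + om v (y1, y2) := by
        simp only [om, Prod.fst_add, Prod.snd_add, Prod.smul_fst, Prod.smul_snd, smul_eq_mul]; ring
      exact this ▸ add_mem (hmul _ hx2) (om_mem_left _ hy1 hy2 _).2
  let s : ((↥(c ^ a) × ↥(c ^ a)) × (↥(c ^ l) × ↥(c ^ l))) →ₗ[B] TT c v w a l :=
    { toFun := fun z => ⟨g z, hg z⟩
      map_add' := fun x y => Subtype.ext (by ext <;> simp [g] <;> ring)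
      map_smul' := fun b x => Subtype.ext (by ext <;> simp [g] <;> ring) }
  refine Module.Projective.of_split i s ?_
  ext x
  · simp only [s, i, g, om, LinearMap.comp_apply, LinearMap.coe_mk, AddHom.coe_mk, LinearMap.id_apply,
      Prod.fst_add, Prod.smul_fst, smul_eq_mul, hvw]
    ring
  · simp only [s, i, g, om, LinearMap.comp_apply, LinearMap.coe_mk, AddHom.coe_mk, LinearMap.id_apply,
      Prod.snd_add, Prod.smul_snd, smul_eq_mul, hvw]
    ring

theorem prod_proj (a b : Ideal B) [Module.Projective B a] [Module.Projective B b] :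
    Module.Projective B (Submodule.prod a b) := by
  let e : Submodule.prod a b ≃ₗ[B] (a × b) :=
    { toFun := fun x => (⟨x.1.1, x.2.1⟩, ⟨x.1.2, x.2.2⟩)
      invFun := fun z => ⟨(z.1.1, z.2.1), ⟨z.1.2, z.2.2⟩⟩
      map_add' := fun x y => rfl
      map_smul' := fun x y => rfl
      left_inv := fun x => rfl
      right_inv := fun x => rfl }
  exact Module.Projective.of_equiv e.symm

variable [IsNoetherianRing B] (c : Ideal B) [Module.Invertible B c]

theorem chain_base
    (hd : DimLt (⊥ : Ideal (B ⧸ c)) 2) (H : Subgroup (CommRing.Pic (B ⧸ c)))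
    (hA : CommRing.Pic.mapAlgebra B (B ⧸ c) (CommRing.Pic.mk B c) ∈ H)
    (hE2 : rho c ((1 : B), (0 : B)) ((0 : B), (0 : B)) (by simp) (by simp [om]) ∈ H)
    (hE1 : rho c ((0 : B), (0 : B)) ((0 : B), (1 : B)) (by simp) (by simp [om]) ∈ H) (a : ℕ) :
    ∃ δ ∈ H, Inv c (Submodule.prod (c ^ a) (c ^ a) : Submodule B (B × B)) (2 * a) δ := by
  induction a with
  | zero =>
    refine ⟨1, one_mem _, Inv.base.congr ((Submodule.topEquiv.symm).trans
      (LinearEquiv.ofEq _ _ ?_))⟩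
    ext; simp
  | succ a ih =>
    obtain ⟨δ, hδ, h⟩ := ih
    have := pow_inv c a
    have := pow_inv c (a + 1)
    have hle : c ^ (a + 1) ≤ c ^ a := Ideal.pow_le_pow_right (by omega)
    have := prod_proj (c ^ a) (c ^ a)
    have := prod_proj (c ^ a) (c ^ (a + 1))
    have s1 := chain_step c hd ((1 : B), (0 : B)) ((0 : B), (0 : B)) (by simp) (by simp [om])
      (Submodule.prod (c ^ a) (c ^ a) : Submodule B (B × B))
      (Submodule.prod (c ^ a) (c ^ (a + 1)) : Submodule B (B × B)) a
      (fun x hx => by simpa [om] using hx.2) (fun x hx => by simp [om])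
      (fun y hy => by simp [hy])
      (fun x => by
        simp only [Submodule.mem_prod, om]
        constructor
        · rintro ⟨h1, h2⟩; exact ⟨⟨h1, hle h2⟩, by simp, by simpa using h2⟩
        · rintro ⟨h1, -, h2⟩; exact ⟨h1.1, by simpa using h2⟩) h
    have s2 := chain_step c hd ((0 : B), (0 : B)) ((0 : B), (1 : B)) (by simp) (by simp [om])
      (Submodule.prod (c ^ a) (c ^ (a + 1)) : Submodule B (B × B))
      (Submodule.prod (c ^ (a + 1)) (c ^ (a + 1)) : Submodule B (B × B)) a
      (fun x hx => by simpa [om] using hx.1) (fun x hx => by simp [om])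
      (fun y hy => by simp [hy])
      (fun x => by
        simp only [Submodule.mem_prod, om]
        constructor
        · rintro ⟨h1, h2⟩; exact ⟨⟨hle h1, h2⟩, by simpa using h1, by simp⟩
        · rintro ⟨h1, h2, -⟩; exact ⟨by simpa using h2, h1.2⟩) s1
    exact ⟨_, mul_mem (mul_mem hδ (mul_mem hE2 (pow_mem hA _))) (mul_mem hE1 (pow_mem hA _)), s2⟩

theorem chain_main
    (hd : DimLt (⊥ : Ideal (B ⧸ c)) 2) (H : Subgroup (CommRing.Pic (B ⧸ c)))
    (hA : CommRing.Pic.mapAlgebra B (B ⧸ c) (CommRing.Pic.mk B c) ∈ H)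
    (v w : B × B) (h1 : v.1 + w.2 = 1) (h0 : om v w ∈ c)
    {q : ℕ} (h2 : om v w ∈ c ^ q) (hr : rho c v w h1 h0 ∈ H) (a n : ℕ)
    (hb : ∃ δ ∈ H, Inv c (Submodule.prod (c ^ a) (c ^ a) : Submodule B (B × B)) n δ)
    (j : ℕ) (hj : j ≤ q) :
    ∃ δ ∈ H, Inv c (TT c v w a (a + j)) (n + j) δ := by
  induction j with
  | zero =>
    obtain ⟨δ, hδ, h⟩ := hb
    refine ⟨δ, hδ, h.congr (LinearEquiv.ofEq _ _ ?_)⟩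
    ext x
    rw [Submodule.mem_prod, mem_TT]
    exact ⟨fun h => ⟨h, (om_mem_left _ h.1 h.2 w).1, (om_mem_left _ h.1 h.2 v).2⟩, fun h => h.1⟩
  | succ j ih =>
    obtain ⟨δ, hδ, h⟩ := ih (by omega)
    have := TT_proj c v w h1 h2 a (a + j) (by omega) (by omega)
    have hle : c ^ (a + j) ≤ c ^ a := Ideal.pow_le_pow_right (by omega)
    have hvw : v.1 = 1 - w.2 := by rw [← h1]; ring
    have hmul : ∀ x ∈ c ^ a, om v w * x ∈ c ^ (a + j + 1) := fun x hx =>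
      Ideal.pow_le_pow_right (by omega : a + j + 1 ≤ q + a)
        (by rw [pow_add]; exact Ideal.mul_mem_mul h2 hx)
    have s1 := chain_step c hd v w h1 h0 (TT c v w a (a + j)) (TT c v w a (a + (j + 1))) (a + j)
      (fun x hx => hx.2) (fun x hx => ⟨hmul _ hx.1.1, hmul _ hx.1.2⟩)
      (fun y hy => by
        have key : ∀ z : B × B, y • z ∈ TT c v w a (a + j) := fun z => by
          have k1 : (y • z).1 ∈ c ^ (a + j) := Ideal.mul_mem_right _ _ hy
          have k2 : (y • z).2 ∈ c ^ (a + j) := Ideal.mul_mem_right _ _ hy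
          exact ⟨⟨hle k1, hle k2⟩, (om_mem_left _ k1 k2 w).1, (om_mem_left _ k1 k2 v).2⟩
        exact ⟨key _, key _⟩)
      (fun x => by
        rw [mem_TT, mem_TT]
        have : c ^ (a + (j + 1)) ≤ c ^ (a + j) := Ideal.pow_le_pow_right (by omega)
        exact ⟨fun h => ⟨⟨h.1, this h.2.1, this h.2.2⟩, h.2⟩, fun h => ⟨h.1.1, h.2⟩⟩) h
    exact ⟨_, mul_mem hδ (mul_mem hr (pow_mem hA _)), s1⟩

end
end FpLci
end

section
universe u
namespace FpLci
open TensorProduct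

section
variable {B : Type u} [CommRing B]

theorem pic_mem_of_entries {C : Type u} [CommRing C] {R : Type*} [CommRing R] [Algebra R C]
    (C0 : Subalgebra R C) {n : ℕ}
    {E : Matrix (Fin n) (Fin n) C} (h : RankOne E) (hE : ∀ i j, E i j ∈ C0)
    (D : Type u) [AddCommGroup D] [Module C D]
    [Module.Invertible C D] (e : D ≃ₗ[C] rng E) :
    CommRing.Pic.mk C D ∈ (CommRing.Pic.mapAlgebra C0 C).range := by
  let E0 : Matrix (Fin n) (Fin n) C0 := fun i j => ⟨E i j, hE i j⟩
  have h0 : E0.map (algebraMap C0 C) = E := by ext i j; rfl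
  have h1 : RankOne E0 := by
    refine ⟨fun i j k l => Subtype.ext (h.comm i j k l), Subtype.ext ?_⟩
    have := h.tr
    simpa [E0] using this
  exact pic_map_rng C0 h1 D (e.trans (LinearEquiv.ofEq _ _ (by rw [h0])))

theorem rho_mem {R : Type*} [CommRing R] [Algebra R B] (c : Ideal B) (v w : B × B)
    (h1 : v.1 + w.2 = 1) (h2 : om v w ∈ c)
    (C0 : Subalgebra R (B ⧸ c)) (a1 : Ideal.Quotient.mk c v.1 ∈ C0)
    (a2 : Ideal.Quotient.mk c v.2 ∈ C0) (a3 : Ideal.Quotient.mk c w.1 ∈ C0)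
    (a4 : Ideal.Quotient.mk c w.2 ∈ C0) :
    rho c v w h1 h2 ∈ (CommRing.Pic.mapAlgebra C0 (B ⧸ c)).range := by
  have := (eM_rankOne c v w h1 h2).inv
  refine pic_mem_of_entries C0 (eM_rankOne c v w h1 h2) ?_ _ (LinearEquiv.refl _ _)
  intro i j
  fin_cases i <;> fin_cases j <;> simp [eM, *]

theorem exists_H {k : Type*} [Field k] (p : ℕ) [Fact p.Prime] [Algebra (ZMod p) k]
    [Algebra.IsAlgebraic (ZMod p) k] [Algebra k B] [Algebra (ZMod p) B]
    [IsScalarTower (ZMod p) k B] [Algebra.FiniteType k B]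
    (c : Ideal B) [Module.Invertible B c] (hd : DimLt (⊥ : Ideal (B ⧸ c)) 2)
    (v w : B × B) :
    ∃ H : Subgroup (CommRing.Pic (B ⧸ c)), Finite H ∧
      CommRing.Pic.mapAlgebra B (B ⧸ c) (CommRing.Pic.mk B c) ∈ H ∧
      rho c ((1 : B), (0 : B)) ((0 : B), (0 : B)) (by simp) (by simp [om]) ∈ H ∧
      rho c ((0 : B), (0 : B)) ((0 : B), (1 : B)) (by simp) (by simp [om]) ∈ H ∧
      ∀ q h1 h2, rho c (fr q v) (fr q w) h1 h2 ∈ H := by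
  classical
  obtain ⟨n, E, hE, ⟨eE⟩⟩ := exists_rankOne (C := B ⧸ c) ((B ⧸ c) ⊗[B] c)
  obtain ⟨S, hS⟩ := (Algebra.FiniteType.out : (⊤ : Subalgebra k (B ⧸ c)).FG)
  let m := Ideal.Quotient.mk c
  let S' : Finset (B ⧸ c) := S ∪ {m v.1, m v.2, m w.1, m w.2} ∪
    (Finset.univ.image fun ij : Fin n × Fin n => E ij.1 ij.2)
  let C0 : Subalgebra (ZMod p) (B ⧸ c) := Algebra.adjoin (ZMod p) (S' : Set (B ⧸ c))
  have hsub : ∀ x ∈ S', x ∈ C0 := fun x hx => Algebra.subset_adjoin hx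
  have : Algebra.FiniteType (ZMod p) C0 :=
    (Subalgebra.fg_iff_finiteType _).1 ⟨S', rfl⟩
  have hIntegral : Algebra.IsIntegral C0 (B ⧸ c) := by
    refine ⟨fun x => ?_⟩
    have hx : x ∈ Algebra.adjoin k (S : Set (B ⧸ c)) := by rw [hS]; trivial
    induction hx using Algebra.adjoin_induction with
    | mem x hx =>
      have hx0 : x ∈ C0 := hsub x (by simp only [S', Finset.mem_union]; exact Or.inl (Or.inl hx))
      exact isIntegral_algebraMap (x := (⟨x, hx0⟩ : C0))
    | algebraMap r =>
      have h1 : IsIntegral (ZMod p) r := Algebra.IsIntegral.isIntegral r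
      have h2 : IsIntegral (ZMod p) (algebraMap k (B ⧸ c) r) := h1.algebraMap
      exact h2.tower_top
    | add x y _ _ hx hy => exact hx.add hy
    | mul x y _ _ hx hy => exact hx.mul hy
  have hd0 : DimLt (⊥ : Ideal C0) 2 := DimLt.of_integral Subtype.val_injective hd
  have := finite_pic p hd0
  refine ⟨(CommRing.Pic.mapAlgebra C0 (B ⧸ c)).range, ?_, ?_, ?_, ?_, ?_⟩
  · exact Set.finite_range _
  · rw [CommRing.Pic.mapAlgebra_apply]
    refine pic_mem_of_entries C0 hE (fun i j => hsub _ ?_) _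
      ((AlgebraTensorModule.congr (LinearEquiv.refl (B ⧸ c) (B ⧸ c))
        (CommRing.Pic.mk.linearEquiv B c)).trans eE)
    simp only [S', Finset.mem_union]
    exact Or.inr (Finset.mem_image_of_mem _ (Finset.mem_univ (i, j)))
  · apply rho_mem <;> simp
  · apply rho_mem <;> simp
  · intro q h1 h2
    have h : ∀ x ∈ ({m v.1, m v.2, m w.1, m w.2} : Finset (B ⧸ c)), x ∈ C0 := fun x hx =>
      hsub x (by simp only [S', Finset.mem_union]; exact Or.inl (Or.inr hx))
    apply rho_mem <;> simp only [fr, map_pow] <;> refine pow_mem (h _ ?_) _ <;> simp [m]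

end
end FpLci
end

section
universe u
namespace FpLci
open TensorProduct

section
variable {B : Type u} [CommRing B]

theorem locFree_of_approx {M : Type*} [AddCommGroup M] [Module B M] {n : ℕ}
    (H : ∀ p : Ideal B, p.IsPrime → ∃ h ∉ p, ∃ α : (Fin n → B) →ₗ[B] M,
      (∀ x, ∃ y, α y = h • x) ∧ ∀ y, α y = 0 → h • y = 0) : LocFree B M n := by
  intro p hp
  obtain ⟨h, hh, α, h1, h2⟩ := H p hp
  choose g hg using h1
  have huniq : ∀ y y', α y = α y' → h • y = h • y' := fun y y' hy => by
    rw [← sub_eq_zero, ← smul_sub]; apply h2; rw [map_sub, hy, sub_self]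
  let β : M →ₗ[B] (Fin n → B) :=
    { toFun := fun x => h • g x
      map_add' := fun x y => by
        rw [← smul_add]; apply huniq; rw [map_add, hg, hg, hg, smul_add]
      map_smul' := fun b x => by
        rw [RingHom.id_apply, smul_comm b h]; apply huniq; rw [map_smul, hg, hg, smul_comm] }
  refine ⟨h * h, fun hm => ?_, α, β, ?_, ?_⟩
  · rcases hp.mem_or_mem hm with h | h <;> exact hh h
  · intro x
    change α (h • g x) = _
    rw [map_smul, hg, mul_smul]
  · intro y
    change h • g (α y) = _
    rw [mul_smul]
    apply huniq
    rw [hg, map_smul]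

theorem inv_of_locFree {M : Type u} [AddCommGroup M] [Module B M] (h : LocFree B M 1) :
    Module.Invertible B M := by
  classical
  let S : Set B := {b | ∃ (φ : M →ₗ[B] B) (x : M), φ x = b ∧ ∀ y z, φ y • z = φ z • y}
  have hS : Ideal.span S = ⊤ := by
    by_contra hne
    obtain ⟨m, hm, hle⟩ := Ideal.exists_le_maximal _ hne
    obtain ⟨t, ht, α, β, hab, hba⟩ := h m hm.isPrime
    apply ht
    have hM : t * t ∈ S := by
      refine ⟨t • (LinearMap.proj 0 ∘ₗ β), α (fun _ => 1), ?_, fun y z => ?_⟩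
      · simp [hba]
      · simp only [LinearMap.smul_apply, LinearMap.comp_apply, LinearMap.proj_apply, smul_eq_mul]
        have key : ∀ y z : M, (t * β y 0) • z = (β y 0 * β z 0) • α (fun _ => 1) := fun y z => by
          rw [mul_comm, mul_smul, ← hab z, mul_smul]
          congr 1
          rw [← map_smul]
          congr 1
          funext i
          fin_cases i
          simp
        rw [key, key, mul_comm]
    rcases hm.isPrime.mem_or_mem (hle (Ideal.subset_span hM)) with h | h <;> exact h
  obtain ⟨n, f, g, hfg⟩ := (Submodule.mem_span_set' (R := B)).1
    (show (1 : B) ∈ Submodule.span B S by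
      have : (1 : B) ∈ Ideal.span S := by rw [hS]; trivial
      exact this)
  choose φ x hφ hc using fun i => (g i).2
  refine inv_of_data (n := n) (fun i => f i • φ i) x ?_ ?_
  · rw [← hfg]
    exact Finset.sum_congr rfl fun i _ => by simp [hφ]
  · intro i y z
    simp only [LinearMap.smul_apply, smul_eq_mul, mul_smul]
    rw [hc]

/-- ideal generated by the minors -/
def cI (L : Submodule B (B × B)) : Ideal B := Ideal.span {z | ∃ x ∈ L, ∃ y ∈ L, z = om x y}

theorem om_mem_cI {L : Submodule B (B × B)} {x y : B × B} (hx : x ∈ L) (hy : y ∈ L) :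
    om x y ∈ cI L := Ideal.subset_span ⟨x, hx, y, hy, rfl⟩

/-- `v, w` generate `L` away from `t`. -/
def LocGen (L : Submodule B (B × B)) (t : B) (v w : B × B) : Prop :=
  v ∈ L ∧ w ∈ L ∧ ∀ x ∈ L, ∃ a b : B, t • x = a • v + b • w

theorem LocGen.dvd {L : Submodule B (B × B)} {t : B} {v w : B × B} (h : LocGen L t v w) (l : ℕ)
    {y : B} (hy : y ∈ cI L ^ l) : ∃ z, t ^ (2 * l) * y = om v w ^ l * z := by
  have h1 : Ideal.span {t ^ 2} * cI L ≤ Ideal.span {om v w} := by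
    rw [cI, Ideal.span_mul_span', Ideal.span_le]
    rintro _ ⟨_, rfl, _, ⟨x, hx, y, hy, rfl⟩, rfl⟩
    obtain ⟨a, b, hab⟩ := h.2.2 x hx
    obtain ⟨a', b', hab'⟩ := h.2.2 y hy
    refine Ideal.mem_span_singleton.2 ⟨a * b' - b * a', ?_⟩
    have e1 : t ^ 2 * om x y = om (t • x) (t • y) := by
      simp only [om, Prod.smul_fst, Prod.smul_snd, smul_eq_mul]; ring
    change t ^ 2 * om x y = _
    rw [e1, hab, hab']
    simp only [om, Prod.smul_fst, Prod.smul_snd, smul_eq_mul, Prod.fst_add, Prod.snd_add]; ring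
  have h2 := Ideal.pow_right_mono h1 l
  rw [mul_pow, Ideal.span_singleton_pow, Ideal.span_singleton_pow, ← pow_mul] at h2
  exact Ideal.mem_span_singleton.1 (h2 (Ideal.mul_mem_mul (Ideal.mem_span_singleton_self _) hy))

theorem LocGen.nzd {L : Submodule B (B × B)} {t : B} {v w : B × B} (h : LocGen L t v w)
    {s : B} (hs : s ∈ cI L) (hs' : s ∈ nonZeroDivisors B) (l : ℕ)
    {y : B} (hy : om v w ^ l * y = 0) : t ^ (2 * l) * y = 0 := by
  obtain ⟨z, hz⟩ := h.dvd l (Ideal.pow_mem_pow hs l)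
  have h1 : t ^ (2 * l) * y * s ^ l = 0 := by linear_combination y * hz + z * hy
  exact (mul_right_mem_nonZeroDivisors_eq_zero_iff (pow_mem hs' l)).1 h1

theorem cI_inv {L : Submodule B (B × B)}
    (hL : ∀ p : Ideal B, p.IsPrime → ∃ t ∉ p, ∃ v w, LocGen L t v w)
    {s : B} (hs : s ∈ cI L) (hs' : s ∈ nonZeroDivisors B) : Module.Invertible B (cI L) := by
  apply inv_of_locFree
  apply locFree_of_approx
  intro p hp
  obtain ⟨t, ht, v, w, h⟩ := hL p hp
  refine ⟨t ^ 2, fun hm => ht (hp.mem_of_pow_mem _ hm),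
    (LinearMap.toSpanSingleton B (cI L) ⟨om v w, om_mem_cI h.1 h.2.1⟩) ∘ₗ LinearMap.proj 0, ?_, ?_⟩
  · intro x
    obtain ⟨z, hz⟩ := h.dvd 1 (by rw [pow_one]; exact x.2)
    refine ⟨fun _ => z, Subtype.ext ?_⟩
    simp only [mul_one, pow_one] at hz
    simp [hz, mul_comm]
  · intro y hy
    have h1 : y 0 * om v w = 0 := by
      have := congrArg Subtype.val hy
      simpa using this
    have := h.nzd hs hs' 1 (y := y 0) (by rw [pow_one, mul_comm]; exact h1)
    funext i
    fin_cases i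
    simpa using this

/-- the local structure of the modules `c^e L^{(q)}`. -/
def GoodX (L X : Submodule B (B × B)) (e q : ℕ) : Prop :=
  (∀ v ∈ L, ∀ w ∈ L, om v w ^ e • fr q v ∈ X ∧ om v w ^ e • fr q w ∈ X) ∧
  ∀ t v w, LocGen L t v w → ∃ N : ℕ, ∀ x ∈ X, ∃ a b : B,
    t ^ N • x = om v w ^ e • (a • fr q v + b • fr q w)

theorem om_fr (p : ℕ) [Fact p.Prime] [CharP B p] (i : ℕ) (x y : B × B) :
    om (fr (p ^ i) x) (fr (p ^ i) y) = om x y ^ p ^ i := by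
  simp only [om, fr]
  rw [sub_pow_char_pow, mul_pow, mul_pow]

theorem good_TT (p : ℕ) [Fact p.Prime] [CharP B p] {L : Submodule B (B × B)}
    {s : B} (hs : s ∈ cI L) (hs' : s ∈ nonZeroDivisors B) {v0 w0 : B × B} (hv0 : v0 ∈ L)
    (hw0 : w0 ∈ L) (h1 : v0.1 + w0.2 = 1) (i e : ℕ) :
    GoodX L (TT (cI L) (fr (p ^ i) v0) (fr (p ^ i) w0) e (e + p ^ i)) e (p ^ i) := by
  have htr : v0.1 ^ p ^ i + w0.2 ^ p ^ i = 1 := by rw [← add_pow_char_pow, h1, one_pow]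
  have hmem : ∀ x ∈ L, ∀ z ∈ cI L ^ e,
      z • fr (p ^ i) x ∈ TT (cI L) (fr (p ^ i) v0) (fr (p ^ i) w0) e (e + p ^ i) := by
    intro x hx z hz
    refine ⟨⟨Ideal.mul_mem_right _ _ hz, Ideal.mul_mem_right _ _ hz⟩, ?_, ?_⟩
    · have : om (z • fr (p ^ i) x) (fr (p ^ i) w0) = z * om (fr (p ^ i) x) (fr (p ^ i) w0) := by
        simp only [om, Prod.smul_fst, Prod.smul_snd, smul_eq_mul]; ring
      rw [this, om_fr, pow_add]
      exact Ideal.mul_mem_mul hz (Ideal.pow_mem_pow (om_mem_cI hx hw0) _)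
    · have : om (fr (p ^ i) v0) (z • fr (p ^ i) x) = z * om (fr (p ^ i) v0) (fr (p ^ i) x) := by
        simp only [om, Prod.smul_fst, Prod.smul_snd, smul_eq_mul]; ring
      rw [this, om_fr, pow_add]
      exact Ideal.mul_mem_mul hz (Ideal.pow_mem_pow (om_mem_cI hv0 hx) _)
  refine ⟨fun v hv w hw => ⟨hmem v hv _ (Ideal.pow_mem_pow (om_mem_cI hv hw) _),
    hmem w hw _ (Ideal.pow_mem_pow (om_mem_cI hv hw) _)⟩, fun t v w h => ?_⟩
  generalize hq : p ^ i = q at *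
  have omfr : ∀ x y : B × B, om (fr q x) (fr q y) = om x y ^ q := fun x y => hq ▸ om_fr p i x y
  refine ⟨2 * q + 2 * (e + q), fun x hx => ?_⟩
  obtain ⟨⟨x1, x2⟩, x3, x4⟩ := hx
  have key : ∀ y ∈ L, om x (fr q y) ∈ cI L ^ (e + q) := by
    intro y hy
    have : om x (fr q y) = om (om x (fr q w0), om (fr q v0) x) (fr q y) +
        (x.1 * om (fr q v0) (fr q y) + x.2 * om (fr q w0) (fr q y)) := by
      simp only [om, fr]
      linear_combination (-(x.1 * y.2 ^ q) + x.2 * y.1 ^ q) * htr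
    rw [this, omfr, omfr]
    refine add_mem (om_mem_left _ x3 x4 _).1 (add_mem ?_ ?_)
    · rw [pow_add]; exact Ideal.mul_mem_mul x1 (Ideal.pow_mem_pow (om_mem_cI hv0 hy) _)
    · rw [pow_add]; exact Ideal.mul_mem_mul x2 (Ideal.pow_mem_pow (om_mem_cI hw0 hy) _)
  obtain ⟨a, ha⟩ := h.dvd _ (key w h.2.1)
  obtain ⟨b, hb⟩ := h.dvd _ (key v h.1)
  refine ⟨t ^ (2 * q) * a, - (t ^ (2 * q) * b), ?_⟩
  have hpl : om v w ^ q • (t ^ (2 * (e + q)) • x - om v w ^ e • (a • fr q v - b • fr q w)) = 0 := by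
    have := omfr v w
    simp only [om, fr] at this ha hb
    ext
    · simp only [om, fr, Prod.smul_fst, Prod.smul_snd, smul_eq_mul, Prod.fst_sub, Prod.fst_zero]
      linear_combination (-(t ^ (2 * (e + q)) * x.1)) * this + v.1 ^ q * ha - w.1 ^ q * hb
    · simp only [om, fr, Prod.smul_fst, Prod.smul_snd, smul_eq_mul, Prod.snd_sub, Prod.snd_zero]
      linear_combination (-(t ^ (2 * (e + q)) * x.2)) * this + v.2 ^ q * ha - w.2 ^ q * hb
  have e1 := h.nzd hs hs' q (congrArg Prod.fst hpl)
  have e2 := h.nzd hs hs' q (congrArg Prod.snd hpl)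
  simp only [Prod.smul_fst, Prod.smul_snd, smul_eq_mul, Prod.fst_sub, Prod.snd_sub] at e1 e2
  ext
  · simp only [Prod.smul_fst, smul_eq_mul, Prod.fst_add, pow_add]
    linear_combination e1
  · simp only [Prod.smul_snd, smul_eq_mul, Prod.snd_add, pow_add]
    linear_combination e2

end
end FpLci
end

section
universe u
namespace FpLci
open TensorProduct

section
variable {B : Type u} [CommRing B]

theorem fr_smul (Q : ℕ) (b : B) (x : B × B) : fr Q (b • x) = b ^ Q • fr Q x := by
  ext <;> simp [fr, mul_pow]

theorem fr_fr (Q q : ℕ) (x : B × B) : fr Q (fr q x) = fr (q * Q) x := by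
  ext <;> simp [fr, pow_mul]

theorem fr_add (p : ℕ) [Fact p.Prime] [CharP B p] (m : ℕ) (x y : B × B) :
    fr (p ^ m) (x + y) = fr (p ^ m) x + fr (p ^ m) y := by
  ext <;> simp [fr, add_pow_char_pow]

theorem good_frobS (p : ℕ) [Fact p.Prime] [CharP B p] {L X : Submodule B (B × B)} {e q : ℕ}
    (h : GoodX L X e q) (m : ℕ) : GoodX L (frobS (p ^ m) X) (e * p ^ m) (q * p ^ m) := by
  refine ⟨fun v hv w hw => ?_, fun t v w hg => ?_⟩
  · obtain ⟨h1, h2⟩ := h.1 v hv w hw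
    have k1 := fr_mem (p ^ m) h1
    have k2 := fr_mem (p ^ m) h2
    rw [fr_smul, fr_fr, ← pow_mul] at k1 k2
    exact ⟨k1, k2⟩
  · obtain ⟨N, hN⟩ := h.2 t v w hg
    refine ⟨N * p ^ m, fun x hx => ?_⟩
    induction hx using Submodule.span_induction with
    | mem x hx =>
      obtain ⟨y, hy, rfl⟩ := hx
      obtain ⟨a, b, hab⟩ := hN y hy
      refine ⟨a ^ p ^ m, b ^ p ^ m, ?_⟩
      have := congrArg (fr (p ^ m)) hab
      rwa [fr_smul, fr_smul, fr_add, fr_smul, fr_smul, fr_fr, fr_fr, ← pow_mul, ← pow_mul] at this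
    | zero => exact ⟨0, 0, by simp⟩
    | add x y _ _ hx hy =>
      obtain ⟨a, b, hab⟩ := hx
      obtain ⟨a', b', hab'⟩ := hy
      refine ⟨a + a', b + b', ?_⟩
      rw [smul_add, hab, hab', ← smul_add, add_smul, add_smul]
      abel_nf
    | smul r x _ hx =>
      obtain ⟨a, b, hab⟩ := hx
      refine ⟨r * a, r * b, ?_⟩
      rw [smul_comm, hab, smul_comm, mul_smul, mul_smul, smul_add]

theorem good_locFree (p : ℕ) [Fact p.Prime] [CharP B p] {L : Submodule B (B × B)}
    (hL : ∀ p : Ideal B, p.IsPrime → ∃ t ∉ p, ∃ v w, LocGen L t v w)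
    {s : B} (hs : s ∈ cI L) (hs' : s ∈ nonZeroDivisors B) {X : Submodule B (B × B)} {e i : ℕ}
    (h : GoodX L X e (p ^ i)) : LocFree B X 2 := by
  apply locFree_of_approx
  intro P hP
  obtain ⟨t, ht, v, w, hg⟩ := hL P hP
  obtain ⟨N, hN⟩ := h.2 t v w hg
  obtain ⟨g1, g2⟩ := h.1 v hg.1 w hg.2.1
  let q := p ^ i
  refine ⟨t ^ (N + 2 * (e + q)), fun hm => ht (hP.mem_of_pow_mem _ hm),
    (LinearMap.toSpanSingleton B X ⟨_, g1⟩) ∘ₗ LinearMap.proj 0 +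
    (LinearMap.toSpanSingleton B X ⟨_, g2⟩) ∘ₗ LinearMap.proj 1, ?_, ?_⟩
  · intro x
    obtain ⟨a, b, hab⟩ := hN x.1 x.2
    refine ⟨fun j => if j = 0 then t ^ (2 * (e + q)) * a else t ^ (2 * (e + q)) * b,
      Subtype.ext ?_⟩
    rw [pow_add, mul_comm (t ^ N), mul_smul, Submodule.coe_smul, Submodule.coe_smul, hab]
    ext <;> simp <;> ring
  · intro y hy
    have h1 : y 0 • om v w ^ e • fr q v + y 1 • om v w ^ e • fr q w = 0 := by
      have := congrArg Subtype.val hy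
      simpa using this
    have hom := om_fr p i v w
    have k0 : om v w ^ (e + q) * y 0 = 0 := by
      have e1 := congrArg Prod.fst h1
      have e2 := congrArg Prod.snd h1
      simp only [fr, Prod.fst_add, Prod.snd_add, Prod.smul_fst, Prod.smul_snd, smul_eq_mul,
        Prod.fst_zero, Prod.snd_zero] at e1 e2
      rw [pow_add, ← hom]
      have hom' : om (fr (p ^ i) v) (fr (p ^ i) w) = v.1 ^ q * w.2 ^ q - v.2 ^ q * w.1 ^ q := rfl
      rw [hom']
      linear_combination w.2 ^ q * e1 - w.1 ^ q * e2
    have k1 : om v w ^ (e + q) * y 1 = 0 := by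
      have e1 := congrArg Prod.fst h1
      have e2 := congrArg Prod.snd h1
      simp only [fr, Prod.fst_add, Prod.snd_add, Prod.smul_fst, Prod.smul_snd, smul_eq_mul,
        Prod.fst_zero, Prod.snd_zero] at e1 e2
      rw [pow_add, ← hom]
      have hom' : om (fr (p ^ i) v) (fr (p ^ i) w) = v.1 ^ q * w.2 ^ q - v.2 ^ q * w.1 ^ q := rfl
      rw [hom']
      linear_combination v.1 ^ q * e2 - v.2 ^ q * e1
    have l0 := hg.nzd hs hs' _ k0
    have l1 := hg.nzd hs hs' _ k1
    funext j
    fin_cases j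
    · change t ^ (N + 2 * (e + q)) * y 0 = 0
      rw [pow_add, mul_assoc, l0, mul_zero]
    · change t ^ (N + 2 * (e + q)) * y 1 = 0
      rw [pow_add, mul_assoc, l1, mul_zero]

theorem F8_main [IsNoetherianRing B] {k : Type*} [Field k] [IsAlgClosed k] (p : ℕ) [hp : Fact p.Prime]
    [CharP k p] [CharP B p] [Algebra (ZMod p) k]
    [Algebra.IsAlgebraic (ZMod p) k] [Algebra k B] [Algebra (ZMod p) B]
    [IsScalarTower (ZMod p) k B] [Algebra.FiniteType k B]
    (hd : DimLt (⊥ : Ideal B) 3) {L : Submodule B (B × B)}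
    (hL : ∀ p : Ideal B, p.IsPrime → ∃ t ∉ p, ∃ v w, LocGen L t v w)
    {s : B} (hs : s ∈ cI L) (hs' : s ∈ nonZeroDivisors B) {v0 w0 : B × B} (hv0 : v0 ∈ L)
    (hw0 : w0 ∈ L) (h1 : v0.1 + w0.2 = 1) :
    ∃ (X X' : Submodule B (B × B)) (e e' i m : ℕ), Nonempty (X' ≃ₗ[B] X) ∧
      GoodX L X e (p ^ i) ∧ GoodX L X' e' (p ^ (i + m)) ∧ 0 < m ∧
      2 * e + p ^ i = 2 * e' + p ^ (i + m) := by
  have := cI_inv hL hs hs'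
  have hdc : DimLt (⊥ : Ideal (B ⧸ cI L)) 2 :=
    ((DimLt.drop_nzd hd hs').anti ((Ideal.span_singleton_le_iff_mem _).2 hs)).quot
  obtain ⟨H, hH, hA, hE2, hE1, hr⟩ := exists_H (k := k) p (cI L) hdc v0 w0
  let K := p ^ (Nat.card H + 1)
  have hp2 := hp.out.two_le
  have tr : ∀ i, (fr (p ^ i) v0).1 + (fr (p ^ i) w0).2 = 1 := fun i => by
    simp only [fr]; rw [← add_pow_char_pow, h1, one_pow]
  have hom : ∀ i, om (fr (p ^ i) v0) (fr (p ^ i) w0) ∈ cI L ^ (p ^ i) := fun i => by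
    rw [om_fr]; exact Ideal.pow_mem_pow (om_mem_cI hv0 hw0) _
  have hom0 : ∀ i, om (fr (p ^ i) v0) (fr (p ^ i) w0) ∈ cI L := fun i =>
    Ideal.pow_le_self (pow_ne_zero _ hp.out.ne_zero) (hom i)
  let T : ℕ → ℕ → Submodule B (B × B) := fun i a =>
    TT (cI L) (fr (p ^ i) v0) (fr (p ^ i) w0) a (a + p ^ i)
  have hch : ∀ i a, ∃ δ ∈ H, Inv (cI L) (T i a) (2 * a + p ^ i) δ := fun i a =>
    chain_main (cI L) hdc H hA _ _ (tr i) (hom0 i) (hom i) (hr _ _ _) a (2 * a)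
      (chain_base (cI L) hdc H hA hE2 hE1 a) (p ^ i) le_rfl
  let ee : ℕ → ℕ := fun i => K - p ^ i / 2
  choose δ hδ hδ' using fun i => hch i (ee i)
  let F : Fin (Nat.card H + 1) → H := fun i => ⟨δ (i + 1), hδ _⟩
  have hninj : ¬ Function.Injective F := by
    intro hF
    have := Nat.card_le_card_of_injective F hF
    simp at this
  obtain ⟨i, j, hij, hne, hlt⟩ : ∃ i j, F i = F j ∧ i ≠ j ∧ i < j := by
    simp only [Function.Injective, not_forall] at hninj
    obtain ⟨i, j, h, hne⟩ := hninj
    rcases lt_or_gt_of_ne hne with h' | h'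
    · exact ⟨i, j, h, hne, h'⟩
    · exact ⟨j, i, h.symm, Ne.symm hne, h'⟩
  have hN : ∀ i : Fin (Nat.card H + 1), 2 * ee (i + 1) + p ^ (i.1 + 1) = 2 * K + p % 2 := by
    intro i
    have hle : p ^ (i.1 + 1) ≤ K := Nat.pow_le_pow_right (by omega) (by omega)
    have hmod : p ^ (i.1 + 1) % 2 = p % 2 := by
      rcases Nat.mod_two_eq_zero_or_one p with h | h
      · rw [h, Nat.pow_mod, h]; simp
      · rw [h, Nat.pow_mod, h]; simp
    simp only [ee]
    omega
  have hst : StabEq B (T (i + 1) (ee (i + 1))) (T (j + 1) (ee (j + 1))) := by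
    have k1 := hδ' (i + 1)
    have k2 := hδ' (j + 1)
    rw [hN] at k1 k2
    have : δ (i + 1) = δ (j + 1) := congrArg Subtype.val hij
    rw [this] at k1
    exact k1.stab k2 inferInstance
  have g1 := good_TT p hs hs' hv0 hw0 h1 (i.1 + 1) (ee (i + 1))
  have g2 := good_TT p hs hs' hv0 hw0 h1 (j.1 + 1) (ee (j + 1))
  have l1 := good_locFree p hL hs hs' g1
  have l2 := good_locFree p hL hs hs' g2
  obtain ⟨e⟩ := stab_cancel l2 l1 hd hst.symm
  have hsm : ∀ i a M : ℕ, a + p ^ i ≤ M → ∀ z, s ^ M • z ∈ T i a := fun i a M hM z => by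
    have k : ∀ x : B, s ^ M * x ∈ cI L ^ (a + p ^ i) := fun x =>
      Ideal.mul_mem_right _ _ (Ideal.pow_le_pow_right hM (Ideal.pow_mem_pow hs M))
    have hle : cI L ^ (a + p ^ i) ≤ cI L ^ a := Ideal.pow_le_pow_right (by omega)
    have k1 : (s ^ M • z).1 ∈ cI L ^ (a + p ^ i) := k _
    have k2 : (s ^ M • z).2 ∈ cI L ^ (a + p ^ i) := k _
    exact ⟨⟨hle k1, hle k2⟩, (om_mem_left _ k1 k2 _).1, (om_mem_left _ k1 k2 _).2⟩
  let M := (ee (i + 1) + p ^ (i.1 + 1)) + (ee (j + 1) + p ^ (j.1 + 1))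
  obtain ⟨m, ⟨E⟩⟩ := cancel_main (k := k) p (T (i + 1) (ee (i + 1))) (T (j + 1) (ee (j + 1)))
    (s ^ M) (pow_mem hs' _) (hsm _ _ _ (by omega)) (hsm _ _ _ (by omega)) l1 hd e
  have G1 := good_frobS p g1 m
  have G2 := good_frobS p g2 m
  rw [← pow_add] at G1 G2
  have hij' : i.1 < j.1 := hlt
  have hjm : i.1 + 1 + m + (j.1 - i.1) = j.1 + 1 + m := by omega
  refine ⟨_, _, _, ee (j + 1) * p ^ m, i.1 + 1 + m, j.1 - i.1, ⟨E⟩, G1, ?_, by omega, ?_⟩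
  · rw [hjm]; exact G2
  · rw [hjm, pow_add p (i.1 + 1) m, pow_add p (j.1 + 1) m]
    calc _ = (2 * ee (i + 1) + p ^ (i.1 + 1)) * p ^ m := by ring
      _ = (2 * ee (j + 1) + p ^ (j.1 + 1)) * p ^ m := by rw [hN, hN]
      _ = _ := by ring

end
end FpLci
end

section
universe u
namespace FpLci
section
variable {R : Type*} [CommRing R]

/-- the geometric sum `∑ a^i b^(n-1-i)` -/
def gs : ℕ → R → R → R
  | 0, _, _ => 0
  | n + 1, a, b => a * gs n a b + b ^ n

theorem gs_succ' (n : ℕ) (a b : R) : gs (n + 1) a b = a ^ n + b * gs n a b := by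
  induction n with
  | zero => simp [gs]
  | succ n ih =>
    have h1 : gs (n + 1 + 1) a b = a * gs (n + 1) a b + b ^ (n + 1) := rfl
    have h2 : gs (n + 1) a b = a * gs n a b + b ^ n := rfl
    rw [h1]
    linear_combination a * ih - b * h2

theorem gs_mul (n : ℕ) (a b : R) : (a - b) * gs n a b = a ^ n - b ^ n := by
  have h := gs_succ' n a b
  rw [gs] at h
  linear_combination h

theorem gs_self (n : ℕ) (a : R) : gs (n + 1) a a = (n + 1 : ℕ) * a ^ n := by
  induction n with
  | zero => simp [gs]
  | succ n ih => rw [gs, ih]; push_cast; ring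

theorem gs_char [IsDomain R] (p : ℕ) [hp : Fact p.Prime] [CharP R p] {m n : ℕ} (hm : 0 < m)
    (hn : n + 1 = p ^ m) (a b : R) : gs (n + 1) a b = (a - b) ^ n := by
  by_cases h : a - b = 0
  · have hab : b = a := (sub_eq_zero.1 h).symm
    have hn0 : n ≠ 0 := by
      rintro rfl
      have := Nat.one_lt_pow hm.ne' hp.out.one_lt
      omega
    rw [h, zero_pow hn0, hab, gs_self, hn]
    have : ((p ^ m : ℕ) : R) = 0 := by
      push_cast
      rw [CharP.cast_eq_zero R p, zero_pow hm.ne']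
    rw [this, zero_mul]
  · apply mul_left_cancel₀ h
    rw [gs_mul, ← pow_succ', hn, sub_pow_char_pow]

/-- the first form -/
def Lq (q : ℕ) (x y α β γ δ : R) : R := x * (γ * x ^ q + δ * y ^ q) - y * (α * x ^ q + β * y ^ q)

/-- the second form, `n = q - 1`. -/
def Dq (n : ℕ) (x y α β γ δ : R) : R :=
  α * (α * x ^ (n + 1) + β * y ^ (n + 1)) ^ n + δ * (γ * x ^ (n + 1) + δ * y ^ (n + 1)) ^ n +
    (α * δ - β * γ) * (x * y) * gs n (x * (γ * x ^ (n + 1) + δ * y ^ (n + 1)))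
      (y * (α * x ^ (n + 1) + β * y ^ (n + 1)))

theorem Dq_x [IsDomain R] (p : ℕ) [hp : Fact p.Prime] [CharP R p] {m n : ℕ} (hm : 0 < m)
    (hn : n + 1 = p ^ m) (x y α β γ δ : R) :
    Dq n x y α β γ δ * x ^ (n + 1) = (α * x ^ (n + 1) + β * y ^ (n + 1)) ^ (n + 1) +
      Lq (n + 1) x y α β γ δ ^ n * (δ * x - β * y) := by
  have h1 := gs_char p hm hn (x * (γ * x ^ (n + 1) + δ * y ^ (n + 1)))
      (y * (α * x ^ (n + 1) + β * y ^ (n + 1)))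
  have h2 := gs_succ' n (x * (γ * x ^ (n + 1) + δ * y ^ (n + 1)))
      (y * (α * x ^ (n + 1) + β * y ^ (n + 1)))
  have h3 := h1
  rw [gs] at h1
  rw [h2] at h3
  change _ = Lq (n + 1) x y α β γ δ ^ n at h1 h3
  rw [mul_pow] at h1 h3
  rw [Dq]
  linear_combination δ * x * h3 - β * y * h1

theorem Dq_y [IsDomain R] (p : ℕ) [hp : Fact p.Prime] [CharP R p] {m n : ℕ} (hm : 0 < m)
    (hn : n + 1 = p ^ m) (x y α β γ δ : R) :
    Dq n x y α β γ δ * y ^ (n + 1) = (γ * x ^ (n + 1) + δ * y ^ (n + 1)) ^ (n + 1) +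
      Lq (n + 1) x y α β γ δ ^ n * (α * y - γ * x) := by
  have h1 := gs_char p hm hn (x * (γ * x ^ (n + 1) + δ * y ^ (n + 1)))
      (y * (α * x ^ (n + 1) + β * y ^ (n + 1)))
  have h2 := gs_succ' n (x * (γ * x ^ (n + 1) + δ * y ^ (n + 1)))
      (y * (α * x ^ (n + 1) + β * y ^ (n + 1)))
  have h3 := h1
  rw [gs] at h1
  rw [h2] at h3
  change _ = Lq (n + 1) x y α β γ δ ^ n at h1 h3
  rw [mul_pow] at h1 h3
  rw [Dq]
  linear_combination α * y * h1 - γ * x * h3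

/-- if both forms vanish, everything vanishes. -/
theorem LD_zero [IsDomain R] (p : ℕ) [hp : Fact p.Prime] [CharP R p] {m n : ℕ} (hm : 0 < m)
    (hn : n + 1 = p ^ m) {x y α β γ δ : R} (hL : Lq (n + 1) x y α β γ δ = 0)
    (hD : Dq n x y α β γ δ = 0) :
    α * x ^ (n + 1) + β * y ^ (n + 1) = 0 ∧ γ * x ^ (n + 1) + δ * y ^ (n + 1) = 0 := by
  have hn0 : n ≠ 0 := by
    rintro rfl
    have := Nat.one_lt_pow hm.ne' hp.out.one_lt
    omega
  have h1 := Dq_x p hm hn x y α β γ δ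
  have h2 := Dq_y p hm hn x y α β γ δ
  rw [hL, hD, zero_pow hn0, zero_mul, zero_mul, add_zero] at h1 h2
  exact ⟨pow_eq_zero_iff (by omega) |>.1 h1.symm, pow_eq_zero_iff (by omega) |>.1 h2.symm⟩

/-- Covariance. `(x', y') = (x, y) S`, `S = [[a, a'], [b, b']]`, `T S = κ S^(q) G`,
`T = [[α, γ], [β, δ]]`, `G = [[A, A'],[C, C']]`. -/
theorem L_cov {q : ℕ} {x y a b a' b' α β γ δ A C A' C' κ : R}
    (hx : (a * x + b * y) ^ q = a ^ q * x ^ q + b ^ q * y ^ q)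
    (hy : (a' * x + b' * y) ^ q = a' ^ q * x ^ q + b' ^ q * y ^ q)
    (h1 : α * a + γ * b = κ * (a ^ q * A + a' ^ q * C))
    (h2 : β * a + δ * b = κ * (b ^ q * A + b' ^ q * C))
    (h3 : α * a' + γ * b' = κ * (a ^ q * A' + a' ^ q * C'))
    (h4 : β * a' + δ * b' = κ * (b ^ q * A' + b' ^ q * C')) :
    (a * b' - b * a') * Lq q x y α β γ δ =
      κ * Lq q (a * x + b * y) (a' * x + b' * y) A C A' C' := by
  simp only [Lq]
  rw [hx, hy]
  linear_combination (a * x + b * y) * (x ^ q * h3 + y ^ q * h4) -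
    (a' * x + b' * y) * (x ^ q * h1 + y ^ q * h2)

theorem D_cov [IsDomain R] (p : ℕ) [hp : Fact p.Prime] [CharP R p] {m n : ℕ} (hm : 0 < m)
    (hn : n + 1 = p ^ m) {x y a b a' b' α β γ δ A C A' C' κ : R}
    (h1 : α * a + γ * b = κ * (a ^ (n + 1) * A + a' ^ (n + 1) * C))
    (h2 : β * a + δ * b = κ * (b ^ (n + 1) * A + b' ^ (n + 1) * C))
    (h3 : α * a' + γ * b' = κ * (a ^ (n + 1) * A' + a' ^ (n + 1) * C'))
    (h4 : β * a' + δ * b' = κ * (b ^ (n + 1) * A' + b' ^ (n + 1) * C'))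
    (hd : a * b' - b * a' ≠ 0) (hx0 : a * x + b * y ≠ 0) :
    Dq n x y α β γ δ =
      κ ^ (n + 1) * Dq n (a * x + b * y) (a' * x + b' * y) A C A' C' := by
  have fz : ∀ z z' : R, (z + z') ^ (n + 1) = z ^ (n + 1) + z' ^ (n + 1) := fun z z' => by
    rw [hn, add_pow_char_pow]
  have hx : (a * x + b * y) ^ (n + 1) = a ^ (n + 1) * x ^ (n + 1) + b ^ (n + 1) * y ^ (n + 1) := by
    rw [fz, mul_pow, mul_pow]
  have hy : (a' * x + b' * y) ^ (n + 1) =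
      a' ^ (n + 1) * x ^ (n + 1) + b' ^ (n + 1) * y ^ (n + 1) := by
    rw [fz, mul_pow, mul_pow]
  have hLc := L_cov hx hy h1 h2 h3 h4
  have e1 := Dq_x p hm hn x y α β γ δ
  have e2 := Dq_y p hm hn x y α β γ δ
  have e3 := Dq_x p hm hn (a * x + b * y) (a' * x + b' * y) A C A' C'
  have hdq : (a * b' - b * a') ^ (n + 1) =
      a ^ (n + 1) * b' ^ (n + 1) - b ^ (n + 1) * a' ^ (n + 1) := by
    rw [hn, sub_pow_char_pow, mul_pow, mul_pow]
  -- the value of `T` on the first column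
  have hv : (a * (α * x ^ (n + 1) + β * y ^ (n + 1)) + b * (γ * x ^ (n + 1) + δ * y ^ (n + 1))) =
      κ * (A * (a * x + b * y) ^ (n + 1) + C * (a' * x + b' * y) ^ (n + 1)) := by
    rw [hx, hy]
    linear_combination x ^ (n + 1) * h1 + y ^ (n + 1) * h2
  have hvq := congrArg (· ^ (n + 1)) hv
  beta_reduce at hvq
  rw [fz, mul_pow, mul_pow, mul_pow κ] at hvq
  -- adjugate
  have hadj : (a * b' - b * a') * (a ^ (n + 1) * (δ * x - β * y) + b ^ (n + 1) * (α * y - γ * x)) =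
      κ * (a * b' - b * a') ^ (n + 1) * (C' * (a * x + b * y) - C * (a' * x + b' * y)) := by
    rw [hdq]
    linear_combination (-(a ^ (n + 1)) * (a' * x + b' * y)) * h2 +
      (a ^ (n + 1)) * (a * x + b * y) * h4 + b ^ (n + 1) * (a' * x + b' * y) * h1
      - b ^ (n + 1) * (a * x + b * y) * h3
  apply mul_right_cancel₀ (pow_ne_zero (n + 1) hx0)
  apply mul_left_cancel₀ (pow_ne_zero (n + 1) hd)
  rw [mul_assoc (κ ^ (n + 1)), e3]
  have hLn := congrArg (· ^ n) hLc
  simp only [mul_pow] at hLn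
  rw [hx, mul_add, mul_left_comm _ (a ^ (n + 1)), mul_left_comm _ (b ^ (n + 1)), e1, e2]
  have E : (a * b' - b * a') ^ (n + 1) * (Lq (n + 1) x y α β γ δ ^ n *
      (a ^ (n + 1) * (δ * x - β * y) + b ^ (n + 1) * (α * y - γ * x))) =
      κ ^ n * Lq (n + 1) (a * x + b * y) (a' * x + b' * y) A C A' C' ^ n *
      (κ * (a * b' - b * a') ^ (n + 1) * (C' * (a * x + b * y) - C * (a' * x + b' * y))) := by
    rw [← hadj, ← hLn]; ring
  rw [← hx] 
  linear_combination (a * b' - b * a') ^ (n + 1) * hvq + E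

end
end FpLci
end

section
universe u
namespace FpLci
open TensorProduct
section
variable {B : Type u} [CommRing B]

theorem exists_gen_mod (c : Ideal B) [Module.Invertible B c] (l : ℕ)
    (h : (CommRing.Pic.mapAlgebra B (B ⧸ c) (CommRing.Pic.mk B c)) ^ l = 1) :
    ∃ y ∈ c ^ l, c ^ l ≤ Ideal.span {y} ⊔ c ^ (l + 1) := by
  have := pow_inv c l
  rw [← map_pow, ← pow_mk, CommRing.Pic.mapAlgebra_apply] at h
  have e0 : (B ⧸ c) ⊗[B] (CommRing.Pic.mk B ↥(c ^ l)) ≃ₗ[B ⧸ c] (B ⧸ c) ⊗[B] ↥(c ^ l) :=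
    (CommRing.Pic.mk.linearEquiv B ↥(c ^ l)).baseChange B (B ⧸ c) _ _
  obtain ⟨e1⟩ := CommRing.Pic.mk_eq_one_iff.1 h
  have e := e0.symm.trans e1
  obtain ⟨y, hy⟩ : ∃ y : ↥(c ^ l), (1 : B ⧸ c) ⊗ₜ[B] y = e.symm 1 := by
    generalize e.symm 1 = m
    induction m using TensorProduct.induction_on with
    | zero => exact ⟨0, by simp⟩
    | tmul a z =>
      obtain ⟨b, rfl⟩ := Ideal.Quotient.mk_surjective a
      refine ⟨b • z, ?_⟩
      rw [← TensorProduct.smul_tmul]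
      congr 1
      rw [Algebra.smul_def, mul_one]; rfl
    | add a b ha hb =>
      obtain ⟨y, hy⟩ := ha
      obtain ⟨z, hz⟩ := hb
      exact ⟨y + z, by rw [TensorProduct.tmul_add, hy, hz]⟩
  refine ⟨y, y.2, fun z hz => ?_⟩
  obtain ⟨b, hb⟩ := Ideal.Quotient.mk_surjective (e ((1 : B ⧸ c) ⊗ₜ[B] ⟨z, hz⟩))
  have h1 : (1 : B ⧸ c) ⊗ₜ[B] (⟨z, hz⟩ : ↥(c ^ l)) = (1 : B ⧸ c) ⊗ₜ[B] (b • y) := by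
    apply e.injective
    rw [← hb, TensorProduct.tmul_smul, hy]
    have : b • e.symm 1 = (Ideal.Quotient.mk c b) • e.symm 1 := by
      rw [← algebraMap_smul (B ⧸ c) b]; rfl
    rw [this, map_smul, e.apply_symm_apply, smul_eq_mul, mul_one]
  have h2 := mem_pow_of_tmul_eq_zero c l (⟨z, hz⟩ - b • y) (by
    rw [TensorProduct.tmul_sub, h1, sub_self])
  have h3 : z = b * y.1 + (z - b * y.1) := by ring
  rw [h3]
  exact Submodule.add_mem_sup (Ideal.mul_mem_left _ _ (Ideal.subset_span rfl)) h2

theorem two_gen_of_gen [IsNoetherianRing B] (c : Ideal B) (l : ℕ) {y : B} (hy : y ∈ c ^ l)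
    (h : c ^ l ≤ Ideal.span {y} ⊔ c ^ (l + 1)) : ∃ x ∈ c ^ l, c ^ l = Ideal.span {x, y} := by
  obtain ⟨r, hr, hr'⟩ := Submodule.exists_sub_one_mem_and_smul_eq_zero_of_fg_of_le_smul c
    (Submodule.map (Submodule.mkQ (Ideal.span {y})) (c ^ l)) ((IsNoetherian.noetherian _).map _) (by
      rw [← Submodule.map_smul'']
      rintro _ ⟨z, hz, rfl⟩
      obtain ⟨a, ha, b, hb, rfl⟩ := Submodule.mem_sup.1 (h hz)
      refine ⟨b, by rw [pow_succ'] at hb; exact hb, ?_⟩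
      have h0 : (Submodule.mkQ (Ideal.span {y})) a = 0 :=
        (Submodule.Quotient.mk_eq_zero (Ideal.span {y})).2 ha
      rw [map_add, h0, zero_add])
  have hr2 : ∀ z ∈ c ^ l, r * z ∈ Ideal.span {y} := fun z hz => by
    have := hr' _ ⟨z, hz, rfl⟩
    rw [← map_smul] at this
    exact (Submodule.Quotient.mk_eq_zero _).1 this
  refine ⟨(1 - r) ^ l, Ideal.pow_mem_pow (by rw [← neg_mem_iff]; simpa using hr) _, ?_⟩
  apply le_antisymm
  · intro z hz
    have hd : r ∣ 1 - (1 - r) ^ l := by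
      have := sub_dvd_pow_sub_pow (1 : B) (1 - r) l
      rwa [one_pow, sub_sub_cancel] at this
    obtain ⟨w, hw⟩ := hd
    have : z = z * (1 - r) ^ l + w * (r * z) := by
      rw [← mul_assoc, mul_comm w, ← hw]; ring
    rw [this]
    refine Ideal.add_mem _ (Ideal.mul_mem_left _ _ (Ideal.subset_span (by simp)))
      (Ideal.mul_mem_left _ _ ?_)
    exact Ideal.span_mono (by simp) (hr2 z hz)
  · rw [Ideal.span_le]
    rintro _ (rfl | rfl)
    · exact Ideal.pow_mem_pow (by rw [← neg_mem_iff]; simpa using hr) _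
    · exact hy

theorem two_gen [IsNoetherianRing B] {k : Type*} [Field k] (p : ℕ) [Fact p.Prime]
    [Algebra (ZMod p) k]
    [Algebra.IsAlgebraic (ZMod p) k] [Algebra k B] [Algebra (ZMod p) B]
    [IsScalarTower (ZMod p) k B] [Algebra.FiniteType k B]
    (c : Ideal B) [Module.Invertible B c] (hd : DimLt (⊥ : Ideal (B ⧸ c)) 2) :
    ∃ N, 0 < N ∧ ∀ j, ∃ x y : B, c ^ (N * j) = Ideal.span {x, y} := by
  obtain ⟨H, hH, hA, -⟩ := exists_H (k := k) p c hd 0 0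
  refine ⟨Nat.card H, Nat.card_pos, fun j => ?_⟩
  have h : (CommRing.Pic.mapAlgebra B (B ⧸ c) (CommRing.Pic.mk B c)) ^ (Nat.card H * j) = 1 := by
    rw [pow_mul]
    have := congrArg Subtype.val (pow_card_eq_one' (x := (⟨_, hA⟩ : H)))
    rw [Subgroup.coe_pow, Subgroup.coe_one] at this
    rw [this, one_pow]
  obtain ⟨y, hy, h'⟩ := exists_gen_mod c _ h
  obtain ⟨x, -, hx⟩ := two_gen_of_gen c _ hy h'
  exact ⟨x, y, hx⟩

/-- elements of the inverse ideal -/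
theorem exists_mu (c : Ideal B) [Module.Invertible B c] (l : ℕ) {x y : B}
    (h : c ^ l = Ideal.span {x, y}) : ∃ μ1 μ2 : ↥(c ^ l) →ₗ[B] B,
      ∀ z, μ1 z * x + μ2 z * y = z.1 := by
  have := pow_inv c l
  have hx : x ∈ c ^ l := h ▸ Ideal.subset_span (by simp)
  have hy : y ∈ c ^ l := h ▸ Ideal.subset_span (by simp)
  let f : (B × B) →ₗ[B] ↥(c ^ l) := (LinearMap.toSpanSingleton B _ ⟨x, hx⟩).coprod
    (LinearMap.toSpanSingleton B _ ⟨y, hy⟩)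
  have hf : Function.Surjective f := by
    rintro ⟨z, hz⟩
    have hz' := hz
    rw [h] at hz'
    obtain ⟨a, b, hab⟩ := Ideal.mem_span_pair.1 hz'
    refine ⟨(a, b), Subtype.ext ?_⟩
    simpa [f] using hab
  obtain ⟨g, hg⟩ := Module.projective_lifting_property f LinearMap.id hf
  refine ⟨LinearMap.fst B B B ∘ₗ g, LinearMap.snd B B B ∘ₗ g, fun z => ?_⟩
  have := congrArg Subtype.val (LinearMap.congr_fun hg z)
  simpa [f] using this

end
end FpLci
end

section
universe u
namespace FpLci
open MvPolynomial
section
variable {R : Type*} [CommRing R]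

theorem gs_scale (n : ℕ) (l a b : R) : l * gs n (l * a) (l * b) = l ^ n * gs n a b := by
  induction n with
  | zero => simp [gs]
  | succ n ih =>
    have h1 : gs (n + 1) (l * a) (l * b) = (l * a) * gs n (l * a) (l * b) + (l * b) ^ n := rfl
    have h2 : gs (n + 1) a b = a * gs n a b + b ^ n := rfl
    rw [h1, h2, mul_pow]
    linear_combination l * a * ih

theorem Lq_scale (q : ℕ) (l x y α β γ δ : R) :
    Lq q x y (l * α) (l * β) (l * γ) (l * δ) = l * Lq q x y α β γ δ := by
  simp only [Lq]; ring

theorem Dq_scale (n : ℕ) (l x y α β γ δ : R) :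
    Dq n x y (l * α) (l * β) (l * γ) (l * δ) = l ^ (n + 1) * Dq n x y α β γ δ := by
  simp only [Dq]
  have h1 : x * (l * γ * x ^ (n + 1) + l * δ * y ^ (n + 1)) =
    l * (x * (γ * x ^ (n + 1) + δ * y ^ (n + 1))) := by ring
  have h2 : y * (l * α * x ^ (n + 1) + l * β * y ^ (n + 1)) =
    l * (y * (α * x ^ (n + 1) + β * y ^ (n + 1))) := by ring
  have h3 : l * α * x ^ (n + 1) + l * β * y ^ (n + 1) =
    l * (α * x ^ (n + 1) + β * y ^ (n + 1)) := by ring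
  have h4 : l * γ * x ^ (n + 1) + l * δ * y ^ (n + 1) =
    l * (γ * x ^ (n + 1) + δ * y ^ (n + 1)) := by ring
  have h5 := gs_scale n l (x * (γ * x ^ (n + 1) + δ * y ^ (n + 1)))
    (y * (α * x ^ (n + 1) + β * y ^ (n + 1)))
  rw [h1, h2, h3, h4, mul_pow l, mul_pow l]
  linear_combination l * (α * δ - β * γ) * (x * y) * h5

theorem map_gs {R' : Type*} [CommRing R'] (ψ : R →+* R') (n : ℕ) (a b : R) :
    ψ (gs n a b) = gs n (ψ a) (ψ b) := by
  induction n with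
  | zero => simp [gs]
  | succ n ih => simp [gs, ih]

theorem map_Lq {R' : Type*} [CommRing R'] (ψ : R →+* R') (q : ℕ) (x y α β γ δ : R) :
    ψ (Lq q x y α β γ δ) = Lq q (ψ x) (ψ y) (ψ α) (ψ β) (ψ γ) (ψ δ) := by
  simp [Lq]

theorem map_Dq {R' : Type*} [CommRing R'] (ψ : R →+* R') (q : ℕ) (x y α β γ δ : R) :
    ψ (Dq q x y α β γ δ) = Dq q (ψ x) (ψ y) (ψ α) (ψ β) (ψ γ) (ψ δ) := by
  simp [Dq, map_gs]

theorem loc_LD [IsDomain R] (p : ℕ) [hp : Fact p.Prime] [CharP R p] {m n i e' f : ℕ} (hm : 0 < m)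
    (hn : n + 1 = p ^ m) {X1 X2 v1 v2 w1 w2 α β γ δ A C A' C' T c : R}
    (hc : c = v1 * w2 - v2 * w1) (hc0 : c ≠ 0) (hV : v1 * X1 + v2 * X2 ≠ 0)
    (h1 : T * c ^ (e' + f) * (α * v1 ^ p ^ i + γ * v2 ^ p ^ i) =
      c ^ e' * (A * v1 ^ p ^ (i + m) + C * w1 ^ p ^ (i + m)))
    (h2 : T * c ^ (e' + f) * (β * v1 ^ p ^ i + δ * v2 ^ p ^ i) =
      c ^ e' * (A * v2 ^ p ^ (i + m) + C * w2 ^ p ^ (i + m)))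
    (h3 : T * c ^ (e' + f) * (α * w1 ^ p ^ i + γ * w2 ^ p ^ i) =
      c ^ e' * (A' * v1 ^ p ^ (i + m) + C' * w1 ^ p ^ (i + m)))
    (h4 : T * c ^ (e' + f) * (β * w1 ^ p ^ i + δ * w2 ^ p ^ i) =
      c ^ e' * (A' * v2 ^ p ^ (i + m) + C' * w2 ^ p ^ (i + m))) :
    T * c ^ (f + p ^ i) * Lq (n + 1) (X1 ^ p ^ i) (X2 ^ p ^ i) α β γ δ =
      Lq (n + 1) ((v1 * X1 + v2 * X2) ^ p ^ i) ((w1 * X1 + w2 * X2) ^ p ^ i) A C A' C' ∧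
    (T * c ^ f) ^ (n + 1) * Dq n (X1 ^ p ^ i) (X2 ^ p ^ i) α β γ δ =
      Dq n ((v1 * X1 + v2 * X2) ^ p ^ i) ((w1 * X1 + w2 * X2) ^ p ^ i) A C A' C' := by
  have hce : c ^ e' ≠ 0 := pow_ne_zero _ hc0
  have red : ∀ z z', T * c ^ (e' + f) * z = c ^ e' * z' → (T * c ^ f) * z = z' := by
    intro z z' h
    apply mul_left_cancel₀ hce
    rw [← h, pow_add]; ring
  have k1 := red _ _ h1
  have k2 := red _ _ h2
  have k3 := red _ _ h3
  have k4 := red _ _ h4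
  have hq : ∀ z : R, z ^ p ^ (i + m) = (z ^ p ^ i) ^ (n + 1) := fun z => by
    rw [hn, ← pow_mul, ← pow_add]
  have fz : ∀ a b : R, (a * X1 + b * X2) ^ p ^ i = a ^ p ^ i * X1 ^ p ^ i + b ^ p ^ i * X2 ^ p ^ i :=
    fun a b => by rw [add_pow_char_pow, mul_pow, mul_pow]
  have fz2 : ∀ z z' : R, (z + z') ^ (n + 1) = z ^ (n + 1) + z' ^ (n + 1) := fun z z' => by
    rw [hn, add_pow_char_pow]
  have hV' := pow_ne_zero (p ^ i) hV
  have hcq : c ^ p ^ i = v1 ^ p ^ i * w2 ^ p ^ i - v2 ^ p ^ i * w1 ^ p ^ i := by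
    rw [hc, sub_pow_char_pow, mul_pow, mul_pow]
  have hcq0 := pow_ne_zero (p ^ i) hc0
  rw [hq, hq] at k1 k2 k3 k4
  rw [fz] at hV'
  rw [fz, fz, pow_add]
  generalize X1 ^ p ^ i = x at *
  generalize X2 ^ p ^ i = y at *
  generalize v1 ^ p ^ i = a at *
  generalize v2 ^ p ^ i = b at *
  generalize w1 ^ p ^ i = a' at *
  generalize w2 ^ p ^ i = b' at *
  have l1 : (T * c ^ f * α) * a + (T * c ^ f * γ) * b =
      1 * (a ^ (n + 1) * A + a' ^ (n + 1) * C) := by linear_combination k1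
  have l2 : (T * c ^ f * β) * a + (T * c ^ f * δ) * b =
      1 * (b ^ (n + 1) * A + b' ^ (n + 1) * C) := by linear_combination k2
  have l3 : (T * c ^ f * α) * a' + (T * c ^ f * γ) * b' =
      1 * (a ^ (n + 1) * A' + a' ^ (n + 1) * C') := by linear_combination k3
  have l4 : (T * c ^ f * β) * a' + (T * c ^ f * δ) * b' =
      1 * (b ^ (n + 1) * A' + b' ^ (n + 1) * C') := by linear_combination k4
  constructor
  · have := L_cov (x := x) (y := y) (by rw [fz2, mul_pow, mul_pow]) (by rw [fz2, mul_pow, mul_pow])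
      l1 l2 l3 l4
    rw [Lq_scale, one_mul, ← hcq] at this
    rw [← this]; ring
  · have := D_cov p hm hn l1 l2 l3 l4 (hcq ▸ hcq0) hV'
    rw [Dq_scale, one_pow, one_mul] at this
    exact this

/-- coefficients of the rank one projector. -/
def P5 (a b : R) : R := a ^ 2 + 5 * a * b + 10 * b ^ 2

theorem P5_sum {a b : R} (h : a + b = 1) : a ^ 3 * P5 a b + b ^ 3 * P5 b a = 1 := by
  have : (a + b) ^ 5 = 1 := by rw [h, one_pow]
  rw [← this, P5, P5]; ring

/-- the form of negative weight -/
def kk (u1 u2 X Y : R) : R := u2 ^ 2 * X - u1 ^ 2 * Y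
/-- the form of positive weight -/
def ll (g1 g2 a b X Y : R) : R := g1 ^ 2 * (a + 3 * b) * X + g2 ^ 2 * (3 * a + b) * Y

theorem loc_gamma [IsDomain R] {P T2 T g1 g2 u1 u2 G1 G2 U1 U2 X Y X' Y' : R} (hP : P ≠ 0)
    (h1 : T2 * g1 = P * G1) (h2 : T2 * g2 = P * G2) (h3 : P * u1 = U1) (h4 : P * u2 = U2)
    (h5 : T * P * X = X') (h6 : T * P * Y = Y') :
    T2 ^ 3 * T * (g1 ^ 3 * kk u1 u2 X Y) = G1 ^ 3 * kk U1 U2 X' Y' ∧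
    T2 ^ 3 * T * (g2 ^ 3 * kk u1 u2 X Y) = G2 ^ 3 * kk U1 U2 X' Y' ∧
    ∀ a b, T2 ^ 6 * T ^ 3 * (u1 ^ 3 * P5 a b * ll g1 g2 a b X Y ^ 3) =
      U1 ^ 3 * P5 a b * ll G1 G2 a b X' Y' ^ 3 ∧
      T2 ^ 6 * T ^ 3 * (u2 ^ 3 * P5 b a * ll g1 g2 a b X Y ^ 3) =
      U2 ^ 3 * P5 b a * ll G1 G2 a b X' Y' ^ 3 := by
  have hl : ∀ a b, T2 ^ 2 * T * ll g1 g2 a b X Y = P * ll G1 G2 a b X' Y' := fun a b => by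
    apply mul_left_cancel₀ hP
    have e1 : P * (T2 ^ 2 * T * ll g1 g2 a b X Y) =
      P * T * ((T2 * g1) ^ 2 * (a + 3 * b) * X + (T2 * g2) ^ 2 * (3 * a + b) * Y) := by
      rw [ll]; ring
    rw [e1, h1, h2, ← h5, ← h6, ll]; ring
  subst h3 h4
  refine ⟨?_, ?_, fun a b => ⟨?_, ?_⟩⟩
  · apply mul_left_cancel₀ (pow_ne_zero 3 hP)
    have e1 : P ^ 3 * (T2 ^ 3 * T * (g1 ^ 3 * kk u1 u2 X Y)) =
      P ^ 3 * T * ((T2 * g1) ^ 3 * kk u1 u2 X Y) := by ring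
    rw [e1, h1, ← h5, ← h6, kk, kk]; ring
  · apply mul_left_cancel₀ (pow_ne_zero 3 hP)
    have e1 : P ^ 3 * (T2 ^ 3 * T * (g2 ^ 3 * kk u1 u2 X Y)) =
      P ^ 3 * T * ((T2 * g2) ^ 3 * kk u1 u2 X Y) := by ring
    rw [e1, h2, ← h5, ← h6, kk, kk]; ring
  · have e1 : T2 ^ 6 * T ^ 3 * (u1 ^ 3 * P5 a b * ll g1 g2 a b X Y ^ 3) =
      u1 ^ 3 * P5 a b * (T2 ^ 2 * T * ll g1 g2 a b X Y) ^ 3 := by ring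
    rw [e1, hl]; ring
  · have e1 : T2 ^ 6 * T ^ 3 * (u2 ^ 3 * P5 b a * ll g1 g2 a b X Y ^ 3) =
      u2 ^ 3 * P5 b a * (T2 ^ 2 * T * ll g1 g2 a b X Y) ^ 3 := by ring
    rw [e1, hl]; ring

theorem omega_zero [IsDomain R] {T2 G1 G2 U1 U2 a b X Y : R} (hT : T2 ≠ 0) (hab : a + b = 1)
    (h1 : U1 * G1 = T2 * a) (h2 : U2 * G2 = T2 * b)
    (k1 : G1 ^ 3 * kk U1 U2 X Y = 0) (k2 : G2 ^ 3 * kk U1 U2 X Y = 0)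
    (l1 : U1 ^ 3 * P5 a b * ll G1 G2 a b X Y ^ 3 = 0)
    (l2 : U2 ^ 3 * P5 b a * ll G1 G2 a b X Y ^ 3 = 0) : X = 0 ∧ Y = 0 := by
  have hp := P5_sum hab
  have hk : kk U1 U2 X Y = 0 := by
    have : T2 ^ 3 * kk U1 U2 X Y = 0 := by
      have e : T2 ^ 3 * kk U1 U2 X Y =
        ((T2 * a) ^ 3 * P5 a b + (T2 * b) ^ 3 * P5 b a) * kk U1 U2 X Y := by
        linear_combination - T2 ^ 3 * kk U1 U2 X Y * hp
      rw [e, ← h1, ← h2]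
      linear_combination U1 ^ 3 * P5 a b * k1 + U2 ^ 3 * P5 b a * k2
    exact (mul_eq_zero.1 this).resolve_left (pow_ne_zero _ hT)
  have hl : ll G1 G2 a b X Y = 0 := by
    have : T2 ^ 3 * ll G1 G2 a b X Y ^ 3 = 0 := by
      have e : T2 ^ 3 * ll G1 G2 a b X Y ^ 3 =
        ((T2 * a) ^ 3 * P5 a b + (T2 * b) ^ 3 * P5 b a) * ll G1 G2 a b X Y ^ 3 := by
        linear_combination - T2 ^ 3 * ll G1 G2 a b X Y ^ 3 * hp
      rw [e, ← h1, ← h2]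
      linear_combination G1 ^ 3 * l1 + G2 ^ 3 * l2
    exact pow_eq_zero_iff (by norm_num) |>.1
      ((mul_eq_zero.1 this).resolve_left (pow_ne_zero _ hT))
  rw [kk] at hk
  rw [ll] at hl
  have h3 : a ^ 2 * (a + 3 * b) + b ^ 2 * (3 * a + b) = 1 := by
    have : (a + b) ^ 3 = 1 := by rw [hab, one_pow]
    rw [← this]; ring
  have e : T2 ^ 2 = (U1 * G1) ^ 2 * (a + 3 * b) + (U2 * G2) ^ 2 * (3 * a + b) := by
    rw [h1, h2]; linear_combination - T2 ^ 2 * h3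
  constructor
  · have : T2 ^ 2 * X = 0 := by
      rw [e]; linear_combination U1 ^ 2 * hl + G2 ^ 2 * (3 * a + b) * hk
    exact (mul_eq_zero.1 this).resolve_left (pow_ne_zero _ hT)
  · have : T2 ^ 2 * Y = 0 := by
      rw [e]; linear_combination U2 ^ 2 * hl - G1 ^ 2 * (a + 3 * b) * hk
    exact (mul_eq_zero.1 this).resolve_left (pow_ne_zero _ hT)

end

section
variable {K : Type u} [CommRing K]

theorem test_zero [IsReduced K] {σ : Type*} (x : MvPolynomial σ K) (t : K)
    (h : ∀ (F : Type u) [Field F] (ψ : K →+* F), ψ t ≠ 0 → MvPolynomial.map ψ x = 0) :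
    C t * x = 0 := by
  ext d
  rw [coeff_C_mul, coeff_zero]
  apply IsReduced.eq_zero
  rw [← mem_nilradical, nilradical_eq_sInf, Submodule.mem_sInf]
  intro (P : Ideal K) hP
  have hP' : P.IsPrime := hP
  by_cases ht : t ∈ P
  · exact Ideal.mul_mem_right _ _ ht
  · have h1 := h P.ResidueField (algebraMap K P.ResidueField) (by
      rwa [ne_eq, ← RingHom.mem_ker, Ideal.ker_algebraMap_residueField])
    have h2 := congrArg (coeff d) h1
    rw [coeff_map, coeff_zero, ← RingHom.mem_ker, Ideal.ker_algebraMap_residueField] at h2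
    exact Ideal.mul_mem_left _ _ h2

theorem test_eq [IsReduced K] {σ : Type*} (x y : MvPolynomial σ K) (t : K)
    (h : ∀ (F : Type u) [Field F] (ψ : K →+* F), ψ t ≠ 0 →
      MvPolynomial.map ψ x = MvPolynomial.map ψ y) :
    C t * x = C t * y := by
  have := test_zero (x - y) t fun F _ ψ hψ => by rw [map_sub, h F ψ hψ, sub_self]
  rwa [mul_sub, sub_eq_zero] at this

theorem glue_poly {B : Type u} [CommRing B] [Algebra B K] {σ : Type*} (x : MvPolynomial σ K)
    (h : ∀ p : Ideal B, p.IsPrime → ∃ t ∉ p, ∃ y : MvPolynomial σ B,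
      MvPolynomial.map (algebraMap B K) y = C (algebraMap B K t) * x) :
    ∃ y : MvPolynomial σ B, MvPolynomial.map (algebraMap B K) y = x := by
  let a : Ideal B :=
    { carrier := {b | ∃ y : MvPolynomial σ B,
        MvPolynomial.map (algebraMap B K) y = C (algebraMap B K b) * x}
      add_mem' := by
        rintro b b' ⟨y, hy⟩ ⟨y', hy'⟩
        exact ⟨y + y', by rw [map_add, hy, hy', map_add, map_add, add_mul]⟩
      zero_mem' := ⟨0, by simp⟩
      smul_mem' := by
        rintro b b' ⟨y, hy⟩
        exact ⟨C b * y, by rw [map_mul, hy, map_C, smul_eq_mul, map_mul, map_mul, mul_assoc]⟩ }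
  have ha : (1 : B) ∈ a := by
    have : a = ⊤ := by
      by_contra hne
      obtain ⟨M, hM, hle⟩ := Ideal.exists_le_maximal a hne
      obtain ⟨t, ht, y, hy⟩ := h M hM.isPrime
      exact ht (hle ⟨y, hy⟩)
    rw [this]; trivial
  obtain ⟨y, hy⟩ := ha
  exact ⟨y, by simpa using hy⟩

end
end FpLci
end

section
universe u
namespace FpLci
open MvPolynomial
section
variable {B : Type u} [CommRing B]

theorem charP_of_hom (p : ℕ) [hp : Fact p.Prime] [CharP B p] {S : Type*} [CommRing S] [Nontrivial S]
    (f : B →+* S) : CharP S p := by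
  rw [CharP.charP_iff_prime_eq_zero hp.out, ← map_natCast f, CharP.cast_eq_zero, map_zero]

theorem cI_smul_mem {L : Submodule B (B × B)} {z : B} (hz : z ∈ cI L) (x : B × B) : z • x ∈ L := by
  induction hz using Submodule.span_induction with
  | mem z h =>
    obtain ⟨v, hv, w, hw, rfl⟩ := h
    have : om v w • x = om x w • v + om v x • w := by
      ext <;> simp [om] <;> ring
    rw [this]
    exact L.add_mem (L.smul_mem _ hv) (L.smul_mem _ hw)
  | zero => simp
  | add a b _ _ ha hb => rw [add_smul]; exact L.add_mem ha hb
  | smul a b _ hb => rw [smul_assoc]; exact L.smul_mem _ hb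

variable {K : Type u} [CommRing K] [Algebra B K]

theorem loc_data {L X X' : Submodule B (B × B)} {e e' q q' : ℕ} (hX : GoodX L X e q)
    (hX' : GoodX L X' e' q') (E : X' ≃ₗ[B] X) {α β γ δ : K}
    (h1 : ∀ x : X, algebraMap B K (E.symm x).1.1 = α * algebraMap B K x.1.1 + γ * algebraMap B K x.1.2)
    (h2 : ∀ x : X, algebraMap B K (E.symm x).1.2 = β * algebraMap B K x.1.1 + δ * algebraMap B K x.1.2)
    {t : B} {v w : B × B} (hl : LocGen L t v w) :
    ∃ (N N' : ℕ) (A C A' C' a b a' b' : B), let i := algebraMap B K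
      (i t ^ N * i (om v w) ^ e * (α * i v.1 ^ q + γ * i v.2 ^ q) =
        i (om v w) ^ e' * (i A * i v.1 ^ q' + i C * i w.1 ^ q')) ∧
      (i t ^ N * i (om v w) ^ e * (β * i v.1 ^ q + δ * i v.2 ^ q) =
        i (om v w) ^ e' * (i A * i v.2 ^ q' + i C * i w.2 ^ q')) ∧
      (i t ^ N * i (om v w) ^ e * (α * i w.1 ^ q + γ * i w.2 ^ q) =
        i (om v w) ^ e' * (i A' * i v.1 ^ q' + i C' * i w.1 ^ q')) ∧
      (i t ^ N * i (om v w) ^ e * (β * i w.1 ^ q + δ * i w.2 ^ q) =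
        i (om v w) ^ e' * (i A' * i v.2 ^ q' + i C' * i w.2 ^ q')) ∧
      (t ^ N' * om v w ^ e') • fr q' v = om v w ^ e' •
        (a • (A • fr q' v + C • fr q' w) + b • (A' • fr q' v + C' • fr q' w)) ∧
      (t ^ N' * om v w ^ e') • fr q' w = om v w ^ e' •
        (a' • (A • fr q' v + C • fr q' w) + b' • (A' • fr q' v + C' • fr q' w)) := by
  obtain ⟨N1, hN1⟩ := hX.2 t v w hl
  obtain ⟨N2, hN2⟩ := hX'.2 t v w hl
  let b1 : X := ⟨_, (hX.1 v hl.1 w hl.2.1).1⟩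
  let b2 : X := ⟨_, (hX.1 v hl.1 w hl.2.1).2⟩
  let b1' : X' := ⟨_, (hX'.1 v hl.1 w hl.2.1).1⟩
  let b2' : X' := ⟨_, (hX'.1 v hl.1 w hl.2.1).2⟩
  obtain ⟨A, C, hA⟩ := hN2 _ (E.symm b1).2
  obtain ⟨A', C', hA'⟩ := hN2 _ (E.symm b2).2
  obtain ⟨a, b, ha⟩ := hN1 _ (E b1').2
  obtain ⟨a', b', ha'⟩ := hN1 _ (E b2').2
  -- inverse relations
  have inv : ∀ (b' : X') (a b : B), t ^ N1 • (E b').1 = om v w ^ e • (a • fr q v + b • fr q w) →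
      t ^ (N1 + N2) • b'.1 = om v w ^ e' •
        (a • (A • fr q' v + C • fr q' w) + b • (A' • fr q' v + C' • fr q' w)) := by
    intro b' a b h
    have k1 : t ^ N1 • E b' = a • b1 + b • b2 := by
      apply Subtype.ext
      change t ^ N1 • (E b').1 = a • (om v w ^ e • fr q v) + b • (om v w ^ e • fr q w)
      rw [h, smul_add, smul_comm, smul_comm _ b]
    have k2 := congrArg E.symm k1
    rw [map_smul, E.symm_apply_apply, map_add, map_smul, map_smul] at k2
    have k3 := congrArg Subtype.val k2
    change t ^ N1 • b'.1 = a • (E.symm b1).1 + b • (E.symm b2).1 at k3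
    rw [pow_add, mul_comm, mul_smul, k3, smul_add, smul_comm _ a, smul_comm _ b, hA, hA']
    module
  have i1 := inv b1' a b ha
  have i2 := inv b2' a' b' ha'
  let i := algebraMap B K
  have aux : ∀ (x : X) (A C : B), t ^ N2 • (E.symm x).1 = om v w ^ e' • (A • fr q' v + C • fr q' w) →
      i t ^ (N1 + N2) * (α * i x.1.1 + γ * i x.1.2) = i (om v w) ^ e' * (i (t ^ N1 * A) * i v.1 ^ q' +
        i (t ^ N1 * C) * i w.1 ^ q') ∧ 
      i t ^ (N1 + N2) * (β * i x.1.1 + δ * i x.1.2) = i (om v w) ^ e' * (i (t ^ N1 * A) * i v.2 ^ q' +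
        i (t ^ N1 * C) * i w.2 ^ q') := by
    intro x A C h
    have g1 := congrArg (fun z => i z.1) h
    have g2 := congrArg (fun z => i z.2) h
    simp only [Prod.smul_fst, Prod.smul_snd, Prod.fst_add, Prod.snd_add, smul_eq_mul, map_mul,
      map_add, map_pow, fr] at g1 g2
    rw [h1] at g1
    rw [h2] at g2
    constructor
    · rw [pow_add, mul_assoc, g1, map_mul, map_mul, map_pow]; ring
    · rw [pow_add, mul_assoc, g2, map_mul, map_mul, map_pow]; ring
  obtain ⟨x1, x2⟩ := aux b1 A C hA
  obtain ⟨x3, x4⟩ := aux b2 A' C' hA'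
  refine ⟨N1 + N2, N1 + (N1 + N2), t ^ N1 * A, t ^ N1 * C, t ^ N1 * A', t ^ N1 * C', a, b, a', b',
    ?_, ?_, ?_, ?_, ?_, ?_⟩
  · rw [← x1]; simp only [b1, fr, Prod.smul_fst, Prod.smul_snd, smul_eq_mul, map_mul, map_pow, i]; ring
  · rw [← x2]; simp only [b1, fr, Prod.smul_fst, Prod.smul_snd, smul_eq_mul, map_mul, map_pow, i]; ring
  · rw [← x3]; simp only [b2, fr, Prod.smul_fst, Prod.smul_snd, smul_eq_mul, map_mul, map_pow, i]; ring
  · rw [← x4]; simp only [b2, fr, Prod.smul_fst, Prod.smul_snd, smul_eq_mul, map_mul, map_pow, i]; ring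
  · change t ^ (N1 + N2) • (om v w ^ e' • fr q' v) = _ at i1
    rw [pow_add, mul_assoc, mul_smul, mul_smul, i1]
    module
  · change t ^ (N1 + N2) • (om v w ^ e' • fr q' w) = _ at i2
    rw [pow_add, mul_assoc, mul_smul, mul_smul, i2]
    module

end
end FpLci
end

section
universe u
namespace FpLci
open MvPolynomial
section
variable {R : Type*} [CommRing R]


/-- first normalised form -/
def XF (n q f N : ℕ) (x y α β γ δ : R) : R :=
  Lq (n + 1) (x ^ q) (y ^ q) α β γ δ ^ (f * (n + 1) * N)
/-- second normalised form -/
def YF (n q f N : ℕ) (x y α β γ δ : R) : R :=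
  Dq n (x ^ q) (y ^ q) α β γ δ ^ ((f + q) * N)

theorem map_XF {R' : Type*} [CommRing R'] (ψ : R →+* R') (n q f N : ℕ) (x y α β γ δ : R) :
    ψ (XF n q f N x y α β γ δ) = XF n q f N (ψ x) (ψ y) (ψ α) (ψ β) (ψ γ) (ψ δ) := by
  simp only [XF, map_pow, map_Lq]
theorem map_YF {R' : Type*} [CommRing R'] (ψ : R →+* R') (n q f N : ℕ) (x y α β γ δ : R) :
    ψ (YF n q f N x y α β γ δ) = YF n q f N (ψ x) (ψ y) (ψ α) (ψ β) (ψ γ) (ψ δ) := by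
  simp only [YF, map_pow, map_Dq]
theorem map_kk {R' : Type*} [CommRing R'] (ψ : R →+* R') (a b x y : R) :
    ψ (kk a b x y) = kk (ψ a) (ψ b) (ψ x) (ψ y) := by
  simp [kk]
theorem map_ll {R' : Type*} [CommRing R'] (ψ : R →+* R') (g g' a b x y : R) :
    ψ (ll g g' a b x y) = ll (ψ g) (ψ g') (ψ a) (ψ b) (ψ x) (ψ y) := by
  simp [ll, map_ofNat]
theorem map_P5 {R' : Type*} [CommRing R'] (ψ : R →+* R') (a b : R) :
    ψ (P5 a b) = P5 (ψ a) (ψ b) := by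
  simp [P5, map_ofNat]

theorem loc_field [IsDomain R] (p : ℕ) [hp : Fact p.Prime] [CharP R p] {m n i e' f : ℕ} (hm : 0 < m)
    (hn : n + 1 = p ^ m) {X1 X2 v1 v2 w1 w2 α β γ δ A C A' C' T c : R}
    (hc : c = v1 * w2 - v2 * w1) (hc0 : c ≠ 0) (hV : v1 * X1 + v2 * X2 ≠ 0)
    (h1 : T * c ^ (e' + f) * (α * v1 ^ p ^ i + γ * v2 ^ p ^ i) =
      c ^ e' * (A * v1 ^ p ^ (i + m) + C * w1 ^ p ^ (i + m)))
    (h2 : T * c ^ (e' + f) * (β * v1 ^ p ^ i + δ * v2 ^ p ^ i) =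
      c ^ e' * (A * v2 ^ p ^ (i + m) + C * w2 ^ p ^ (i + m)))
    (h3 : T * c ^ (e' + f) * (α * w1 ^ p ^ i + γ * w2 ^ p ^ i) =
      c ^ e' * (A' * v1 ^ p ^ (i + m) + C' * w1 ^ p ^ (i + m)))
    (h4 : T * c ^ (e' + f) * (β * w1 ^ p ^ i + δ * w2 ^ p ^ i) =
      c ^ e' * (A' * v2 ^ p ^ (i + m) + C' * w2 ^ p ^ (i + m))) {N k1 k2 W : ℕ}
    (hk1 : k1 = f * (n + 1) * N) (hk2 : k2 = (n + 1) * ((f + p ^ i) * N))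
    (hW : W = f * (n + 1) * ((f + p ^ i) * N)) {V1 V2 : R} (hV1 : V1 = v1 * X1 + v2 * X2)
    (hV2 : V2 = w1 * X1 + w2 * X2) :
    T ^ (k1 + k2) * c ^ W * XF n (p ^ i) f N X1 X2 α β γ δ =
      T ^ k2 * XF n (p ^ i) f N V1 V2 A C A' C' ∧
    T ^ (k1 + k2) * c ^ W * YF n (p ^ i) f N X1 X2 α β γ δ =
      T ^ k1 * YF n (p ^ i) f N V1 V2 A C A' C' := by
  obtain ⟨h, h'⟩ := loc_LD p hm hn hc hc0 hV h1 h2 h3 h4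
  rw [XF, XF, YF, YF, hV1, hV2, ← h, ← h']
  have e1 : W = (f + p ^ i) * k1 := by rw [hW, hk1]; ring
  have e2 : c ^ W = (c ^ f) ^ k2 := by rw [← pow_mul, hW, hk2]; ring
  constructor
  · rw [mul_pow, mul_pow, ← hk1, ← pow_mul, ← e1]; ring
  · rw [e2, mul_pow _ _ ((f + p ^ i) * N), ← pow_mul (T * c ^ f), ← hk2]; ring

end

section
variable {B : Type u} [CommRing B] {K : Type u} [CommRing K] [Algebra B K]

theorem rel_UG {L : Submodule B (B × B)} {t : B} {v w : B × B} (hl : LocGen L t v w) {s : B}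
    (hs : s ∈ cI L) (hs' : s ∈ nonZeroDivisors B) {W : ℕ} (μ : ↥(cI L ^ W) →ₗ[B] B) (g : ↥(cI L ^ W))
    {G : B} (hG : t ^ (2 * W) * g.1 = om v w ^ W * G) (hc : om v w ^ W ∈ cI L ^ W) :
    t ^ (2 * W) * (μ ⟨_, hc⟩ * G - t ^ (2 * W) * μ g) = 0 := by
  apply hl.nzd hs hs'
  have h1 : om v w ^ W * μ g = g.1 * μ ⟨_, hc⟩ := by
    rw [← smul_eq_mul, ← smul_eq_mul, ← map_smul, ← map_smul]
    congr 1
    apply Subtype.ext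
    simp [mul_comm]
  linear_combination - μ ⟨_, hc⟩ * hG - t ^ (2 * W) * h1

theorem rel_inv (p : ℕ) [Fact p.Prime] [CharP B p] {L : Submodule B (B × B)} {t : B} {v w : B × B}
    (hl : LocGen L t v w) {s : B} (hs : s ∈ cI L) (hs' : s ∈ nonZeroDivisors B) {e' j N' : ℕ}
    {A C A' C' a b : B}
    (h : (t ^ N' * om v w ^ e') • fr (p ^ j) v = om v w ^ e' •
        (a • (A • fr (p ^ j) v + C • fr (p ^ j) w) + b • (A' • fr (p ^ j) v + C' • fr (p ^ j) w))) :
    t ^ (2 * (e' + p ^ j)) * (t ^ N' - (a * A + b * A')) = 0 ∧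
      t ^ (2 * (e' + p ^ j)) * (a * C + b * C') = 0 := by
  have hd := om_fr p j v w
  simp only [om] at hd
  have h1 := congrArg Prod.fst h
  have h2 := congrArg Prod.snd h
  simp only [Prod.smul_fst, Prod.smul_snd, Prod.fst_add, Prod.snd_add, smul_eq_mul] at h1 h2
  constructor
  · apply hl.nzd hs hs'
    rw [pow_add]
    change _ * (v.1 * w.2 - v.2 * w.1) ^ p ^ j * _ = 0
    rw [← hd]
    linear_combination (fr (p ^ j) w).2 * h1 - (fr (p ^ j) w).1 * h2
  · apply hl.nzd hs hs'
    rw [pow_add]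
    change _ * (v.1 * w.2 - v.2 * w.1) ^ p ^ j * _ = 0
    rw [← hd]
    linear_combination (fr (p ^ j) v).2 * h1 - (fr (p ^ j) v).1 * h2

theorem rel_inv' (p : ℕ) [Fact p.Prime] [CharP B p] {L : Submodule B (B × B)} {t : B} {v w : B × B}
    (hl : LocGen L t v w) {s : B} (hs : s ∈ cI L) (hs' : s ∈ nonZeroDivisors B) {e' j N' : ℕ}
    {A C A' C' a b : B}
    (h : (t ^ N' * om v w ^ e') • fr (p ^ j) w = om v w ^ e' •
        (a • (A • fr (p ^ j) v + C • fr (p ^ j) w) + b • (A' • fr (p ^ j) v + C' • fr (p ^ j) w))) :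
    t ^ (2 * (e' + p ^ j)) * (t ^ N' - (a * C + b * C')) = 0 ∧
      t ^ (2 * (e' + p ^ j)) * (a * A + b * A') = 0 := by
  have hd := om_fr p j v w
  simp only [om] at hd
  have h1 := congrArg Prod.fst h
  have h2 := congrArg Prod.snd h
  simp only [Prod.smul_fst, Prod.smul_snd, Prod.fst_add, Prod.snd_add, smul_eq_mul] at h1 h2
  constructor
  · apply hl.nzd hs hs'
    rw [pow_add]
    change _ * (v.1 * w.2 - v.2 * w.1) ^ p ^ j * _ = 0
    rw [← hd]
    linear_combination - (fr (p ^ j) v).2 * h1 + (fr (p ^ j) v).1 * h2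
  · apply hl.nzd hs hs'
    rw [pow_add]
    change _ * (v.1 * w.2 - v.2 * w.1) ^ p ^ j * _ = 0
    rw [← hd]
    linear_combination - (fr (p ^ j) w).2 * h1 + (fr (p ^ j) w).1 * h2

theorem loc_main [IsReduced K] (p : ℕ) [Fact p.Prime] [CharP B p]
    {L X X' : Submodule B (B × B)} {e' f i m n N W : ℕ} (hm : 0 < m) (hn : n + 1 = p ^ m)
    (hW : W = f * (n + 1) * ((f + p ^ i) * N))
    (hX : GoodX L X (e' + f) (p ^ i))
    (hX' : GoodX L X' e' (p ^ (i + m))) (E : X' ≃ₗ[B] X) {α β γ δ : K}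
    (h1 : ∀ x : X, algebraMap B K (E.symm x).1.1 = α * algebraMap B K x.1.1 + γ * algebraMap B K x.1.2)
    (h2 : ∀ x : X, algebraMap B K (E.symm x).1.2 = β * algebraMap B K x.1.1 + δ * algebraMap B K x.1.2)
    {s : B} (hs : s ∈ cI L) (hs' : s ∈ nonZeroDivisors B) (hsu : IsUnit (algebraMap B K s))
    {σ : Type*} {X1 X2 : MvPolynomial σ K} (ε : L →ₗ[B] MvPolynomial σ B)
    (hε : ∀ y : L, MvPolynomial.map (algebraMap B K) (ε y) = MvPolynomial.C (algebraMap B K y.1.1) * X1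
      + MvPolynomial.C (algebraMap B K y.1.2) * X2)
    (hε0 : ∀ (F : Type u) [Field F] (ψ : K →+* F) (y : L),
      MvPolynomial.map ψ (MvPolynomial.map (algebraMap B K) (ε y)) = 0 →
      ψ (algebraMap B K y.1.1) = 0 ∧ ψ (algebraMap B K y.1.2) = 0)
    (g1 g2 : ↥(cI L ^ W)) (μ1 μ2 : ↥(cI L ^ W) →ₗ[B] B) {u1 u2 : K}
    (hu1 : ∀ z, u1 * algebraMap B K z.1 = algebraMap B K (μ1 z))
    (hu2 : ∀ z, u2 * algebraMap B K z.1 = algebraMap B K (μ2 z))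
    (hab : μ1 g1 + μ2 g2 = 1)
    {t : B} {v w : B × B} (hl : LocGen L t v w) :
    let c' : B →+* MvPolynomial σ K := MvPolynomial.C.comp (algebraMap B K)
    let Xg := XF n (p ^ i) f N X1 X2 (MvPolynomial.C α) (MvPolynomial.C β) (MvPolynomial.C γ) (MvPolynomial.C δ)
    let Yg := YF n (p ^ i) f N X1 X2 (MvPolynomial.C α) (MvPolynomial.C β) (MvPolynomial.C γ) (MvPolynomial.C δ)
    ∃ (M M' : ℕ) (Γ1 Γ2 H1 H2 : MvPolynomial σ B),
      MvPolynomial.map (algebraMap B K) Γ1 = c' t ^ M * (c' g1 ^ 3 * kk (MvPolynomial.C u1) (MvPolynomial.C u2) Xg Yg) ∧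
      MvPolynomial.map (algebraMap B K) Γ2 = c' t ^ M * (c' g2 ^ 3 * kk (MvPolynomial.C u1) (MvPolynomial.C u2) Xg Yg) ∧
      MvPolynomial.map (algebraMap B K) H1 = c' t ^ M' * (MvPolynomial.C u1 ^ 3 *
        P5 (c' (μ1 g1)) (c' (μ2 g2)) * ll (c' g1) (c' g2) (c' (μ1 g1)) (c' (μ2 g2)) Xg Yg ^ 3) ∧
      MvPolynomial.map (algebraMap B K) H2 = c' t ^ M' * (MvPolynomial.C u2 ^ 3 *
        P5 (c' (μ2 g2)) (c' (μ1 g1)) * ll (c' g1) (c' g2) (c' (μ1 g1)) (c' (μ2 g2)) Xg Yg ^ 3) ∧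
      ∀ Q : Ideal (MvPolynomial σ B), Q.IsPrime → MvPolynomial.C t ∉ Q → Γ1 ∈ Q → Γ2 ∈ Q → H1 ∈ Q →
        H2 ∈ Q → ∀ y : L, ε y ∈ Q := by
  intro c' Xg Yg
  obtain ⟨T0, N', A, C, A', C', a, b, a', b', x1, x2, x3, x4, r1, r2⟩ := loc_data hX hX' E h1 h2 hl
  obtain ⟨G1, hG1⟩ := hl.dvd W g1.2
  obtain ⟨G2, hG2⟩ := hl.dvd W g2.2
  have hcm : om v w ^ W ∈ cI L ^ W := Ideal.pow_mem_pow (om_mem_cI hl.1 hl.2.1) _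
  have d1 := rel_UG hl hs hs' μ1 g1 hG1 hcm
  have d2 := rel_UG hl hs hs' μ2 g2 hG2 hcm
  obtain ⟨r3, r4⟩ := rel_inv p hl hs hs' r1
  obtain ⟨r5, r6⟩ := rel_inv' p hl hs hs' r2
  set U1 := μ1 ⟨_, hcm⟩ with hU1
  set U2 := μ2 ⟨_, hcm⟩ with hU2
  have hu1' := hu1 ⟨_, hcm⟩
  have hu2' := hu2 ⟨_, hcm⟩
  rw [← hU1] at hu1'
  rw [← hU2] at hu2'
  obtain ⟨zs, hzs⟩ := hl.dvd 1 (by rw [pow_one]; exact hs)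
  let vL : L := ⟨v, hl.1⟩
  let wL : L := ⟨w, hl.2.1⟩
  let cc : B →+* MvPolynomial σ B := MvPolynomial.C
  generalize hk1 : f * (n + 1) * N = k1
  generalize hk2 : (n + 1) * ((f + p ^ i) * N) = k2
  let X' : MvPolynomial σ B := (cc t ^ T0) ^ k2 * XF n (p ^ i) f N (ε vL) (ε wL) (cc A) (cc C) (cc A') (cc C')
  let Y' : MvPolynomial σ B := (cc t ^ T0) ^ k1 * YF n (p ^ i) f N (ε vL) (ε wL) (cc A) (cc C) (cc A') (cc C')
  have key : ∀ (F : Type u) [Field F] (ψ : K →+* F), ψ (algebraMap B K t) ≠ 0 →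
      ∃ P : MvPolynomial σ F, P ≠ 0 ∧ MvPolynomial.map ψ (c' t ^ (2 * W) * c' g1) = P * MvPolynomial.map ψ (c' G1) ∧
        MvPolynomial.map ψ (c' t ^ (2 * W) * c' g2) = P * MvPolynomial.map ψ (c' G2) ∧
        P * MvPolynomial.map ψ (MvPolynomial.C u1) = MvPolynomial.map ψ (c' U1) ∧
        P * MvPolynomial.map ψ (MvPolynomial.C u2) = MvPolynomial.map ψ (c' U2) ∧
        MvPolynomial.map ψ ((c' t ^ T0) ^ (k1 + k2)) * P * MvPolynomial.map ψ Xg =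
          MvPolynomial.map ψ (MvPolynomial.map (algebraMap B K) X') ∧
        MvPolynomial.map ψ ((c' t ^ T0) ^ (k1 + k2)) * P * MvPolynomial.map ψ Yg =
          MvPolynomial.map ψ (MvPolynomial.map (algebraMap B K) Y') := by
    intro F _ ψ ht
    let j : B →+* MvPolynomial σ F := MvPolynomial.C.comp (ψ.comp (algebraMap B K))
    have hj : ∀ b, MvPolynomial.map ψ (c' b) = j b := fun b => by
      simp [c', j]
    let jj : MvPolynomial σ B →+* MvPolynomial σ F := (MvPolynomial.map ψ).comp (MvPolynomial.map (algebraMap B K))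
    have hjj : ∀ b, MvPolynomial.map ψ (MvPolynomial.map (algebraMap B K) b) = jj b := fun b => rfl
    have hjj' : ∀ b, jj (cc b) = j b := fun b => by simp [cc, jj, j]
    have hj0 : ∀ b, ψ (algebraMap B K b) ≠ 0 → j b ≠ 0 := fun b hb => by
      simpa [j] using hb
    have hc0' : ψ (algebraMap B K (om v w)) ≠ 0 := by
      intro h0
      have := congrArg (fun z => ψ (algebraMap B K z)) hzs
      simp only [map_mul, map_pow, h0, pow_one, zero_mul, mul_eq_zero] at this
      rcases this with h | h
      · exact ht (pow_eq_zero_iff (by norm_num) |>.1 h)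
      · exact (hsu.map ψ).ne_zero h
    have hc0 := hj0 _ hc0'
    have hcp : CharP (MvPolynomial σ F) p := charP_of_hom p j
    have hεj : ∀ y : L, jj (ε y) = j y.1.1 * MvPolynomial.map ψ X1 + j y.1.2 * MvPolynomial.map ψ X2 := by
      intro y
      rw [← hjj, hε, map_add, map_mul, map_mul]
      simp [j]
    let κ : K →+* MvPolynomial σ F := MvPolynomial.C.comp ψ
    have hκ : ∀ b, κ (algebraMap B K b) = j b := fun b => rfl
    have hκ' : ∀ b, MvPolynomial.map ψ (MvPolynomial.C b) = κ b := fun b => by simp [κ]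
    have y1 := congrArg κ x1
    have y2 := congrArg κ x2
    have y3 := congrArg κ x3
    have y4 := congrArg κ x4
    simp only [map_mul, map_add, map_pow, hκ] at y1 y2 y3 y4
    have hV : j v.1 * MvPolynomial.map ψ X1 + j v.2 * MvPolynomial.map ψ X2 ≠ 0 := by
      intro h0
      have h := hεj vL
      rw [h0] at h
      obtain ⟨q1, q2⟩ := hε0 F ψ vL h
      apply hc0'
      simp only [om, map_sub, map_mul]
      change ψ (algebraMap B K v.1) = 0 at q1
      change ψ (algebraMap B K v.2) = 0 at q2
      rw [q1, q2]; ring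
    have hcc : j (om v w) = j v.1 * j w.2 - j v.2 * j w.1 := by simp only [om, map_sub, map_mul]
    obtain ⟨q1, q2⟩ := loc_field p hm hn hcc hc0 hV y1 y2 y3 y4 hk1.symm hk2.symm hW (hεj vL) (hεj wL)
    refine ⟨j (om v w) ^ W, pow_ne_zero _ hc0, ?_, ?_, ?_, ?_, ?_, ?_⟩
    · rw [← map_pow c', ← map_mul c', hG1, map_mul, map_mul, hj, hj, map_pow]
    · rw [← map_pow c', ← map_mul c', hG2, map_mul, map_mul, hj, hj, map_pow]
    · rw [hκ', hj, mul_comm, ← hκ U1, ← hu1', map_mul, hκ, map_pow]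
    · rw [hκ', hj, mul_comm, ← hκ U2, ← hu2', map_mul, hκ, map_pow]
    · rw [map_pow, map_pow, hj, map_XF, hκ', hκ', hκ', hκ', q1]
      simp only [X', map_mul, map_pow, map_XF, hjj, hjj']
    · rw [map_pow, map_pow, hj, map_YF, hκ', hκ', hκ', hκ', q2]
      simp only [Y', map_mul, map_pow, map_YF, hjj, hjj']
  have hcm' : ∀ b, MvPolynomial.map (algebraMap B K) (cc b) = c' b := fun b => by simp [cc, c']
  have T1 := test_eq (x := (c' t ^ (2 * W)) ^ 3 * (c' t ^ T0) ^ (k1 + k2) *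
      (c' g1 ^ 3 * kk (MvPolynomial.C u1) (MvPolynomial.C u2) Xg Yg))
    (y := MvPolynomial.map (algebraMap B K) (cc G1 ^ 3 * kk (cc U1) (cc U2) X' Y')) (algebraMap B K t)
    (fun F _ ψ hψ => by
      obtain ⟨P, hP, q1, q2, q3, q4, q5, q6⟩ := key F ψ hψ
      rw [map_mul] at q1 q2
      have := (loc_gamma hP q1 q2 q3 q4 q5 q6).1
      simp only [map_mul, map_pow, map_kk, hcm'] at this ⊢
      exact this)
  have T2 := test_eq (x := (c' t ^ (2 * W)) ^ 3 * (c' t ^ T0) ^ (k1 + k2) *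
      (c' g2 ^ 3 * kk (MvPolynomial.C u1) (MvPolynomial.C u2) Xg Yg))
    (y := MvPolynomial.map (algebraMap B K) (cc G2 ^ 3 * kk (cc U1) (cc U2) X' Y')) (algebraMap B K t)
    (fun F _ ψ hψ => by
      obtain ⟨P, hP, q1, q2, q3, q4, q5, q6⟩ := key F ψ hψ
      rw [map_mul] at q1 q2
      have := (loc_gamma hP q1 q2 q3 q4 q5 q6).2.1
      simp only [map_mul, map_pow, map_kk, hcm'] at this ⊢
      exact this)
  have T3 := test_eq (x := (c' t ^ (2 * W)) ^ 6 * ((c' t ^ T0) ^ (k1 + k2)) ^ 3 *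
      (MvPolynomial.C u1 ^ 3 *
        P5 (c' (μ1 g1)) (c' (μ2 g2)) * ll (c' g1) (c' g2) (c' (μ1 g1)) (c' (μ2 g2)) Xg Yg ^ 3))
    (y := MvPolynomial.map (algebraMap B K) (cc U1 ^ 3 * P5 (cc (μ1 g1)) (cc (μ2 g2)) *
      ll (cc G1) (cc G2) (cc (μ1 g1)) (cc (μ2 g2)) X' Y' ^ 3)) (algebraMap B K t)
    (fun F _ ψ hψ => by
      obtain ⟨P, hP, q1, q2, q3, q4, q5, q6⟩ := key F ψ hψ
      rw [map_mul] at q1 q2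
      have := ((loc_gamma hP q1 q2 q3 q4 q5 q6).2.2 (MvPolynomial.map ψ (c' (μ1 g1)))
        (MvPolynomial.map ψ (c' (μ2 g2)))).1
      simp only [map_mul, map_pow, map_P5, map_ll, hcm'] at this ⊢
      exact this)
  have T4 := test_eq (x := (c' t ^ (2 * W)) ^ 6 * ((c' t ^ T0) ^ (k1 + k2)) ^ 3 *
      (MvPolynomial.C u2 ^ 3 *
        P5 (c' (μ2 g2)) (c' (μ1 g1)) * ll (c' g1) (c' g2) (c' (μ1 g1)) (c' (μ2 g2)) Xg Yg ^ 3))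
    (y := MvPolynomial.map (algebraMap B K) (cc U2 ^ 3 * P5 (cc (μ2 g2)) (cc (μ1 g1)) *
      ll (cc G1) (cc G2) (cc (μ1 g1)) (cc (μ2 g2)) X' Y' ^ 3)) (algebraMap B K t)
    (fun F _ ψ hψ => by
      obtain ⟨P, hP, q1, q2, q3, q4, q5, q6⟩ := key F ψ hψ
      rw [map_mul] at q1 q2
      have := ((loc_gamma hP q1 q2 q3 q4 q5 q6).2.2 (MvPolynomial.map ψ (c' (μ1 g1)))
        (MvPolynomial.map ψ (c' (μ2 g2)))).2
      simp only [map_mul, map_pow, map_P5, map_ll, hcm'] at this ⊢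
      exact this)
  have hct : MvPolynomial.C (algebraMap B K t) = c' t := rfl
  have hcmul : ∀ z, MvPolynomial.map (algebraMap B K) (cc t * z) =
      c' t * MvPolynomial.map (algebraMap B K) z := fun z => by rw [map_mul, hcm']
  rw [hct] at T1 T2 T3 T4
  refine ⟨1 + (2 * W * 3 + T0 * (k1 + k2)), 1 + (2 * W * 6 + T0 * (k1 + k2) * 3), cc t * _, cc t * _,
    cc t * _, cc t * _, (hcmul _).trans (T1.symm.trans ?_), (hcmul _).trans (T2.symm.trans ?_),
    (hcmul _).trans (T3.symm.trans ?_), (hcmul _).trans (T4.symm.trans ?_), ?_⟩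
  · ring
  · ring
  · ring
  · ring
  intro Q hQ htQ z1 z2 z3 z4
  have w1 := (hQ.mem_or_mem z1).resolve_left htQ
  have w2 := (hQ.mem_or_mem z2).resolve_left htQ
  have w3 := (hQ.mem_or_mem z3).resolve_left htQ
  have w4 := (hQ.mem_or_mem z4).resolve_left htQ
  let π : MvPolynomial σ B →+* MvPolynomial σ B ⧸ Q := Ideal.Quotient.mk Q
  have hπ : ∀ z, π z = 0 ↔ z ∈ Q := fun z => Ideal.Quotient.eq_zero_iff_mem
  let ρ : B →+* MvPolynomial σ B ⧸ Q := π.comp cc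
  have hρ : ∀ b, π (cc b) = ρ b := fun b => rfl
  have ht0 : ρ t ≠ 0 := fun h => htQ ((hπ _).1 h)
  have hcancel : ∀ (l : ℕ) (z : B), t ^ l * z = 0 → ρ z = 0 := fun l z h => by
    have := congrArg ρ h
    rw [map_mul, map_pow, map_zero] at this
    exact (mul_eq_zero.1 this).resolve_left (pow_ne_zero _ ht0)
  rw [← hπ] at w1 w2 w3 w4
  simp only [map_mul, map_pow, map_kk, map_P5, map_ll, hρ] at w1 w2 w3 w4
  have e1 := hcancel _ _ d1
  have e2 := hcancel _ _ d2
  rw [map_sub, sub_eq_zero, map_mul, map_mul] at e1 e2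
  have hab' : ρ (μ1 g1) + ρ (μ2 g2) = 1 := by rw [← map_add, hab, map_one]
  obtain ⟨hx0, hy0⟩ := omega_zero (by rw [map_pow]; exact pow_ne_zero _ ht0) hab' e1 e2 w1 w2 w3 w4
  have hx1 := (mul_eq_zero.1 ((map_mul π _ _).symm.trans hx0)).resolve_left (by
    rw [map_pow, map_pow]; exact pow_ne_zero _ (pow_ne_zero _ ht0))
  have hy1 := (mul_eq_zero.1 ((map_mul π _ _).symm.trans hy0)).resolve_left (by
    rw [map_pow, map_pow]; exact pow_ne_zero _ (pow_ne_zero _ ht0))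
  rw [map_XF] at hx1
  rw [map_YF] at hy1
  have hx2 := eq_zero_of_pow_eq_zero hx1
  have hy2 := eq_zero_of_pow_eq_zero hy1
  have hcp : CharP (MvPolynomial σ B ⧸ Q) p := charP_of_hom p ρ
  obtain ⟨f1, f2⟩ := LD_zero p hm hn hx2 hy2
  simp only [hρ] at f1 f2
  have q3 := hcancel _ _ r3
  have q4 := hcancel _ _ r4
  have q5 := hcancel _ _ r5
  have q6 := hcancel _ _ r6
  simp only [map_sub, map_add, map_mul, map_pow] at q3 q4 q5 q6
  have v0 : π (ε vL) = 0 := by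
    have : ρ t ^ N' * (π (ε vL) ^ p ^ i) ^ (n + 1) = 0 := by
      linear_combination (π (ε vL) ^ p ^ i) ^ (n + 1) * q3 + ρ a * f1 + ρ b * f2 -
        (π (ε wL) ^ p ^ i) ^ (n + 1) * q4
    exact eq_zero_of_pow_eq_zero (eq_zero_of_pow_eq_zero
      ((mul_eq_zero.1 this).resolve_left (pow_ne_zero _ ht0)))
  have w0 : π (ε wL) = 0 := by
    have : ρ t ^ N' * (π (ε wL) ^ p ^ i) ^ (n + 1) = 0 := by
      linear_combination (π (ε wL) ^ p ^ i) ^ (n + 1) * q5 + ρ a' * f1 + ρ b' * f2 -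
        (π (ε vL) ^ p ^ i) ^ (n + 1) * q6
    exact eq_zero_of_pow_eq_zero (eq_zero_of_pow_eq_zero
      ((mul_eq_zero.1 this).resolve_left (pow_ne_zero _ ht0)))
  intro y
  obtain ⟨a, b, hy⟩ := hl.2.2 y.1 y.2
  have hy' : t • y = a • vL + b • wL := Subtype.ext hy
  have hy3 := congrArg (fun z => π (ε z)) hy'
  simp only [map_add, map_smul] at hy3
  rw [MvPolynomial.smul_eq_C_mul, MvPolynomial.smul_eq_C_mul, MvPolynomial.smul_eq_C_mul, map_mul, map_mul,
    map_mul, v0, w0, mul_zero, mul_zero, add_zero] at hy3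
  exact (hπ _).1 ((mul_eq_zero.1 hy3).resolve_left ht0)

end
end FpLci
end

section
universe u
namespace FpLci
open MvPolynomial
section
variable {R : Type*} [CommRing R] {σ : Type*}

theorem gs_hom (n d : ℕ) {a b : MvPolynomial σ R} (ha : a.IsHomogeneous d) (hb : b.IsHomogeneous d) :
    (gs (n + 1) a b).IsHomogeneous (d * n) := by
  induction n with
  | zero => simpa [gs] using isHomogeneous_one _ _
  | succ n ih =>
    have h1 : gs (n + 1 + 1) a b = a * gs (n + 1) a b + b ^ (n + 1) := rfl
    rw [h1]
    have := ha.mul ih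
    rw [show d + d * n = d * (n + 1) by ring] at this
    exact this.add (hb.pow _)

theorem lin_hom {d : ℕ} {a b : MvPolynomial σ R} (ha : a.IsHomogeneous d) (hb : b.IsHomogeneous d)
    (α β : R) : (C α * a + C β * b).IsHomogeneous d :=
  (ha.C_mul α).add (hb.C_mul β)

theorem XF_hom {n q f N : ℕ} {x y : MvPolynomial σ R} (hx : x.IsHomogeneous 1)
    (hy : y.IsHomogeneous 1) (α β γ δ : R) :
    (XF n q f N x y (C α) (C β) (C γ) (C δ)).IsHomogeneous ((q + q * (n + 1)) * (f * (n + 1) * N)) := by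
  have hx := hx.pow q
  have hy := hy.pow q
  rw [one_mul] at hx hy
  exact ((hx.mul (lin_hom (hx.pow _) (hy.pow _) γ δ)).sub
    (hy.mul (lin_hom (hx.pow _) (hy.pow _) α β))).pow _

theorem YF_hom {n q f N : ℕ} (hn : 0 < n) {x y : MvPolynomial σ R} (hx : x.IsHomogeneous 1)
    (hy : y.IsHomogeneous 1) (α β γ δ : R) :
    (YF n q f N x y (C α) (C β) (C γ) (C δ)).IsHomogeneous (q * (n + 1) * n * ((f + q) * N)) := by
  have hx := hx.pow q
  have hy := hy.pow q
  rw [one_mul] at hx hy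
  have l1 := lin_hom (hx.pow (n + 1)) (hy.pow (n + 1)) α β
  have l2 := lin_hom (hx.pow (n + 1)) (hy.pow (n + 1)) γ δ
  refine ((((l1.pow n).C_mul α).add ((l2.pow n).C_mul δ)).add ?_).pow _
  obtain ⟨n, rfl⟩ : ∃ k, n = k + 1 := ⟨n - 1, by omega⟩
  have := (((hx.mul hy).C_mul (α * δ - β * γ))).mul (gs_hom n _ (hx.mul l2) (hy.mul l1))
  rw [show q + q + (q + q * (n + 1 + 1)) * n = q * (n + 1 + 1) * (n + 1) by ring] at this
  simpa only [map_sub, map_mul] using this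

end

section
variable {B : Type u} [CommRing B]

theorem F10_main [IsNoetherianRing B] [IsReduced B] {k : Type*} [Field k] [IsAlgClosed k] (p : ℕ)
    [hp : Fact p.Prime]
    [CharP k p] [CharP B p] [Algebra (ZMod p) k]
    [Algebra.IsAlgebraic (ZMod p) k] [Algebra k B] [Algebra (ZMod p) B]
    [IsScalarTower (ZMod p) k B] [Algebra.FiniteType k B]
    (hd : DimLt (⊥ : Ideal B) 3) {L : Submodule B (B × B)}
    (hL : ∀ p : Ideal B, p.IsPrime → ∃ t ∉ p, ∃ v w, LocGen L t v w)
    {s : B} (hs : s ∈ cI L) (hs' : s ∈ nonZeroDivisors B) {v0 w0 : B × B} (hv0 : v0 ∈ L)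
    (hw0 : w0 ∈ L) (h1 : v0.1 + w0.2 = 1) {ν : ℕ} (vl : Fin ν → L) (φ : Fin ν → (L →ₗ[B] B))
    (hφ : ∀ y, y = ∑ l, φ l y • vl l) :
    ∃ (d d' : ℕ) (γ1 γ2 η1 η2 : MvPolynomial (Fin ν) B) (e11 e12 e21 e22 : B),
      0 < d ∧ 0 < d' ∧ γ1.IsHomogeneous d ∧ γ2.IsHomogeneous d ∧ η1.IsHomogeneous d' ∧ η2.IsHomogeneous d' ∧
      e11 + e22 = 1 ∧ e11 * e22 = e12 * e21 ∧
      C e11 * γ1 + C e12 * γ2 = γ1 ∧ C e21 * γ1 + C e22 * γ2 = γ2 ∧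
      C e11 * η1 + C e21 * η2 = η1 ∧ C e12 * η1 + C e22 * η2 = η2 ∧
      ∀ q : Ideal B, q.IsPrime → ∃ t ∉ q, ∀ y : L, C t * (∑ l, C (φ l y) * X l) ∈
        (Ideal.span {γ1, γ2, η1, η2}).radical := by
  obtain ⟨Xm, Xm', e, e', i, m, ⟨E⟩, hX, hX', hm, he⟩ := F8_main (k := k) p hd hL hs hs' hv0 hw0 h1
  have := cI_inv hL hs hs'
  have hdc : DimLt (⊥ : Ideal (B ⧸ cI L)) 2 :=
    ((DimLt.drop_nzd hd hs').anti ((Ideal.span_singleton_le_iff_mem _).2 hs)).quot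
  obtain ⟨N, hN, h2g⟩ := two_gen (k := k) p (cI L) hdc
  have hpm : p ^ i < p ^ (i + m) := Nat.pow_lt_pow_right hp.out.one_lt (by omega)
  obtain ⟨f, rfl⟩ : ∃ f, e = e' + f := ⟨e - e', by omega⟩
  have hpm1 : 1 < p ^ m := Nat.one_lt_pow hm.ne' hp.out.one_lt
  obtain ⟨n, hn⟩ : ∃ n, n + 1 = p ^ m := ⟨p ^ m - 1, by omega⟩
  have hn0 : 0 < n := by omega
  have hf : 2 * f = p ^ i * n := by
    rw [pow_add, ← hn] at he
    have : p ^ i * (n + 1) = p ^ i * n + p ^ i := by ring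
    omega
  obtain ⟨W, hW⟩ : ∃ W, W = f * (n + 1) * ((f + p ^ i) * N) := ⟨_, rfl⟩
  have hW0 : 0 < 2 * W := by
    have h1 : 0 < p ^ i * n := Nat.mul_pos (Nat.pow_pos hp.out.pos) hn0
    have h2 : 0 < f := by omega
    rw [hW]
    positivity
  obtain ⟨g1, g2, hg⟩ := h2g (f * (n + 1) * (f + p ^ i))
  rw [show N * (f * (n + 1) * (f + p ^ i)) = W by rw [hW]; ring] at hg
  obtain ⟨μ1, μ2, hμ⟩ := exists_mu (cI L) W hg
  have hg1 : g1 ∈ cI L ^ W := hg ▸ Ideal.subset_span (by simp)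
  have hg2 : g2 ∈ cI L ^ W := hg ▸ Ideal.subset_span (by simp)
  let K := FractionRing B
  let a : B →+* K := algebraMap B K
  have hinj : Function.Injective a := IsFractionRing.injective B K
  have hmapinj : Function.Injective (MvPolynomial.map (σ := Fin ν) a) := MvPolynomial.map_injective _ hinj
  have hred : IsReduced K := isReduced_localizationPreserves (nonZeroDivisors B) K inferInstance
  have hsu : IsUnit (a s) := IsLocalization.map_units K (⟨s, hs'⟩ : nonZeroDivisors B)
  obtain ⟨si, hsi⟩ := hsu.exists_right_inv
  -- the matrix of the isomorphism
  let M := 2 * (e' + f) + p ^ i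
  have hsL : ∀ x, s • x ∈ L := fun x => cI_smul_mem hs x
  have hb := hX.1 _ (hsL (1, 0)) _ (hsL (0, 1))
  have hom : om (s • ((1 : B), (0 : B))) (s • ((0 : B), (1 : B))) = s ^ 2 := by
    simp [om]; ring
  have hb1 : s ^ M • ((1 : B), (0 : B)) ∈ Xm := by
    have := hb.1
    rw [hom, fr_smul] at this
    convert this using 1
    ext
    · simp [fr, M]; ring
    · simp [fr, hp.out.ne_zero]
  have hb2 : s ^ M • ((0 : B), (1 : B)) ∈ Xm := by
    have := hb.2
    rw [hom, fr_smul] at this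
    convert this using 1
    ext
    · simp [fr, hp.out.ne_zero]
    · simp [fr, M]; ring
  have hsiM : ∀ j, a s ^ j * si ^ j = 1 := fun j => by rw [← mul_pow, hsi, one_pow]
  let T1 := (E.symm ⟨_, hb1⟩).1
  let T2 := (E.symm ⟨_, hb2⟩).1
  have hT : ∀ x : Xm, s ^ M • (E.symm x).1 = x.1.1 • T1 + x.1.2 • T2 := by
    intro x
    have : s ^ M • x = x.1.1 • (⟨_, hb1⟩ : Xm) + x.1.2 • (⟨_, hb2⟩ : Xm) := by
      apply Subtype.ext
      ext
      · simp [mul_comm]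
      · simp [mul_comm]
    have h := congrArg (fun z => (E.symm z).1) this
    beta_reduce at h
    rw [map_smul, map_add, map_smul, map_smul] at h
    exact h
  have hk1 : ∀ x : Xm, a (E.symm x).1.1 = (si ^ M * a T1.1) * a x.1.1 + (si ^ M * a T2.1) * a x.1.2 := by
    intro x
    have h := congrArg (fun z => a z.1) (hT x)
    simp only [Prod.smul_fst, Prod.fst_add, smul_eq_mul, map_mul, map_add, map_pow] at h
    linear_combination si ^ M * h - a (E.symm x).1.1 * hsiM M
  have hk2 : ∀ x : Xm, a (E.symm x).1.2 = (si ^ M * a T1.2) * a x.1.1 + (si ^ M * a T2.2) * a x.1.2 := by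
    intro x
    have h := congrArg (fun z => a z.2) (hT x)
    simp only [Prod.smul_snd, Prod.snd_add, smul_eq_mul, map_mul, map_add, map_pow] at h
    linear_combination si ^ M * h - a (E.symm x).1.2 * hsiM M
  -- inverse ideal
  have hsW : s ^ W ∈ cI L ^ W := Ideal.pow_mem_pow hs _
  have hμc : ∀ (μ : ↥(cI L ^ W) →ₗ[B] B) z, (si ^ W * a (μ ⟨_, hsW⟩)) * a z.1 = a (μ z) := by
    intro μ z
    have h : s ^ W * μ z = z.1 * μ ⟨_, hsW⟩ := by
      rw [← smul_eq_mul, ← smul_eq_mul, ← map_smul, ← map_smul]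
      congr 1
      apply Subtype.ext
      simp [mul_comm]
    have h := congrArg a h
    simp only [map_mul, map_pow] at h
    linear_combination - si ^ W * h + a (μ z) * hsiM W
  obtain ⟨u1, hu1'⟩ : ∃ u, u = si ^ W * a (μ1 ⟨_, hsW⟩) := ⟨_, rfl⟩
  obtain ⟨u2, hu2'⟩ : ∃ u, u = si ^ W * a (μ2 ⟨_, hsW⟩) := ⟨_, rfl⟩
  have hu1 : ∀ z : ↥(cI L ^ W), u1 * a z.1 = a (μ1 z) := fun z => by rw [hu1', hμc]
  have hu2 : ∀ z : ↥(cI L ^ W), u2 * a z.1 = a (μ2 z) := fun z => by rw [hu2', hμc]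
  let G1 : ↥(cI L ^ W) := ⟨g1, hg1⟩
  let G2 : ↥(cI L ^ W) := ⟨g2, hg2⟩
  have hug : u1 * a g1 + u2 * a g2 = 1 := by
    have h := congrArg a (hμ ⟨_, hsW⟩)
    simp only [map_add, map_mul, map_pow] at h
    rw [hu1', hu2']
    linear_combination si ^ W * h + hsiM W
  have hab : μ1 G1 + μ2 G2 = 1 := by
    apply hinj
    rw [map_add, map_one, ← hu1, ← hu2]
    exact hug
  -- the forms
  let ε : L →ₗ[B] MvPolynomial (Fin ν) B :=
    { toFun := fun y => ∑ l, C (φ l y) * X l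
      map_add' := fun x y => by simp only [map_add, add_mul, Finset.sum_add_distrib]
      map_smul' := fun r y => by
        simp only [map_smul, smul_eq_mul, map_mul, RingHom.id_apply, MvPolynomial.smul_eq_C_mul,
          Finset.mul_sum, mul_assoc] }
  have hεh : ∀ y, (ε y).IsHomogeneous 1 := fun y => by
    apply IsHomogeneous.sum
    intro l _
    exact (isHomogeneous_X _ l).C_mul _
  let X1 : MvPolynomial (Fin ν) K := C si * MvPolynomial.map a (ε ⟨_, hsL (1, 0)⟩)
  let X2 : MvPolynomial (Fin ν) K := C si * MvPolynomial.map a (ε ⟨_, hsL (0, 1)⟩)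
  have hX1 : X1.IsHomogeneous 1 := ((hεh _).map a).C_mul _
  have hX2 : X2.IsHomogeneous 1 := ((hεh _).map a).C_mul _
  have hε : ∀ y : L, MvPolynomial.map a (ε y) = C (a y.1.1) * X1 + C (a y.1.2) * X2 := by
    intro y
    have h : s • y = y.1.1 • (⟨_, hsL (1, 0)⟩ : L) + y.1.2 • (⟨_, hsL (0, 1)⟩ : L) := by
      apply Subtype.ext
      ext
      · simp [mul_comm]
      · simp [mul_comm]
    have h := congrArg (fun z => MvPolynomial.map a (ε z)) h
    simp only [map_add, map_smul, MvPolynomial.smul_eq_C_mul, map_mul, map_C] at h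
    have hC : C (a s) * C si = (1 : MvPolynomial (Fin ν) K) := by rw [← C_mul, hsi, C_1]
    simp only [X1, X2]
    linear_combination C si * h - MvPolynomial.map a (ε y) * hC
  have hε0 : ∀ (F : Type u) [Field F] (ψ : K →+* F) (y : L),
      MvPolynomial.map ψ (MvPolynomial.map a (ε y)) = 0 → ψ (a y.1.1) = 0 ∧ ψ (a y.1.2) = 0 := by
    intro F _ ψ y h
    have hc : ∀ l, ψ (a (φ l y)) = 0 := by
      intro l
      have h2 := congrArg (coeff (Finsupp.single l 1)) h
      have h3 : coeff (Finsupp.single l 1) (ε y) = φ l y := by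
        change coeff (Finsupp.single l 1) (∑ l, C (φ l y) * X l) = φ l y
        rw [coeff_sum, Finset.sum_eq_single l]
        · simp
        · intro j _ hj
          rw [coeff_C_mul, coeff_X, if_neg, mul_zero]
          intro hh
          exact hj (Finsupp.single_left_injective one_ne_zero hh)
        · simp
      rw [coeff_map, coeff_map, h3, coeff_zero] at h2
      exact h2
    have hy := congrArg Subtype.val (hφ y)
    rw [Submodule.coe_sum] at hy
    constructor
    · rw [hy, Prod.fst_sum, map_sum, map_sum]
      exact Finset.sum_eq_zero fun l _ => by simp [hc]
    · rw [hy, Prod.snd_sum, map_sum, map_sum]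
      exact Finset.sum_eq_zero fun l _ => by simp [hc]
  have loc := fun t v w (hl : LocGen L t v w) =>
    loc_main p hm hn hW hX hX' E hk1 hk2 hs hs' hsu ε hε hε0 G1 G2 μ1 μ2 hu1 hu2 hab hl
  beta_reduce at loc
  generalize hα : si ^ M * a T1.1 = α at *
  generalize hβ : si ^ M * a T1.2 = β at *
  generalize hγ : si ^ M * a T2.1 = γ at *
  generalize hδ : si ^ M * a T2.2 = δ at *
  clear hα hβ hγ hδ
  obtain ⟨Xg, hXg⟩ : ∃ z, z = XF n (p ^ i) f N X1 X2 (C α) (C β) (C γ) (C δ) := ⟨_, rfl⟩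
  obtain ⟨Yg, hYg⟩ : ∃ z, z = YF n (p ^ i) f N X1 X2 (C α) (C β) (C γ) (C δ) := ⟨_, rfl⟩
  rw [← hXg, ← hYg] at loc
  have hXh : Xg.IsHomogeneous (2 * W) := by
    have := XF_hom (n := n) (q := p ^ i) (f := f) (N := N) hX1 hX2 α β γ δ
    have h3 : 2 * f + 2 * p ^ i = p ^ i + p ^ i * (n + 1) := by rw [hf]; ring
    rw [← hXg, ← h3, show (2 * f + 2 * p ^ i) * (f * (n + 1) * N) = 2 * W by rw [hW]; ring] at this
    exact this
  have hYh : Yg.IsHomogeneous (2 * W) := by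
    have := YF_hom (q := p ^ i) (f := f) (N := N) hn0 hX1 hX2 α β γ δ
    rw [← hYg, show p ^ i * (n + 1) * n = (p ^ i * n) * (n + 1) by ring, ← hf,
      show 2 * f * (n + 1) * ((f + p ^ i) * N) = 2 * W by rw [hW]; ring] at this
    exact this
  let c' : B →+* MvPolynomial (Fin ν) K := MvPolynomial.C.comp a
  have hc' : ∀ b, MvPolynomial.map a (C b : MvPolynomial (Fin ν) B) = c' b := fun b => by simp [c']
  let kf := kk (C u1) (C u2) Xg Yg
  let lf := ll (c' g1) (c' g2) (c' (μ1 G1)) (c' (μ2 G2)) Xg Yg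
  have hkh : kf.IsHomogeneous (2 * W) := by
    simp only [kf, kk, ← C_pow]
    exact (hXh.C_mul _).sub (hYh.C_mul _)
  have hlh : lf.IsHomogeneous (2 * W) := by
    have : lf = C (a (g1 ^ 2 * (μ1 G1 + 3 * μ2 G2))) * Xg + C (a (g2 ^ 2 * (3 * μ1 G1 + μ2 G2))) * Yg := by
      simp only [lf, ll, c', RingHom.comp_apply, map_mul, map_add, map_pow, map_ofNat]
    rw [this]
    exact lin_hom hXh hYh _ _
  have glue : ∀ z : MvPolynomial (Fin ν) K, (∀ t v w, LocGen L t v w → ∃ (M : ℕ) (y : _),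
      MvPolynomial.map a y = c' t ^ M * z) → ∃ y, MvPolynomial.map a y = z := by
    intro z hz
    apply glue_poly (B := B)
    intro q hq
    obtain ⟨t, ht, v, w, hl⟩ := hL q hq
    obtain ⟨M, y, hy⟩ := hz t v w hl
    refine ⟨t ^ M, fun h => ht (hq.mem_of_pow_mem _ h), y, ?_⟩
    change MvPolynomial.map a y = _
    rw [hy, map_pow, map_pow]
    rfl
  obtain ⟨γ1, hγ1⟩ := glue (c' g1 ^ 3 * kf) fun t v w hl => by
    obtain ⟨M, M', y1, y2, y3, y4, w1, w2, w3, w4, -⟩ := loc t v w hl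
    exact ⟨M, y1, w1⟩
  obtain ⟨γ2, hγ2⟩ := glue (c' g2 ^ 3 * kf) fun t v w hl => by
    obtain ⟨M, M', y1, y2, y3, y4, w1, w2, w3, w4, -⟩ := loc t v w hl
    exact ⟨M, y2, w2⟩
  obtain ⟨η1, hη1⟩ := glue (C u1 ^ 3 * P5 (c' (μ1 G1)) (c' (μ2 G2)) * lf ^ 3) fun t v w hl => by
    obtain ⟨M, M', y1, y2, y3, y4, w1, w2, w3, w4, -⟩ := loc t v w hl
    exact ⟨M', y3, w3⟩
  obtain ⟨η2, hη2⟩ := glue (C u2 ^ 3 * P5 (c' (μ2 G2)) (c' (μ1 G1)) * lf ^ 3) fun t v w hl => by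
    obtain ⟨M, M', y1, y2, y3, y4, w1, w2, w3, w4, -⟩ := loc t v w hl
    exact ⟨M', y4, w4⟩
  have m11 : a (μ1 G1) = u1 * a g1 := (hu1 G1).symm
  have m21 : a (μ1 G2) = u1 * a g2 := (hu1 G2).symm
  have m12 : a (μ2 G1) = u2 * a g1 := (hu2 G1).symm
  have m22 : a (μ2 G2) = u2 * a g2 := (hu2 G2).symm
  have hsum := P5_sum hug
  have hsum' : (c' (μ1 G1)) ^ 3 * P5 (c' (μ1 G1)) (c' (μ2 G2)) +
      (c' (μ2 G2)) ^ 3 * P5 (c' (μ2 G2)) (c' (μ1 G1)) = 1 := by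
    apply P5_sum
    rw [← map_add, hab, map_one]
  have n11 : c' (μ1 G1) = C u1 * c' g1 := by simp [c', m11]
  have n21 : c' (μ1 G2) = C u1 * c' g2 := by simp [c', m21]
  have n12 : c' (μ2 G1) = C u2 * c' g1 := by simp [c', m12]
  have n22 : c' (μ2 G2) = C u2 * c' g2 := by simp [c', m22]
  refine ⟨2 * W, 2 * W * 3, γ1, γ2, η1, η2, μ1 G1 ^ 3 * P5 (μ1 G1) (μ2 G2), μ2 G1 ^ 3 * P5 (μ2 G2) (μ1 G1),
    μ1 G2 ^ 3 * P5 (μ1 G1) (μ2 G2), μ2 G2 ^ 3 * P5 (μ2 G2) (μ1 G1), hW0, by omega, ?_, ?_, ?_, ?_, ?_, ?_, ?_, ?_, ?_, ?_, ?_⟩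
  · refine IsHomogeneous.of_map hinj ?_
    rw [hγ1, ← map_pow]
    exact hkh.C_mul _
  · refine IsHomogeneous.of_map hinj ?_
    rw [hγ2, ← map_pow]
    exact hkh.C_mul _
  · refine IsHomogeneous.of_map hinj ?_
    rw [hη1, ← map_pow, ← map_P5, mul_assoc]
    exact ((hlh.pow 3).C_mul _).C_mul _
  · refine IsHomogeneous.of_map hinj ?_
    rw [hη2, ← map_pow, ← map_P5, mul_assoc]
    exact ((hlh.pow 3).C_mul _).C_mul _
  · exact P5_sum hab
  · apply hinj
    simp only [map_mul, map_pow, m11, m12, m21, m22]; ring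
  · apply hmapinj
    simp only [map_add, map_mul, hc', map_pow, map_P5, hγ1, hγ2]
    rw [n12]
    rw [n11, n22] at hsum' ⊢
    linear_combination c' g1 ^ 3 * kf * hsum'
  · apply hmapinj
    simp only [map_add, map_mul, hc', map_pow, map_P5, hγ1, hγ2]
    rw [n21]
    rw [n11, n22] at hsum' ⊢
    linear_combination c' g2 ^ 3 * kf * hsum'
  · apply hmapinj
    simp only [map_add, map_mul, hc', map_pow, map_P5, hη1, hη2]
    rw [n21]
    rw [n11, n22] at hsum' ⊢
    linear_combination C u1 ^ 3 * P5 (C u1 * c' g1) (C u2 * c' g2) * lf ^ 3 * hsum'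
  · apply hmapinj
    simp only [map_add, map_mul, hc', map_pow, map_P5, hη1, hη2]
    rw [n12]
    rw [n11, n22] at hsum' ⊢
    linear_combination C u2 ^ 3 * P5 (C u2 * c' g2) (C u1 * c' g1) * lf ^ 3 * hsum'
  · intro q hq
    obtain ⟨t, ht, v, w, hl⟩ := hL q hq
    refine ⟨t, ht, fun y => ?_⟩
    change C t * ε y ∈ _
    rw [Ideal.radical_eq_sInf, Submodule.mem_sInf]
    rintro (Q : Ideal _) ⟨hle, hQ⟩
    by_cases htQ : C t ∈ Q
    · exact Ideal.mul_mem_right _ _ htQ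
    obtain ⟨M, M', y1, y2, y3, y4, w1, w2, w3, w4, hfin⟩ := loc t v w hl
    have fin : ∀ (M : ℕ) (y z : MvPolynomial (Fin ν) B), MvPolynomial.map a y = c' t ^ M *
        MvPolynomial.map a z → z ∈ ({γ1, γ2, η1, η2} : Set (MvPolynomial (Fin ν) B)) → y ∈ Q := by
      intro M y z h hz
      rw [← hc', ← map_pow, ← map_mul] at h
      rw [hmapinj h]
      exact Ideal.mul_mem_left _ _ (hle (Ideal.subset_span hz))
    exact Ideal.mul_mem_left _ _ (hfin Q hQ htQ (fin M _ γ1 (hγ1 ▸ w1) (by simp))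
      (fin M _ γ2 (hγ2 ▸ w2) (by simp)) (fin M' _ η1 (hη1 ▸ w3) (by simp))
      (fin M' _ η2 (hη2 ▸ w4) (by simp)) y)

end
end FpLci
end

section
universe u
namespace FpLci

section F7
variable {B : Type u} [CommRing B] {P : Type u} [AddCommGroup P] [Module B P]

theorem nzd_of_minimal [IsReduced B] {x : B} (hx : ∀ q ∈ (⊥ : Ideal B).minimalPrimes, x ∉ q) :
    x ∈ nonZeroDivisors B := by
  rw [mem_nonZeroDivisors_iff_right]
  intro y hy
  have : y ∈ (⊥ : Ideal B).radical := by
    rw [← Ideal.sInf_minimalPrimes, Ideal.mem_sInf]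
    intro q hq
    have hqp := hq.1.1
    exact (hqp.mem_or_mem (show y * x ∈ q by rw [hy]; exact q.zero_mem)).resolve_right (hx q hq)
  obtain ⟨n, hn⟩ := this
  exact (IsReduced.eq_zero y ⟨n, hn⟩)

theorem glue_bot [IsNoetherianRing B] [IsReduced B] {n : ℕ} (hM : LocFree B P n) :
    ∃ h ∈ nonZeroDivisors B,
      ∃ (α : (Fin n → B) →ₗ[B] P) (β : P →ₗ[B] (Fin n → B)),
        (∀ v, β (α v) = h • v) ∧ (∀ m, α (β m) = h • m) := by
  classical
  have hfin : (⊥ : Ideal B).minimalPrimes.Finite := Ideal.finite_minimalPrimes_of_isNoetherianRing B ⊥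
  let S := hfin.toFinset
  have hS : ∀ {q}, q ∈ S ↔ q ∈ (⊥ : Ideal B).minimalPrimes := hfin.mem_toFinset
  have hinc : ∀ q ∈ S, ∀ q' ∈ S, q ≤ q' → q = q' := fun q hq q' hq' hle =>
    le_antisymm hle ((hS.1 hq').2 ((hS.1 hq).1) hle)
  have hu : ∀ q : S, ∃ u : B, u ∉ q.1 ∧ ∀ q' ∈ S, q' ≠ q.1 → u ∈ q' := by
    intro q
    obtain ⟨c, h1, h2⟩ := exists_prescribed S (fun q hq => (hS.1 hq).1.1) hinc (fun q' => q' = q.1)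
    exact ⟨c, h1 _ q.2 rfl, fun q' hq' hne => h2 q' hq' hne⟩
  choose u hu1 hu2 using hu
  have ht := fun q : S => hM q.1 (hS.1 q.2).1.1
  choose t ht α β hαβ hβα using ht
  have hmem0 : ∀ x : B, (∀ q ∈ S, x ∈ q) → x = 0 := by
    intro x hx
    have : x ∈ (⊥ : Ideal B).radical := by
      rw [← Ideal.sInf_minimalPrimes, Ideal.mem_sInf]
      exact fun q hq => hx q (hS.2 hq)
    obtain ⟨n, hn⟩ := this
    exact (IsReduced.eq_zero x ⟨n, hn⟩)
  have huu : ∀ x y : S, x ≠ y → u x * u y = 0 := by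
    intro x y hxy
    apply hmem0
    intro q hq
    by_cases h : q = x.1
    · exact q.mul_mem_left _ (hu2 y q hq (fun h' => hxy (Subtype.ext (h.symm.trans h'))))
    · exact q.mul_mem_right _ (hu2 x q hq h)
  refine ⟨∑ q, u q ^ 2 * t q, ?_, ∑ q, u q • α q, ∑ q, u q • β q, ?_, ?_⟩
  · apply nzd_of_minimal
    intro q hq hmem
    have hqS : q ∈ S := hS.2 hq
    rw [← Finset.add_sum_erase _ _ (Finset.mem_univ (⟨q, hqS⟩ : S))] at hmem
    have h2 : ∑ x ∈ Finset.univ.erase (⟨q, hqS⟩ : S), u x ^ 2 * t x ∈ q := by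
      refine Ideal.sum_mem _ fun x hx => ?_
      refine q.mul_mem_right _ (q.pow_mem_of_mem (hu2 x q hqS ?_) 2 (by norm_num))
      rintro rfl
      exact (Finset.mem_erase.1 hx).1 rfl
    have h3 := (Ideal.add_mem_iff_left q h2).1 hmem
    have hqp := hq.1.1
    rcases hqp.mem_or_mem h3 with h | h
    · exact hu1 ⟨q, hqS⟩ (hqp.mem_of_pow_mem _ h)
    · exact ht ⟨q, hqS⟩ h
  · intro v
    simp only [LinearMap.sum_apply, LinearMap.smul_apply, map_sum, Finset.sum_smul]
    refine Finset.sum_congr rfl fun x _ => ?_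
    rw [Finset.sum_eq_single x]
    · rw [map_smul, hβα, smul_smul, smul_smul]; congr 1; ring
    · intro y _ hy
      rw [map_smul, smul_smul, huu _ _ hy, zero_smul]
    · simp
  · intro v
    simp only [LinearMap.sum_apply, LinearMap.smul_apply, map_sum, Finset.sum_smul]
    refine Finset.sum_congr rfl fun x _ => ?_
    rw [Finset.sum_eq_single x]
    · rw [map_smul, hαβ, smul_smul, smul_smul]; congr 1; ring
    · intro y _ hy
      rw [map_smul, smul_smul, huu _ _ hy, zero_smul]
    · simp

theorem LocFree.dual {n : ℕ} (hM : LocFree B P n) : LocFree B (P →ₗ[B] B) n := by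
  classical
  intro p hp
  obtain ⟨t, ht, α, β, h1, h2⟩ := hM p hp
  have key : ∀ v : Fin n → B, v = ∑ i, v i • Pi.single i 1 := fun v => by
    ext j; simp [Finset.sum_apply, Pi.single_apply]
  refine ⟨t, ht, 
    { toFun := fun v => ∑ i, v i • (LinearMap.proj i ∘ₗ β)
      map_add' := fun x y => by simp [add_smul, Finset.sum_add_distrib]
      map_smul' := fun r y => by simp [mul_smul, Finset.smul_sum] },
    { toFun := fun ψ i => ψ (α (Pi.single i 1))
      map_add' := fun x y => by ext; simp
      map_smul' := fun r y => by ext; simp }, ?_, ?_⟩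
  · intro ψ
    ext m
    simp only [LinearMap.coe_mk, AddHom.coe_mk, LinearMap.sum_apply, LinearMap.smul_apply,
      LinearMap.comp_apply, LinearMap.proj_apply, smul_eq_mul]
    rw [← smul_eq_mul t, ← map_smul, ← h1]
    conv_rhs => rw [key (β m)]
    simp [mul_comm]
  · intro v
    ext i
    simp [h2, Pi.single_apply, mul_comm]

theorem LocFree.torsion_free {n : ℕ} (hM : LocFree B P n) {h : B} (hh : h ∈ nonZeroDivisors B)
    {z : P} (hz : h • z = 0) : z = 0 := by
  have htop : (Ideal.span {b : B | b • z = 0}) = ⊤ := by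
    apply eq_top_of_no_prime
    intro p hp hle
    obtain ⟨t, ht, α, β, h1, h2⟩ := hM p hp
    apply ht
    apply hle
    apply Ideal.subset_span
    have : β z = 0 := by
      have := congrArg β hz
      rw [map_smul, map_zero] at this
      ext i
      have := congrFun this i
      simp only [Pi.smul_apply, smul_eq_mul, Pi.zero_apply] at this ⊢
      exact (mem_nonZeroDivisors_iff.1 hh).1 _ this
    change t • z = 0
    rw [← h1, this, map_zero]
  have h1 : (1 : B) ∈ (LinearMap.ker (LinearMap.toSpanSingleton B P z)) := by
    have : Ideal.span {b : B | b • z = 0} ≤ LinearMap.ker (LinearMap.toSpanSingleton B P z) := by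
      rw [Ideal.span_le]
      intro b hb
      simpa using hb
    exact this (htop ▸ Submodule.mem_top)
  simpa using h1

theorem LocFree.dualBasis {n : ℕ} (hM : LocFree B P n) :
    ∃ (ν : ℕ) (vl : Fin ν → P) (φ : Fin ν → (P →ₗ[B] B)), ∀ y, y = ∑ l, φ l y • vl l := by
  classical
  let J : Ideal B := 
    { carrier := {b | ∃ (ν : ℕ) (vl : Fin ν → P) (φ : Fin ν → (P →ₗ[B] B)), 
        ∀ y, b • y = ∑ l, φ l y • vl l}
      zero_mem' := ⟨0, Fin.elim0, Fin.elim0, by simp⟩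
      add_mem' := by
        rintro a b ⟨ν, vl, φ, h⟩ ⟨ν', vl', φ', h'⟩
        refine ⟨ν + ν', Fin.append vl vl', Fin.append φ φ', fun y => ?_⟩
        rw [Fin.sum_univ_add, add_smul, h, h']
        simp
      smul_mem' := by
        rintro a b ⟨ν, vl, φ, h⟩
        refine ⟨ν, fun l => a • vl l, φ, fun y => ?_⟩
        rw [smul_eq_mul, mul_smul, h, Finset.smul_sum]
        exact Finset.sum_congr rfl fun l _ => smul_comm _ _ _ }
  have : J = ⊤ := by
    apply eq_top_of_no_prime
    intro p hp hle
    obtain ⟨t, ht, α, β, h1, h2⟩ := hM p hp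
    refine ht (hle ⟨n, fun i => α (Pi.single i 1), fun i => LinearMap.proj i ∘ₗ β, fun y => ?_⟩)
    have key : ∀ v : Fin n → B, v = ∑ i, v i • Pi.single i 1 := fun v => by
      ext j; simp [Finset.sum_apply, Pi.single_apply]
    rw [← h1]
    conv_lhs => rw [key (β y)]
    simp
  obtain ⟨ν, vl, φ, h⟩ : (1 : B) ∈ J := this ▸ Submodule.mem_top
  exact ⟨ν, vl, φ, fun y => by rw [← h, one_smul]⟩

/-- embed a rank two module into `B × B` -/
theorem exists_embed [IsNoetherianRing B] [IsReduced B] (hP : LocFree B P 2)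
    (hd : DimLt (⊥ : Ideal B) 3) :
    ∃ σ : P →ₗ[B] (B × B), Function.Injective σ ∧ 
      (∃ a b, om (σ a) (σ b) ∈ nonZeroDivisors B) ∧ (∃ a b, (σ a).1 + (σ b).2 = 1) := by
  obtain ⟨h, hh, α, β, hβα, hαβ⟩ := glue_bot hP
  obtain ⟨s2, hs2⟩ := srm hP.dual 2 le_rfl (Ideal.span {h}) (hd.drop_nzd hh) 0 1
    (fun p hp _ h1 => absurd ((Ideal.eq_top_iff_one p).2 h1) hp.ne_top)
  simp only [one_smul, zero_add] at hs2
  have hr : LinearMap.range s2 ⊔ Ideal.span {h} = ⊤ := by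
    apply eq_top_of_no_prime
    intro p hp hle
    refine hs2 p hp (le_sup_right.trans hle) ?_
    intro z hz
    obtain ⟨Φ, rfl⟩ := mem_ordI.1 hz
    obtain ⟨t, ht, α', β', h1, h2⟩ := hP p hp
    have : t • s2 = ∑ i, s2 (α' (Pi.single i 1)) • (LinearMap.proj i ∘ₗ β') := by
      ext m
      have key : ∀ v : Fin 2 → B, v = ∑ i, v i • Pi.single i 1 := fun v => by
        ext j; simp [Finset.sum_apply, Pi.single_apply]
      rw [LinearMap.smul_apply, ← map_smul, ← h1]
      conv_lhs => rw [key (β' m)]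
      simp [mul_comm]
    have h3 : t * Φ s2 ∈ p := by
      rw [← smul_eq_mul, ← map_smul, this, map_sum]
      refine Ideal.sum_mem _ fun i _ => ?_
      rw [map_smul, smul_eq_mul]
      exact p.mul_mem_right _ (le_sup_left.trans hle ⟨_, rfl⟩)
    exact (hp.mem_or_mem h3).resolve_left ht
  let a0 := α (Pi.single 0 1)
  let b0 := α (Pi.single 1 1)
  have hfin : (⊥ : Ideal B).minimalPrimes.Finite := Ideal.finite_minimalPrimes_of_isNoetherianRing B ⊥
  have hS : ∀ {q}, q ∈ hfin.toFinset ↔ q ∈ (⊥ : Ideal B).minimalPrimes := hfin.mem_toFinset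
  have hinc : ∀ q ∈ hfin.toFinset, ∀ q' ∈ hfin.toFinset, q ≤ q' → q = q' := fun q hq q' hq' hle =>
    le_antisymm hle ((hS.1 hq').2 ((hS.1 hq).1) hle)
  obtain ⟨r, hr1⟩ := exists_add_mul_notMem hfin.toFinset (fun q hq => (hS.1 hq).1.1) hinc 
    (s2 b0) (h * h)
  have hnz : s2 b0 + h * h * r ∈ nonZeroDivisors B := by
    apply nzd_of_minimal
    intro q hq
    apply hr1 q (hS.2 hq)
    intro hmem
    exact Set.disjoint_left.1 (Ideal.disjoint_nonZeroDivisors_of_mem_minimalPrimes hq) hmem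
      (mul_mem hh hh)
  have hβa0 : β a0 = h • Pi.single 0 1 := hβα _
  have hβb0 : β b0 = h • Pi.single 1 1 := hβα _
  let s2' : P →ₗ[B] B := s2 + (h * r) • (LinearMap.proj 1 ∘ₗ β)
  have hs2b : s2' b0 = s2 b0 + h * h * r := by
    simp [s2', hβb0]; ring
  have hσ : ∀ z, LinearMap.prod (LinearMap.proj 0 ∘ₗ β) s2' z = (β z 0, s2' z) := fun _ => rfl
  refine ⟨LinearMap.prod (LinearMap.proj 0 ∘ₗ β) s2', ?_, ⟨a0, b0, ?_⟩, ?_⟩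
  · rw [← LinearMap.ker_eq_bot, LinearMap.ker_eq_bot']
    intro z hz
    simp only [hσ, Prod.mk_eq_zero] at hz
    have h1 : h • z = β z 1 • b0 := by
      have : β z = β z 1 • Pi.single 1 1 := by
        ext i; fin_cases i
        · simp [hz.1]
        · simp
      rw [← hαβ, this, map_smul]
      simp [b0]
    have h2 : β z 1 * (s2 b0 + h * h * r) = 0 := by
      rw [← hs2b, ← smul_eq_mul, ← map_smul, ← h1, map_smul, hz.2, smul_zero]
    have h3 := (mem_nonZeroDivisors_iff.1 hnz).2 _ h2
    rw [h3, zero_smul] at h1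
    exact hP.torsion_free hh h1
  · have : om ((LinearMap.prod (LinearMap.proj 0 ∘ₗ β) s2') a0) 
        ((LinearMap.prod (LinearMap.proj 0 ∘ₗ β) s2') b0) = h * (s2 b0 + h * h * r) := by
      simp only [hσ, om, hs2b,
        hβa0, hβb0]
      simp
    rw [this]
    exact mul_mem hh hnz
  · have h1 : (1 : B) ∈ LinearMap.range s2 ⊔ Ideal.span {h} := hr ▸ Submodule.mem_top
    obtain ⟨_, ⟨b, rfl⟩, y, hy, hby⟩ := Submodule.mem_sup.1 h1
    obtain ⟨c, rfl⟩ := Ideal.mem_span_singleton'.1 hy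
    refine ⟨(c - r * β b 1) • a0, b, ?_⟩
    rw [← hby]
    simp only [hσ, map_smul, hβa0, s2',
      LinearMap.add_apply, LinearMap.smul_apply, LinearMap.comp_apply, LinearMap.proj_apply]
    simp
    ring

open MvPolynomial in
theorem F7_main [IsNoetherianRing B] [IsReduced B] {k : Type*} [Field k] [IsAlgClosed k] (p : ℕ)
    [hp : Fact p.Prime]
    [CharP k p] [CharP B p] [Algebra (ZMod p) k]
    [Algebra.IsAlgebraic (ZMod p) k] [Algebra k B] [Algebra (ZMod p) B]
    [IsScalarTower (ZMod p) k B] [Algebra.FiniteType k B]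
    (hd : DimLt (⊥ : Ideal B) 3) (hP : LocFree B P 2) {ν : ℕ} (vl : Fin ν → P) 
    (φ : Fin ν → (P →ₗ[B] B)) (hφ : ∀ y, y = ∑ l, φ l y • vl l) :
    ∃ (d d' : ℕ) (γ1 γ2 η1 η2 : MvPolynomial (Fin ν) B) (e11 e12 e21 e22 : B),
      0 < d ∧ 0 < d' ∧ γ1.IsHomogeneous d ∧ γ2.IsHomogeneous d ∧ η1.IsHomogeneous d' ∧ η2.IsHomogeneous d' ∧
      e11 + e22 = 1 ∧ e11 * e22 = e12 * e21 ∧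
      C e11 * γ1 + C e12 * γ2 = γ1 ∧ C e21 * γ1 + C e22 * γ2 = γ2 ∧
      C e11 * η1 + C e21 * η2 = η1 ∧ C e12 * η1 + C e22 * η2 = η2 ∧
      ∀ q : Ideal B, q.IsPrime → ∃ t ∉ q, ∀ y : P, C t * (∑ l, C (φ l y) * X l) ∈
        (Ideal.span {γ1, γ2, η1, η2}).radical := by
  obtain ⟨σ, hσ, ⟨a, b, hab⟩, ⟨v, w, hvw⟩⟩ := exists_embed hP hd
  let E : P ≃ₗ[B] LinearMap.range σ := LinearEquiv.ofInjective σ hσ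
  obtain ⟨d, d', γ1, γ2, η1, η2, e11, e12, e21, e22, h1, h2, h3, h4, h5, h6, h7, h8, h9, h10, h11, h12, h13⟩ := 
    F10_main (k := k) p hd (L := LinearMap.range σ) (by
      intro q hq
      obtain ⟨t, ht, α, β, h1, h2⟩ := hP q hq
      refine ⟨t, ht, σ (α (Pi.single 0 1)), σ (α (Pi.single 1 1)), ⟨_, rfl⟩, ⟨_, rfl⟩, ?_⟩
      rintro _ ⟨z, rfl⟩
      refine ⟨β z 0, β z 1, ?_⟩
      rw [← map_smul, ← h1]
      simp only [← map_smul, ← map_add]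
      congr 2
      ext i
      fin_cases i <;> simp) (om_mem_cI ⟨a, rfl⟩ ⟨b, rfl⟩) hab ⟨v, rfl⟩ ⟨w, rfl⟩ hvw (fun l => E (vl l))
      (fun l => φ l ∘ₗ E.symm.toLinearMap) (fun y => by
        conv_lhs => rw [← E.apply_symm_apply y, hφ (E.symm y)]
        simp only [map_sum, map_smul]
        rfl)
  refine ⟨d, d', γ1, γ2, η1, η2, e11, e12, e21, e22, h1, h2, h3, h4, h5, h6, h7, h8, h9, h10, h11, h12, ?_⟩
  intro q hq
  obtain ⟨t, ht, h⟩ := h13 q hq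
  refine ⟨t, ht, fun y => ?_⟩
  have := h (E y)
  simpa using this

end F7
end FpLci
end

section
universe u
namespace FpLci
open RingTheory.Sequence CategoryTheory Abelian Limits

section G1
variable {R : Type u} [CommRing R]

theorem ofList_ofFn {n : ℕ} (g : Fin n → R) : Ideal.ofList (List.ofFn g) = Ideal.span (Set.range g) := by
  simp [Ideal.ofList, List.mem_ofFn', Set.range]

theorem syz_mem : ∀ (n : ℕ) (g : Fin n → R), IsWeaklyRegular R (List.ofFn g) →
    ∀ c : Fin n → R, ∑ i, c i * g i = 0 → ∀ i, c i ∈ Ideal.span (Set.range g)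
  | 0, _, _, _, _, i => i.elim0
  | n + 1, g, hg, c, hc, i => by
    rw [List.ofFn_succ', List.concat_eq_append, isWeaklyRegular_append_iff, 
      isWeaklyRegular_singleton_iff] at hg
    obtain ⟨h1, h2⟩ := hg
    have hr : Set.range (fun i : Fin n => g i.castSucc) ⊆ Set.range g := by
      rintro _ ⟨j, rfl⟩; exact ⟨_, rfl⟩
    rw [ofList_ofFn, smul_eq_mul, Ideal.mul_top] at h2
    rw [Fin.sum_univ_castSucc] at hc
    have hlast : c (Fin.last n) ∈ Ideal.span (Set.range (fun i : Fin n => g i.castSucc)) := by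
      rw [← Ideal.Quotient.eq_zero_iff_mem]
      apply h2
      beta_reduce
      rw [smul_zero]
      change (Ideal.Quotient.mk _ (g (Fin.last n) * c (Fin.last n))) = 0
      rw [Ideal.Quotient.eq_zero_iff_mem]
      have : g (Fin.last n) * c (Fin.last n) = - ∑ i : Fin n, c i.castSucc * g i.castSucc := by
        linear_combination hc
      rw [this]
      exact neg_mem (Ideal.sum_mem _ fun j _ => Ideal.mul_mem_left _ _ (Ideal.subset_span ⟨j, rfl⟩))
    obtain ⟨d, hd⟩ := Ideal.mem_span_range_iff_exists_fun.1 hlast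
    have ih := syz_mem n (fun i => g i.castSucc) h1 (fun i => c i.castSucc + d i * g (Fin.last n)) (by
      rw [← hc, ← hd, Finset.sum_mul, ← Finset.sum_add_distrib]
      exact Finset.sum_congr rfl fun j _ => by ring)
    refine Fin.lastCases ?_ (fun j => ?_) i
    · exact Ideal.span_mono hr hlast
    · have h3 := Ideal.span_mono hr (ih j)
      have h4 : d j * g (Fin.last n) ∈ Ideal.span (Set.range g) :=
        Ideal.mul_mem_left _ _ (Ideal.subset_span (Set.mem_range_self (Fin.last n)))
      exact (Ideal.add_mem_iff_left _ h4).1 h3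

theorem avoid_list (S : Finset (Ideal R)) (hS : ∀ q ∈ S, q.IsPrime)
    (hinc : ∀ q ∈ S, ∀ q' ∈ S, q ≤ q' → q = q') : ∀ (fs : List R) (a : R),
    ∃ z ∈ Ideal.ofList fs, ∀ q ∈ S, (a ∉ q ∨ ∃ f ∈ fs, f ∉ q) → a + z ∉ q
  | [], a => ⟨0, Submodule.zero_mem _, fun q _ h => by simpa using h⟩
  | f :: fs, a => by
    obtain ⟨c, hc⟩ := exists_add_mul_notMem S hS hinc a f
    obtain ⟨z, hz, h⟩ := avoid_list S hS hinc fs (a + f * c)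
    refine ⟨f * c + z, ?_, fun q hq h1 => ?_⟩
    · rw [Ideal.ofList_cons]
      exact Submodule.add_mem_sup (Ideal.mul_mem_right _ _ (Ideal.mem_span_singleton_self f)) hz
    · rw [← add_assoc]
      apply h q hq
      by_cases hf : f ∈ q
      · have hfc : f * c ∈ q := q.mul_mem_right _ hf
        rcases h1 with h1 | ⟨f', hf', h1⟩
        · exact Or.inl fun h2 => h1 ((Ideal.add_mem_iff_left _ hfc).1 h2)
        · rcases List.mem_cons.1 hf' with rfl | hf'
          · exact absurd hf h1
          · exact Or.inr ⟨f', hf', h1⟩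
      · exact Or.inl (hc q hq hf)

theorem reg_gen [IsNoetherianRing R] (J : Ideal R) : ∀ (fs : List R) (M : ModuleCat.{u} R) 
    [Module.Finite R M] (K : Ideal R), (∀ x ∈ K, ∀ m : M, x • m = 0) → K ⊔ Ideal.ofList fs = J →
    (∀ i < fs.length, Subsingleton (Ext (ModuleCat.of R (R ⧸ J)) M i)) →
    ∃ gs : List R, gs.length = fs.length ∧ Ideal.ofList gs = Ideal.ofList fs ∧ IsWeaklyRegular M gs
  | [], M, _, K, _, _, _ => ⟨[], rfl, rfl, IsWeaklyRegular.nil R M⟩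
  | f :: fs, M, _, K, hK, hJ, hE => by
    classical
    have h0 : Subsingleton ((ModuleCat.of R (R ⧸ J)) ⟶ M) :=
      Ext.addEquiv₀.subsingleton_congr.mp (hE 0 (by simp))
    have h0' : Subsingleton ((R ⧸ J) →ₗ[R] M) :=
      (ModuleCat.homAddEquiv (M := ModuleCat.of R (R ⧸ J)) (N := M)).symm.subsingleton
    obtain ⟨x, hxa, hx⟩ := IsSMulRegular.subsingleton_linearMap_iff.mp h0'
    rw [Ideal.annihilator_quotient] at hxa
    have hun := biUnion_associatedPrimes_eq_compl_regular R M
    have hfin : (associatedPrimes R M).Finite := associatedPrimes.finite R M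
    let S := hfin.toFinset.filter (fun q => ∀ q' ∈ associatedPrimes R M, q ≤ q' → q = q')
    have hS : ∀ {q}, q ∈ S ↔ q ∈ associatedPrimes R M ∧ ∀ q' ∈ associatedPrimes R M, q ≤ q' → q = q' := by
      intro q; simp [S]
    obtain ⟨z, hz, hav⟩ := avoid_list S (fun q hq => (hS.1 hq).1.isPrime)
      (fun q hq q' hq' h => (hS.1 hq).2 q' (hS.1 hq').1 h) fs f
    have hg : IsSMulRegular M (f + z) := by
      by_contra hng
      have : f + z ∈ ⋃ p ∈ associatedPrimes R M, (p : Set R) := by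
        rw [hun]; exact hng
      simp only [Set.mem_iUnion, SetLike.mem_coe, exists_prop] at this
      obtain ⟨q, hq, hgq⟩ := this
      obtain ⟨q', hle, hmax⟩ := hfin.exists_le_maximal hq
      have hq'S : q' ∈ S := hS.2 ⟨hmax.1, fun q'' h'' h => le_antisymm h (hmax.2 h'' h)⟩
      refine hav q' hq'S ?_ (hle hgq)
      by_contra hcon
      push Not at hcon
      have hxq : x ∈ q' := by
        have hJq : J ≤ q' := by
          rw [← hJ]
          refine sup_le ?_ ?_
          · intro y hy
            obtain ⟨m, hm⟩ := hmax.1.2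
            have := hmax.1
            exact this.annihilator_le (Module.mem_annihilator.2 fun m => Subtype.ext (hK y hy m))
          · rw [Ideal.ofList, Ideal.span_le]
            intro y hy
            rcases List.mem_cons.1 hy with rfl | hy
            · exact hcon.1
            · exact hcon.2 y hy
        exact hJq hxa
      have : x ∈ ⋃ p ∈ associatedPrimes R M, (p : Set R) := by
        simp only [Set.mem_iUnion, SetLike.mem_coe, exists_prop]
        exact ⟨q', hmax.1, hxq⟩
      rw [hun] at this
      exact this hx
    have hspan : Ideal.ofList ((f + z) :: fs) = Ideal.ofList (f :: fs) := by
      rw [Ideal.ofList_cons, Ideal.ofList_cons]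
      apply le_antisymm
      · refine sup_le ((Ideal.span_singleton_le_iff_mem _).2 ?_) le_sup_right
        exact Submodule.add_mem_sup (Ideal.mem_span_singleton_self f) hz
      · refine sup_le ((Ideal.span_singleton_le_iff_mem _).2 ?_) le_sup_right
        have : (f + z) + (-z) ∈ Ideal.span {f + z} ⊔ Ideal.ofList fs :=
          Submodule.add_mem_sup (Ideal.mem_span_singleton_self (f + z)) (neg_mem hz)
        rwa [add_neg_cancel_right] at this
    obtain ⟨gs, hl, hgs, hreg⟩ := reg_gen J fs (ModuleCat.of R (QuotSMulTop (f + z) M)) (K ⊔ Ideal.span {f + z}) (by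
      intro y hy m
      obtain ⟨a, ha, b, hb, rfl⟩ := Submodule.mem_sup.1 hy
      obtain ⟨c, rfl⟩ := Ideal.mem_span_singleton'.1 hb
      obtain ⟨m, rfl⟩ := Submodule.Quotient.mk_surjective _ m
      rw [← Submodule.Quotient.mk_smul, Submodule.Quotient.mk_eq_zero, add_smul, hK a ha, zero_add, mul_comm, mul_smul]
      exact Submodule.smul_mem_pointwise_smul _ _ _ trivial) (by
        rw [sup_assoc, ← Ideal.ofList_cons, hspan, hJ]) (by
        intro i hi
        have zero1 := AddCommGrpCat.isZero_of_iff_subsingleton.mpr (hE i (by simp; omega))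
        have zero2 := AddCommGrpCat.isZero_of_iff_subsingleton.mpr (hE (i + 1) (by simp; omega))
        exact AddCommGrpCat.subsingleton_of_isZero <| ShortComplex.Exact.isZero_of_both_zeros
          ((Ext.covariant_sequence_exact₃' _ hg.smulShortComplex_shortExact) i (i + 1) rfl)
          (zero1.eq_zero_of_src _) (zero2.eq_zero_of_tgt _))
    refine ⟨(f + z) :: gs, by simp [hl], ?_, ?_⟩
    · rw [← hspan, Ideal.ofList_cons, hgs, ← Ideal.ofList_cons]
    · exact IsWeaklyRegular.cons hg hreg

/-- if `I` is generated by a regular sequence of length `n` and `J` has the same radical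
and is generated by `n` elements then `J` is generated by a regular sequence of length `n`. -/
theorem reg_transfer [IsNoetherianRing R] [IsLocalRing R] (I J : Ideal R) (rs fs : List R) 
    (hrs : IsRegular R rs) (hI : Ideal.ofList rs = I) (hJ : Ideal.ofList fs = J)
    (hl : fs.length = rs.length) (hrad : J.radical = I.radical) :
    ∃ gs : List R, gs.length = rs.length ∧ IsRegular R gs ∧ Ideal.ofList gs = J := by
  have hI' : I ≠ ⊤ := by
    rintro rfl
    apply hrs.top_ne_smul
    rw [hI]; simp
  have hJ' : J ≠ ⊤ := by
    intro h
    rw [h, Ideal.radical_top] at hrad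
    exact hI' (Ideal.radical_eq_top.1 hrad.symm)
  obtain ⟨gs, h1, h2, h3⟩ := reg_gen J fs (ModuleCat.of R R) ⊥ (by simp) (by rw [bot_sup_eq, hJ]) (by
    have := ModuleCat.subsingleton_ext_of_exists_isRegular I (ModuleCat.of R (R ⧸ J)) (by
      change Module.support R (R ⧸ J) ⊆ _
      rw [Module.support_eq_zeroLocus, Ideal.annihilator_quotient, ← PrimeSpectrum.zeroLocus_radical, hrad,
        PrimeSpectrum.zeroLocus_radical]) (ModuleCat.of R R) (by
        rw [lt_top_iff_ne_top]
        intro h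
        apply hI'
        change I • (⊤ : Submodule R R) = ⊤ at h
        simpa using h) rs (fun r hr => hI ▸ Ideal.subset_span hr) hrs
    rw [hl]
    exact this)
  refine ⟨gs, h1.trans hl, ?_, h2.trans hJ⟩
  apply IsRegular.of_isWeaklyRegular_of_mem_maximalIdeal R _ h3
  intro r hr
  have : r ∈ J := by
    rw [← hJ, ← h2]; exact Ideal.subset_span hr
  exact IsLocalRing.le_maximalIdeal hJ' this

/-- independence of `n` generators of an ideal generated by a regular sequence of length `n` -/
theorem indep_gen (gs : List R) (hg : IsWeaklyRegular R gs) {n : ℕ} (hn : gs.length = n)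
    (f : Fin n → R) (hf : Ideal.span (Set.range f) = Ideal.ofList gs) (a : Fin n → R)
    (ha : ∑ i, a i * f i ∈ (Ideal.ofList gs) ^ 2) : ∀ i, a i ∈ Ideal.ofList gs := by
  obtain ⟨g, rfl⟩ : ∃ g : Fin n → R, gs = List.ofFn g := by
    subst hn
    exact ⟨gs.get, by simp⟩
  rw [ofList_ofFn] at *
  set J := Ideal.span (Set.range g) with hJ
  -- matrices over the quotient
  have hfg : ∀ i, ∃ c : Fin n → R, ∑ j, c j * g j = f i := fun i => by
    have : f i ∈ J := hf ▸ Ideal.subset_span ⟨i, rfl⟩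
    exact Ideal.mem_span_range_iff_exists_fun.1 this
  have hgf : ∀ i, ∃ c : Fin n → R, ∑ j, c j * f j = g i := fun i => by
    have : g i ∈ Ideal.span (Set.range f) := hf ▸ Ideal.subset_span ⟨i, rfl⟩
    exact Ideal.mem_span_range_iff_exists_fun.1 this
  choose U hU using hfg
  choose V hV using hgf
  have hind : ∀ c : Fin n → R, ∑ i, c i * g i ∈ J ^ 2 → ∀ i, c i ∈ J := by
    intro c hc i
    rw [pow_two, ← smul_eq_mul] at hc
    have hc' : ∑ i, c i * g i ∈ J • Ideal.span (Set.range g) := hc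
    obtain ⟨b, hb, hs⟩ := (Submodule.mem_ideal_smul_span_iff_exists_sum J g _).1 hc'
    rw [Finsupp.sum_fintype _ _ (by simp)] at hs
    have h := syz_mem n g hg (fun i => c i - b i) (by
      simp only [sub_mul, Finset.sum_sub_distrib, sub_eq_zero]
      exact hs.symm) i
    have h' := J.add_mem h (hb i)
    rwa [sub_add_cancel] at h'
  let mk := Ideal.Quotient.mk J
  let Um : Matrix (Fin n) (Fin n) (R ⧸ J) := Matrix.of fun i j => mk (U i j)
  let Vm : Matrix (Fin n) (Fin n) (R ⧸ J) := Matrix.of fun i j => mk (V i j)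
  have hVU : Vm * Um = 1 := by
    ext i j
    have h1 : ∑ j, ((∑ l, V i l * U l j) - if i = j then 1 else 0) * g j = 0 := by
      simp only [sub_mul, Finset.sum_sub_distrib, ite_mul, one_mul, zero_mul, Finset.sum_ite_eq, 
        Finset.mem_univ, if_true, Finset.sum_mul]
      rw [Finset.sum_comm]
      simp only [mul_assoc, ← Finset.mul_sum, hU, hV, sub_self]
    have h2 := hind _ (h1 ▸ zero_mem _) j
    rw [← Ideal.Quotient.eq_zero_iff_mem, map_sub, sub_eq_zero] at h2
    simp only [Matrix.mul_apply, Um, Vm, Matrix.of_apply, Matrix.one_apply]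
    rw [map_sum] at h2
    simp only [map_mul] at h2
    change ∑ x, mk (V i x) * mk (U x j) = _ at h2
    rw [h2]
    split_ifs <;> simp
  have hUV : Um * Vm = 1 := mul_eq_one_comm.1 hVU
  have h3 : ∀ j, ∑ i, a i * U i j ∈ J := by
    apply hind
    convert ha using 1
    simp only [Finset.sum_mul]
    rw [Finset.sum_comm]
    simp only [mul_assoc, ← Finset.mul_sum, hU]
  have h4 : Matrix.vecMul (fun i => mk (a i)) Um = 0 := by
    ext j
    have := Ideal.Quotient.eq_zero_iff_mem.2 (h3 j)
    rw [map_sum] at this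
    simpa [Matrix.vecMul, dotProduct, Um, mk] using this
  have h5 : (fun i => mk (a i)) = 0 := by
    rw [← Matrix.vecMul_one (fun i => mk (a i)), ← hUV, ← Matrix.vecMul_vecMul, h4, Matrix.zero_vecMul]
  intro i
  exact Ideal.Quotient.eq_zero_iff_mem.1 (congrFun h5 i)

end G1
end FpLci
end

section
universe u
namespace FpLci
open RingTheory.Sequence

section G2
variable {A : Type u} [CommRing A]

theorem idealHeight_congr (I J : Ideal A) (h : J.radical = I.radical) : idealHeight J = idealHeight I := by
  unfold idealHeight
  congr 1
  ext p : 1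
  have : (J ≤ p.asIdeal) = (I ≤ p.asIdeal) := by
    rw [← p.2.radical_le_iff, h, p.2.radical_le_iff]
  simp [this]

theorem assembly [IsNoetherianRing A] (I : Ideal A) (r : ℕ) 
    (hI : IsLocalCompleteIntersectionOfHeight I r) (f : Fin r → A) (hf : ∀ i, f i ∈ I) (u : A)
    (hu : u - 1 ∈ I.radical) (M : ℕ) (hM : ∀ y ∈ I ^ M, u * y ∈ Ideal.span (Set.range f)) :
    ∃ J : Ideal A, J.radical = I.radical ∧ IsLocalCompleteIntersectionOfHeight J r ∧
      Nonempty (Module.Basis (Fin r) (A ⧸ J) J.Cotangent) := by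
  let J : Ideal A := Ideal.span (Set.range f) ⊔ I ^ (M + 1)
  have hfI : Ideal.span (Set.range f) ≤ I := by
    rw [Ideal.span_le]; rintro _ ⟨i, rfl⟩; exact hf i
  have hJI : J ≤ I := sup_le hfI (Ideal.pow_le_self (by omega))
  have hrad : J.radical = I.radical := by
    apply le_antisymm (Ideal.radical_mono hJI)
    rw [← Ideal.radical_pow I (n := M + 1) (by omega)]
    exact Ideal.radical_mono le_sup_right
  have hfJ : ∀ i, f i ∈ J := fun i => Ideal.mem_sup_left (Ideal.subset_span ⟨i, rfl⟩)
  have hM' : ∀ y ∈ I ^ (M + 1), u * y ∈ Ideal.span (Set.range f) := fun y hy =>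
    hM y (Ideal.pow_le_pow_right (by omega) hy)
  have huJ : ∀ y ∈ J, u * y ∈ Ideal.span (Set.range f) := by
    intro y hy
    obtain ⟨a, ha, b, hb, rfl⟩ := Submodule.mem_sup.1 hy
    rw [mul_add]
    exact add_mem (Ideal.mul_mem_left _ _ ha) (hM' b hb)
  -- `J = (f) + J ^ 2`
  have hJ2 : ∀ y ∈ J, ∃ z ∈ Ideal.span (Set.range f), y - z ∈ J ^ 2 := by
    intro y hy
    have h1 : 1 - u ∈ J.radical := by rw [hrad, ← neg_sub]; exact neg_mem hu
    obtain ⟨K, hK⟩ := h1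
    obtain ⟨w, hw⟩ : u ∣ 1 - (1 - u) ^ K := by
      have := sub_dvd_pow_sub_pow 1 (1 - u) K
      simpa using this
    refine ⟨u * (w * y), huJ _ (J.mul_mem_left _ hy), ?_⟩
    have : y - u * (w * y) = (1 - u) ^ K * y := by linear_combination y * hw
    rw [this, pow_two]
    exact Ideal.mul_mem_mul hK hy
  -- localization
  have hloc : ∀ (P : Ideal A) [P.IsPrime], J ≤ P → Ideal.span (Set.range fun i => algebraMap A (Localization.AtPrime P) (f i)) = J.map (algebraMap A (Localization.AtPrime P)) := by
    intro P _ hP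
    have hs : Ideal.span (Set.range fun i => algebraMap A (Localization.AtPrime P) (f i)) =
        (Ideal.span (Set.range f)).map (algebraMap A (Localization.AtPrime P)) := by
      rw [Ideal.map_span, ← Set.range_comp]; rfl
    rw [hs]
    apply le_antisymm (Ideal.map_mono le_sup_left)
    rw [Ideal.map_le_iff_le_comap]
    intro y hy
    have huP : u ∈ P.primeCompl := by
      intro h
      have h2 : u - 1 ∈ P := by
        have h3 : J.radical ≤ P := (‹P.IsPrime›.radical_le_iff).2 hP
        exact h3 (hrad ▸ hu)
      have h4 := P.sub_mem h h2
      rw [sub_sub_cancel] at h4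
      exact ‹P.IsPrime›.ne_top ((Ideal.eq_top_iff_one _).2 h4)
    have hun : IsUnit (algebraMap A (Localization.AtPrime P) u) := 
      IsLocalization.map_units (Localization.AtPrime P) ⟨u, huP⟩
    have h5 := Ideal.mem_map_of_mem (algebraMap A (Localization.AtPrime P)) (huJ y hy)
    rw [map_mul] at h5
    exact (Ideal.unit_mul_mem_iff_mem _ hun).1 h5
  have hJlci : ∀ (P : Ideal A) [P.IsPrime], J ≤ P →
    ∃ rs : List (Localization.AtPrime P),
      rs.length = r ∧ RingTheory.Sequence.IsRegular (Localization.AtPrime P) rs ∧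
      Ideal.ofList rs = J.map (algebraMap A (Localization.AtPrime P)) := by
    intro P _ hP
    have hIP : I ≤ P := by
      rw [← ‹P.IsPrime›.radical_le_iff, ← hrad, ‹P.IsPrime›.radical_le_iff]; exact hP
    obtain ⟨rs, h1, h2, h3⟩ := hI.2 P hIP
    have : IsNoetherianRing (Localization.AtPrime P) := IsLocalization.isNoetherianRing P.primeCompl _ inferInstance
    obtain ⟨gs, h4, h5, h6⟩ := reg_transfer (I.map (algebraMap A (Localization.AtPrime P)))
      (J.map (algebraMap A (Localization.AtPrime P))) rs
      (List.ofFn fun i => algebraMap A (Localization.AtPrime P) (f i)) h2 h3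
      (by rw [ofList_ofFn, hloc P hP]) (by simp [h1]) (by
        apply le_antisymm (Ideal.radical_mono (Ideal.map_mono hJI))
        rw [Ideal.radical_le_radical_iff]
        refine le_trans (Ideal.map_mono ?_) (Ideal.map_radical_le _)
        rw [hrad]; exact Ideal.le_radical)
    exact ⟨gs, h4.trans h1, h5, h6⟩
  refine ⟨J, hrad, ⟨(idealHeight_congr I J hrad).trans hI.1, hJlci⟩, ?_⟩
  have hind : ∀ a : Fin r → A, ∑ i, a i * f i ∈ J ^ 2 → ∀ i, a i ∈ J := by
    intro a ha i
    apply Ideal.mem_of_localization_maximal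
    intro P hPm
    by_cases hP : J ≤ P
    · obtain ⟨rs, h1, h2, h3⟩ := hJlci P hP
      rw [← h3]
      apply indep_gen rs h2.1 h1 (fun i => algebraMap A (Localization.AtPrime P) (f i)) ((hloc P hP).trans h3.symm)
        (fun i => algebraMap A (Localization.AtPrime P) (a i))
      rw [h3, ← Ideal.map_pow]
      have := Ideal.mem_map_of_mem (algebraMap A (Localization.AtPrime P)) ha
      simpa [map_sum] using this
    · obtain ⟨x, hx, hxP⟩ := Set.not_subset.1 hP
      have : J.map (algebraMap A (Localization.AtPrime P)) = ⊤ :=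
        Ideal.eq_top_of_isUnit_mem _ (Ideal.mem_map_of_mem _ hx) 
          (IsLocalization.map_units (Localization.AtPrime P) (⟨x, hxP⟩ : P.primeCompl))
      rw [this]; trivial
  let v : Fin r → J.Cotangent := fun i => J.toCotangent ⟨f i, hfJ i⟩
  have hsm : ∀ a : Fin r → A, ∑ i, Ideal.Quotient.mk J (a i) • v i = J.toCotangent (∑ i, a i • ⟨f i, hfJ i⟩) := by
    intro a
    rw [map_sum]
    refine Finset.sum_congr rfl fun i _ => ?_
    rw [map_smul]
    rfl
  have hval : ∀ a : Fin r → A, ((∑ i, a i • (⟨f i, hfJ i⟩ : J) : J) : A) = ∑ i, a i * f i := by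
    intro a; simp
  refine ⟨Module.Basis.mk (v := v) ?_ ?_⟩
  · rw [Fintype.linearIndependent_iff]
    intro g hg i
    choose a ha using fun i => Ideal.Quotient.mk_surjective (g i)
    simp only [← ha] at hg ⊢
    rw [hsm, Ideal.toCotangent_eq_zero, hval] at hg
    exact Ideal.Quotient.eq_zero_iff_mem.2 (hind a hg i)
  · intro y _
    obtain ⟨⟨y, hy⟩, rfl⟩ := J.toCotangent_surjective y
    obtain ⟨z, hz, hyz⟩ := hJ2 y hy
    obtain ⟨a, rfl⟩ := Ideal.mem_span_range_iff_exists_fun.1 hz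
    have : J.toCotangent ⟨y, hy⟩ = ∑ i, Ideal.Quotient.mk J (a i) • v i := by
      rw [hsm, Ideal.toCotangent_eq, hval]
      exact hyz
    rw [this]
    exact Submodule.sum_mem _ fun i _ => Submodule.smul_mem _ _ (Submodule.subset_span ⟨i, rfl⟩)

end G2
end FpLci
end

section
universe u
namespace FpLci
open RingTheory.Sequence

section G3a
variable {B : Type u} [CommRing B]

theorem unif_smul {M : Type*} [AddCommGroup M] [Module B M] (S : Submonoid B) (X Y : Submodule B M)
    (hX : X.FG) (h : ∀ x ∈ X, ∃ s ∈ S, s • x ∈ Y) : ∃ s ∈ S, ∀ x ∈ X, s • x ∈ Y := by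
  classical
  obtain ⟨F, rfl⟩ := hX
  choose! σ h1 h2 using h
  refine ⟨∏ x ∈ F, σ x, Submonoid.prod_mem _ fun x hx => h1 x (Submodule.subset_span hx), ?_⟩
  have : Submodule.span B (F : Set M) ≤ Y.comap (LinearMap.lsmul B M (∏ x ∈ F, σ x)) := by
    rw [Submodule.span_le]
    intro x hx
    change (∏ x ∈ F, σ x) • x ∈ Y
    rw [← Finset.prod_erase_mul F σ hx, mul_smul]
    exact Y.smul_mem _ (h2 x (Submodule.subset_span hx))
  exact fun x hx => this hx

theorem locFree_ker {M : Type*} [AddCommGroup M] [Module B M] {n : ℕ} (hM : LocFree B M (n + 1))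
    (φ : M →ₗ[B] B) (y : M) (hy : φ y = 1) : LocFree B (LinearMap.ker φ) n := by
  classical
  apply locFree_of_approx
  intro p hp
  obtain ⟨t, ht, α, β, h1, h2⟩ := hM p hp
  have hα : ∀ v, α v = ∑ i, v i • α (Pi.single i 1) := by
    intro v
    conv_lhs => rw [pi_eq_sum_univ' v, map_sum]
    refine Finset.sum_congr rfl fun i _ => ?_
    rw [map_smul]
  obtain ⟨j, hj⟩ : ∃ j, φ (α (Pi.single j 1)) ∉ p := by
    by_contra hcon
    push Not at hcon
    apply ht
    have : φ (α (β y)) = t := by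
      rw [h1]; simp [hy]
    rw [← this, hα, map_sum]
    refine Ideal.sum_mem _ fun i _ => ?_
    rw [map_smul]
    exact p.mul_mem_left _ (hcon i)
  set w : Fin (n + 1) → M := fun i => α (Pi.single i 1) with hw
  set s := φ (w j) with hs
  let γ : (Fin n → B) →ₗ[B] M := Fintype.linearCombination B (fun i => s • w (j.succAbove i) - φ (w (j.succAbove i)) • w j)
  have hγ : ∀ v, γ v = ∑ i, v i • (s • w (j.succAbove i) - φ (w (j.succAbove i)) • w j) := fun v => rfl
  have hγk : ∀ v, φ (γ v) = 0 := by
    intro v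
    rw [hγ, map_sum]
    refine Finset.sum_eq_zero fun i _ => ?_
    simp only [map_smul, map_sub, smul_eq_mul, ← hs]
    ring
  refine ⟨t * s, fun h => (hp.mem_or_mem h).elim ht hj, γ.codRestrict (LinearMap.ker φ) hγk, ?_, ?_⟩
  · rintro ⟨z, hz⟩
    have hz' : φ z = 0 := hz
    have e1 : t • z = ∑ i, (β z) i • w i := by
      rw [← h1, hα]
    set b := β z
    have e2 : ∑ i, b i * φ (w i) = 0 := by
      have := congrArg φ e1
      rw [map_smul, hz', smul_zero, map_sum] at this
      simpa using this.symm
    refine ⟨fun i => b (j.succAbove i), Subtype.ext ?_⟩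
    change γ _ = (t * s) • z
    rw [mul_comm, mul_smul, e1, hγ, Fin.sum_univ_succAbove _ j, smul_add, Finset.smul_sum]
    rw [Fin.sum_univ_succAbove _ j] at e2
    have e3 : s * b j = - ∑ i : Fin n, b (j.succAbove i) * φ (w (j.succAbove i)) := by
      linear_combination e2
    rw [smul_smul, e3]
    simp only [smul_sub, Finset.sum_sub_distrib, neg_smul, Finset.sum_smul, smul_smul]
    rw [sub_eq_add_neg, add_comm]
    congr 1
    exact Finset.sum_congr rfl fun i _ => by rw [mul_comm]
  · intro v hv
    have hv' : γ v = 0 := congrArg Subtype.val hv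
    let V : Fin (n + 1) → B := j.insertNth (-∑ i, v i * φ (w (j.succAbove i))) (fun i => s * v i)
    have hV : α V = 0 := by
      rw [hα, Fin.sum_univ_succAbove _ j, ← hv', hγ]
      simp only [V, Fin.insertNth_apply_same, Fin.insertNth_apply_succAbove, smul_sub, Finset.sum_sub_distrib, 
        neg_smul, Finset.sum_smul, smul_smul]
      rw [sub_eq_add_neg, add_comm]
      congr 1
      exact Finset.sum_congr rfl fun i _ => by rw [mul_comm]
    have h3 := h2 V
    rw [hV, map_zero] at h3
    ext i
    have := congrFun h3 (j.succAbove i)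
    simp [V] at this
    simpa [mul_assoc] using this.symm

theorem split_free [IsNoetherianRing B] (hd : DimLt (⊥ : Ideal B) 3) : ∀ (m : ℕ) (P : Type u) [AddCommGroup P] [Module B P],
    LocFree B P (m + 2) → ∃ (P2 : Type u) (_ : AddCommGroup P2) (_ : Module B P2), LocFree B P2 2 ∧
      Nonempty (P ≃ₗ[B] ((Fin m → B) × P2))
  | 0, P, _, _, h => ⟨P, inferInstance, inferInstance, h, ⟨(LinearEquiv.uniqueProd (R := B) (M := P) (M₂ := Fin 0 → B)).symm⟩⟩
  | m + 1, P, _, _, h => by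
    obtain ⟨y, φ, hφ⟩ := exists_unimodular h (hd.mono (by omega)) 0 1 (by simp)
    simp only [one_smul, zero_add] at hφ
    obtain ⟨P2, _, _, h2, ⟨e⟩⟩ := split_free hd m (LinearMap.ker φ) (locFree_ker h φ y hφ)
    refine ⟨P2, inferInstance, inferInstance, h2, ⟨?_⟩⟩
    have e0 : P ≃ₗ[B] B × LinearMap.ker φ :=
      LinearEquiv.ofLinearMap
        (LinearMap.prod φ ((LinearMap.id - (LinearMap.toSpanSingleton B P y).comp φ).codRestrict (LinearMap.ker φ) (fun z => by
          simp [hφ])))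
        (LinearMap.coprod (LinearMap.toSpanSingleton B P y) (LinearMap.ker φ).subtype)
        (by
          apply LinearMap.ext
          rintro ⟨b, ⟨z, hz⟩⟩
          have hz' : φ z = 0 := hz
          refine Prod.ext ?_ (Subtype.ext ?_)
          · simp [hφ, hz']
          · simp [hφ, hz'])
        (by
          apply LinearMap.ext
          intro z
          simp)
    exact e0.trans ((LinearEquiv.prodCongr (LinearEquiv.refl B B) e).trans
      ((LinearEquiv.prodAssoc B B (Fin m → B) P2).symm.trans
        (LinearEquiv.prodCongr (Fin.consLinearEquiv B (fun _ : Fin (m + 1) => B)) (LinearEquiv.refl B P2))))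
end G3a
end FpLci
end

section
universe u
namespace FpLci
open RingTheory.Sequence

section G4
variable {A : Type u} [CommRing A]

/-- local generators -/
theorem local_gens [IsNoetherianRing A] (I : Ideal A) (r : ℕ) (P : Ideal A) [P.IsPrime] 
    (rs : List (Localization.AtPrime P)) (hl : rs.length = r)
    (hrs : Ideal.ofList rs = I.map (algebraMap A (Localization.AtPrime P))) :
    ∃ g : Fin r → A, (∀ i, g i ∈ I) ∧ 
      Ideal.span (Set.range fun i => algebraMap A (Localization.AtPrime P) (g i)) = Ideal.ofList rs := by
  subst hl
  have h : ∀ i : Fin rs.length, ∃ a ∈ I, ∃ s ∈ P.primeCompl, 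
      rs.get i * algebraMap A (Localization.AtPrime P) s = algebraMap A _ a := by
    intro i
    have h1 : rs.get i ∈ I.map (algebraMap A (Localization.AtPrime P)) := by
      rw [← hrs]; exact Ideal.subset_span (List.get_mem rs i)
    obtain ⟨⟨a, s⟩, h2⟩ := (IsLocalization.mem_map_algebraMap_iff P.primeCompl _).1 h1
    exact ⟨a, a.2, s, s.2, h2⟩
  choose g hg s hs hgs using h
  refine ⟨g, hg, le_antisymm ?_ ?_⟩
  · rw [Ideal.span_le]
    rintro _ ⟨i, rfl⟩
    change algebraMap A _ (g i) ∈ Ideal.ofList rs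
    rw [hrs]
    exact Ideal.mem_map_of_mem _ (hg i)
  · rw [Ideal.ofList, Ideal.span_le]
    intro x hx
    obtain ⟨i, rfl⟩ := List.get_of_mem hx
    have hun : IsUnit (algebraMap A (Localization.AtPrime P) (s i)) := 
      IsLocalization.map_units (Localization.AtPrime P) (⟨s i, hs i⟩ : P.primeCompl)
    refine (Ideal.mul_unit_mem_iff_mem _ hun).1 ?_
    rw [hgs i]
    exact Ideal.subset_span ⟨i, rfl⟩

theorem conormal_locFree [IsNoetherianRing A] (I N : Ideal A) (hIN : I ≤ N) (r : ℕ) 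
    (hI : ∀ (P : Ideal A) [P.IsPrime], I ≤ P → ∃ rs : List (Localization.AtPrime P),
      rs.length = r ∧ RingTheory.Sequence.IsRegular (Localization.AtPrime P) rs ∧
      Ideal.ofList rs = I.map (algebraMap A (Localization.AtPrime P))) :
    LocFree (A ⧸ N) (I ⧸ (N • ⊤ : Submodule A I)) r := by
  apply locFree_of_approx
  intro p hp
  set P : Ideal A := p.comap (Ideal.Quotient.mk N) with hPdef
  have hPp : P.IsPrime := Ideal.IsPrime.comap _
  have hNP : N ≤ P := by
    intro x hx
    change Ideal.Quotient.mk N x ∈ p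
    rw [Ideal.Quotient.eq_zero_iff_mem.2 hx]; exact zero_mem _
  obtain ⟨rs, hl, hreg, hrs⟩ := hI P (hIN.trans hNP)
  obtain ⟨g, hgI, hg⟩ := local_gens I r P rs hl hrs
  -- the uniform denominator for surjectivity
  obtain ⟨t, ht, htI⟩ := unif_smul P.primeCompl I (Ideal.span (Set.range g)) (IsNoetherian.noetherian I) (by
    intro x hx
    have h1 : algebraMap A (Localization.AtPrime P) x ∈ (Ideal.span (Set.range g)).map (algebraMap A (Localization.AtPrime P)) := by
      rw [Ideal.map_span, ← Set.range_comp]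
      change _ ∈ Ideal.span (Set.range fun i => algebraMap A (Localization.AtPrime P) (g i))
      rw [hg, hrs]
      exact Ideal.mem_map_of_mem _ hx
    rw [IsLocalization.algebraMap_mem_map_algebraMap_iff P.primeCompl] at h1
    exact h1)
  let v : Fin r → I ⧸ (N • ⊤ : Submodule A I) := fun i => Submodule.Quotient.mk ⟨g i, hgI i⟩
  let α : (Fin r → A ⧸ N) →ₗ[A ⧸ N] I ⧸ (N • ⊤ : Submodule A I) := Fintype.linearCombination (A ⧸ N) v
  have hα : ∀ a : Fin r → A, α (fun i => Ideal.Quotient.mk N (a i)) = 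
      Submodule.Quotient.mk (∑ i, a i • (⟨g i, hgI i⟩ : I)) := by
    intro a
    change _ = Submodule.mkQ _ _
    rw [map_sum]
    change ∑ i : Fin r, Ideal.Quotient.mk N (a i) • v i = _
    refine Finset.sum_congr rfl fun i _ => ?_
    rw [map_smul]
    rfl
  have hker : ∀ y ∈ LinearMap.ker α, ∃ s ∈ p.primeCompl, s • y ∈ (⊥ : Submodule (A ⧸ N) (Fin r → A ⧸ N)) := by
    intro y hy
    obtain ⟨a, rfl⟩ : ∃ a : Fin r → A, y = fun i => Ideal.Quotient.mk N (a i) := by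
      choose a ha using fun i => Ideal.Quotient.mk_surjective (y i)
      exact ⟨a, funext fun i => (ha i).symm⟩
    rw [LinearMap.mem_ker, hα, Submodule.Quotient.mk_eq_zero] at hy
    have h1 : ∑ i, a i * g i ∈ N * I := by
      have := Submodule.mem_map_of_mem (f := I.subtype) hy
      rw [Submodule.map_smul'', Submodule.map_top, Submodule.range_subtype] at this
      simpa using this
    have h2 := Ideal.mem_map_of_mem (algebraMap A (Localization.AtPrime P)) h1
    rw [Ideal.map_mul, ← hrs, ← hg, ← smul_eq_mul] at h2
    obtain ⟨b, hb, hbs⟩ := (Submodule.mem_ideal_smul_span_iff_exists_sum _ (fun i => algebraMap A (Localization.AtPrime P) (g i)) _).1 h2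
    rw [Finsupp.sum_fintype _ _ (by simp)] at hbs
    have h3 := indep_gen rs hreg.1 hl _ hg (fun i => algebraMap A (Localization.AtPrime P) (a i) - b i) (by
      have : ∑ i, (algebraMap A (Localization.AtPrime P) (a i) - b i) * algebraMap A (Localization.AtPrime P) (g i) = 0 := by
        simp only [sub_mul, Finset.sum_sub_distrib, ← map_mul, ← map_sum]
        rw [← hbs]
        simp
      rw [this]; exact zero_mem _)
    have h4 : ∀ i, ∃ s ∈ P.primeCompl, s * a i ∈ N := by
      intro i
      rw [← IsLocalization.algebraMap_mem_map_algebraMap_iff P.primeCompl (Localization.AtPrime P)]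
      have h5 := h3 i
      rw [hrs] at h5
      have h6 := Ideal.add_mem _ (Ideal.map_mono hIN h5) (hb i)
      rwa [sub_add_cancel] at h6
    choose s hs hsa using h4
    refine ⟨Ideal.Quotient.mk N (∏ i, s i), ?_, ?_⟩
    · exact P.primeCompl.prod_mem fun i _ => hs i
    · rw [Submodule.mem_bot]
      ext i
      change Ideal.Quotient.mk N (∏ i, s i) * Ideal.Quotient.mk N (a i) = 0
      rw [← map_mul, Ideal.Quotient.eq_zero_iff_mem, ← Finset.prod_erase_mul _ _ (Finset.mem_univ i), mul_assoc]
      exact N.mul_mem_left _ (hsa i)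
  obtain ⟨t', ht', hk⟩ := unif_smul p.primeCompl (LinearMap.ker α) ⊥ (IsNoetherian.noetherian _) hker
  refine ⟨t' * Ideal.Quotient.mk N t, fun h => (hp.mem_or_mem h).elim ht' ht, α, ?_, ?_⟩
  · intro x
    obtain ⟨⟨x, hx⟩, rfl⟩ := Submodule.Quotient.mk_surjective _ x
    obtain ⟨a, ha⟩ := Ideal.mem_span_range_iff_exists_fun.1 (htI x hx)
    refine ⟨t' • (fun i => Ideal.Quotient.mk N (a i)), ?_⟩
    rw [map_smul, hα, mul_smul]
    congr 1
    change _ = Submodule.Quotient.mk (t • (⟨x, hx⟩ : I))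
    congr 1
    apply Subtype.ext
    simpa using ha
  · intro y hy
    rw [mul_comm, mul_smul, (Submodule.mem_bot _).1 (hk y hy), smul_zero]

end G4
end FpLci
end

section
universe u
namespace FpLci
open MvPolynomial

section G5
variable {A : Type u} [CommRing A]

theorem ev_mem {ν : ℕ} (c : Ideal A) (x : Fin ν → A) (g : MvPolynomial (Fin ν) A) (n : ℕ)
    (hg : g.IsHomogeneous n) (hc : ∀ e, coeff e g ∈ c) :
    eval x g ∈ c * Ideal.span (Set.range x) ^ n := by
  rw [eval_eq']
  refine Ideal.sum_mem _ fun e _ => ?_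
  by_cases he : e.degree = n
  · apply Ideal.mul_mem_mul (hc e)
    rw [← he, Finsupp.degree_eq_sum, ← Finset.prod_pow_eq_pow_sum]
    exact Ideal.prod_mem_prod fun i _ => Ideal.pow_mem_pow (Ideal.subset_span (Set.mem_range_self i)) _
  · rw [hg.coeff_eq_zero he, zero_mul]; exact zero_mem _

theorem ev_mem_of_map {ν : ℕ} (N : Ideal A) (x : Fin ν → A) (I : Ideal A) (hx : ∀ i, x i ∈ I)
    (g : MvPolynomial (Fin ν) A) (n : ℕ)
    (hg : g.IsHomogeneous n) (hc : map (Ideal.Quotient.mk N) g = 0) :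
    eval x g ∈ N * I ^ n := by
  refine Ideal.mul_mono le_rfl (Ideal.pow_right_mono ?_ n) (ev_mem N x g n hg fun e => ?_)
  · rw [Ideal.span_le]; rintro _ ⟨i, rfl⟩; exact hx i
  · rw [← Ideal.Quotient.eq_zero_iff_mem, ← coeff_map, hc, coeff_zero]

theorem ev_mem_pow {ν : ℕ} (x : Fin ν → A) (I : Ideal A) (hx : ∀ i, x i ∈ I)
    (g : MvPolynomial (Fin ν) A) (n : ℕ) (hg : g.IsHomogeneous n) :
    eval x g ∈ I ^ n := by
  have := ev_mem ⊤ x g n hg (fun _ => trivial)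
  rw [Ideal.top_mul] at this
  refine Ideal.pow_right_mono ?_ n this
  rw [Ideal.span_le]; rintro _ ⟨i, rfl⟩; exact hx i

theorem hom_lift {ν : ℕ} (N : Ideal A) (γ : MvPolynomial (Fin ν) (A ⧸ N)) (d : ℕ) (hγ : γ.IsHomogeneous d) :
    ∃ g : MvPolynomial (Fin ν) A, g.IsHomogeneous d ∧ map (Ideal.Quotient.mk N) g = γ := by
  obtain ⟨g, rfl⟩ := map_surjective (σ := Fin ν) _ (Ideal.Quotient.mk_surjective (I := N)) γ
  refine ⟨homogeneousComponent d g, homogeneousComponent_isHomogeneous d g, ?_⟩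
  rw [← homogeneousComponent_eq_self hγ]
  ext e
  simp only [coeff_map, coeff_homogeneousComponent]
  split_ifs <;> simp

theorem homComp_mul {ν : ℕ} (a γ : MvPolynomial (Fin ν) A) (d M : ℕ) (hγ : γ.IsHomogeneous d) (h : d ≤ M) :
    homogeneousComponent M (a * γ) = homogeneousComponent (M - d) a * γ := by
  conv_lhs => rw [← sum_homogeneousComponent a, Finset.sum_mul, map_sum]
  have h1 : ∀ i, homogeneousComponent M (homogeneousComponent i a * γ) = 
      if M - d = i then homogeneousComponent (M - d) a * γ else 0 := by
    intro i
    rw [homogeneousComponent_of_mem ((homogeneousComponent_isHomogeneous i a).mul hγ)]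
    by_cases hi : M - d = i
    · rw [if_pos (by omega), if_pos hi, hi]
    · rw [if_neg (by omega), if_neg hi]
  simp only [h1, Finset.sum_ite_eq, Finset.mem_range]
  split_ifs with h2
  · rfl
  · rw [homogeneousComponent_eq_zero _ _ (by omega), zero_mul]

/-- lifting the idempotent matrix modulo a high power of the ideal -/
theorem lift_idem (p : ℕ) [Fact p.Prime] [CharP A p] (N : Ideal A) (e11 e12 e21 e22 : A ⧸ N)
    (h1 : e11 + e22 = 1) (h2 : e11 * e22 = e12 * e21) (s : ℕ) :
    ∃ a b c d : A, Ideal.Quotient.mk N a = e11 ∧ Ideal.Quotient.mk N b = e12 ∧ 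
      Ideal.Quotient.mk N c = e21 ∧ Ideal.Quotient.mk N d = e22 ∧
      a * a + b * c - a ∈ N ^ (p ^ s) ∧ a * b + b * d - b ∈ N ^ (p ^ s) ∧ c * a + d * c - c ∈ N ^ (p ^ s) ∧
      c * b + d * d - d ∈ N ^ (p ^ s) ∧ a * d - b * c ∈ N ^ (p ^ s) := by
  let E : Matrix (Fin 2) (Fin 2) (A ⧸ N) := !![e11, e12; e21, e22]
  have hE : E * E = E := by
    ext i j
    fin_cases i <;> fin_cases j <;> simp [E, Matrix.mul_apply, Fin.sum_univ_two]
    · linear_combination e11 * h1 - h2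
    · linear_combination e12 * h1
    · linear_combination e21 * h1
    · linear_combination e22 * h1 - h2
  obtain ⟨a0, ha⟩ := Ideal.Quotient.mk_surjective e11
  obtain ⟨b0, hb⟩ := Ideal.Quotient.mk_surjective e12
  obtain ⟨c0, hc⟩ := Ideal.Quotient.mk_surjective e21
  obtain ⟨d0, hd⟩ := Ideal.Quotient.mk_surjective e22
  let X : Matrix (Fin 2) (Fin 2) A := !![a0, b0; c0, d0]
  have hX : (Ideal.Quotient.mk N).mapMatrix X = E := by
    ext i j
    fin_cases i <;> fin_cases j <;> simp [X, E, ha, hb, hc, hd]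
  have hpow : ∀ (Y : Matrix (Fin 2) (Fin 2) A), (∀ i j, Y i j ∈ N) → ∀ n i j, (Y ^ n) i j ∈ N ^ n := by
    intro Y hY n
    induction n with
    | zero => intro i j; simp
    | succ n ih =>
      intro i j
      rw [pow_succ Y, Matrix.mul_apply, pow_succ N]
      exact Ideal.sum_mem _ fun k _ => Ideal.mul_mem_mul (ih i k) (hY k j)
  set Q := p ^ s with hQ
  let Z := X ^ Q
  have hE' : ∀ n, E ^ (n + 1) = E := by
    intro n
    induction n with
    | zero => simp
    | succ n ih => rw [pow_succ, ih, hE]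
  have hQ0 : Q = Q - 1 + 1 := by
    have : 0 < Q := pow_pos (Fact.out : p.Prime).pos _
    omega
  have hZ : (Ideal.Quotient.mk N).mapMatrix Z = E := by
    rw [map_pow, hX, hQ0, hE']
  have hZZ : ∀ i j, (Z * Z - Z) i j ∈ N ^ Q := by
    have h3 : Z * Z - Z = (X * X - X) ^ Q := by
      rw [hQ, sub_pow_char_pow_of_commute (R := Matrix (Fin 2) (Fin 2) A) p s ((Commute.refl X).mul_left (Commute.refl X)), 
        (Commute.refl X).mul_pow]
    rw [h3]
    apply hpow
    intro i j
    rw [← Ideal.Quotient.eq_zero_iff_mem]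
    change ((Ideal.Quotient.mk N).mapMatrix (X * X - X)) i j = 0
    rw [map_sub, map_mul, hX, hE, sub_self]; rfl
  have hdet : Z.det ∈ N ^ Q := by
    rw [Matrix.det_pow]
    apply Ideal.pow_mem_pow
    rw [← Ideal.Quotient.eq_zero_iff_mem, RingHom.map_det, hX, Matrix.det_fin_two_of, h2, sub_self]
  refine ⟨Z 0 0, Z 0 1, Z 1 0, Z 1 1, ?_, ?_, ?_, ?_, ?_, ?_, ?_, ?_, ?_⟩
  · exact congrFun (congrFun hZ 0) 0
  · exact congrFun (congrFun hZ 0) 1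
  · exact congrFun (congrFun hZ 1) 0
  · exact congrFun (congrFun hZ 1) 1
  · simpa [Matrix.mul_apply, Fin.sum_univ_two] using hZZ 0 0
  · simpa [Matrix.mul_apply, Fin.sum_univ_two] using hZZ 0 1
  · simpa [Matrix.mul_apply, Fin.sum_univ_two] using hZZ 1 0
  · simpa [Matrix.mul_apply, Fin.sum_univ_two] using hZZ 1 1
  · rwa [Matrix.det_fin_two] at hdet

theorem pow_le_aux (I X N f : Ideal A) (hX : X ≤ I) (H : I ≤ f ⊔ X ⊔ N * I)  (M : ℕ) :
    I ^ M ≤ f ⊔ X ^ M ⊔ N * I ^ M := by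
  induction M with
  | zero => simp
  | succ M ih =>
    have h1 : X ^ M * (N * I) ≤ N * I ^ (M + 1) := by
      rw [mul_left_comm, pow_succ]
      exact Ideal.mul_mono le_rfl (Ideal.mul_mono (Ideal.pow_right_mono hX M) le_rfl)
    have h2 : (f ⊔ X ^ M ⊔ N * I ^ M) * I = f * I ⊔ X ^ M * I ⊔ N * I ^ (M + 1) := by
      rw [Ideal.sup_mul, Ideal.sup_mul, mul_assoc, ← pow_succ]
    have h3 : I ^ (M + 1) ≤ f * I ⊔ X ^ M * I ⊔ N * I ^ (M + 1) := by
      rw [← h2, pow_succ]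
      exact Ideal.mul_mono ih le_rfl
    have h4 : X ^ M * (f ⊔ X ⊔ N * I) = X ^ M * f ⊔ X ^ (M + 1) ⊔ X ^ M * (N * I) := by
      rw [Ideal.mul_sup, Ideal.mul_sup, ← pow_succ]
    have h5 : X ^ M * I ≤ f ⊔ X ^ (M + 1) ⊔ N * I ^ (M + 1) := by
      have h6 : X ^ M * I ≤ X ^ M * (f ⊔ X ⊔ N * I) := Ideal.mul_mono le_rfl H
      rw [h4] at h6
      exact h6.trans (sup_le_sup (sup_le_sup Ideal.mul_le_right le_rfl) h1)
    have h7 : f * I ≤ f ⊔ X ^ (M + 1) ⊔ N * I ^ (M + 1) :=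
      Ideal.mul_le_left.trans (le_sup_left.trans le_sup_left)
    exact h3.trans (sup_le (sup_le h7 h5) le_sup_right)
end G5
end FpLci
end

section
universe u
namespace FpLci
open MvPolynomial
open scoped Pointwise

section G6
variable {A : Type u} [CommRing A]

theorem prod_sub_mem {ι : Type*} (N I : Ideal A) (S : Finset ι) (x y : ι → A) (hx : ∀ i, x i ∈ I) (hy : ∀ i, y i ∈ I)
    (h : ∀ i, y i - x i ∈ N * I) : ∏ i ∈ S, y i - ∏ i ∈ S, x i ∈ N * I ^ S.card := by
  classical
  induction S using Finset.induction_on with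
  | empty => simp
  | insert i S hi ih =>
    rw [Finset.prod_insert hi, Finset.prod_insert hi, Finset.card_insert_of_notMem hi]
    have h1 : ∏ i ∈ S, y i ∈ I ^ S.card := by
      rw [← Finset.prod_const]; exact Ideal.prod_mem_prod fun i _ => hy i
    have h2 : y i * ∏ i ∈ S, y i - x i * ∏ i ∈ S, x i = 
      (y i - x i) * ∏ i ∈ S, y i + x i * (∏ i ∈ S, y i - ∏ i ∈ S, x i) := by ring
    have e1 : N * I ^ (S.card + 1) = (N * I) * I ^ S.card := by rw [pow_succ', mul_assoc]
    have e2 : N * I ^ (S.card + 1) = I * (N * I ^ S.card) := by rw [pow_succ', mul_left_comm]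
    rw [h2]
    refine add_mem ?_ ?_
    · rw [e1]; exact Ideal.mul_mem_mul (h i) h1
    · rw [e2]; exact Ideal.mul_mem_mul (hx i) ih

theorem core2 (N I T : Ideal A) {ν : ℕ} (x : Fin ν → A) (hx : ∀ l, x l ∈ I) (a : Fin ν → Fin ν → A)
    (H2 : ∀ j, ∑ l, a j l * x l - x j ∈ N * I) (M n d d' : ℕ) (hT : N * I ^ M ≤ T)
    (hn : n ≤ M) (hd : d ≤ M) (hd' : d' ≤ M)
    (g1 g2 h1 h2 : MvPolynomial (Fin ν) A) (hg1 : g1.IsHomogeneous d) (hg2 : g2.IsHomogeneous d)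
    (hh1 : h1.IsHomogeneous d') (hh2 : h2.IsHomogeneous d')
    (Tg1 : ∀ c ∈ I ^ (M - d), c * eval x g1 ∈ T) (Tg2 : ∀ c ∈ I ^ (M - d), c * eval x g2 ∈ T)
    (Th1 : ∀ c ∈ I ^ (M - d'), c * eval x h1 ∈ T) (Th2 : ∀ c ∈ I ^ (M - d'), c * eval x h2 ∈ T)
    (K : Ideal (MvPolynomial (Fin ν) (A ⧸ N)))
    (hK : K = Ideal.span {map (Ideal.Quotient.mk N) g1, map (Ideal.Quotient.mk N) g2, map (Ideal.Quotient.mk N) h1, map (Ideal.Quotient.mk N) h2})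
    (hKn : K.radical ^ n ≤ K) (t : A)
    (ht : ∀ j, C (Ideal.Quotient.mk N t) * (∑ l, C (Ideal.Quotient.mk N (a j l)) * X l) ∈ K.radical)
    (j : Fin M → Fin ν) : t ^ M * ∏ s, x (j s) ∈ T := by
  set mk := Ideal.Quotient.mk N with hmk
  let L : Fin ν → MvPolynomial (Fin ν) A := fun i => ∑ l, C (a i l) * X l
  have hL : ∀ i, (L i).IsHomogeneous 1 := by
    intro i
    apply IsHomogeneous.sum
    intro l _
    exact (isHomogeneous_X _ l).C_mul _
  have hLm : ∀ i, map mk (L i) = ∑ l, C (mk (a i l)) * X l := by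
    intro i; simp [L]
  have hLe : ∀ i, eval x (L i) = ∑ l, a i l * x l := by
    intro i; simp [L]
  let W : MvPolynomial (Fin ν) A := C (t ^ M) * ∏ s, L (j s)
  have hW : W.IsHomogeneous M := by
    have : (∏ s, L (j s)).IsHomogeneous (∑ s : Fin M, 1) := IsHomogeneous.prod _ _ _ fun s _ => hL (j s)
    simp only [Finset.sum_const, Finset.card_univ, Fintype.card_fin, smul_eq_mul, mul_one] at this
    exact this.C_mul _
  have hWK : map mk W ∈ K := by
    have e : map mk W = ∏ s, (C (mk t) * map mk (L (j s))) := by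
      rw [Finset.prod_mul_distrib]
      simp [W, map_prod]
    rw [e]
    apply hKn
    apply Ideal.pow_le_pow_right hn
    have h3 : (K.radical) ^ M = ∏ s : Fin M, K.radical := by simp
    rw [h3]
    refine Ideal.prod_mem_prod fun s _ => ?_
    rw [hLm]
    exact ht (j s)
  rw [hK] at hWK
  simp only [Ideal.mem_span_insert, Ideal.mem_span_singleton'] at hWK
  obtain ⟨b1, _, ⟨b2, _, ⟨c1, _, ⟨c2, rfl⟩, rfl⟩, rfl⟩, hWe⟩ := hWK
  have hWm : (map mk W).IsHomogeneous M := hW.map mk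
  have hWe' := congrArg (homogeneousComponent M) hWe
  rw [homogeneousComponent_eq_self hWm, map_add, map_add, map_add, homComp_mul _ _ d M (hg1.map mk) hd,
    homComp_mul _ _ d M (hg2.map mk) hd, homComp_mul _ _ d' M (hh1.map mk) hd', homComp_mul _ _ d' M (hh2.map mk) hd'] at hWe'
  obtain ⟨B1, hB1, hB1m⟩ := hom_lift N _ _ (homogeneousComponent_isHomogeneous (M - d) b1)
  obtain ⟨B2, hB2, hB2m⟩ := hom_lift N _ _ (homogeneousComponent_isHomogeneous (M - d) b2)
  obtain ⟨C1, hC1, hC1m⟩ := hom_lift N _ _ (homogeneousComponent_isHomogeneous (M - d') c1)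
  obtain ⟨C2, hC2, hC2m⟩ := hom_lift N _ _ (homogeneousComponent_isHomogeneous (M - d') c2)
  have hom : ∀ (e : ℕ) (P Q : MvPolynomial (Fin ν) A), e ≤ M → P.IsHomogeneous (M - e) → Q.IsHomogeneous e →
      (P * Q).IsHomogeneous M := by
    intro e P Q he hP hQ
    have := hP.mul hQ
    rwa [Nat.sub_add_cancel he] at this
  have hdiff := ev_mem_of_map N x I hx (W - (B1 * g1 + (B2 * g2 + (C1 * h1 + C2 * h2)))) M
    (hW.sub ((hom _ _ _ hd hB1 hg1).add ((hom _ _ _ hd hB2 hg2).add ((hom _ _ _ hd' hC1 hh1).add (hom _ _ _ hd' hC2 hh2))))) (by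
      rw [map_sub, sub_eq_zero, map_add, map_add, map_add, map_mul _ B1, map_mul _ B2, map_mul _ C1, map_mul _ C2, hB1m, hB2m, hC1m, hC2m]
      exact hWe')
  have hWT : eval x W ∈ T := by
    have h4 : eval x (B1 * g1 + (B2 * g2 + (C1 * h1 + C2 * h2))) ∈ T := by
      simp only [map_add, map_mul]
      exact add_mem (Tg1 _ (ev_mem_pow x I hx _ _ hB1)) (add_mem (Tg2 _ (ev_mem_pow x I hx _ _ hB2))
        (add_mem (Th1 _ (ev_mem_pow x I hx _ _ hC1)) (Th2 _ (ev_mem_pow x I hx _ _ hC2))))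
    rw [map_sub] at hdiff
    have := T.add_mem (hT hdiff) h4
    rwa [sub_add_cancel] at this
  have hWv : eval x W = t ^ M * ∏ s, (∑ l, a (j s) l * x l) := by
    simp only [W, map_mul, eval_C, map_prod, hLe]
  have hp := prod_sub_mem N I Finset.univ (fun s => x (j s)) (fun s => ∑ l, a (j s) l * x l) (fun s => hx _)
    (fun s => Ideal.sum_mem _ fun l _ => I.mul_mem_left _ (hx l)) (fun s => H2 (j s))
  rw [Finset.card_univ, Fintype.card_fin] at hp
  have h5 : t ^ M * ∏ s, x (j s) = eval x W - t ^ M * (∏ s, (∑ l, a (j s) l * x l) - ∏ s, x (j s)) := by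
    rw [hWv]; ring
  rw [h5]
  exact sub_mem hWT (T.mul_mem_left _ (hT hp))

theorem F11 [IsNoetherianRing A] (p : ℕ) [Fact p.Prime] [CharP A p] (N I : Ideal A) (hN : N = I.radical)
    {m ν : ℕ} (f : Fin m → A) (x : Fin ν → A) (hx : ∀ l, x l ∈ I) (a : Fin ν → Fin ν → A)
    (H1 : I ≤ Ideal.span (Set.range f) ⊔ Ideal.span (Set.range x) ⊔ N * I)
    (H2 : ∀ j, ∑ l, a j l * x l - x j ∈ N * I) (d d' : ℕ) (hd : 0 < d) (hd' : 0 < d')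
    (γ1 γ2 η1 η2 : MvPolynomial (Fin ν) (A ⧸ N)) (e11 e12 e21 e22 : A ⧸ N)
    (hγ1 : γ1.IsHomogeneous d) (hγ2 : γ2.IsHomogeneous d) (hη1 : η1.IsHomogeneous d') (hη2 : η2.IsHomogeneous d')
    (he1 : e11 + e22 = 1) (he2 : e11 * e22 = e12 * e21)
    (E1 : C e11 * γ1 + C e12 * γ2 = γ1) (E2 : C e21 * γ1 + C e22 * γ2 = γ2)
    (E3 : C e11 * η1 + C e21 * η2 = η1) (E4 : C e12 * η1 + C e22 * η2 = η2)
    (H3 : ∀ q : Ideal (A ⧸ N), q.IsPrime → ∃ t ∉ q, ∀ j, C t * (∑ l, C (Ideal.Quotient.mk N (a j l)) * X l) ∈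
        (Ideal.span {γ1, γ2, η1, η2}).radical) :
    ∃ F ∈ I, ∃ G ∈ I, ∃ u : A, u - 1 ∈ N ∧ ∃ M : ℕ, ∀ y ∈ I ^ M, 
      u * y ∈ Ideal.span {F, G} ⊔ Ideal.span (Set.range f) := by
  set K := Ideal.span {γ1, γ2, η1, η2} with hK
  obtain ⟨n, hn⟩ := K.exists_radical_pow_le_of_fg (IsNoetherian.noetherian _)
  obtain ⟨k, hk⟩ := I.exists_radical_pow_le_of_fg (IsNoetherian.noetherian _)
  rw [← hN] at hk
  set M := n + d + d' with hM
  obtain ⟨s, hs⟩ : ∃ s, k * M + 1 ≤ p ^ s := ⟨k * M + 1, (Nat.lt_pow_self (Fact.out : p.Prime).one_lt).le⟩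
  have hNQ : N ^ (p ^ s) ≤ N * I ^ M := by
    refine (Ideal.pow_le_pow_right hs).trans ?_
    rw [pow_succ', pow_mul]
    exact Ideal.mul_mono le_rfl (Ideal.pow_right_mono hk M)
  obtain ⟨ea, eb, ec, ed, ha, hb, hc, hd1, i1, i2, i3, i4, i5⟩ := lift_idem p N e11 e12 e21 e22 he1 he2 s
  obtain ⟨g1, hg1, mg1⟩ := hom_lift N γ1 d hγ1
  obtain ⟨g2, hg2, mg2⟩ := hom_lift N γ2 d hγ2
  obtain ⟨h1, hh1, mh1⟩ := hom_lift N η1 d' hη1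
  obtain ⟨h2, hh2, mh2⟩ := hom_lift N η2 d' hη2
  set G1 := eval x g1 with hG1
  set G2 := eval x g2 with hG2
  set L1 := eval x h1 with hL1
  set L2 := eval x h2 with hL2
  have hG1I : G1 ∈ I := Ideal.pow_le_self hd.ne' (ev_mem_pow x I hx g1 d hg1)
  have hG2I : G2 ∈ I := Ideal.pow_le_self hd.ne' (ev_mem_pow x I hx g2 d hg2)
  have hL1I : L1 ∈ I := Ideal.pow_le_self hd'.ne' (ev_mem_pow x I hx h1 d' hh1)
  have hL2I : L2 ∈ I := Ideal.pow_le_self hd'.ne' (ev_mem_pow x I hx h2 d' hh2)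
  set ξ1 := ea * G1 + eb * G2 with hξ1
  set ξ2 := ec * G1 + ed * G2 with hξ2
  set ζ1 := ea * L1 + ec * L2 with hζ1
  set ζ2 := eb * L1 + ed * L2 with hζ2
  set F := ξ1 - ζ2 with hF
  set G := ξ2 + ζ1 with hG
  have hFI : F ∈ I := sub_mem (add_mem (I.mul_mem_left _ hG1I) (I.mul_mem_left _ hG2I))
    (add_mem (I.mul_mem_left _ hL1I) (I.mul_mem_left _ hL2I))
  have hGI : G ∈ I := add_mem (add_mem (I.mul_mem_left _ hG1I) (I.mul_mem_left _ hG2I))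
    (add_mem (I.mul_mem_left _ hL1I) (I.mul_mem_left _ hL2I))
  set 𝔞 := Ideal.span {F, G} ⊔ Ideal.span (Set.range f) with h𝔞
  set T := 𝔞 ⊔ N * I ^ M with hT
  have hTN : N * I ^ M ≤ T := le_sup_right
  have hTQ : N ^ (p ^ s) ≤ T := hNQ.trans hTN
  have hFT : F ∈ T := Ideal.mem_sup_left (Ideal.mem_sup_left (Ideal.subset_span (by simp)))
  have hGT : G ∈ T := Ideal.mem_sup_left (Ideal.mem_sup_left (Ideal.subset_span (by simp)))
  have j1 := hTQ i1
  have j2 := hTQ i2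
  have j3 := hTQ i3
  have j4 := hTQ i4
  have j5 := hTQ i5
  have hTξ1 : ξ1 ∈ T := by
    have e : ξ1 = ea * F + eb * G - ((ea * ea + eb * ec - ea) * G1 + (ea * eb + eb * ed - eb) * G2)
        + (ea * ed - eb * ec) * L2 := by
      simp only [hF, hG, hξ1, hξ2, hζ1, hζ2]; ring
    rw [e]
    exact add_mem (sub_mem (add_mem (T.mul_mem_left _ hFT) (T.mul_mem_left _ hGT))
      (add_mem (T.mul_mem_right _ j1) (T.mul_mem_right _ j2))) (T.mul_mem_right _ j5)
  have hTξ2 : ξ2 ∈ T := by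
    have e : ξ2 = ec * F + ed * G - ((ec * ea + ed * ec - ec) * G1 + (ec * eb + ed * ed - ed) * G2)
        - (ea * ed - eb * ec) * L1 := by
      simp only [hF, hG, hξ1, hξ2, hζ1, hζ2]; ring
    rw [e]
    exact sub_mem (sub_mem (add_mem (T.mul_mem_left _ hFT) (T.mul_mem_left _ hGT))
      (add_mem (T.mul_mem_right _ j3) (T.mul_mem_right _ j4))) (T.mul_mem_right _ j5)
  have hTζ1 : ζ1 ∈ T := by
    have e : ζ1 = G - ξ2 := by rw [hG]; ring
    rw [e]; exact sub_mem hGT hTξ2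
  have hTζ2 : ζ2 ∈ T := by
    have e : ζ2 = ξ1 - F := by rw [hF]; ring
    rw [e]; exact sub_mem hTξ1 hFT
  -- the four membership statements
  have key : ∀ (e : ℕ) (P Q R : MvPolynomial (Fin ν) A) (b c : A), e ≤ M → P.IsHomogeneous e → Q.IsHomogeneous e →
      R.IsHomogeneous e → map (Ideal.Quotient.mk N) (C b * P + C c * Q - R) = 0 → 
      b * eval x P + c * eval x Q ∈ T → ∀ z ∈ I ^ (M - e), z * eval x R ∈ T := by
    intro e P Q R b c he hP hQ hR h0 hm z hz
    have h3 := ev_mem_of_map N x I hx _ e (((hP.C_mul b).add (hQ.C_mul c)).sub hR) h0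
    have h4 : z * eval x (C b * P + C c * Q - R) ∈ T := by
      apply hTN
      have e5 : N * I ^ M = I ^ (M - e) * (N * I ^ e) := by
        rw [mul_left_comm, ← pow_add, Nat.sub_add_cancel he]
      rw [e5]
      exact Ideal.mul_mem_mul hz h3
    simp only [map_sub, map_add, map_mul, eval_C] at h4
    have h5 : z * eval x R = z * (b * eval x P + c * eval x Q) - z * (b * eval x P + c * eval x Q - eval x R) := by ring
    rw [h5]
    exact sub_mem (T.mul_mem_left _ hm) h4
  have Tg1 := key d g1 g2 g1 ea eb (by omega) hg1 hg2 hg1 (by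
    simp only [map_sub, map_add, map_mul, map_C, ha, hb, mg1, mg2, E1, sub_self]) hTξ1
  have Tg2 := key d g1 g2 g2 ec ed (by omega) hg1 hg2 hg2 (by
    simp only [map_sub, map_add, map_mul, map_C, hc, hd1, mg1, mg2, E2, sub_self]) hTξ2
  have Th1 := key d' h1 h2 h1 ea ec (by omega) hh1 hh2 hh1 (by
    simp only [map_sub, map_add, map_mul, map_C, ha, hc, mh1, mh2, E3, sub_self]) hTζ1
  have Th2 := key d' h1 h2 h2 eb ed (by omega) hh1 hh2 hh2 (by
    simp only [map_sub, map_add, map_mul, map_C, hb, hd1, mh1, mh2, E4, sub_self]) hTζ2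
  have hXI : Ideal.span (Set.range x) ≤ I := by
    rw [Ideal.span_le]; rintro _ ⟨i, rfl⟩; exact hx i
  have hpow := pow_le_aux I (Ideal.span (Set.range x)) N (Ideal.span (Set.range f)) hXI H1 M
  have hfT : Ideal.span (Set.range f) ≤ T := le_sup_right.trans le_sup_left
  -- the colon ideal
  have hIT : I ^ M ≤ T := by
    have htop : T.colon (I ^ M : Ideal A) = ⊤ := by
      by_contra hne
      obtain ⟨𝔪, h𝔪, hle⟩ := Ideal.exists_le_maximal _ hne
      have hN𝔪 : N ≤ 𝔪 := by
        refine le_trans ?_ hle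
        intro z hz
        rw [Submodule.mem_colon]
        intro y hy
        exact hTN (Ideal.mul_mem_mul hz hy)
      have hmap : (𝔪.map (Ideal.Quotient.mk N)).IsPrime :=
        Ideal.map_isPrime_of_surjective Ideal.Quotient.mk_surjective (by rwa [Ideal.mk_ker])
      obtain ⟨t, ht, hh⟩ := H3 _ hmap
      obtain ⟨t, rfl⟩ := Ideal.Quotient.mk_surjective t
      apply ht
      apply Ideal.mem_map_of_mem
      have : t ^ M ∈ 𝔪 := by
        apply hle
        rw [Submodule.mem_colon]
        intro y hy
        have hX : ∀ w ∈ Ideal.span (Set.range x) ^ M, t ^ M * w ∈ T := by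
          have e6 : Ideal.span (Set.range x) ^ M = Ideal.span (Set.range x ^ M) := Submodule.span_pow _ _
          rw [e6]
          intro w hw
          induction hw using Submodule.span_induction with
          | mem w hw =>
            obtain ⟨z, hz, rfl⟩ := Set.mem_pow_iff_prod.1 hw
            choose j hj using hz
            simp only [← hj]
            refine core2 N I T x hx a H2 M n d d' hTN (by omega) (by omega) (by omega) g1 g2 h1 h2 hg1 hg2 hh1 hh2 
              Tg1 Tg2 Th1 Th2 K (by rw [mg1, mg2, mh1, mh2]) hn t hh j
          | zero => simp
          | add u v _ _ hu hv => rw [mul_add]; exact add_mem hu hv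
          | smul b u _ hu => rw [smul_eq_mul, mul_left_comm]; exact T.mul_mem_left _ hu
        obtain ⟨y1, hy1, y2, hy2, rfl⟩ := Submodule.mem_sup.1 (hpow hy)
        obtain ⟨y3, hy3, y4, hy4, rfl⟩ := Submodule.mem_sup.1 hy1
        rw [smul_eq_mul, mul_add, mul_add]
        exact add_mem (add_mem (T.mul_mem_left _ (hfT hy3)) (hX _ hy4)) (T.mul_mem_left _ (hTN hy2))
      exact h𝔪.isPrime.mem_of_pow_mem _ this
    intro y hy
    have := (Submodule.mem_colon.1 (htop ▸ Submodule.mem_top : (1 : A) ∈ T.colon (I ^ M : Ideal A))) y hy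
    simpa using this
  obtain ⟨u, hu, hu2⟩ := Submodule.exists_sub_one_mem_and_smul_le_of_fg_of_le_sup (I := N) (N := 𝔞) (N' := I ^ M) (P := I ^ M)
    (IsNoetherian.noetherian _) le_rfl hIT
  refine ⟨F, hFI, G, hGI, u, hu, M, fun y hy => ?_⟩
  exact hu2 (Submodule.smul_mem_pointwise_smul _ _ _ hy)

end G6
end FpLci
end

section
universe u
namespace FpLci
open MvPolynomial

section G7
theorem main_aux (p : ℕ) [Fact p.Prime]
    {A : Type u} [CommRing A] [Algebra (AlgebraicClosure (ZMod p)) A]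
    [Algebra.FiniteType (AlgebraicClosure (ZMod p)) A]
    (I : Ideal A) (r : ℕ) (hr : 2 ≤ r)
    (hI : IsLocalCompleteIntersectionOfHeight I r)
    (hdim : ringKrullDim (A ⧸ I) ≤ 2) :
    ∃ J : Ideal A, J.radical = I.radical ∧
      IsLocalCompleteIntersectionOfHeight J r ∧
      Nonempty (Module.Basis (Fin r) (A ⧸ J) J.Cotangent) := by
  have hAN : IsNoetherianRing A := Algebra.FiniteType.isNoetherianRing (AlgebraicClosure (ZMod p)) A
  have hItop : I ≠ ⊤ := by
    rintro rfl
    have h := hI.1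
    have h2 : idealHeight (⊤ : Ideal A) = ⊤ := by
      unfold idealHeight
      simp only [iInf_eq_top]
      intro q hq
      exact absurd (top_le_iff.1 hq) q.2.ne_top
    rw [h2] at h
    exact ENat.coe_ne_top r h.symm
  have hAnt : Nontrivial A := by
    by_contra h
    rw [not_nontrivial_iff_subsingleton] at h
    exact hItop (Subsingleton.elim _ _)
  have : CharP (AlgebraicClosure (ZMod p)) p := charP_of_injective_algebraMap (algebraMap (ZMod p) _).injective p
  have hAp : CharP A p := charP_of_hom p (algebraMap (AlgebraicClosure (ZMod p)) A)
  obtain ⟨N, hN⟩ : ∃ N, N = I.radical := ⟨_, rfl⟩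
  have hIN : I ≤ N := hN ▸ Ideal.le_radical
  have hNtop : N ≠ ⊤ := by rw [hN]; exact fun h => hItop (Ideal.radical_eq_top.1 h)
  have hBnt : Nontrivial (A ⧸ N) := Ideal.Quotient.nontrivial_iff.2 hNtop
  have hBred : IsReduced (A ⧸ N) := (Ideal.isRadical_iff_quotient_reduced N).1 (hN ▸ Ideal.radical_isRadical I)
  have hBp : CharP (A ⧸ N) p := charP_of_hom p (Ideal.Quotient.mk N)
  have hft : Algebra.FiniteType (AlgebraicClosure (ZMod p)) (A ⧸ N) := inferInstance
  letI : Algebra (ZMod p) (A ⧸ N) := 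
    ((algebraMap (AlgebraicClosure (ZMod p)) (A ⧸ N)).comp (algebraMap (ZMod p) _)).toAlgebra
  have : IsScalarTower (ZMod p) (AlgebraicClosure (ZMod p)) (A ⧸ N) := IsScalarTower.of_algebraMap_eq' rfl
  have hd3 : DimLt (⊥ : Ideal (A ⧸ N)) 3 := by
    apply DimLt.quot
    have h1 : DimLt I 3 := dimLt_of_ringKrullDim hdim
    exact h1.anti hIN
  obtain ⟨m, rfl⟩ : ∃ m, r = m + 2 := ⟨r - 2, by omega⟩
  have hPl := conormal_locFree I N hIN (m + 2) hI.2
  obtain ⟨P2, _, _, hP2, ⟨e⟩⟩ := split_free hd3 m _ hPl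
  obtain ⟨ν, vl, φ, hφ⟩ := hP2.dualBasis
  obtain ⟨d, d', γ1, γ2, η1, η2, e11, e12, e21, e22, h1, h2, h3, h4, h5, h6, h7, h8, h9, h10, h11, h12, h13⟩ :=
    F7_main (k := AlgebraicClosure (ZMod p)) p hd3 hP2 vl φ hφ
  choose f hf using fun i : Fin m => Submodule.Quotient.mk_surjective (N • ⊤ : Submodule A I) (e.symm (Pi.single i 1, 0))
  choose x hx using fun l : Fin ν => Submodule.Quotient.mk_surjective (N • ⊤ : Submodule A I) (e.symm (0, vl l))
  choose a ha using fun (j l : Fin ν) => Ideal.Quotient.mk_surjective (I := N) (φ l (vl j))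
  have hz : ∀ w : I, (Submodule.Quotient.mk w : I ⧸ (N • ⊤ : Submodule A I)) = 0 → (w : A) ∈ N * I := by
    intro w hw
    rw [Submodule.Quotient.mk_eq_zero] at hw
    have := Submodule.mem_map_of_mem (f := I.subtype) hw
    rw [Submodule.map_smul'', Submodule.map_top, Submodule.range_subtype] at this
    simpa using this
  have hmksum : ∀ (n : ℕ) (c : Fin n → A) (y : Fin n → I), 
      (Submodule.Quotient.mk (∑ i, c i • y i) : I ⧸ (N • ⊤ : Submodule A I)) = 
      ∑ i, Ideal.Quotient.mk N (c i) • (Submodule.Quotient.mk (y i) : I ⧸ (N • ⊤ : Submodule A I)) := by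
    intro n c y
    change Submodule.mkQ _ _ = _
    rw [map_sum]
    refine Finset.sum_congr rfl fun i _ => ?_
    rw [map_smul]
    rfl
  have hxs : ∀ c : Fin ν → A, (Submodule.Quotient.mk (∑ l, c l • x l) : I ⧸ (N • ⊤ : Submodule A I)) = 
      e.symm (0, ∑ l, Ideal.Quotient.mk N (c l) • vl l) := by
    intro c
    rw [hmksum]
    apply e.injective
    rw [LinearEquiv.apply_symm_apply, map_sum]
    simp only [map_smul, hx, LinearEquiv.apply_symm_apply]
    ext i
    · simp [Prod.fst_sum]
    · simp [Prod.snd_sum]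
  have hfs : ∀ c : Fin m → A, (Submodule.Quotient.mk (∑ l, c l • f l) : I ⧸ (N • ⊤ : Submodule A I)) = 
      e.symm (fun i => Ideal.Quotient.mk N (c i), 0) := by
    intro c
    rw [hmksum]
    apply e.injective
    rw [LinearEquiv.apply_symm_apply, map_sum]
    simp only [map_smul, hf, LinearEquiv.apply_symm_apply]
    ext i
    · simp [Prod.fst_sum, Pi.single_apply]
    · simp [Prod.snd_sum]
  obtain ⟨F, hF, G, hG, u, hu, M, hM⟩ := F11 p N I hN (fun i => (f i : A)) (fun l => (x l : A)) (fun l => (x l).2) a (by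
      intro y hy
      obtain ⟨⟨c, z⟩, hcz⟩ : ∃ w, (Submodule.Quotient.mk (⟨y, hy⟩ : I) : I ⧸ (N • ⊤ : Submodule A I)) = e.symm w :=
        ⟨e (Submodule.Quotient.mk (⟨y, hy⟩ : I)), by simp⟩
      choose c' hc' using fun i => Ideal.Quotient.mk_surjective (c i)
      choose b hb using fun l => Ideal.Quotient.mk_surjective (φ l z)
      have h0 := hz (⟨y, hy⟩ - (∑ i, c' i • f i + ∑ l, b l • x l)) (by
        rw [Submodule.Quotient.mk_sub, Submodule.Quotient.mk_add, hcz, hfs, hxs, ← map_add, sub_eq_zero]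
        congr 1
        simp only [hc', hb, ← hφ, Prod.mk_add_mk, add_zero, zero_add])
      have h1 : y = (∑ i, c' i * (f i : A) + ∑ l, b l * (x l : A)) + (y - (∑ i, c' i * (f i : A) + ∑ l, b l * (x l : A))) := by ring
      rw [h1]
      refine Submodule.add_mem_sup (Submodule.add_mem_sup ?_ ?_) ?_
      · exact Ideal.sum_mem _ fun i _ => Ideal.mul_mem_left _ _ (Ideal.subset_span ⟨i, rfl⟩)
      · exact Ideal.sum_mem _ fun i _ => Ideal.mul_mem_left _ _ (Ideal.subset_span ⟨i, rfl⟩)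
      · simpa using h0) (by
      intro j
      have h0 := hz (∑ l, a j l • x l - x j) (by
        rw [Submodule.Quotient.mk_sub, hxs, hx, sub_eq_zero]
        simp only [ha, ← hφ])
      simpa using h0) d d' h1 h2 γ1 γ2 η1 η2 e11 e12 e21 e22 h3 h4 h5 h6 h7 h8 h9 h10 h11 h12 (by
      intro q hq
      obtain ⟨t, ht, hh⟩ := h13 q hq
      refine ⟨t, ht, fun j => ?_⟩
      simp only [ha]
      exact hh (vl j))
  refine assembly I (m + 2) hI (Fin.append (fun i => (f i : A)) ![F, G]) ?_ u (hN ▸ hu) M ?_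
  · intro i
    refine Fin.addCases (fun i => ?_) (fun i => ?_) i
    · rw [Fin.append_left]; exact (f i).2
    · rw [Fin.append_right]
      fin_cases i
      · exact hF
      · exact hG
  · intro y hy
    refine (sup_le ?_ ?_ : Ideal.span {F, G} ⊔ Ideal.span (Set.range fun i => (f i : A)) ≤ _) (hM y hy)
    · rw [Ideal.span_le]
      rintro z (rfl | rfl)
      · exact Ideal.subset_span ⟨Fin.natAdd m 0, by rw [Fin.append_right]; rfl⟩
      · exact Ideal.subset_span ⟨Fin.natAdd m 1, by rw [Fin.append_right]; rfl⟩
    · rw [Ideal.span_le]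
      rintro _ ⟨i, rfl⟩
      exact Ideal.subset_span ⟨Fin.castAdd 2 i, by rw [Fin.append_left]⟩
end G7
end FpLci
end

/-- Refined Ferrand construction over `𝔽_p`-bar: for a local complete
intersection ideal `I` of height `r ≥ 2` with `dim(A/I) ≤ 2` in an affine
algebra `A` over the algebraic closure of `𝔽_p`, there is an ideal `J` with
`√J = √I` which is a local complete intersection of height `r` and whose
conormal module `J/J²` is free of rank `r` over `A/J`. -/
theorem exists_lci_ideal_same_radical_with_free_conormal_over_Fpbar
    (p : ℕ) [Fact p.Prime]
    {A : Type*} [CommRing A] [Algebra (AlgebraicClosure (ZMod p)) A]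
    [Algebra.FiniteType (AlgebraicClosure (ZMod p)) A]
    (I : Ideal A) (r : ℕ) (hr : 2 ≤ r)
    (hI : IsLocalCompleteIntersectionOfHeight I r)
    (hdim : ringKrullDim (A ⧸ I) ≤ 2) :
    ∃ J : Ideal A, J.radical = I.radical ∧
      IsLocalCompleteIntersectionOfHeight J r ∧
      Nonempty (Module.Basis (Fin r) (A ⧸ J) J.Cotangent) := by
  exact FpLci.main_aux p I r hr hI hdim
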